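/- Let k ≥ 2 and let H be the k-chromatic bottle-graph with neck σ and width ω (so H = K_{σ,ω,…,ω} with k − 1 parts of size ω), let α = σ/ω and γ = α/((k−1)(k−1+α)). There exist a constant C = C(H) and an integer n₀ such that if G is a graph on n ≥ n₀ vertices and d(x) + d(y) ≥ 2(1 − 1/(k−1) + γ)·n for all nonadjacent x, y ∈ V(G), then G contains an H-tiling covering all but at most C vertices. (Note that 1 − 1/(k−1) + γ = 1 − 1/χ_cr(H), where χ_cr(H) = k − 1 + α.) -/

import Mathlib

/-- `𝒯` is an `H`-tiling in `G`: a collection of pairwise vertex-disjoint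
subgraphs of `G`, each isomorphic to `H`. -/
def IsTiling {W V : Type*} (H : SimpleGraph W) (G : SimpleGraph V)
    (𝒯 : Finset (W → V)) : Prop :=
  (∀ f ∈ 𝒯, Function.Injective f ∧ ∀ a b : W, H.Adj a b → G.Adj (f a) (f b)) ∧
  ((𝒯 : Set (W → V)).Pairwise fun f g => Disjoint (Set.range f) (Set.range g))

/-- The set of vertices of `G` not covered by the tiling `𝒯`. -/
def untiled {W V : Type*} (𝒯 : Finset (W → V)) : Set V :=
  {v : V | ∀ f ∈ 𝒯, v ∉ Set.range f}

/-- The vertex type of the `k`-chromatic bottle-graph with neck `σ` and width `ω`: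
one part (indexed by `0`) of size `σ` and `k - 1` parts of size `ω`. -/
abbrev BottleVert (k σ ω : ℕ) := Σ i : Fin k, Fin (if (i : ℕ) = 0 then σ else ω)

/-- The `k`-chromatic bottle-graph with neck `σ` and width `ω`, i.e. the complete
`k`-partite graph `K_{σ,ω,…,ω}`. -/
def bottleGraph (k σ ω : ℕ) : SimpleGraph (BottleVert k σ ω) :=
  SimpleGraph.completeMultipartiteGraph fun i : Fin k => Fin (if (i : ℕ) = 0 then σ else ω)


set_option linter.unusedVariables false
set_option linter.unusedSectionVars false
namespace OBT
open scoped Classical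
open Finset

variable {V : Type*}

/-- complete between two vertex sets -/
def Cm (G : SimpleGraph V) (S T : Finset V) : Prop := ∀ u ∈ S, ∀ v ∈ T, G.Adj u v

lemma Cm.symm {G : SimpleGraph V} {S T : Finset V} (h : Cm G S T) : Cm G T S :=
  fun u hu v hv => (h v hv u hu).symm

lemma Cm.mono {G : SimpleGraph V} {S T S' T' : Finset V} (h : Cm G S T) (h1 : S' ⊆ S)
    (h2 : T' ⊆ T) : Cm G S' T' := fun u hu v hv => h u (h1 hu) v (h2 hv)

lemma Cm.disj {G : SimpleGraph V} {S T : Finset V} (h : Cm G S T) : Disjoint S T := by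
  rw [Finset.disjoint_left]
  intro a ha hb
  exact G.irrefl (h a ha a hb)

def sz (σ ω : ℕ) {p : ℕ} (i : Fin (p+1)) : ℕ := if i = 0 then σ else ω

def IsTile (G : SimpleGraph V) (p σ ω t : ℕ) (S : Finset V) : Prop :=
  ∃ P : Fin (p+1) → Finset V, (∀ i, (P i).card = sz σ ω i * t) ∧
    (∀ i j, i ≠ j → Cm G (P i) (P j)) ∧ S = univ.biUnion P

def HasTiles (G : SimpleGraph V) (p σ ω t q : ℕ) (S : Finset V) : Prop :=
  ∃ f : Fin q → Finset V, (∀ i, IsTile G p σ ω t (f i) ∧ f i ⊆ S) ∧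
    (∀ i j, i ≠ j → Disjoint (f i) (f j))

lemma exists_disj_family {ι : Type*} (I : Finset ι) (s : ι → ℕ) (A : Finset V)
    (h : ∑ i ∈ I, s i ≤ A.card) :
    ∃ f : ι → Finset V, (∀ i ∈ I, f i ⊆ A ∧ (f i).card = s i) ∧
      (∀ i ∈ I, ∀ j ∈ I, i ≠ j → Disjoint (f i) (f j)) := by
  induction I using Finset.induction_on generalizing A with
  | empty => exact ⟨fun _ => ∅, by simp, by simp⟩
  | insert a I ha ih =>
    rw [Finset.sum_insert ha] at h
    obtain ⟨B, hB, hBc⟩ := Finset.exists_subset_card_eq (show s a ≤ A.card by omega)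
    have h2 : ∑ i ∈ I, s i ≤ (A \ B).card := by
      rw [Finset.card_sdiff_of_subset hB]; omega
    obtain ⟨f, hf, hd⟩ := ih (A \ B) h2
    refine ⟨fun i => if i = a then B else f i, ?_, ?_⟩
    · intro i hi
      by_cases hia : i = a
      · simp [hia, hB, hBc]
      · have hi' : i ∈ I := by simpa [hia] using hi
        simp only [hia, if_false]
        exact ⟨(hf i hi').1.trans Finset.sdiff_subset, (hf i hi').2⟩
    · have key : ∀ j ∈ I, Disjoint B (f j) := fun j hj =>
        (Finset.disjoint_sdiff (s := B) (t := A)).mono_right (hf j hj).1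
      intro i hi j hj hij
      by_cases hia : i = a
      · have hja : j ≠ a := fun h => hij (hia.trans h.symm)
        have hj' : j ∈ I := by simpa [hja] using hj
        simpa [hia, hja] using key j hj'
      · have hi' : i ∈ I := by simpa [hia] using hi
        by_cases hja : j = a
        · simpa [hia, hja] using (key i hi').symm
        · have hj' : j ∈ I := by simpa [hja] using hj
          simpa [hia, hja] using hd i hi' j hj' hij

lemma HasTiles.of_fintype {G : SimpleGraph V} {p σ ω t : ℕ} {S : Finset V} {K : Type*} [Fintype K]
    (f : K → Finset V) (h1 : ∀ i, IsTile G p σ ω t (f i) ∧ f i ⊆ S)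
    (h2 : ∀ i j, i ≠ j → Disjoint (f i) (f j)) : HasTiles G p σ ω t (Fintype.card K) S :=
  ⟨fun i => f ((Fintype.equivFin K).symm i), fun i => h1 _, fun i j hij =>
    h2 _ _ (fun h => hij ((Fintype.equivFin K).symm.injective h))⟩

lemma HasTiles.mono {G : SimpleGraph V} {p σ ω t q : ℕ} {S T : Finset V}
    (h : HasTiles G p σ ω t q S) (hST : S ⊆ T) : HasTiles G p σ ω t q T := by
  obtain ⟨f, h1, h2⟩ := h
  exact ⟨f, fun i => ⟨(h1 i).1, (h1 i).2.trans hST⟩, h2⟩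

lemma HasTiles.le {G : SimpleGraph V} {p σ ω t q q' : ℕ} {S : Finset V}
    (h : HasTiles G p σ ω t q S) (hq : q' ≤ q) : HasTiles G p σ ω t q' S := by
  obtain ⟨f, h1, h2⟩ := h
  exact ⟨fun i => f (Fin.castLE hq i), fun i => h1 _, fun i j hij =>
    h2 _ _ (fun h => hij (Fin.castLE_injective hq h))⟩

lemma HasTiles.add {G : SimpleGraph V} {p σ ω t q q' : ℕ} {S T : Finset V}
    (h : HasTiles G p σ ω t q S) (h' : HasTiles G p σ ω t q' T) (hd : Disjoint S T) :
    HasTiles G p σ ω t (q + q') (S ∪ T) := by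
  obtain ⟨f, h1, h2⟩ := h
  obtain ⟨g, g1, g2⟩ := h'
  have := HasTiles.of_fintype (G := G) (p := p) (σ := σ) (ω := ω) (t := t) (S := S ∪ T)
    (K := Fin q ⊕ Fin q') (Sum.elim f g) ?_ ?_
  · simpa using this
  · rintro (i | i)
    · exact ⟨(h1 i).1, (h1 i).2.trans subset_union_left⟩
    · exact ⟨(g1 i).1, (g1 i).2.trans subset_union_right⟩
  · rintro (i | i) (j | j) hij
    · exact h2 i j (fun h => hij (by rw [h]))
    · exact (hd.mono (h1 i).2 (g1 j).2)
    · exact (hd.mono (h1 j).2 (g1 i).2).symm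
    · exact g2 i j (fun h => hij (by rw [h]))

lemma HasTiles.zero {G : SimpleGraph V} {p σ ω t : ℕ} {S : Finset V} :
    HasTiles G p σ ω t 0 S := ⟨fun _ => ∅, fun i => i.elim0, fun i => i.elim0⟩

lemma HasTiles.biUnion {G : SimpleGraph V} {p σ ω t q : ℕ} {ι : Type*} (I : Finset ι)
    (B : ι → Finset V) (h : ∀ i ∈ I, HasTiles G p σ ω t q (B i))
    (hd : ∀ i ∈ I, ∀ j ∈ I, i ≠ j → Disjoint (B i) (B j)) :
    HasTiles G p σ ω t (q * I.card) (I.biUnion B) := by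
  induction I using Finset.induction_on with
  | empty => simpa using HasTiles.zero
  | insert a I ha ih =>
    rw [Finset.card_insert_of_notMem ha, Finset.biUnion_insert, mul_add, mul_one, add_comm]
    refine HasTiles.add (h a (by simp)) (ih (fun i hi => h i (by simp [hi]))
      (fun i hi j hj => hd i (by simp [hi]) j (by simp [hj]))) ?_
    rw [Finset.disjoint_biUnion_right]
    intro i hi
    exact hd a (by simp) i (by simp [hi]) (fun h => ha (h ▸ hi))

lemma sum_sz (p σ ω : ℕ) : ∑ i : Fin (p+1), sz σ ω i = p * ω + σ := by
  rw [Fin.sum_univ_succ]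
  simp [sz, Fin.succ_ne_zero, add_comm]

lemma IsTile.card {G : SimpleGraph V} {p σ ω t : ℕ} {S : Finset V} (h : IsTile G p σ ω t S) :
    S.card = (p * ω + σ) * t := by
  obtain ⟨P, h1, h2, rfl⟩ := h
  rw [Finset.card_biUnion (fun i _ j _ hij => (h2 i j hij).disj)]
  simp_rw [h1]
  rw [← Finset.sum_mul, sum_sz]

lemma HasTiles.card_le {G : SimpleGraph V} {p σ ω t q : ℕ} {S : Finset V}
    (h : HasTiles G p σ ω t q S) : (p * ω + σ) * t * q ≤ S.card := by
  obtain ⟨f, h1, h2⟩ := h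
  have : (univ.biUnion f).card = (p * ω + σ) * t * q := by
    rw [Finset.card_biUnion (fun i _ j _ hij => h2 i j hij)]
    simp [(h1 _).1.card, mul_comm]
  rw [← this]
  exact Finset.card_le_card (Finset.biUnion_subset.2 fun i _ => (h1 i).2)

/-- tile from a family indexed by an arbitrary type, with a distinguished neck -/
lemma IsTile.of_fintype {G : SimpleGraph V} {p σ ω t : ℕ} {Γ : Type*} [Fintype Γ]
    (hc : Fintype.card Γ = p + 1) (γ : Γ) (P : Γ → Finset V)
    (h0 : (P γ).card = σ * t) (h1 : ∀ c, c ≠ γ → (P c).card = ω * t)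
    (h2 : ∀ c d, c ≠ d → Cm G (P c) (P d)) : IsTile G p σ ω t (univ.biUnion P) := by
  let e0 : Fin (p+1) ≃ Γ := (Fintype.equivFinOfCardEq hc).symm
  let e : Fin (p+1) ≃ Γ := e0.trans (Equiv.swap (e0 0) γ)
  have he : e 0 = γ := by simp [e]
  refine ⟨fun i => P (e i), ?_, ?_, ?_⟩
  · intro i
    by_cases hi : i = 0
    · subst hi; simp [he, sz, h0]
    · have : e i ≠ γ := fun h => hi (e.injective (h.trans he.symm))
      simp [sz, hi, h1 _ this]
  · intro i j hij
    exact h2 _ _ (fun h => hij (e.injective h))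
  · ext x
    simp only [mem_biUnion, mem_univ, true_and]
    exact ⟨fun ⟨c, hc⟩ => ⟨e.symm c, by simpa using hc⟩, fun ⟨i, hi⟩ => ⟨e i, hi⟩⟩

lemma builder {G : SimpleGraph V} {p σ ω t : ℕ} {Γ K : Type*} [Fintype Γ] [Fintype K]
    (C : Γ → Finset V) (hC : ∀ c d, c ≠ d → Cm G (C c) (C d))
    (e : K → Fin (p+1) ≃ Γ)
    (hs : ∀ c, ∑ κ, sz σ ω ((e κ).symm c) * t ≤ (C c).card) :
    HasTiles G p σ ω t (Fintype.card K) (univ.biUnion C) := by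
  choose g hg hgd using fun c => exists_disj_family (univ : Finset K)
    (fun κ => sz σ ω ((e κ).symm c) * t) (C c) (hs c)
  refine HasTiles.of_fintype (fun κ => univ.biUnion fun i => g (e κ i) κ) ?_ ?_
  · intro κ
    refine ⟨⟨fun i => g (e κ i) κ, fun i => ?_, fun i j hij => ?_, rfl⟩, ?_⟩
    · rw [(hg (e κ i) κ (mem_univ _)).2]; simp
    · exact (hC _ _ (fun h => hij ((e κ).injective h))).mono (hg _ κ (mem_univ _)).1
        (hg _ κ (mem_univ _)).1
    · intro x hx
      simp only [mem_biUnion, mem_univ, true_and] at hx ⊢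
      obtain ⟨i, hi⟩ := hx
      exact ⟨e κ i, (hg _ κ (mem_univ _)).1 hi⟩
  · intro κ κ' hκ
    rw [Finset.disjoint_biUnion_left]
    intro i _
    rw [Finset.disjoint_biUnion_right]
    intro j _
    by_cases h : e κ i = e κ' j
    · rw [h]; exact hgd _ κ (mem_univ _) κ' (mem_univ _) hκ
    · exact ((hC _ _ h).disj).mono (hg _ κ (mem_univ _)).1 (hg _ κ' (mem_univ _)).1

lemma split {G : SimpleGraph V} {p σ ω t q : ℕ} (P : Fin (p+1) → Finset V)
    (h1 : ∀ i, sz σ ω i * t * q ≤ (P i).card)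
    (h2 : ∀ i j, i ≠ j → Cm G (P i) (P j)) : HasTiles G p σ ω t q (univ.biUnion P) := by
  have := builder (G := G) (p := p) (σ := σ) (ω := ω) (t := t) (K := Fin q) P h2
    (fun _ => Equiv.refl _) (fun c => by simpa [mul_comm] using h1 c)
  simpa using this

lemma IsTile.split {G : SimpleGraph V} {p σ ω t q : ℕ} {S : Finset V}
    (h : IsTile G p σ ω (q * t) S) : HasTiles G p σ ω t q S := by
  obtain ⟨P, h1, h2, rfl⟩ := h
  exact OBT.split P (fun i => by rw [h1]; apply le_of_eq; ring) h2

/-- The gain lemma. -/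
lemma gain {G : SimpleGraph V} {p σ ω t θ r : ℕ} (hσ : σ < ω) (hr : 1 ≤ r) (hrp : r ≤ p)
    (P : Fin (p+1) → Finset V) (h1 : ∀ i, (P i).card = sz σ ω i * (θ * t))
    (h2 : ∀ i j, i ≠ j → Cm G (P i) (P j))
    (hθ : p * ω + σ ≤ θ)
    (D : Fin r → Finset V) (hD : ∀ i j, i ≠ j → Cm G (D i) (D j))
    (hDc : ∀ i, (p+1) * ω * (ω * t) ≤ (D i).card)
    (hdisj : ∀ l i, Disjoint (D l) (P i))
    (R : Finset (Fin (p+1))) (hR0 : (0 : Fin (p+1)) ∉ R) (hRc : R.card = p + 1 - r)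
    (Q : Fin (p+1) → Finset V) (hQ : ∀ j ∈ R, Q j ⊆ P j)
    (hQc : ∀ j ∈ R, ω * (p * ω + σ) * t ≤ (Q j).card)
    (hDQ : ∀ l, ∀ j ∈ R, Cm G (D l) (Q j)) :
    HasTiles G p σ ω t (θ + 1) (univ.biUnion P ∪ univ.biUnion D) := by
  obtain ⟨ρ, hρ⟩ : ∃ ρ, ρ + 1 = R.card := ⟨R.card - 1, by omega⟩
  -- a = ρ ω + σ
  set a := ρ * ω + σ with ha
  have haθ : a ≤ p * ω + σ := by
    have : ρ ≤ p := by omega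
    have := Nat.mul_le_mul_right ω this
    omega
  have hsub : ∀ j, ∃ Q' : Finset V, j ∈ R → (Q' ⊆ Q j ∧ Q'.card = ω * a * t) := by
    intro j
    by_cases hj : j ∈ R
    · obtain ⟨Q', hQ', hc⟩ := Finset.exists_subset_card_eq (s := Q j) (n := ω * a * t)
        (le_trans (Nat.mul_le_mul_right t (Nat.mul_le_mul_left ω haθ)) (hQc j hj))
      exact ⟨Q', fun _ => ⟨hQ', hc⟩⟩
    · exact ⟨∅, fun h => absurd h hj⟩
  choose Q' hQ' using hsub
  -- new tiles
  let Γ := {j // j ∈ R} ⊕ Fin r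
  let C : Γ → Finset V := Sum.elim (fun j => Q' j.1) D
  have hcard : Fintype.card Γ = p + 1 := by
    simp only [Γ, Fintype.card_sum, Fintype.card_coe, Fintype.card_fin]; omega
  have hC : ∀ c d, c ≠ d → Cm G (C c) (C d) := by
    rintro (c | c) (d | d) hcd
    · have : c.1 ≠ d.1 := fun h => hcd (by rw [Subtype.ext h])
      exact (h2 _ _ this).mono ((hQ' _ c.2).1.trans (hQ _ c.2)) ((hQ' _ d.2).1.trans (hQ _ d.2))
    · exact ((hDQ d c.1 c.2).mono subset_rfl (hQ' _ c.2).1).symm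
    · exact (hDQ c d.1 d.2).mono subset_rfl (hQ' _ d.2).1
    · exact hD _ _ (fun h => hcd (by rw [h]))
  let e0 : Fin (p+1) ≃ Γ := (Fintype.equivFinOfCardEq hcard).symm
  let e : {j // j ∈ R} × Fin ω → Fin (p+1) ≃ Γ :=
    fun κ => e0.trans (Equiv.swap (e0 0) (Sum.inl κ.1))
  let dem : Γ → {j // j ∈ R} → ℕ := fun c j => if c = Sum.inl j then σ else ω
  have he : ∀ κ c, sz σ ω ((e κ).symm c) = dem c κ.1 := by
    intro κ c
    have h0 : (e κ) 0 = Sum.inl κ.1 := by simp [e]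
    by_cases hc : c = Sum.inl κ.1
    · have : (e κ).symm c = 0 := by rw [Equiv.symm_apply_eq, h0, hc]
      simp only [dem]
      rw [sz, if_pos this, if_pos hc]
    · have : (e κ).symm c ≠ 0 := by
        intro h; rw [Equiv.symm_apply_eq, h0] at h; exact hc h
      simp only [dem]
      rw [sz, if_neg this, if_neg hc]
  have hnew := builder (G := G) (p := p) (σ := σ) (ω := ω) (t := t) C hC e (by
    intro c
    simp_rw [he]
    rw [Fintype.sum_prod_type]
    simp only [sum_const, card_univ, Fintype.card_fin, smul_eq_mul]
    rcases c with c | c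
    · have : ∀ x : {j // j ∈ R}, ω * (dem (Sum.inl c) x * t)
          = ω * t * (if c = x then σ else ω) := by
        intro x
        by_cases h : c = x
        · simp only [dem, h, if_true]; ring
        · have : (Sum.inl c : Γ) ≠ Sum.inl x := fun h' => h (Sum.inl_injective h')
          simp only [dem]
          rw [if_neg this, if_neg h]; ring
      rw [Finset.sum_congr rfl (fun x _ => this x), ← Finset.mul_sum]
      have h3 : ∑ x : {j // j ∈ R}, (if c = x then σ else ω) = a := by
        rw [← Finset.add_sum_erase _ _ (mem_univ c)]
        rw [Finset.sum_congr rfl (g := fun _ => ω)]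
        · rw [sum_const, Finset.card_erase_of_mem (mem_univ _), card_univ, Fintype.card_coe,
            ← hρ, ha]; simp [add_comm]
        · intro x hx
          have : c ≠ x := fun h => (Finset.ne_of_mem_erase hx) h.symm
          simp [this]
      rw [h3]
      show _ ≤ (Q' c.1).card
      rw [(hQ' _ c.2).2]
      apply le_of_eq; ring
    · have : ∀ x : {j // j ∈ R}, ω * (dem (Sum.inr c) x * t)
          = ω * (ω * t) := by
        intro x
        have h : (Sum.inr c : Γ) ≠ Sum.inl x := by simp
        simp only [dem]; rw [if_neg h]
      rw [Finset.sum_congr rfl (fun x _ => this x), sum_const, card_univ, Fintype.card_coe]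
      refine le_trans ?_ (hDc c)
      have : R.card ≤ p + 1 := by omega
      calc R.card • (ω * (ω * t)) ≤ (p+1) * (ω * (ω * t)) := by
            rw [smul_eq_mul]; exact Nat.mul_le_mul_right _ this
        _ = _ := by ring)
  have hKcard : Fintype.card ({j // j ∈ R} × Fin ω) = (ρ + 1) * ω := by
    simp [hρ]
  rw [hKcard] at hnew
  -- the rest
  let P' : Fin (p+1) → Finset V := fun j => if j ∈ R then P j \ Q' j else P j
  have hP'P : ∀ j, P' j ⊆ P j := by
    intro j; by_cases h : j ∈ R
    · simp [P', h]
    · simp [P', h]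
  have hrest : HasTiles G p σ ω t (θ - a) (univ.biUnion P') := by
    apply split
    · intro i
      by_cases h : i ∈ R
      · have hi0 : i ≠ 0 := fun h' => hR0 (h' ▸ h)
        simp only [P', h, if_true]
        rw [Finset.card_sdiff_of_subset ((hQ' _ h).1.trans (hQ _ h)), (hQ' _ h).2, h1]
        simp only [sz, hi0, if_false]
        rw [Nat.mul_sub]
        apply le_of_eq
        congr 1 <;> ring
      · simp only [P', h, if_false]
        rw [h1]
        calc sz σ ω i * t * (θ - a) ≤ sz σ ω i * t * θ := Nat.mul_le_mul_left _ (Nat.sub_le _ _)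
          _ = _ := by ring
    · intro i j hij
      exact (h2 i j hij).mono (hP'P i) (hP'P j)
  have hd : Disjoint (univ.biUnion C) (univ.biUnion P') := by
    rw [Finset.disjoint_biUnion_left]
    intro c _
    rw [Finset.disjoint_biUnion_right]
    intro j _
    rcases c with c | c
    · by_cases hcj : c.1 = j
      · subst hcj
        simp only [C, Sum.elim_inl, P', c.2, if_true]
        exact Finset.disjoint_sdiff
      · exact ((h2 _ _ hcj).disj).mono ((hQ' _ c.2).1.trans (hQ _ c.2)) (hP'P j)
    · exact (hdisj c j).mono_right (hP'P j)
  have := (hnew.add hrest hd).mono (T := univ.biUnion P ∪ univ.biUnion D) ?_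
  · refine this.le ?_
    have : (ρ + 1) * ω = a + (ω - σ) := by rw [ha]; have := hσ.le; rw [add_mul]; omega
    omega
  · apply Finset.union_subset
    · intro x hx
      simp only [mem_biUnion, mem_univ, true_and, mem_union] at hx ⊢
      obtain ⟨c, hc⟩ := hx
      rcases c with c | c
      · exact Or.inl ⟨c.1, hQ _ c.2 ((hQ' _ c.2).1 hc)⟩
      · exact Or.inr ⟨c, hc⟩
    · intro x hx
      simp only [mem_biUnion, mem_univ, true_and, mem_union] at hx ⊢
      obtain ⟨c, hc⟩ := hx
      exact Or.inl ⟨c, hP'P c hc⟩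

end OBT

set_option linter.unusedVariables false
set_option linter.unusedSectionVars false
namespace OBT
open scoped Classical
open Finset

variable {V : Type*}

/-- neighbours of `x` in `S` -/
noncomputable def nb (G : SimpleGraph V) (x : V) (S : Finset V) : Finset V := S.filter (fun v => G.Adj x v)
/-- number of non-neighbours of `x` in `S` -/
noncomputable def ms (G : SimpleGraph V) (x : V) (S : Finset V) : ℕ := (S.filter (fun v => ¬ G.Adj x v)).card

lemma nb_sub {G : SimpleGraph V} {x : V} {S : Finset V} : nb G x S ⊆ S := filter_subset _ _

lemma mem_nb {G : SimpleGraph V} {x v : V} {S : Finset V} : v ∈ nb G x S ↔ v ∈ S ∧ G.Adj x v := by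
  simp [nb]

lemma nb_add_ms (G : SimpleGraph V) (x : V) (S : Finset V) : (nb G x S).card + ms G x S = S.card :=
  Finset.card_filter_add_card_filter_not _

lemma ms_le (G : SimpleGraph V) (x : V) (S : Finset V) : ms G x S ≤ S.card := card_filter_le _ _

lemma ms_mono {G : SimpleGraph V} {x : V} {S T : Finset V} (h : S ⊆ T) : ms G x S ≤ ms G x T :=
  card_le_card (filter_subset_filter _ h)

lemma ms_union_le (G : SimpleGraph V) (x : V) (S T : Finset V) :
    ms G x (S ∪ T) ≤ ms G x S + ms G x T := by
  unfold ms; rw [filter_union]; exact card_union_le _ _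

lemma ms_biUnion {ι : Type*} (G : SimpleGraph V) (x : V) (I : Finset ι) (B : ι → Finset V)
    (hd : ∀ i ∈ I, ∀ j ∈ I, i ≠ j → Disjoint (B i) (B j)) :
    ms G x (I.biUnion B) = ∑ i ∈ I, ms G x (B i) := by
  unfold ms
  rw [filter_biUnion, card_biUnion]
  intro i hi j hj hij
  exact (hd i hi j hj hij).mono (filter_subset _ _) (filter_subset _ _)

lemma sum_ms_comm (G : SimpleGraph V) (S T : Finset V) :
    ∑ x ∈ S, ms G x T = ∑ y ∈ T, ms G y S := by
  unfold ms
  simp_rw [card_filter]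
  rw [sum_comm]
  simp_rw [G.adj_comm]

lemma sum_nb_comm (G : SimpleGraph V) (S T : Finset V) :
    ∑ x ∈ S, (nb G x T).card = ∑ y ∈ T, (nb G y S).card := by
  unfold nb
  simp_rw [card_filter]
  rw [sum_comm]
  simp_rw [G.adj_comm]

/-- configuration lemma -/
lemma cfgLemma {G : SimpleGraph V} {p σ ω m θ N c0 g : ℕ} {W : Finset V} (B : Fin N → Finset V)
    (hB : ∀ i, IsTile G p σ ω (θ * m) (B i) ∧ B i ⊆ W)
    (hBd : ∀ i j, i ≠ j → Disjoint (B i) (B j))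
    (hg : ∀ Q, HasTiles G p σ ω m Q W → Q ≤ θ * N + g) :
    ∃ (I : Finset (Fin N)) (q : ℕ) (F : Finset V), F ⊆ W ∧ Disjoint F (I.biUnion B) ∧
      F.card = (p * ω + σ) * m * q ∧ HasTiles G p σ ω m q F ∧
      N ≤ I.card + (c0 + 1) * g ∧ q ≤ (θ * (c0 + 1) + 1) * g ∧
      ∀ I0 ⊆ I, I0.card ≤ c0 → ¬ HasTiles G p σ ω m (θ * I0.card + 1)
        ((W \ (I.biUnion B)) \ F ∪ I0.biUnion B) := by
  let Good : ℕ → Prop := fun φ => ∃ (I : Finset (Fin N)) (q : ℕ),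
    HasTiles G p σ ω m q (W \ I.biUnion B) ∧ φ = (c0 + 1) * (θ * I.card + q) + I.card
  have hsub : ∀ I : Finset (Fin N), I.biUnion B ⊆ W := fun I => biUnion_subset.2 fun i _ => (hB i).2
  have hIB : ∀ I : Finset (Fin N), HasTiles G p σ ω m (θ * I.card) (I.biUnion B) := fun I =>
    HasTiles.biUnion I B (fun i _ => (hB i).1.split) (fun i _ j _ => hBd i j)
  have hq : ∀ (I : Finset (Fin N)) q, HasTiles G p σ ω m q (W \ I.biUnion B) →
      θ * I.card + q ≤ θ * N + g := by
    intro I q h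
    apply hg
    refine ((hIB I).add h disjoint_sdiff).mono ?_
    exact union_subset (hsub I) sdiff_subset
  have hIN : ∀ I : Finset (Fin N), I.card ≤ N := fun I => by simpa using I.card_le_univ
  have hbdd : ∀ φ, Good φ → φ ≤ (c0 + 1) * (θ * N + g) + N := by
    rintro φ ⟨I, q, h, rfl⟩
    exact add_le_add (Nat.mul_le_mul_left _ (hq I q h)) (hIN I)
  have hex : ∃ φ, Good φ := ⟨_, univ, 0, HasTiles.zero, rfl⟩
  obtain ⟨φ, hφ, hmax⟩ : ∃ φ, Good φ ∧ ∀ ψ, Good ψ → ψ ≤ φ := by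
    refine ⟨Nat.findGreatest Good ((c0 + 1) * (θ * N + g) + N), ?_, ?_⟩
    · obtain ⟨φ, h⟩ := hex
      exact Nat.findGreatest_spec (hbdd φ h) h
    · intro ψ h
      exact Nat.le_findGreatest (hbdd ψ h) h
  obtain ⟨I, q, h, rfl⟩ := hφ
  have h0 := hmax _ ⟨univ, 0, HasTiles.zero, rfl⟩
  simp only [card_univ, Fintype.card_fin, add_zero] at h0
  have h1 : θ * N ≤ θ * I.card + q := by
    have := hIN I
    by_contra hlt
    push Not at hlt
    have : (c0+1) * (θ * I.card + q) ≤ (c0 + 1) * (θ * N) := Nat.mul_le_mul_left _ hlt.le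
    have h3 : (c0+1) * (θ * I.card + q + 1) ≤ (c0 + 1) * (θ * N) := Nat.mul_le_mul_left _ hlt
    rw [mul_add] at h3
    omega
  have h2 := hq I q h
  have h3 : N ≤ I.card + (c0 + 1) * g := by
    have := Nat.mul_le_mul_left (c0+1) h2
    rw [mul_add (c0+1) (θ * N) g] at this
    omega
  obtain ⟨f, f1, f2⟩ := h
  refine ⟨I, q, univ.biUnion f, ?_, ?_, ?_, ?_, h3, ?_, ?_⟩
  · exact biUnion_subset.2 fun i _ => (f1 i).2.trans sdiff_subset
  · rw [disjoint_biUnion_left]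
    intro i _
    exact (disjoint_sdiff (s := I.biUnion B) (t := W)).symm.mono_left (f1 i).2
  · rw [card_biUnion (fun i _ j _ hij => f2 i j hij)]
    simp [(f1 _).1.card, mul_comm]
  · exact ⟨f, fun i => ⟨(f1 i).1, subset_biUnion_of_mem f (mem_univ i)⟩, f2⟩
  · have : θ * N ≤ θ * I.card + θ * ((c0 + 1) * g) := by
      rw [← mul_add]; exact Nat.mul_le_mul_left _ h3
    rw [add_mul, one_mul, mul_assoc]
    omega
  · intro I0 hI0 hc hT
    have hF : HasTiles G p σ ω m q (univ.biUnion f) :=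
      ⟨f, fun i => ⟨(f1 i).1, subset_biUnion_of_mem f (mem_univ i)⟩, f2⟩
    have hFd : Disjoint (univ.biUnion f) (I.biUnion B) := by
      rw [disjoint_biUnion_left]
      intro i _
      exact (disjoint_sdiff (s := I.biUnion B) (t := W)).symm.mono_left (f1 i).2
    have hd : Disjoint (univ.biUnion f) ((W \ (I.biUnion B)) \ univ.biUnion f ∪ I0.biUnion B) := by
      rw [disjoint_union_right]
      exact ⟨disjoint_sdiff, hFd.mono_right (biUnion_subset_biUnion_of_subset_left _ hI0)⟩
    have hnew := (hF.add hT hd).mono (T := W \ (I \ I0).biUnion B) (by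
      intro x hx
      have hxd : ∀ i ∈ I0, x ∈ B i → x ∉ (I \ I0).biUnion B := by
        intro i hi hxi hx2
        rw [mem_biUnion] at hx2
        obtain ⟨j, hj, hxj⟩ := hx2
        rw [mem_sdiff] at hj
        exact (disjoint_left.1 (hBd i j (fun h => hj.2 (h ▸ hi)))) hxi hxj
      have hII : (I \ I0).biUnion B ⊆ I.biUnion B :=
        biUnion_subset_biUnion_of_subset_left _ sdiff_subset
      rw [mem_union, mem_union] at hx
      rcases hx with hx | hx | hx
      · rw [mem_sdiff]
        refine ⟨biUnion_subset.2 (fun i _ => (f1 i).2.trans sdiff_subset) hx, fun h => ?_⟩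
        exact disjoint_left.1 hFd hx (hII h)
      · rw [mem_sdiff, mem_sdiff] at hx
        rw [mem_sdiff]
        exact ⟨hx.1.1, fun h => hx.1.2 (hII h)⟩
      · rw [mem_sdiff]
        refine ⟨hsub I0 hx, ?_⟩
        rw [mem_biUnion] at hx
        obtain ⟨i, hi, hxi⟩ := hx
        exact hxd i hi hxi)
    have := hmax _ ⟨I \ I0, _, hnew, rfl⟩
    rw [card_sdiff_of_subset hI0] at this
    have hle := card_le_card hI0
    obtain ⟨d, hd⟩ := Nat.exists_eq_add_of_le hle
    rw [hd] at this
    simp only [Nat.add_sub_cancel_left] at this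
    have e1 : (c0+1) * (θ * d + (q + (θ * I0.card + 1))) =
      (c0+1) * (θ * (I0.card + d) + q) + (c0 + 1) := by ring
    rw [e1] at this
    omega

lemma tile_of_cells {G : SimpleGraph V} {p σ ω m r : ℕ} (hσ : σ ≤ ω) (Q : Fin r → Finset V)
    (hQ : ∀ i j, i ≠ j → Cm G (Q i) (Q j)) (hc : ∀ i, ω * m ≤ (Q i).card)
    (hr : p * ω + σ ≤ r * ω) (hω : 0 < ω) : HasTiles G p σ ω m 1 (univ.biUnion Q) := by
  have hpr : p ≤ r := by
    have : p * ω ≤ r * ω := by omega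
    exact Nat.le_of_mul_le_mul_right this hω
  let idx : Fin (p+1) → ℕ := fun i => if i = 0 then p else i.val - 1
  have hidx : ∀ i j, idx i = idx j → i = j := by
    intro i j h
    have hi := i.2
    have hj := j.2
    simp only [idx] at h
    split_ifs at h with h1 h2 h2
    · rw [h1, h2]
    · have : j.val ≠ 0 := fun h => h2 (Fin.ext h)
      omega
    · have : i.val ≠ 0 := fun h => h1 (Fin.ext h)
      omega
    · have : i.val ≠ 0 := fun h => h1 (Fin.ext h)
      have : j.val ≠ 0 := fun h => h2 (Fin.ext h)
      exact Fin.ext (by omega)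
  let P : Fin (p+1) → Finset V := fun i => if h : idx i < r then Q ⟨idx i, h⟩ else ∅
  have hP : HasTiles G p σ ω m 1 (univ.biUnion P) := by
    apply OBT.split
    · intro i
      by_cases h : idx i < r
      · simp only [P, h, dif_pos]
        refine le_trans ?_ (hc _)
        rw [mul_one]
        apply Nat.mul_le_mul_right
        unfold sz; split_ifs <;> omega
      · have hi : i = 0 := by
          by_contra hi
          have : i.val ≠ 0 := fun h => hi (Fin.ext h)
          have hi2 := i.2
          simp only [idx, hi, if_false] at h
          omega
        have h' := h
        simp only [idx, hi, if_true] at h'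
        have : r = p := by omega
        have hs : σ = 0 := by rw [this] at hr; omega
        simp [sz, hi, hs]
    · intro i j hij
      by_cases h : idx i < r
      · by_cases h' : idx j < r
        · simp only [P, h, h', dif_pos]
          apply hQ
          intro he
          exact hij (hidx i j (by simpa using he))
        · intro u hu v hv
          simp only [P, h', dif_neg, not_false_eq_true] at hv
          simp at hv
      · intro u hu v hv
        simp only [P, h, dif_neg, not_false_eq_true] at hu
        simp at hu
  refine hP.mono ?_
  intro x hx
  simp only [mem_biUnion, mem_univ, true_and] at hx ⊢
  obtain ⟨i, hi⟩ := hx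
  by_cases h : idx i < r
  · simp only [P, h, dif_pos] at hi
    exact ⟨_, hi⟩
  · simp only [P, h, dif_neg, not_false_eq_true] at hi
    simp at hi

lemma tile_of_clique {G : SimpleGraph V} {p σ ω m : ℕ} (A : Finset V)
    (hA : ∀ u ∈ A, ∀ v ∈ A, u ≠ v → G.Adj u v) (hc : (p * ω + σ) * m ≤ A.card) :
    HasTiles G p σ ω m 1 A := by
  obtain ⟨f, hf, hd⟩ := exists_disj_family (univ : Finset (Fin (p+1))) (fun i => sz σ ω i * m) A (by
    rw [← Finset.sum_mul, sum_sz]; exact hc)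
  refine (OBT.split f (fun i => ?_) ?_).mono ?_
  · rw [(hf i (mem_univ _)).2]; simp
  · intro i j hij u hu v hv
    refine hA u ((hf i (mem_univ _)).1 hu) v ((hf j (mem_univ _)).1 hv) ?_
    intro h
    exact disjoint_left.1 (hd i (mem_univ _) j (mem_univ _) hij) hu (h ▸ hv)
  · exact biUnion_subset.2 fun i _ => (hf i (mem_univ _)).1

lemma cells_of_clique {G : SimpleGraph V} {r t : ℕ} (A : Finset V)
    (hA : ∀ u ∈ A, ∀ v ∈ A, u ≠ v → G.Adj u v) (hc : r * t ≤ A.card) :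
    ∃ Q : Fin r → Finset V, (∀ i, Q i ⊆ A ∧ (Q i).card = t) ∧ ∀ i j, i ≠ j → Cm G (Q i) (Q j) := by
  obtain ⟨f, hf, hd⟩ := exists_disj_family (univ : Finset (Fin r)) (fun i => t) A (by
    simpa using hc)
  refine ⟨f, fun i => hf i (mem_univ _), ?_⟩
  intro i j hij u hu v hv
  refine hA u ((hf i (mem_univ _)).1 hu) v ((hf j (mem_univ _)).1 hv) ?_
  intro h
  exact disjoint_left.1 (hd i (mem_univ _) j (mem_univ _) hij) hu (h ▸ hv)

lemma nogain {G : SimpleGraph V} {p σ ω t θ r : ℕ} (hσ : σ < ω) (hr : 1 ≤ r) (hrp : r ≤ p)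
    (P : Fin (p+1) → Finset V) (h1 : ∀ i, (P i).card = sz σ ω i * (θ * t))
    (h2 : ∀ i j, i ≠ j → Cm G (P i) (P j))
    (hθ : p * ω + σ ≤ θ)
    (D : Fin r → Finset V) (hD : ∀ i j, i ≠ j → Cm G (D i) (D j))
    (hDc : ∀ i, (p+1) * ω * (ω * t) ≤ (D i).card)
    (S0 : Finset V) (hDS : ∀ l, D l ⊆ S0)
    (hdisj : Disjoint S0 (univ.biUnion P))
    (hno : ¬ HasTiles G p σ ω t (θ + 1) (S0 ∪ univ.biUnion P))
    (Z : Finset V) (hDZ : ∀ l, Cm G (D l) Z) :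
    r ≤ (univ.filter (fun j : Fin (p+1) => j ≠ 0 ∧ (P j ∩ Z).card < ω * (p * ω + σ) * t)).card := by
  by_contra hlt
  push Not at hlt
  set J := univ.filter (fun j : Fin (p+1) => j ≠ 0 ∧ (P j ∩ Z).card < ω * (p * ω + σ) * t) with hJ
  have hJc : p + 1 - r ≤ ((univ.erase (0 : Fin (p+1))) \ J).card := by
    have := le_card_sdiff J (univ.erase (0 : Fin (p+1)))
    rw [card_erase_of_mem (mem_univ _), card_univ, Fintype.card_fin] at this
    omega
  obtain ⟨R, hR, hRc⟩ := exists_subset_card_eq hJc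
  have hR' : ∀ j ∈ R, j ≠ 0 ∧ ω * (p * ω + σ) * t ≤ (P j ∩ Z).card := by
    intro j hj
    have := hR hj
    simp only [hJ, mem_sdiff, mem_erase, mem_univ, mem_filter, true_and, and_true] at this
    refine ⟨this.1, ?_⟩
    by_contra h
    push Not at h
    exact this.2 ⟨this.1, h⟩
  apply hno
  have := gain hσ hr hrp P h1 h2 hθ D hD hDc
    (fun l i => (hdisj.mono_left (hDS l)).mono_right (subset_biUnion_of_mem P (mem_univ i)))
    R (fun h => (hR' 0 h).1 rfl) hRc (fun j => P j ∩ Z) (fun j _ => inter_subset_left)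
    (fun j hj => (hR' j hj).2) (fun l j hj => (hDZ l).mono subset_rfl inter_subset_right)
  refine this.mono ?_
  rw [union_comm]
  exact union_subset_union_left (biUnion_subset.2 fun l _ => hDS l)

lemma nogain_miss {G : SimpleGraph V} {p σ ω t θ r : ℕ}
    (P : Fin (p+1) → Finset V) (h1 : ∀ i, (P i).card = sz σ ω i * (θ * t))
    (h2 : ∀ i j, i ≠ j → Cm G (P i) (P j)) (Z : Finset V) (c : ℕ)
    (hr : r ≤ (univ.filter (fun j : Fin (p+1) => j ≠ 0 ∧ (P j ∩ Z).card < c)).card) :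
    r * (ω * (θ * t)) ≤ ((univ.biUnion P) \ Z).card + r * c := by
  obtain ⟨J, hJ, hJc⟩ := exists_subset_card_eq hr
  have hd : ∀ i ∈ J, ∀ j ∈ J, i ≠ j → Disjoint (P i \ Z) (P j \ Z) := fun i _ j _ hij =>
    (h2 i j hij).disj.mono sdiff_subset sdiff_subset
  have h3 : (J.biUnion fun j => P j \ Z).card ≤ ((univ.biUnion P) \ Z).card := by
    apply card_le_card
    intro x hx
    simp only [mem_biUnion, mem_sdiff, mem_univ, true_and] at hx ⊢
    obtain ⟨j, _, h, h'⟩ := hx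
    exact ⟨⟨j, h⟩, h'⟩
  rw [card_biUnion hd] at h3
  have h4 : ∑ j ∈ J, (ω * (θ * t)) ≤ ∑ j ∈ J, ((P j \ Z).card + c) := by
    apply sum_le_sum
    intro j hj
    have := hJ hj
    simp only [mem_filter, mem_univ, true_and] at this
    have h5 := card_sdiff_add_card_inter (P j) Z
    rw [h1 j, sz, if_neg this.1] at h5
    omega
  rw [sum_add_distrib, sum_const, sum_const, hJc, smul_eq_mul, smul_eq_mul] at h4
  omega

/-- class of vertices of `Q` with the same pattern on `T` as `x` -/
noncomputable def cls (G : SimpleGraph V) (Q T : Finset V) (x : V) : Finset V :=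
  Q.filter (fun y => nb G y T = nb G x T)

lemma cls_cm {G : SimpleGraph V} {Q T : Finset V} {x : V} : Cm G (cls G Q T x) (nb G x T) := by
  intro u hu v hv
  simp only [cls, mem_filter] at hu
  rw [← hu.2, mem_nb] at hv
  exact hv.2

lemma nonpop {G : SimpleGraph V} (Q T : Finset V) (s : ℕ) :
    (Q.filter (fun x => (cls G Q T x).card < s)).card ≤ s * 2 ^ T.card := by
  have := card_le_mul_card_image_of_maps_to (s := Q.filter (fun x => (cls G Q T x).card < s))
    (t := T.powerset) (f := fun x => nb G x T) (fun x _ => mem_powerset.2 nb_sub) s (by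
      intro Z hZ
      by_cases h : ((Q.filter (fun x => (cls G Q T x).card < s)).filter (fun x => nb G x T = Z)).Nonempty
      · obtain ⟨x, hx⟩ := h
        simp only [mem_filter] at hx
        refine le_trans (card_le_card ?_) hx.1.2.le
        intro y hy
        rw [mem_filter, mem_filter] at hy
        exact mem_filter.2 ⟨hy.1.1, hy.2.trans hx.2.symm⟩
      · rw [not_nonempty_iff_eq_empty.1 h]; simp)
  rwa [card_powerset] at this

lemma pattern_class {G : SimpleGraph V} (E T : Finset V) (t : ℕ) (ht : 1 ≤ t)
    (hbig : 2 ^ T.card * t ≤ E.card) :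
    ∃ C ⊆ E, C.card = t ∧ ∃ x ∈ E, Cm G C (nb G x T) := by
  have hne : T.powerset.Nonempty := ⟨∅, by simp⟩
  obtain ⟨Z, hZ, h⟩ := exists_le_card_fiber_of_mul_le_card_of_maps_to (s := E) (t := T.powerset)
    (f := fun x => nb G x T) (n := t) (fun x _ => mem_powerset.2 nb_sub) hne (by rwa [card_powerset])
  obtain ⟨C, hC, hCc⟩ := exists_subset_card_eq h
  refine ⟨C, hC.trans (filter_subset _ _), hCc, ?_⟩
  have : C.Nonempty := by rw [← card_pos]; omega
  obtain ⟨x, hx⟩ := this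
  refine ⟨x, (mem_filter.1 (hC hx)).1, ?_⟩
  intro u hu v hv
  have h1 := (mem_filter.1 (hC hu)).2
  have h2 := (mem_filter.1 (hC hx)).2
  rw [h2, ← h1, mem_nb] at hv
  exact hv.2

lemma step {G : SimpleGraph V} {r s t μ : ℕ} (Q : Fin r → Finset V) (hQ : ∀ i, (Q i).card = s)
    (ht : 1 ≤ t) (E : Finset V) (hE : ∀ v ∈ E, ∀ l, μ ≤ (nb G v (Q l)).card)
    (hbig : 2 ^ (r * s) * t ≤ E.card) :
    ∃ C ⊆ E, C.card = t ∧ ∃ Q' : Fin r → Finset V, ∀ l, Q' l ⊆ Q l ∧ μ ≤ (Q' l).card ∧ Cm G C (Q' l) := by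
  have hTc : (univ.biUnion Q).card ≤ r * s := by
    refine card_biUnion_le.trans ?_
    simp [hQ]
  obtain ⟨C, hC, hCc, x, hx, hcm⟩ := pattern_class (G := G) E (univ.biUnion Q) t ht
    (le_trans (Nat.mul_le_mul_right _ (Nat.pow_le_pow_right (by norm_num) hTc)) hbig)
  refine ⟨C, hC, hCc, fun l => nb G x (Q l), fun l => ⟨nb_sub, hE x hx l, ?_⟩⟩
  refine hcm.mono subset_rfl ?_
  exact filter_subset_filter _ (subset_biUnion_of_mem Q (mem_univ l))

/-- adding one more cell by double counting misses -/
lemma stepcell {G : SimpleGraph V} {r s t K D : ℕ} (hK : 2 ≤ K) (Q : Fin r → Finset V)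
    (hQ : ∀ i, (Q i).card = K * s) (ht : 1 ≤ t) (hs : 1 ≤ s)
    (U : Finset V) (hm : ∀ i, ∀ x ∈ Q i, ms G x U ≤ D)
    (hbig : (K - 1) * (2 ^ (r * (K * s)) * t) + r * K * D ≤ (K - 1) * U.card) :
    ∃ C ⊆ U, C.card = t ∧ ∃ Q' : Fin r → Finset V, ∀ l, Q' l ⊆ Q l ∧ s ≤ (Q' l).card ∧ Cm G C (Q' l) := by
  set E := U.filter (fun v => ∀ l, s ≤ (nb G v (Q l)).card) with hE
  have h1 : ∑ v ∈ U, ∑ l, ms G v (Q l) ≤ r * (K * s) * D := by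
    rw [sum_comm]
    calc ∑ l, ∑ v ∈ U, ms G v (Q l) = ∑ l, ∑ x ∈ Q l, ms G x U := by
          simp_rw [sum_ms_comm G U]
      _ ≤ ∑ l : Fin r, (K * s) * D := by
          apply sum_le_sum
          intro l _
          refine (sum_le_card_nsmul _ _ D (hm l)).trans ?_
          rw [hQ, smul_eq_mul]
      _ = _ := by simp [mul_assoc]
  have h2 : (U \ E).card * ((K - 1) * s) ≤ ∑ v ∈ U, ∑ l, ms G v (Q l) := by
    calc (U \ E).card * ((K - 1) * s) = ∑ v ∈ U \ E, (K - 1) * s := by simp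
      _ ≤ ∑ v ∈ U \ E, ∑ l, ms G v (Q l) := by
          apply sum_le_sum
          intro v hv
          simp only [hE, mem_sdiff, mem_filter, not_and, not_forall, not_le] at hv
          obtain ⟨l, hl⟩ := hv.2 hv.1
          refine le_trans ?_ (single_le_sum (f := fun l => ms G v (Q l)) (fun _ _ => Nat.zero_le _) (mem_univ l))
          have := nb_add_ms G v (Q l)
          rw [hQ] at this
          rw [Nat.sub_mul, one_mul]
          show K * s - s ≤ ms G v (Q l)
          omega
      _ ≤ _ := sum_le_sum_of_subset sdiff_subset
  have h3 : (U \ E).card * (K - 1) ≤ r * K * D := by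
    have : (U \ E).card * (K - 1) * s ≤ r * K * D * s := by
      calc _ = (U \ E).card * ((K - 1) * s) := by ring
        _ ≤ r * (K * s) * D := h2.trans h1
        _ = _ := by ring
    exact Nat.le_of_mul_le_mul_right this hs
  have h4 : 2 ^ (r * (K * s)) * t ≤ E.card := by
    have h5 : (U \ E).card + E.card = U.card := card_sdiff_add_card_eq_card (filter_subset _ _)
    have : (K - 1) * (2 ^ (r * (K * s)) * t) ≤ (K - 1) * E.card := by
      have : (K - 1) * U.card = (U \ E).card * (K - 1) + (K - 1) * E.card := by rw [← h5]; ring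
      omega
    exact Nat.le_of_mul_le_mul_left this (by omega)
  obtain ⟨C, hC, hCc, Q', hQ'⟩ := step Q hQ ht E (fun v hv l => (mem_filter.1 hv).2 l) h4
  exact ⟨C, hC.trans (filter_subset _ _), hCc, Q', hQ'⟩

end OBT

set_option linter.unusedVariables false
set_option linter.unusedSectionVars false
namespace OBT
open scoped Classical
open Finset

section
variable {V : Type*}

lemma tile_miss {G : SimpleGraph V} {p σ ω m θ r s κ : ℕ} (hσ : σ < ω) (hr : 1 ≤ r) (hrp : r ≤ p)
    (hθ : p * ω + σ ≤ θ) (T : Finset V) (hT : IsTile G p σ ω (θ * m) T)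
    (Q : Fin r → Finset V) (hQ : ∀ i j, i ≠ j → Cm G (Q i) (Q j)) (hQc : ∀ i, (Q i).card = s)
    (L : Finset V) (hQL : ∀ i, Q i ⊆ L) (hLT : Disjoint L T)
    (hno : ¬ HasTiles G p σ ω m (θ + 1) (L ∪ T))
    (hκ : (p+1) * ω * (ω * m) * 2 ^ ((p * ω + σ) * (θ * m)) ≤ κ) (hκs : κ < s) :
    (s - κ) * (r * (ω * (θ * m))) ≤ ∑ l, ∑ x ∈ Q l, ms G x T
      + (s - κ) * (r * (ω * (p * ω + σ) * m)) := by
  set s' := (p+1) * ω * (ω * m) with hs'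
  have hTc := hT.card
  have hpop : ∀ l, ∃ x ∈ Q l, s' ≤ (cls G (Q l) T x).card ∧ (s - κ) * ms G x T ≤ ∑ y ∈ Q l, ms G y T := by
    intro l
    set Pop := (Q l).filter (fun x => ¬ (cls G (Q l) T x).card < s') with hPop
    have h1 : s - κ ≤ Pop.card := by
      have h2 := nonpop (G := G) (Q l) T s'
      have h3 := card_filter_add_card_filter_not (s := Q l) (fun x => (cls G (Q l) T x).card < s')
      rw [hQc] at h3
      rw [hTc] at h2
      have : Pop.card + (filter (fun x => (cls G (Q l) T x).card < s') (Q l)).card = s := by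
        rw [add_comm]; exact h3
      omega
    have hne : Pop.Nonempty := by rw [← card_pos]; omega
    obtain ⟨x, hx, hmin⟩ := exists_min_image Pop (fun x => ms G x T) hne
    rw [hPop, mem_filter, not_lt] at hx
    refine ⟨x, hx.1, hx.2, ?_⟩
    calc (s - κ) * ms G x T ≤ Pop.card * ms G x T := Nat.mul_le_mul_right _ h1
      _ ≤ ∑ y ∈ Pop, ms G y T := by
          have := card_nsmul_le_sum Pop (fun y => ms G y T) (ms G x T) hmin
          simpa using this
      _ ≤ _ := sum_le_sum_of_subset (filter_subset _ _)
  choose x hx hxpop hxs using hpop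
  obtain ⟨P, hP1, hP2, rfl⟩ := hT
  set T := univ.biUnion P with hTdef
  set Z := T.filter (fun v => ∀ l, G.Adj (x l) v) with hZ
  have hclsQ : ∀ l, cls G (Q l) T (x l) ⊆ Q l := fun l => filter_subset _ _
  have hng := nogain hσ hr hrp P hP1 hP2 hθ (fun l => cls G (Q l) T (x l))
    (fun i j hij => (hQ i j hij).mono (hclsQ i) (hclsQ j)) (fun l => hxpop l) L
    (fun l => (hclsQ l).trans (hQL l)) hLT hno Z (fun l => cls_cm.mono subset_rfl (by
      intro v hv
      rw [hZ, mem_filter] at hv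
      exact mem_nb.2 ⟨hv.1, hv.2 l⟩))
  have hmm := nogain_miss P hP1 hP2 Z _ hng
  rw [← hTdef] at hmm
  have hTZ : (T \ Z).card ≤ ∑ l, ms G (x l) T := by
    refine le_trans (card_le_card ?_) card_biUnion_le
    intro v hv
    rw [mem_sdiff, hZ, mem_filter] at hv
    have : ∃ l, ¬ G.Adj (x l) v := by
      by_contra h; push Not at h; exact hv.2 ⟨hv.1, h⟩
    obtain ⟨l, hl⟩ := this
    exact mem_biUnion.2 ⟨l, mem_univ _, mem_filter.2 ⟨hv.1, hl⟩⟩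
  calc (s - κ) * (r * (ω * (θ * m))) ≤ (s - κ) * (∑ l, ms G (x l) T + r * (ω * (p * ω + σ) * m)) :=
        Nat.mul_le_mul_left _ (by omega)
    _ = ∑ l, (s - κ) * ms G (x l) T + (s - κ) * (r * (ω * (p * ω + σ) * m)) := by
        rw [mul_add, mul_sum]
    _ ≤ _ := by
        apply Nat.add_le_add_right
        exact sum_le_sum fun l _ => hxs l

lemma Cells.cons {G : SimpleGraph V} {r t : ℕ} {C : Finset V} {Q : Fin r → Finset V} {S : Finset V}
    (hC : C ⊆ S) (hCc : t ≤ C.card) (hQ : ∀ i j, i ≠ j → Cm G (Q i) (Q j))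
    (hQS : ∀ i, Q i ⊆ S) (hQc : ∀ i, t ≤ (Q i).card) (hCQ : ∀ i, Cm G C (Q i)) :
    ∃ Q' : Fin (r+1) → Finset V, (∀ i j, i ≠ j → Cm G (Q' i) (Q' j)) ∧
      ∀ i, Q' i ⊆ S ∧ (Q' i).card = t := by
  let Q0 : Fin (r+1) → Finset V := Fin.cons C Q
  have h1 : ∀ i, ∃ D ⊆ Q0 i, D.card = t := by
    intro i
    apply exists_subset_card_eq
    refine Fin.cases ?_ (fun i => ?_) i
    · exact hCc
    · exact hQc i
  choose D hD hDc using h1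
  have h2 : ∀ i j, i ≠ j → Cm G (Q0 i) (Q0 j) := by
    intro i j
    refine Fin.cases ?_ (fun i => ?_) i <;> refine Fin.cases ?_ (fun j => ?_) j
    · intro h; exact absurd rfl h
    · intro h; exact hCQ j
    · intro h; exact (hCQ i).symm
    · intro h; exact hQ i j (fun h' => h (by rw [h']))
  refine ⟨D, fun i j hij => (h2 i j hij).mono (hD i) (hD j), fun i => ⟨(hD i).trans ?_, hDc i⟩⟩
  refine Fin.cases ?_ (fun i => ?_) i
  · exact hC
  · exact hQS i

lemma at_step {G : SimpleGraph V} {p σ ω m θ r s1 κ N D : ℕ} (hσ : σ < ω) (hr : 1 ≤ r) (hrp : r ≤ p)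
    (hθ : p * ω + σ ≤ θ) (B : Fin N → Finset V) (hB : ∀ i, IsTile G p σ ω (θ * m) (B i))
    (hBd : ∀ i j, i ≠ j → Disjoint (B i) (B j)) (I : Finset (Fin N))
    (W A L : Finset V) (hA : ∀ u ∈ A, ∀ v ∈ A, u ≠ v → G.Adj u v)
    (hBW : ∀ i, B i ⊆ W) (hLW : L ⊆ W) (hLB : Disjoint L (I.biUnion B))
    (hD : ∀ x ∈ W, x ∉ A → ms G x W ≤ D) (hs1 : 1 ≤ s1)
    (Q : Fin r → Finset V) (hQ : ∀ i j, i ≠ j → Cm G (Q i) (Q j))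
    (hQc : ∀ i, Q i ⊆ L \ A ∧ (Q i).card = 2 * (p * ω + σ) * s1)
    (hno0 : ¬ HasTiles G p σ ω m 1 L)
    (hno : ∀ i ∈ I, ¬ HasTiles G p σ ω m (θ + 1) (L ∪ B i))
    (hκ : (p+1) * ω * (ω * m) * 2 ^ ((p * ω + σ) * (θ * m)) ≤ κ) (hκs : κ < 2 * (p * ω + σ) * s1) :
    (∃ Q' : Fin (r+1) → Finset V, (∀ i j, i ≠ j → Cm G (Q' i) (Q' j)) ∧
      ∀ i, Q' i ⊆ L \ A ∧ (Q' i).card = s1) ∨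
    (L.card - 2 ^ (r * (2 * (p * ω + σ) * s1)) * s1 - (p * ω + σ) * m) *
        (2 * (p * ω + σ) * s1 - s1)
      + I.card * ((2 * (p * ω + σ) * s1 - κ) * (r * (ω * (θ * m)))) ≤
      r * (2 * (p * ω + σ) * s1) * D + I.card * ((2 * (p * ω + σ) * s1 - κ) *
        (r * (ω * (p * ω + σ) * m))) := by
  set h := p * ω + σ with hh
  set s := 2 * h * s1 with hs
  set E := (L \ A).filter (fun v => ∀ l, s1 ≤ (nb G v (Q l)).card) with hE
  by_cases hbig : 2 ^ (r * s) * s1 ≤ E.card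
  · left
    obtain ⟨C, hC, hCc, Q', hQ'⟩ := step Q (fun i => (hQc i).2) hs1 E
      (fun v hv l => (mem_filter.1 hv).2 l) hbig
    exact Cells.cons (hC.trans (filter_subset _ _)) hCc.ge
      (fun i j hij => (hQ i j hij).mono (hQ' i).1 (hQ' j).1)
      (fun i => (hQ' i).1.trans (hQc i).1) (fun i => (hQ' i).2.1) (fun i => (hQ' i).2.2)
  · right
    push Not at hbig
    have hLA : (L ∩ A).card < h * m := by
      by_contra hge
      push Not at hge
      exact hno0 ((tile_of_clique (L ∩ A) (fun u hu v hv huv =>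
        hA u (mem_inter.1 hu).2 v (mem_inter.1 hv).2 huv) hge).mono inter_subset_left)
    have h1 : ∑ l, ∑ x ∈ Q l, ms G x W ≤ r * s * D := by
      calc _ ≤ ∑ l : Fin r, s * D := by
            apply sum_le_sum
            intro l _
            refine (sum_le_card_nsmul _ _ D ?_).trans ?_
            · intro x hx
              have := (hQc l).1 hx
              rw [mem_sdiff] at this
              exact hD x (hLW this.1) this.2
            · rw [(hQc l).2, smul_eq_mul]
        _ = _ := by simp [mul_assoc]
    have h2 : ∑ l, ∑ x ∈ Q l, (ms G x L + ∑ i ∈ I, ms G x (B i)) ≤ ∑ l, ∑ x ∈ Q l, ms G x W := by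
      apply sum_le_sum; intro l _
      apply sum_le_sum; intro x _
      rw [← ms_biUnion G x I B (fun i _ j _ => hBd i j)]
      have : ms G x L + ms G x (I.biUnion B) = ms G x (L ∪ I.biUnion B) := by
        unfold ms
        rw [filter_union, card_union_of_disjoint]
        exact hLB.mono (filter_subset _ _) (filter_subset _ _)
      rw [this]
      exact ms_mono (union_subset hLW (biUnion_subset.2 fun i _ => hBW i))
    have h3 : (L.card - 2 ^ (r * s) * s1 - h * m) * (s - s1) ≤ ∑ l, ∑ x ∈ Q l, ms G x L := by
      have e : ∑ l, ∑ x ∈ Q l, ms G x L = ∑ v ∈ L, ∑ l, ms G v (Q l) := by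
        rw [sum_comm]
        exact sum_congr rfl fun l _ => sum_ms_comm G _ _
      rw [e]
      have hcard : L.card - 2 ^ (r * s) * s1 - h * m ≤ ((L \ A) \ E).card := by
        have a1 := card_sdiff_add_card_inter L A
        have a2 : ((L \ A) \ E).card + E.card = (L \ A).card :=
          card_sdiff_add_card_eq_card (filter_subset _ _)
        omega
      calc _ ≤ ((L \ A) \ E).card * (s - s1) := Nat.mul_le_mul_right _ hcard
        _ = ∑ v ∈ (L \ A) \ E, (s - s1) := by simp
        _ ≤ ∑ v ∈ (L \ A) \ E, ∑ l, ms G v (Q l) := by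
            apply sum_le_sum
            intro v hv
            rw [mem_sdiff, hE, mem_filter] at hv
            have : ∃ l, (nb G v (Q l)).card < s1 := by
              by_contra hcon; push Not at hcon; exact hv.2 ⟨hv.1, hcon⟩
            obtain ⟨l, hl⟩ := this
            refine le_trans ?_ (single_le_sum (f := fun l => ms G v (Q l)) (fun _ _ => Nat.zero_le _) (mem_univ l))
            have := nb_add_ms G v (Q l)
            rw [(hQc l).2] at this
            show s - s1 ≤ ms G v (Q l)
            omega
        _ ≤ _ := sum_le_sum_of_subset (sdiff_subset.trans sdiff_subset)
    have h4 : I.card * ((s - κ) * (r * (ω * (θ * m)))) ≤ ∑ l, ∑ x ∈ Q l, ∑ i ∈ I, ms G x (B i) +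
        I.card * ((s - κ) * (r * (ω * h * m))) := by
      have e : ∑ l, ∑ x ∈ Q l, ∑ i ∈ I, ms G x (B i) = ∑ i ∈ I, ∑ l, ∑ x ∈ Q l, ms G x (B i) := by
        rw [sum_comm (s := I)]
        exact sum_congr rfl fun l _ => sum_comm
      rw [e]
      have : ∑ i ∈ I, ((s - κ) * (r * (ω * (θ * m)))) ≤
          ∑ i ∈ I, (∑ l, ∑ x ∈ Q l, ms G x (B i) + (s - κ) * (r * (ω * h * m))) := by
        apply sum_le_sum
        intro i hi
        exact tile_miss hσ hr hrp hθ (B i) (hB i) Q hQ (fun l => (hQc l).2) L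
          (fun l => (hQc l).1.trans sdiff_subset)
          (hLB.mono_right (subset_biUnion_of_mem B hi)) (hno i hi) hκ hκs
      rw [sum_add_distrib, sum_const, sum_const, smul_eq_mul, smul_eq_mul] at this
      exact this
    simp_rw [sum_add_distrib] at h2
    omega

end

end OBT

set_option linter.unusedVariables false
set_option linter.unusedSectionVars false
namespace OBT
open scoped Classical
open Finset

set_option maxHeartbeats 1000000 in
lemma at_num {n Lc E0 s s1 κ Ic r ω M c D h b δ ε0 : ℝ} (hn : 0 < n) (hs1 : 0 < s1) (hh : 0 < h)
    (hs : s = 2 * h * s1) (hκ : κ ≤ δ * s) (hc : c ≤ δ * (ω * M)) (hD : D ≤ (b + ε0) * n)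
    (hb : b * h = ω) (hr : r * ω ≤ h - 1) (hr0 : 0 ≤ r) (hω : 0 < ω) (hM : 0 ≤ M) (hI0 : 0 ≤ Ic)
    (hI : n - Lc - δ * n ≤ h * M * Ic) (hE : E0 ≤ δ * n) (hδ : 0 < δ) (hδ1 : δ ≤ 1)
    (hL0 : 0 ≤ Lc) (hh1 : 1 ≤ h) (hrh : r ≤ h)
    (hmain : (Lc - E0) * (s - s1) + Ic * ((s - κ) * (r * (ω * M))) ≤
      r * s * D + Ic * ((s - κ) * (r * c))) : Lc / (2 * h) ≤ (4 * δ + h * |ε0|) * n := by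
  have hs0 : 0 < s := by rw [hs]; positivity
  have hb0 : 0 < b := by
    by_contra hcon; push Not at hcon
    nlinarith
  have hrb : r * b ≤ 1 - 1 / h := by
    have : r * b * h ≤ h - 1 := by rw [mul_assoc, hb]; exact hr
    rw [le_sub_iff_add_le, ← sub_nonneg]
    have e : 1 - (r * b + 1 / h) = (h - 1 - r * b * h) / h := by field_simp; ring
    rw [e]; apply div_nonneg; linarith; exact hh.le
  have hrb0 : 0 ≤ r * b := by positivity
  have hrb1 : r * b ≤ 1 := by have : 0 < 1 / h := by positivity
                              linarith
  -- tiles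
  have h1 : s * (r * b) * (n - Lc - 3 * δ * n) ≤ Ic * ((s - κ) * (r * (ω * M - c))) := by
    have a1 : s * (1 - δ) ≤ s - κ := by linarith
    have a2 : ω * M * (1 - δ) ≤ ω * M - c := by linarith
    have a3 : 0 ≤ s * (1 - δ) := mul_nonneg hs0.le (by linarith)
    have a4 : 0 ≤ ω * M * (1 - δ) := mul_nonneg (by positivity) (by linarith)
    have a5 : s * (1 - δ) * (r * (ω * M * (1 - δ))) ≤ (s - κ) * (r * (ω * M - c)) :=
      mul_le_mul a1 (mul_le_mul_of_nonneg_left a2 hr0) (mul_nonneg hr0 a4) (by linarith)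
    have a6 : Ic * (s * (1 - δ) * (r * (ω * M * (1 - δ)))) ≤ Ic * ((s - κ) * (r * (ω * M - c))) :=
      mul_le_mul_of_nonneg_left a5 hI0
    refine le_trans ?_ a6
    have a7 : Ic * (s * (1 - δ) * (r * (ω * M * (1 - δ)))) = s * (r * b) * ((1 - δ)^2 * (h * M * Ic)) := by
      rw [← hb]; ring
    rw [a7]
    apply mul_le_mul_of_nonneg_left _ (mul_nonneg hs0.le hrb0)
    have a8 : (1 - δ)^2 * (n - Lc - δ * n) ≤ (1-δ)^2 * (h * M * Ic) :=
      mul_le_mul_of_nonneg_left hI (sq_nonneg _)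
    have a9 : (1 - δ)^2 = 1 - 2 * δ + δ^2 := by ring
    by_cases hX : 0 ≤ n - Lc - δ * n
    · have : (n - Lc - δ * n) - 2 * δ * n ≤ (1 - δ)^2 * (n - Lc - δ * n) := by
        rw [a9]
        have : 0 ≤ δ^2 * (n - Lc - δ * n) := by positivity
        have : δ * (n - Lc - δ * n) ≤ δ * n := mul_le_mul_of_nonneg_left (by nlinarith) hδ.le
        nlinarith
      linarith
    · have : 0 ≤ (1-δ)^2 * (h * M * Ic) := by positivity
      have : 0 < δ * n := by positivity
      push Not at hX
      linarith
  have h2 : (Lc - E0) * (s - s1) + s * (r * b) * (n - Lc - 3 * δ * n) ≤ r * s * ((b + ε0) * n) := by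
    have : r * s * D ≤ r * s * ((b + ε0) * n) := mul_le_mul_of_nonneg_left hD (by positivity)
    have e : Ic * ((s - κ) * (r * (ω * M - c))) = Ic * ((s - κ) * (r * (ω * M))) - Ic * ((s - κ) * (r * c)) := by ring
    rw [e] at h1
    linarith
  have hs1s : s - s1 = s * (1 - 1 / (2 * h)) := by rw [hs]; field_simp
  have hq : 0 ≤ 1 - 1 / (2 * h) := by
    rw [sub_nonneg, div_le_one (by positivity)]; linarith
  have hq1 : 1 - 1 / (2 * h) ≤ 1 := by
    have : 0 < 1 / (2 * h) := by positivity
    linarith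
  have h3 : (Lc - δ * n) * (1 - 1 / (2 * h)) + (r * b) * (n - Lc - 3 * δ * n) ≤ r * ((b + ε0) * n) := by
    have : s * ((Lc - δ * n) * (1 - 1 / (2 * h)) + (r * b) * (n - Lc - 3 * δ * n)) ≤ s * (r * ((b + ε0) * n)) := by
      have a1 : (Lc - δ * n) * (s - s1) ≤ (Lc - E0) * (s - s1) :=
        mul_le_mul_of_nonneg_right (by linarith) (by rw [hs1s]; positivity)
      rw [hs1s] at a1 h2
      have e1 : s * ((Lc - δ * n) * (1 - 1 / (2 * h)) + (r * b) * (n - Lc - 3 * δ * n)) =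
        (Lc - δ * n) * (s * (1 - 1 / (2 * h))) + s * (r * b) * (n - Lc - 3 * δ * n) := by ring
      have e2 : r * s * ((b + ε0) * n) = s * (r * ((b + ε0) * n)) := by ring
      rw [e1, ← e2]; linarith
    exact le_of_mul_le_mul_left this hs0
  have h4 : r * (ε0 * n) ≤ h * |ε0| * n := by
    calc r * (ε0 * n) ≤ r * (|ε0| * n) := by
          apply mul_le_mul_of_nonneg_left _ hr0
          exact mul_le_mul_of_nonneg_right (le_abs_self _) hn.le
      _ ≤ h * (|ε0| * n) := mul_le_mul_of_nonneg_right hrh (by positivity)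
      _ = _ := by ring
  have hδn : 0 < δ * n := by positivity
  have h5 : r * b * (δ * n) ≤ δ * n := mul_le_of_le_one_left hδn.le hrb1
  have h6 : δ * n * (1 - 1 / (2 * h)) ≤ δ * n := mul_le_of_le_one_right hδn.le hq1
  have h7 : Lc * (1 / h) ≤ Lc * (1 - r * b) := mul_le_mul_of_nonneg_left (by linarith) hL0
  have e1 : Lc / (2 * h) = Lc * (1 / h) - Lc * (1 / (2 * h)) := by field_simp; ring
  rw [e1]
  have e2 : (Lc - δ * n) * (1 - 1 / (2 * h)) = Lc - Lc * (1 / (2 * h)) - δ * n * (1 - 1 / (2 * h)) := by ring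
  have e3 : (r * b) * (n - Lc - 3 * δ * n) = r * b * n - Lc * (r * b) - 3 * (r * b * (δ * n)) := by ring
  have e4 : r * ((b + ε0) * n) = r * b * n + r * (ε0 * n) := by ring
  have e5 : Lc * (1 - r * b) = Lc - Lc * (r * b) := by ring
  have e6 : (4 * δ + h * |ε0|) * n = 4 * (δ * n) + h * |ε0| * n := by ring
  rw [e2, e3, e4] at h3
  rw [e5] at h7
  rw [e6]
  linarith

lemma telescope {J n h : ℕ} (hJ : 1 ≤ J) (U : ℕ → ℕ) (hU : h * U J ≤ n) :
    ∃ i < J, J * (h * U (i+1)) ≤ J * (h * U i) + n := by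
  by_contra hcon
  push Not at hcon
  have : ∀ j ≤ J, j * n ≤ J * (h * U j) := by
    intro j
    induction j with
    | zero => simp
    | succ j ih =>
      intro hj
      have := ih (by omega)
      have := hcon j (by omega)
      rw [add_mul, one_mul]; omega
  have h1 := hcon (J-1) (by omega)
  have h2 := this (J-1) (by omega)
  have e : J - 1 + 1 = J := by omega
  rw [e] at h1
  have h3 : J * (h * U J) ≤ J * n := Nat.mul_le_mul_left _ hU
  have : J * n = (J-1) * n + n := by
    conv_lhs => rw [← e]
    ring
  omega

set_option maxHeartbeats 1000000 in
/-- chain of cells until contradiction -/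
lemma at_core {V : Type} {G : SimpleGraph V} {p σ ω m θ N κ S : ℕ} (hσ : σ < ω)
    (hp : 1 ≤ p)
    (hθ : p * ω + σ ≤ θ) (hm : 1 ≤ m) (B : Fin N → Finset V) (hB : ∀ i, IsTile G p σ ω (θ * m) (B i))
    (hBd : ∀ i j, i ≠ j → Disjoint (B i) (B j)) (I : Finset (Fin N))
    (W A L F : Finset V) (hA : ∀ u ∈ A, ∀ v ∈ A, u ≠ v → G.Adj u v)
    (hBW : ∀ i, B i ⊆ W) (hFW : F ⊆ W) (hL : L = (W \ I.biUnion B) \ F)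
    (δ ε0 : ℝ) (hδ : 0 < δ) (hδ1 : δ ≤ 1)
    (hD : ∀ x ∈ W, x ∉ A → (ms G x W : ℝ) ≤ (ω / (p * ω + σ) + ε0) * W.card)
    (hno0 : ¬ HasTiles G p σ ω m 1 L)
    (hno : ∀ i ∈ I, ¬ HasTiles G p σ ω m (θ + 1) (L ∪ B i))
    (hκ : (p+1) * ω * (ω * m) * 2 ^ ((p * ω + σ) * (θ * m)) ≤ κ)
    (hS : (κ : ℝ) ≤ δ * S) (hκS : κ < S) (hωS : ω * m ≤ S)
    (hc : ((p * ω + σ : ℕ) : ℝ) ≤ δ * θ)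
    (hF : (F.card : ℝ) ≤ δ * W.card)
    (hE0 : ((2 ^ (p * (S * (2 * (p * ω + σ)) ^ p)) * (S * (2 * (p * ω + σ)) ^ p) + (p * ω + σ) * m : ℕ) : ℝ) ≤ δ * W.card)
    (hL1 : S * (2 * (p * ω + σ)) ^ p + (p * ω + σ) * m ≤ L.card)
    (hbig : (4 * δ + (p * ω + σ) * |ε0|) * (2 * (p * ω + σ)) * W.card < L.card) : False := by
  have hω : 0 < ω := by omega
  have hpω : ω ≤ p * ω := Nat.le_mul_of_pos_left _ hp
  set h := p * ω + σ with hh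
  have hh0 : 0 < h := by omega
  have hLW : L ⊆ W := by rw [hL]; exact sdiff_subset.trans sdiff_subset
  have hLB : Disjoint L (I.biUnion B) := by
    rw [hL]; exact (sdiff_disjoint).mono_left sdiff_subset
  have hLA : (L ∩ A).card < h * m := by
    by_contra hge
    push Not at hge
    exact hno0 ((tile_of_clique (L ∩ A) (fun u hu v hv huv =>
      hA u (mem_inter.1 hu).2 v (mem_inter.1 hv).2 huv) hge).mono inter_subset_left)
  have hrp : ∀ r, r * ω < h → r ≤ p := by
    intro r hr
    by_contra hcon
    push Not at hcon
    have : (p + 1) * ω ≤ r * ω := Nat.mul_le_mul_right _ hcon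
    rw [add_mul] at this; omega
  have chain : ∀ r, r ≤ p → ∃ Q' : Fin (r+1) → Finset V, (∀ i j, i ≠ j → Cm G (Q' i) (Q' j)) ∧
      ∀ i, Q' i ⊆ L \ A ∧ (Q' i).card = S * (2 * h) ^ (p - r) := by
    intro r
    induction r with
    | zero =>
      intro _
      have : S * (2 * h) ^ p ≤ (L \ A).card := by
        have a1 := card_sdiff_add_card_inter L A
        omega
      obtain ⟨C, hC, hCc⟩ := exists_subset_card_eq this
      refine ⟨fun _ => C, fun i j hij => absurd (Fin.ext (by have := i.2; have := j.2; omega)) hij, fun i => ⟨hC, by simpa using hCc⟩⟩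
    | succ r ih =>
      intro hr
      obtain ⟨Q, hQ, hQc⟩ := ih (by omega)
      set s1 := S * (2 * h) ^ (p - (r+1)) with hs1
      have hs : S * (2 * h) ^ (p - r) = 2 * h * s1 := by
        have : p - r = (p - (r+1)) + 1 := by omega
        rw [this, pow_succ, hs1]; ring
      have hSs1 : S ≤ s1 := Nat.le_mul_of_pos_right _ (by positivity)
      have hsle : S * (2 * h) ^ (p - r) ≤ S * (2 * h) ^ p :=
        Nat.mul_le_mul_left _ (Nat.pow_le_pow_right (by omega) (by omega))
      rw [hs] at hsle
      have hs1s : s1 ≤ 2 * h * s1 := Nat.le_mul_of_pos_left _ (by omega)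
      by_cases hrω : (r + 1) * ω < h
      · obtain hnew | hineq := at_step (G := G) (D := ⌊(ω / h + ε0) * (W.card : ℝ)⌋₊) hσ
          (by omega) (hrp _ hrω) hθ B hB hBd I W A L hA hBW hLW hLB
          (fun x hx hxA => Nat.le_floor (by have := hD x hx hxA; rw [hh]; push_cast; exact this))
          (s1 := s1) (by omega)
          Q hQ (fun i => ⟨(hQc i).1, by rw [(hQc i).2, hs]⟩) hno0 hno hκ (by rw [← hh]; omega)
        · exact hnew
        · exfalso
          have hSpos : 0 < S := by omega
          have hs1pos : 0 < s1 := by omega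
          have hLpos : 0 < L.card := by
            have : 0 < S * (2 * h) ^ p := by positivity
            omega
          have hWpos : 0 < W.card := lt_of_lt_of_le hLpos (card_le_card hLW)
          have hE : 2 ^ ((r+1) * (2 * h * s1)) * s1 + h * m ≤
              2 ^ (p * (S * (2 * h) ^ p)) * (S * (2 * h) ^ p) + h * m := by
            apply Nat.add_le_add_right
            apply Nat.mul_le_mul
            · exact Nat.pow_le_pow_right (by norm_num) (Nat.mul_le_mul hr hsle)
            · omega
          have hcov : W.card ≤ L.card + F.card + h * (θ * m) * I.card := by
            have e : W ⊆ L ∪ F ∪ I.biUnion B := by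
              intro x hx
              rw [hL]; simp only [mem_union, mem_sdiff]; tauto
            refine (card_le_card e).trans ((card_union_le _ _).trans ?_)
            apply add_le_add (card_union_le _ _)
            refine card_biUnion_le.trans ?_
            rw [sum_congr rfl (fun i _ => (hB i).card)]
            rw [sum_const, smul_eq_mul, mul_comm]
          have hm' : ((m : ℕ) : ℝ) ≥ 1 := by exact_mod_cast hm
          have key := at_num (n := W.card) (Lc := L.card)
            (E0 := ((2 ^ ((r+1) * (2 * h * s1)) * s1 + h * m : ℕ) : ℝ)) (s := ((2 * h * s1 : ℕ) : ℝ))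
            (s1 := s1) (κ := κ) (Ic := I.card) (r := ((r + 1 : ℕ) : ℝ)) (ω := ω)
            (M := ((θ * m : ℕ) : ℝ)) (c := ((ω * h * m : ℕ) : ℝ))
            (D := ((⌊(ω / h + ε0) * (W.card : ℝ)⌋₊ : ℕ) : ℝ)) (h := h) (b := ω / h) (δ := δ) (ε0 := ε0)
            (by exact_mod_cast hWpos) (by exact_mod_cast hs1pos) (by exact_mod_cast hh0)
            (by push_cast; ring)
            (hS.trans (mul_le_mul_of_nonneg_left (by exact_mod_cast hSs1.trans hs1s) hδ.le))
            (by
              push_cast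
              have : (h : ℝ) * (ω * m) ≤ δ * θ * (ω * m) :=
                mul_le_mul_of_nonneg_right hc (by positivity)
              linarith)
            (by
              apply Nat.floor_le
              have hx : ∃ x, x ∈ L \ A := by
                have a1 := card_sdiff_add_card_inter L A
                have : 0 < S * (2 * h) ^ p := by positivity
                have : 0 < (L \ A).card := by omega
                obtain ⟨x, hx⟩ := card_pos.1 this
                exact ⟨x, hx⟩
              obtain ⟨x, hx⟩ := hx
              rw [mem_sdiff] at hx
              have := hD x (hLW hx.1) hx.2
              rw [hh]; push_cast
              exact le_trans (by positivity) this)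
            (by field_simp)
            (by
              have : (r + 1) * ω + 1 ≤ h := hrω
              have : (((r + 1) * ω + 1 : ℕ) : ℝ) ≤ h := by exact_mod_cast this
              push_cast at this ⊢; linarith)
            (by positivity) (by exact_mod_cast hω) (by positivity) (by positivity)
            (by
              have : (W.card : ℝ) ≤ L.card + F.card + h * (θ * m) * I.card := by exact_mod_cast hcov
              push_cast; linarith)
            (le_trans (by exact_mod_cast hE) hE0)
            hδ hδ1 (by positivity) (by exact_mod_cast hh0)
            (by
              have : r + 1 ≤ h := by
                have : (r+1) * 1 ≤ (r + 1) * ω := Nat.mul_le_mul_left _ hω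
                omega
              exact_mod_cast this)
            (by
              have a := hineq
              rw [← hh] at a
              have b1 : (κ : ℝ) ≤ ((2 * h * s1 : ℕ) : ℝ) := by
                have : κ ≤ 2 * h * s1 := by omega
                exact_mod_cast this
              have hk : ((2 * h * s1 - κ : ℕ) : ℝ) = ((2 * h * s1 : ℕ) : ℝ) - κ := by
                rw [Nat.cast_sub (by omega)]
              have hk2 : ((2 * h * s1 - s1 : ℕ) : ℝ) = ((2 * h * s1 : ℕ) : ℝ) - s1 := by
                rw [Nat.cast_sub (by omega)]
              have hk3 : (L.card : ℝ) - ((2 ^ ((r+1) * (2 * h * s1)) * s1 + h * m : ℕ) : ℝ) ≤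
                  ((L.card - 2 ^ ((r+1) * (2 * h * s1)) * s1 - h * m : ℕ) : ℝ) := by
                rw [Nat.sub_sub]
                rw [sub_le_iff_le_add]
                have : L.card ≤ L.card - (2 ^ ((r+1) * (2 * h * s1)) * s1 + h * m) + (2 ^ ((r+1) * (2 * h * s1)) * s1 + h * m) := by omega
                exact_mod_cast this
              have hcast : (((L.card - 2 ^ ((r+1) * (2 * h * s1)) * s1 - h * m) * (2 * h * s1 - s1)
                + I.card * ((2 * h * s1 - κ) * ((r+1) * (ω * (θ * m)))) : ℕ) : ℝ) ≤
                (((r+1) * (2 * h * s1) * ⌊(ω / h + ε0) * (W.card : ℝ)⌋₊ + I.card * ((2 * h * s1 - κ) *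
                  ((r+1) * (ω * h * m))) : ℕ) : ℝ) := by exact_mod_cast a
              rw [Nat.cast_add, Nat.cast_add, Nat.cast_mul, Nat.cast_mul (I.card), Nat.cast_mul (I.card),
                Nat.cast_mul (2 * h * s1 - κ), Nat.cast_mul (2 * h * s1 - κ), hk, hk2,
                Nat.cast_mul ((r+1) * (2 * h * s1)), Nat.cast_mul (r+1) (2 * h * s1),
                Nat.cast_mul (r+1) (ω * (θ * m)), Nat.cast_mul ω, Nat.cast_mul (r+1) (ω * h * m)] at hcast
              refine le_trans (add_le_add_left ?_ _) hcast
              apply mul_le_mul_of_nonneg_right hk3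
              rw [sub_nonneg]; exact_mod_cast hs1s)
          rw [div_le_iff₀ (by positivity)] at key
          have hhc : (h : ℝ) = p * ω + σ := by rw [hh]; push_cast; ring
          rw [hhc] at key
          have e : (4 * δ + (p * ω + σ) * |ε0|) * (2 * (p * ω + σ)) * (W.card : ℝ) = (4 * δ + (p * ω + σ) * |ε0|) * W.card * (2 * (p * ω + σ)) := by ring
          rw [e] at hbig
          linarith
      · exfalso
        push Not at hrω
        apply hno0
        refine (tile_of_cells hσ.le Q hQ (fun i => ?_) hrω hω).mono ?_
        · rw [(hQc i).2, hs]; omega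
        · exact biUnion_subset.2 fun i _ => (hQc i).1.trans sdiff_subset
  obtain ⟨Q, hQ, hQc⟩ := chain p le_rfl
  apply hno0
  refine (tile_of_cells hσ.le Q hQ (fun i => ?_) ?_ hω).mono ?_
  · rw [(hQc i).2]; simpa using hωS
  · rw [add_mul]; omega
  · exact biUnion_subset.2 fun i _ => (hQc i).1.trans sdiff_subset

end OBT

set_option linter.unusedVariables false
set_option linter.unusedSectionVars false
namespace OBT
open scoped Classical
open Finset

/-- maximal number of tiles -/
lemma exists_max_tiles {V : Type} {G : SimpleGraph V} {p σ ω m : ℕ} {W : Finset V}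
    (hpos : 0 < (p * ω + σ) * m) :
    ∃ u, HasTiles G p σ ω m u W ∧ ∀ Q, HasTiles G p σ ω m Q W → Q ≤ u := by
  have hb : ∀ Q, HasTiles G p σ ω m Q W → Q ≤ W.card := by
    intro Q hQ
    have := hQ.card_le
    have : 1 * Q ≤ (p * ω + σ) * m * Q := Nat.mul_le_mul_right _ hpos
    omega
  refine ⟨Nat.findGreatest (fun Q => HasTiles G p σ ω m Q W) W.card, ?_, ?_⟩
  · exact Nat.findGreatest_spec (P := fun Q => HasTiles G p σ ω m Q W) (Nat.zero_le _) HasTiles.zero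
  · intro Q hQ
    exact Nat.le_findGreatest (hb Q hQ) hQ

theorem AT (p σ ω : ℕ) (hp : 1 ≤ p) (hσ : σ < ω) (M : ℕ) (hM : 1 ≤ M) (ε : ℝ) (hε : 0 < ε) :
    ∃ ε0 : ℝ, 0 < ε0 ∧ ∃ n0 : ℕ, ∀ (V : Type) (G : SimpleGraph V) (W A : Finset V),
      (∀ u ∈ A, ∀ v ∈ A, u ≠ v → G.Adj u v) →
      (∀ x ∈ W, x ∉ A → (ms G x W : ℝ) ≤ ((ω : ℝ) / (p * ω + σ) + ε0) * W.card) →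
      n0 ≤ W.card →
      ∃ q, HasTiles G p σ ω M q W ∧ (1 - ε) * W.card ≤ ((p * ω + σ) * M * q : ℕ) := by
  have hω : 0 < ω := by omega
  have hpω : ω ≤ p * ω := Nat.le_mul_of_pos_left _ hp
  set h := p * ω + σ with hh
  have hh0 : 0 < h := by omega
  have hhR : (0 : ℝ) < h := by exact_mod_cast hh0
  have hhc : (h : ℝ) = p * ω + σ := by rw [hh]; push_cast; ring
  obtain ⟨δ, hδ, hδ1, hδε⟩ : ∃ δ : ℝ, 0 < δ ∧ δ ≤ 1 ∧ 10 * h * δ < ε := by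
    refine ⟨min 1 (ε / (20 * h)), by positivity, min_le_left _ _, ?_⟩
    have : min 1 (ε / (20 * h)) ≤ ε / (20 * h) := min_le_right _ _
    calc 10 * h * min 1 (ε / (20 * h)) ≤ 10 * h * (ε / (20 * h)) := by gcongr
      _ = ε / 2 := by field_simp; norm_num
      _ < ε := by linarith
  obtain ⟨θ, hθ⟩ := exists_nat_ge ((h : ℝ) / δ)
  have hθ' : (h : ℝ) ≤ δ * θ := by rw [div_le_iff₀ hδ] at hθ; linarith
  have hθh : h ≤ θ := by
    have : (h : ℝ) ≤ θ := hθ'.trans (mul_le_of_le_one_left (by positivity) hδ1)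
    exact_mod_cast this
  obtain ⟨J, hJ⟩ := exists_nat_ge (((2 * θ + 1 : ℕ) : ℝ) / δ)
  have hJ' : ((2 * θ + 1 : ℕ) : ℝ) ≤ δ * J := by rw [div_le_iff₀ hδ] at hJ; linarith
  have hJ1 : 1 ≤ J := by
    by_contra hcon
    have : J = 0 := by omega
    rw [this] at hJ'
    push_cast at hJ'
    have : (0 : ℝ) ≤ θ := by positivity
    linarith
  set M0 := M * θ ^ J with hM0
  set κ := (p+1) * ω * (ω * M0) * 2 ^ (h * M0) with hκ
  obtain ⟨S1, hS1⟩ := exists_nat_ge ((κ : ℝ) / δ)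
  set S := S1 + κ + ω * M0 + 1 with hS
  have hκS : (κ : ℝ) ≤ δ * S := by
    rw [div_le_iff₀ hδ] at hS1
    have : (S1 : ℝ) ≤ S := by
      have : S1 ≤ S := by omega
      exact_mod_cast this
    have : δ * S1 ≤ δ * S := mul_le_mul_of_nonneg_left this hδ.le
    linarith
  set X := 2 ^ (p * (S * (2 * h) ^ p)) * (S * (2 * h) ^ p) + h * M0 with hX
  obtain ⟨n1, hn1⟩ := exists_nat_ge ((X : ℝ) / δ)
  obtain ⟨n2, hn2⟩ := exists_nat_ge (((S * (2 * h) ^ p + h * M0 : ℕ) : ℝ) / ε)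
  refine ⟨δ / h, by positivity, n1 + n2, ?_⟩
  intro V G W A hA hD hn
  have hθ0 : 0 < θ := by omega
  have hMi : ∀ i ≤ J, 0 < M * θ ^ (J - i) ∧ M * θ ^ (J - i) ≤ M0 := by
    intro i hi
    refine ⟨by positivity, ?_⟩
    exact Nat.mul_le_mul_left _ (Nat.pow_le_pow_right hθ0 (by omega))
  have hmax : ∀ i, ∃ u, HasTiles G p σ ω (M * θ ^ (J - i)) u W ∧
      ∀ Q, HasTiles G p σ ω (M * θ ^ (J - i)) Q W → Q ≤ u := fun i =>
    exists_max_tiles (by rw [← hh]; positivity)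
  choose u hu humax using hmax
  obtain ⟨i, hi, htel⟩ := telescope (J := J) (n := W.card) (h := h) hJ1 (fun i => M * θ ^ (J - i) * u i) (by
    have := (hu J).card_le
    rw [← hh] at this
    calc h * (M * θ ^ (J - J) * u J) = h * (M * θ ^ (J-J)) * u J := by ring
      _ ≤ _ := this)
  obtain ⟨hm0, hmM0⟩ := hMi (i+1) (by omega)
  set m := M * θ ^ (J - (i+1)) with hm
  have hmi : M * θ ^ (J - i) = θ * m := by
    have : J - i = (J - (i+1)) + 1 := by omega
    rw [this, pow_succ, hm]; ring
  have hθm : θ * m ≤ M0 := by rw [← hmi]; exact (hMi i (by omega)).2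
  have hui := hu i
  rw [hmi] at htel hui
  obtain ⟨B, hB, hBd⟩ := hui
  set g := W.card / (J * (h * m)) with hg
  have hJhm : 0 < J * (h * m) := by positivity
  have hgmax : ∀ Q, HasTiles G p σ ω m Q W → Q ≤ θ * u i + g := by
    intro Q hQ
    have h1 := humax (i+1) Q hQ
    refine h1.trans ?_
    have : u (i+1) - θ * u i ≤ g := by
      rw [hg, Nat.le_div_iff_mul_le hJhm, Nat.sub_mul]
      have e1 : J * (h * (m * u (i+1))) = u (i+1) * (J * (h * m)) := by ring
      have e2 : J * (h * (θ * m * u i)) = θ * u i * (J * (h * m)) := by ring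
      rw [e1, e2] at htel
      omega
    omega
  obtain ⟨I, q, F, hFW, hFd, hFc, hFt, hIN, hq, hLM⟩ := cfgLemma (c0 := 1) B hB hBd hgmax
  set L := (W \ I.biUnion B) \ F with hL
  have hIB : I.biUnion B ⊆ W := biUnion_subset.2 fun j _ => (hB j).2
  have hcards : W.card = (I.biUnion B).card + F.card + L.card := by
    have hFs : F ⊆ W \ I.biUnion B := fun x hx => mem_sdiff.2 ⟨hFW hx, disjoint_left.1 hFd hx⟩
    have a : L.card + F.card = (W \ I.biUnion B).card := card_sdiff_add_card_eq_card hFs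
    have b : (W \ I.biUnion B).card + (I.biUnion B).card = W.card := card_sdiff_add_card_eq_card hIB
    omega
  by_cases hLε : ε * W.card ≤ L.card
  · exfalso
    have hgn : J * (h * m) * g ≤ W.card := Nat.mul_div_le _ _
    have hFδ : (F.card : ℝ) ≤ δ * W.card := by
      have a1 : F.card * J ≤ (2 * θ + 1) * W.card := by
        rw [hFc, ← hh]
        calc h * m * q * J ≤ h * m * ((θ * (1 + 1) + 1) * g) * J := by gcongr
          _ = (2 * θ + 1) * (J * (h * m) * g) := by ring
          _ ≤ _ := by gcongr
      have a2 : (F.card : ℝ) * J ≤ ((2 * θ + 1 : ℕ) : ℝ) * W.card := by exact_mod_cast a1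
      have a3 : ((2 * θ + 1 : ℕ) : ℝ) * W.card ≤ δ * J * W.card := by gcongr
      have hJR : (0 : ℝ) < J := by exact_mod_cast hJ1
      have a4 : (F.card : ℝ) * J ≤ δ * W.card * J := by linarith
      exact le_of_mul_le_mul_right a4 hJR
    have hnR : ((n1 : ℝ) + n2) ≤ W.card := by exact_mod_cast hn
    have hn1' : (0 : ℝ) ≤ n1 := by positivity
    have hn2' : (0 : ℝ) ≤ n2 := by positivity
    have hXδ : (X : ℝ) ≤ δ * W.card := by
      rw [div_le_iff₀ hδ] at hn1
      have : δ * n1 ≤ δ * W.card := mul_le_mul_of_nonneg_left (by linarith) hδ.le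
      linarith
    have hLbig : S * (2 * h) ^ p + h * M0 ≤ L.card := by
      rw [div_le_iff₀ hε] at hn2
      have : ε * n2 ≤ ε * W.card := mul_le_mul_of_nonneg_left (by linarith) hε.le
      have : ((S * (2 * h) ^ p + h * M0 : ℕ) : ℝ) ≤ L.card := by linarith
      exact_mod_cast this
    have hSpos : 0 < S := by omega
    have hhm : h * m ≤ h * M0 := Nat.mul_le_mul_left _ hmM0
    have hWpos : (0 : ℝ) < W.card := by
      have : 0 < S * (2 * h) ^ p := by positivity
      have : L.card ≤ W.card := by omega
      have : 0 < W.card := by omega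
      exact_mod_cast this
    refine at_core (G := G) (κ := κ) (S := S) (ε0 := δ / h) hσ hp (by rw [← hh]; exact hθh) hm0 B (fun j => (hB j).1) hBd I
      W A L F hA (fun j => (hB j).2) hFW hL δ hδ hδ1 hD ?_ ?_ ?_ hκS (by omega) ?_ (by rw [← hh]; exact hθ') hFδ ?_ ?_ ?_
    · have := hLM ∅ (empty_subset _) (by simp)
      simpa using this
    · intro j hj
      have := hLM {j} (by simpa using hj) (by simp)
      simpa using this
    · rw [hκ, ← hh]
      gcongr
      norm_num
    · have : ω * m ≤ ω * M0 := Nat.mul_le_mul_left _ hmM0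
      omega
    · rw [← hh]
      refine le_trans ?_ hXδ
      rw [hX]
      exact_mod_cast Nat.add_le_add_left hhm _
    · rw [← hh]; omega
    · rw [← hhc, abs_of_pos (by positivity)]
      have e : (4 * δ + h * (δ / h)) * (2 * h) * (W.card : ℝ) = 10 * h * δ * W.card := by
        field_simp; ring
      rw [e]
      exact lt_of_lt_of_le (mul_lt_mul_of_pos_right hδε hWpos) hLε
  · push Not at hLε
    -- split into tiles of scale M
    set a := θ ^ (J - (i+1)) with ha
    have hma : m = a * M := by rw [hm]; ring
    have t1 : HasTiles G p σ ω M (θ * a * I.card) (I.biUnion B) := by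
      apply HasTiles.biUnion I B _ (fun j _ k _ => hBd j k)
      intro j _
      apply IsTile.split
      have := (hB j).1
      rwa [hma, ← mul_assoc] at this
    have t2 : HasTiles G p σ ω M (a * q) F := by
      obtain ⟨f, hf, hfd⟩ := hFt
      have := HasTiles.biUnion (G := G) (p := p) (σ := σ) (ω := ω) (t := M) (q := a) (univ : Finset (Fin q)) f
        (fun j _ => by
          apply IsTile.split
          have := (hf j).1
          rwa [hma] at this) (fun j _ k _ => hfd j k)
      rw [card_univ, Fintype.card_fin] at this
      exact this.mono (biUnion_subset.2 fun j _ => (hf j).2)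
    have t3 := (t1.add t2 hFd.symm).mono (T := W) (union_subset hIB hFW)
    refine ⟨_, t3, ?_⟩
    have hcI : (I.biUnion B).card = h * (θ * m) * I.card := by
      rw [card_biUnion (fun j _ k _ hjk => hBd j k hjk), sum_congr rfl (fun j _ => (hB j).1.card),
        sum_const, smul_eq_mul, mul_comm]
    have : h * M * (θ * a * I.card + a * q) = (I.biUnion B).card + F.card := by
      rw [hcI, hFc, hma, ← hh]; ring
    rw [this]
    have hc : (W.card : ℝ) = ((I.biUnion B).card + F.card : ℕ) + L.card := by exact_mod_cast hcards
    linarith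

end OBT

set_option linter.unusedVariables false
set_option linter.unusedSectionVars false
namespace OBT
open scoped Classical
open Finset

lemma trim_cells {V : Type} {r t : ℕ} (Q : Fin r → Finset V) (h : ∀ i, t ≤ (Q i).card) :
    ∃ Q' : Fin r → Finset V, ∀ i, Q' i ⊆ Q i ∧ (Q' i).card = t := by
  choose f hf using fun i => exists_subset_card_eq (h i)
  exact ⟨f, hf⟩

lemma kstep (r t : ℕ) (ht : 1 ≤ t) (ζ : ℝ) (hζ : 0 < ζ) :
    ∃ K n0 : ℕ, 1 ≤ K ∧ ∀ (V : Type) (G : SimpleGraph V) (U : Finset V) (n : ℕ) (D : ℝ),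
      n0 ≤ n → D ≤ n → r * D + ζ * n ≤ U.card →
      ∀ Q : Fin r → Finset V, (∀ i, (Q i).card = K * t) → (∀ i, ∀ x ∈ Q i, (ms G x U : ℝ) ≤ D) →
      ∃ C ⊆ U, C.card = t ∧ ∃ Q' : Fin r → Finset V, ∀ l, Q' l ⊆ Q l ∧ (Q' l).card = t ∧ Cm G C (Q' l) := by
  obtain ⟨K1, hK1⟩ := exists_nat_ge (2 * r / ζ)
  set K := K1 + 2 with hK
  obtain ⟨n0, hn0⟩ := exists_nat_ge (2 * ((2 ^ (r * (K * t)) * t : ℕ) : ℝ) / ζ)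
  refine ⟨K, n0, by omega, ?_⟩
  intro V G U n D hn hDn hU Q hQ hm
  rw [div_le_iff₀ hζ] at hK1 hn0
  have hnR : (n0 : ℝ) ≤ n := by exact_mod_cast hn
  have hn0' : (0 : ℝ) ≤ n := by positivity
  have hbig : (K - 1) * (2 ^ (r * (K * t)) * t) + r * K * ⌊D⌋₊ ≤ (K - 1) * U.card := by
    have e : K - 1 = K1 + 1 := by omega
    rw [e]
    have : (((K1 + 1) * (2 ^ (r * (K * t)) * t) + r * K * ⌊D⌋₊ : ℕ) : ℝ) ≤ (((K1 + 1) * U.card : ℕ) : ℝ) := by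
      rw [Nat.cast_add, Nat.cast_mul (K1+1) _, Nat.cast_mul (K1+1) _]
      set Y : ℝ := ((2 ^ (r * (K * t)) * t : ℕ) : ℝ) with hY
      by_cases hD0 : 0 ≤ D
      · have hfl : (⌊D⌋₊ : ℝ) ≤ D := Nat.floor_le hD0
        have hK1' : (0:ℝ) ≤ (K1 : ℝ) := by positivity
        have hr0 : (0:ℝ) ≤ r := by positivity
        have a1 : ((r * K * ⌊D⌋₊ : ℕ) : ℝ) ≤ r * K * D := by push_cast; gcongr
        have a2 : (K : ℝ) = K1 + 2 := by rw [hK]; push_cast; ring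
        have a3 : ((K1 : ℝ) + 1) * (r * D + ζ * n) ≤ (K1 + 1) * U.card := by gcongr
        have a4 : 2 * Y ≤ ζ * n := by
          have : (n0:ℝ) * ζ ≤ n * ζ := by gcongr
          linarith
        have a5 : (r : ℝ) * D ≤ r * n := by gcongr
        have a6 : 2 * r * (n:ℝ) ≤ K1 * ζ * n := by gcongr
        have a7 : ((K1 : ℝ) + 1) * (2 * Y) ≤ (K1 + 1) * (ζ * n) := by gcongr
        have a8 : 0 ≤ ζ * n := by positivity
        rw [a2] at a1
        push_cast
        push_cast at a1
        have e1 : (r:ℝ) * (K1 + 2) * D = (K1 + 1) * (r * D) + r * D := by ring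
        have e2 : ((K1:ℝ) + 1) * (r * D + ζ * n) = (K1 + 1) * (r * D) + K1 * ζ * n + ζ * n := by ring
        have e3 : ((K1:ℝ) + 1) * (ζ * n) = K1 * ζ * n + ζ * n := by ring
        have e4 : ((K1:ℝ) + 1) * (2 * Y) = 2 * ((K1 + 1) * Y) := by ring
        push_cast at hK ⊢
        rw [e1] at a1
        rw [e2] at a3
        rw [e3, e4] at a7
        linarith
      · push Not at hD0
        have hfl : ⌊D⌋₊ = 0 := Nat.floor_of_nonpos hD0.le
        rw [hfl]
        by_cases hr : r = 0
        · have a4 : 2 * Y ≤ ζ * n := by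
            have : (n0:ℝ) * ζ ≤ n * ζ := by gcongr
            linarith
          have : (0:ℝ) ≤ Y := by positivity
          rw [hr] at hU
          simp only [mul_zero, Nat.cast_zero, add_zero]
          gcongr
          simp at hU
          linarith
        · exfalso
          have i : Fin r := ⟨0, by omega⟩
          by_cases hne : (Q i).Nonempty
          · obtain ⟨x, hx⟩ := hne
            have := hm i x hx
            have : (0:ℝ) ≤ ms G x U := by positivity
            linarith
          · rw [not_nonempty_iff_eq_empty] at hne
            have := hQ i
            rw [hne] at this
            simp at this
            omega
    exact_mod_cast this
  obtain ⟨C, hC, hCc, Q', hQ'⟩ := stepcell (G := G) (s := t) (t := t) (K := K) (D := ⌊D⌋₊) (by omega) Q hQ ht ht U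
    (fun i x hx => Nat.le_floor (hm i x hx)) hbig
  obtain ⟨Q2, hQ2⟩ := trim_cells Q' (fun l => (hQ' l).2.1)
  exact ⟨C, hC, hCc, Q2, fun l => ⟨(hQ2 l).1.trans (hQ' l).1, (hQ2 l).2, (hQ' l).2.2.mono subset_rfl (hQ2 l).1⟩⟩

lemma cons_cells {V : Type} {G : SimpleGraph V} {r : ℕ} (C : Finset V) (Q : Fin r → Finset V)
    (hQ : ∀ i j, i ≠ j → Cm G (Q i) (Q j)) (hC : ∀ l, Cm G C (Q l)) :
    ∀ i j, i ≠ j → Cm G ((Fin.cons C Q : Fin (r+1) → Finset V) i) ((Fin.cons C Q : Fin (r+1) → Finset V) j) := by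
  intro i j
  refine Fin.cases ?_ (fun i => ?_) i <;> refine Fin.cases ?_ (fun j => ?_) j
  · intro h; exact absurd rfl h
  · intro _; simpa using hC j
  · intro _; simpa using (hC i).symm
  · intro h; simpa using hQ i j (fun e => h (by rw [e]))

lemma kcells0 (r : ℕ) : ∀ (t : ℕ) (ht : 1 ≤ t) (ζ : ℝ) (hζ : 0 < ζ),
    ∃ n0 : ℕ, ∀ (V : Type) (G : SimpleGraph V) (U : Finset V) (n : ℕ) (D : ℝ),
      n0 ≤ n → D ≤ n → 0 ≤ D → (∀ x ∈ U, (ms G x U : ℝ) ≤ D) →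
      (0 < r → (r - 1) * D + ζ * n ≤ U.card) →
      ∃ Q : Fin r → Finset V, (∀ i, Q i ⊆ U ∧ (Q i).card = t) ∧ ∀ i j, i ≠ j → Cm G (Q i) (Q j) := by
  induction r with
  | zero =>
    intro t ht ζ hζ
    exact ⟨0, fun V G U n D _ _ _ _ _ => ⟨fun i => i.elim0, fun i => i.elim0, fun i => i.elim0⟩⟩
  | succ r ih =>
    intro t ht ζ hζ
    obtain ⟨K, n1, hK, h1⟩ := kstep r t ht ζ hζ
    obtain ⟨n2, h2⟩ := ih (K * t) (Nat.mul_pos hK ht) ζ hζ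
    refine ⟨n1 + n2, ?_⟩
    intro V G U n D hn hDn hD0 hm hU
    have hU' := hU (by omega)
    push_cast at hU'
    have e : (r:ℝ) + 1 - 1 = r := by ring
    rw [e] at hU'
    obtain ⟨Q, hQ, hQc⟩ := h2 V G U n D (by omega) hDn hD0 hm (fun _ => by
      have : ((r:ℝ) - 1) * D ≤ r * D := by gcongr; linarith
      linarith)
    obtain ⟨C, hC, hCc, Q', hQ'⟩ := h1 V G U n D (by omega) hDn hU' Q (fun i => (hQ i).2)
      (fun i x hx => hm x ((hQ i).1 hx))
    refine ⟨Fin.cons C Q', ?_, cons_cells C Q' (fun i j hij => (hQc i j hij).mono (hQ' i).1 (hQ' j).1) (fun l => (hQ' l).2.2)⟩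
    intro i
    refine Fin.cases ?_ (fun i => ?_) i
    · exact ⟨hC, hCc⟩
    · exact ⟨(hQ' i).1.trans (hQ i).1, (hQ' i).2.1⟩

lemma kcells (e t : ℕ) (ht : 1 ≤ t) (ζ : ℝ) (hζ : 0 < ζ) :
    ∃ n0 : ℕ, ∀ (V : Type) (G : SimpleGraph V) (U' U A : Finset V) (n : ℕ) (D : ℝ),
      n0 ≤ n → D ≤ n → 0 ≤ D → U' ⊆ U → (∀ u ∈ A, ∀ v ∈ A, u ≠ v → G.Adj u v) →
      (∀ x ∈ U', x ∉ A → (ms G x U : ℝ) ≤ D) →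
      (0 < e → (e - 1) * D + ζ * n ≤ U'.card) → e * D + ζ * n ≤ U.card →
      ∃ Q : Fin e → Finset V, ∃ C ⊆ U, C.card = t ∧ (∀ i, Q i ⊆ U' ∧ (Q i).card = t) ∧
        (∀ i j, i ≠ j → Cm G (Q i) (Q j)) ∧ ∀ i, Cm G C (Q i) := by
  obtain ⟨K, n1, hK, h1⟩ := kstep e t ht (ζ/2) (by positivity)
  obtain ⟨n2, h2⟩ := kcells0 e (K * t) (Nat.mul_pos hK ht) (ζ/2) (by positivity)
  obtain ⟨n3, hn3⟩ := exists_nat_ge (2 * (((e + 1) * t : ℕ) : ℝ) / ζ)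
  refine ⟨n1 + n2 + n3, ?_⟩
  intro V G U' U A n D hn hDn hD0 hUU hA hm hU' hU
  have hnR : (n3 : ℝ) ≤ n := by
    have : n3 ≤ n := by omega
    exact_mod_cast this
  rw [div_le_iff₀ hζ] at hn3
  have hn4 : (n3:ℝ) * ζ ≤ n * ζ := by gcongr
  by_cases hbig : (e + 1) * t ≤ (U' ∩ A).card
  · obtain ⟨Q, hQ, hQc⟩ := cells_of_clique (G := G) (r := e + 1) (t := t) (U' ∩ A)
      (fun u hu v hv huv => hA u (mem_inter.1 hu).2 v (mem_inter.1 hv).2 huv) hbig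
    refine ⟨fun i => Q i.succ, Q 0, (hQ 0).1.trans (inter_subset_left.trans hUU), (hQ 0).2,
      fun i => ⟨(hQ _).1.trans inter_subset_left, (hQ _).2⟩, fun i j hij => hQc _ _ (fun h => hij (Fin.succ_injective _ h)), fun i => hQc _ _ (Fin.succ_ne_zero i).symm⟩
  · push Not at hbig
    have hcard : (U'.card : ℝ) ≤ (U' \ A).card + ((e + 1) * t : ℕ) := by
      have := card_sdiff_add_card_inter U' A
      have : U'.card ≤ (U' \ A).card + (e+1) * t := by omega
      exact_mod_cast this
    obtain ⟨Q, hQ, hQc⟩ := h2 V G (U' \ A) n D (by omega) hDn hD0 (fun x hx => by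
        rw [mem_sdiff] at hx
        refine le_trans ?_ (hm x hx.1 hx.2)
        exact_mod_cast ms_mono (sdiff_subset.trans hUU))
      (fun he => by
        have := hU' he
        linarith)
    obtain ⟨C, hC, hCc, Q', hQ'⟩ := h1 V G U n D (by omega) hDn (by
        have : 0 ≤ ζ * n := by positivity
        linarith) Q (fun i => (hQ i).2) (fun i x hx => by
        have := (hQ i).1 hx
        rw [mem_sdiff] at this
        exact hm x this.1 this.2)
    exact ⟨Q', C, hC, hCc, fun i => ⟨(hQ' i).1.trans ((hQ i).1.trans sdiff_subset), (hQ' i).2.1⟩,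
      fun i j hij => (hQc i j hij).mono (hQ' i).1 (hQ' j).1, fun i => (hQ' i).2.2⟩

/-- Kovari-Sos-Turan -/
lemma kst (t : ℕ) (ht : 1 ≤ t) (η : ℝ) (hη : 0 < η) :
    ∃ n0 : ℕ, ∀ (V : Type) (G : SimpleGraph V) (U : Finset V) (n : ℕ),
      n0 ≤ n → U.card ≤ n → η * n^2 ≤ ((∑ u ∈ U, (nb G u U).card : ℕ) : ℝ) →
      ∃ P ⊆ U, ∃ P' ⊆ U, P.card = t ∧ P'.card = t ∧ Cm G P P' := by
  obtain ⟨K, hK⟩ := exists_nat_ge (4 * t / η)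
  obtain ⟨n1, hn1⟩ := exists_nat_ge (2 * K / η)
  obtain ⟨n2, hn2⟩ := exists_nat_ge (4 * ((2 ^ K * t : ℕ) : ℝ) / η)
  refine ⟨n1 + n2 + 1, ?_⟩
  intro V G U n hn hUn hsum
  rw [div_le_iff₀ hη] at hK hn1 hn2
  have hnpos : (0:ℝ) < n := by
    have : 0 < n := by omega
    exact_mod_cast this
  have hn1' : (n1:ℝ) ≤ n := by exact_mod_cast (by omega : n1 ≤ n)
  have hn2' : (n2:ℝ) ≤ n := by exact_mod_cast (by omega : n2 ≤ n)
  have hUn' : (U.card : ℝ) ≤ n := by exact_mod_cast hUn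
  have hKpos : (0:ℝ) < K := by
    have : (1:ℝ) ≤ t := by exact_mod_cast ht
    by_contra hcon
    push Not at hcon
    nlinarith
  set X := U.filter (fun x => η * n / 2 ≤ ((nb G x U).card : ℝ)) with hX
  have hXc : (K : ℝ) ≤ X.card := by
    have h1 : ((∑ u ∈ U, (nb G u U).card : ℕ) : ℝ) ≤ X.card * n + U.card * (η * n / 2) := by
      push_cast
      rw [← sum_filter_add_sum_filter_not U (fun x => η * n / 2 ≤ ((nb G x U).card : ℝ))]
      apply add_le_add
      · refine (sum_le_card_nsmul _ _ (n:ℝ) ?_).trans (by rw [nsmul_eq_mul])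
        intro x hx
        exact le_trans (by exact_mod_cast card_le_card nb_sub) hUn'
      · refine (sum_le_card_nsmul _ _ (η * n / 2) ?_).trans ?_
        · intro x hx
          rw [mem_filter] at hx
          exact (not_le.1 hx.2).le
        · rw [nsmul_eq_mul]
          gcongr
          exact filter_subset _ _
    have h2 : (U.card : ℝ) * (η * n / 2) ≤ n * (η * n / 2) := by gcongr
    have h3 : η * n / 2 * n ≤ X.card * n := by nlinarith
    have h4 := le_of_mul_le_mul_right h3 hnpos
    have h5 : (n1:ℝ) * η ≤ n * η := by gcongr
    linarith
  obtain ⟨T, hT, hTc⟩ := exists_subset_card_eq (show K ≤ X.card by exact_mod_cast hXc)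
  have hTU : T ⊆ U := hT.trans (filter_subset _ _)
  set E := U.filter (fun y => t ≤ (nb G y T).card) with hE
  have hEc : 2 ^ (1 * K) * t ≤ E.card := by
    have h0 : (K : ℝ) * (η * n / 2) ≤ ((∑ x ∈ T, (nb G x U).card : ℕ) : ℝ) := by
      push_cast
      rw [← hTc, ← nsmul_eq_mul]
      apply card_nsmul_le_sum
      intro x hx
      have := hT hx
      rw [hX, mem_filter] at this
      exact this.2
    rw [sum_nb_comm] at h0
    have h1 : ((∑ y ∈ U, (nb G y T).card : ℕ) : ℝ) ≤ E.card * K + U.card * t := by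
      push_cast
      rw [← sum_filter_add_sum_filter_not U (fun y => t ≤ (nb G y T).card)]
      apply add_le_add
      · refine (sum_le_card_nsmul _ _ (K:ℝ) ?_).trans (by rw [nsmul_eq_mul])
        intro x hx
        rw [← hTc]
        exact_mod_cast card_le_card nb_sub
      · refine (sum_le_card_nsmul _ _ (t:ℝ) ?_).trans ?_
        · intro x hx
          rw [mem_filter] at hx
          exact_mod_cast (not_le.1 hx.2).le
        · rw [nsmul_eq_mul]
          gcongr
          exact filter_subset _ _
    have h2 : (U.card : ℝ) * t ≤ n * t := by gcongr
    have h3 : (n : ℝ) * (4 * t) ≤ n * (K * η) := by gcongr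
    have h4 : η * n / 4 * K ≤ E.card * K := by nlinarith
    have h5 := le_of_mul_le_mul_right h4 hKpos
    have h6 : (n2:ℝ) * η ≤ n * η := by gcongr
    have h7 : ((2 ^ K * t : ℕ) : ℝ) ≤ E.card := by linarith
    rw [one_mul]
    exact_mod_cast h7
  obtain ⟨C, hC, hCc, Q', hQ'⟩ := step (G := G) (r := 1) (s := K) (t := t) (μ := t) (fun _ => T) (fun _ => hTc) ht E
    (fun v hv l => (mem_filter.1 hv).2) hEc
  obtain ⟨P', hP', hP'c⟩ := exists_subset_card_eq (hQ' 0).2.1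
  exact ⟨C, hC.trans (filter_subset _ _), P', hP'.trans ((hQ' 0).1.trans hTU), hCc, hP'c,
    (hQ' 0).2.2.mono subset_rfl hP'⟩

lemma pair (r s t : ℕ) (ht : 1 ≤ t) (η : ℝ) (hη : 0 < η) :
    ∃ n0 : ℕ, ∀ (V : Type) (G : SimpleGraph V) (U : Finset V) (n : ℕ) (Q : Fin r → Finset V),
      n0 ≤ n → U.card ≤ n → η * n^2 ≤ ((∑ u ∈ U, (nb G u U).card : ℕ) : ℝ) →
      (∀ i, (Q i).card = s) → (∀ v ∈ U, ∀ l, 3 * s ≤ 4 * (nb G v (Q l)).card) →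
      ∃ P ⊆ U, ∃ P' ⊆ U, P.card = t ∧ P'.card = t ∧ Cm G P P' ∧
        ∃ Q' : Fin r → Finset V, ∀ l, Q' l ⊆ Q l ∧ s ≤ 2 * (Q' l).card ∧ Cm G P (Q' l) ∧ Cm G P' (Q' l) := by
  obtain ⟨n0, h0⟩ := kst (2 ^ (r * s) * t) (Nat.mul_pos (by positivity) ht) η hη
  refine ⟨n0, ?_⟩
  intro V G U n Q hn hUn hsum hQ hU
  obtain ⟨P1, hP1, P1', hP1', hc, hc', hcm⟩ := h0 V G U n hn hUn hsum
  have hTc : (univ.biUnion Q).card ≤ r * s := by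
    refine card_biUnion_le.trans ?_
    simp [hQ]
  have hb : 2 ^ (univ.biUnion Q).card * t ≤ 2 ^ (r * s) * t :=
    Nat.mul_le_mul_right _ (Nat.pow_le_pow_right (by norm_num) hTc)
  obtain ⟨P, hP, hPc, x, hx, hxP⟩ := pattern_class (G := G) P1 (univ.biUnion Q) t ht (by omega)
  obtain ⟨P', hP', hPc', x', hx', hxP'⟩ := pattern_class (G := G) P1' (univ.biUnion Q) t ht (by omega)
  refine ⟨P, hP.trans hP1, P', hP'.trans hP1', hPc, hPc', hcm.mono hP hP', fun l => nb G x (Q l) ∩ nb G x' (Q l), ?_⟩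
  intro l
  have hsub : ∀ y, nb G y (Q l) ⊆ nb G y (univ.biUnion Q) := fun y =>
    filter_subset_filter _ (subset_biUnion_of_mem Q (mem_univ l))
  refine ⟨inter_subset_left.trans nb_sub, ?_, hxP.mono subset_rfl (inter_subset_left.trans (hsub x)),
    hxP'.mono subset_rfl (inter_subset_right.trans (hsub x'))⟩
  have h1 := hU x (hP1 hx) l
  have h2 := hU x' (hP1' hx') l
  have h3 := card_union_add_card_inter (nb G x (Q l)) (nb G x' (Q l))
  have h4 : (nb G x (Q l) ∪ nb G x' (Q l)).card ≤ s := by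
    rw [← hQ l]; exact card_le_card (union_subset nb_sub nb_sub)
  show s ≤ 2 * (nb G x (Q l) ∩ nb G x' (Q l)).card
  omega

end OBT

set_option linter.unusedVariables false
set_option linter.unusedSectionVars false
namespace OBT
open scoped Classical
open Finset

/-- non-neighbours set -/
noncomputable def nn {V : Type} (G : SimpleGraph V) (x : V) (S : Finset V) : Finset V := S.filter (fun v => ¬ G.Adj x v)

lemma nn_card {V : Type} (G : SimpleGraph V) (x : V) (S : Finset V) : (nn G x S).card = ms G x S := rfl

lemma nn_biUnion {V ι : Type} (G : SimpleGraph V) (x : V) (I : Finset ι) (B : ι → Finset V) :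
    nn G x (I.biUnion B) = I.biUnion (fun i => nn G x (B i)) := by
  unfold nn; rw [filter_biUnion]

lemma sdiff_nb {V : Type} (G : SimpleGraph V) (x : V) (S : Finset V) : S \ nb G x S = nn G x S := by
  ext v; simp [nb, nn]; tauto

structure Setup {V ι : Type} (G : SimpleGraph V) (p σ ω θ e s s' : ℕ) (I : Finset ι) (P : ι → Fin (p+1) → Finset V)
    (B : ι → Finset V) (Q : Fin (e+1) → Finset V) : Prop where
  hσ : σ < ω
  hep : e + 1 ≤ p
  hθ : p * ω + σ ≤ θ
  hP1 : ∀ i ∈ I, ∀ j, (P i j).card = sz σ ω j * θ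
  hP2 : ∀ i ∈ I, ∀ j k, j ≠ k → Cm G (P i j) (P i k)
  hB : ∀ i ∈ I, B i = univ.biUnion (P i)
  hBd : ∀ i ∈ I, ∀ j ∈ I, i ≠ j → Disjoint (B i) (B j)
  hQc : ∀ l, (Q l).card = s
  hQ : ∀ l l', l ≠ l' → Cm G (Q l) (Q l')
  hQB : ∀ i ∈ I, Disjoint (univ.biUnion Q) (B i)
  hno : ∀ i ∈ I, ¬ HasTiles G p σ ω 1 (θ + 1) (univ.biUnion Q ∪ B i)
  hs' : (p+1) * ω * ω ≤ s'

variable {V ι : Type} {G : SimpleGraph V} {p σ ω θ e s s' : ℕ} {I : Finset ι} {P : ι → Fin (p+1) → Finset V}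
    {B : ι → Finset V} {Q : Fin (e+1) → Finset V}

lemma Setup.pop1 (S : Setup G p σ ω θ e s s' I P B Q) {i : ι} (hi : i ∈ I) {l : Fin (e+1)} {x : V}
    (hx : s' ≤ (cls G (Q l) (B i) x).card) :
    1 ≤ (univ.filter (fun j : Fin (p+1) => j ≠ 0 ∧ (P i j ∩ nb G x (B i)).card < ω * (p * ω + σ))).card := by
  have := nogain (G := G) (t := 1) (r := 1) S.hσ le_rfl (by have := S.hep; omega) (P i) (fun j => by rw [S.hP1 i hi, mul_one])
    (S.hP2 i hi) S.hθ (fun _ => cls G (Q l) (B i) x) (fun a b hab => absurd (Subsingleton.elim a b) hab)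
    (fun _ => by have := S.hs'; rw [mul_one]; omega) (univ.biUnion Q)
    (fun _ => (filter_subset _ _).trans (subset_biUnion_of_mem Q (mem_univ l)))
    (by rw [← S.hB i hi]; exact S.hQB i hi) (by rw [← S.hB i hi]; exact S.hno i hi) (nb G x (B i)) (fun _ => cls_cm)
  simpa using this

lemma Setup.ms1 (S : Setup G p σ ω θ e s s' I P B Q) {i : ι} (hi : i ∈ I) {l : Fin (e+1)} {x : V}
    (hx : s' ≤ (cls G (Q l) (B i) x).card) : ω * θ ≤ ms G x (B i) + ω * (p * ω + σ) := by
  have := nogain_miss (G := G) (t := 1) (r := 1) (P i) (fun j => by rw [S.hP1 i hi, mul_one])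
    (S.hP2 i hi) (nb G x (B i)) _ (S.pop1 hi hx)
  rw [← S.hB i hi, sdiff_nb, nn_card] at this
  simpa using this

lemma Setup.ms2 (S : Setup G p σ ω θ e s s' I P B Q) {i : ι} (hi : i ∈ I) {l l' : Fin (e+1)} (hl : l ≠ l') {x y : V}
    (hx : s' ≤ (cls G (Q l) (B i) x).card) (hy : s' ≤ (cls G (Q l') (B i) y).card) :
    ms G y (nn G x (B i)) + 2 * (ω * θ) ≤ ms G x (B i) + ms G y (B i) + 2 * (ω * (p * ω + σ)) := by
  have hp2 : 2 ≤ p := by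
    have := S.hep
    have h1 := l.2
    have h2 := l'.2
    have : l.val ≠ l'.val := fun h => hl (Fin.ext h)
    omega
  let D : Fin 2 → Finset V := ![cls G (Q l) (B i) x, cls G (Q l') (B i) y]
  have hd : Cm G (D 0) (D 1) := (S.hQ l l' hl).mono (filter_subset _ _) (filter_subset _ _)
  have h1 := nogain (G := G) (t := 1) (r := 2) S.hσ (by norm_num) hp2 (P i) (fun j => by rw [S.hP1 i hi, mul_one])
    (S.hP2 i hi) S.hθ D (fun a b hab => by
      fin_cases a <;> fin_cases b
      · exact absurd rfl hab
      · exact hd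
      · exact hd.symm
      · exact absurd rfl hab)
    (fun a => by
      have := S.hs'
      rw [mul_one]
      fin_cases a
      · exact this.trans hx
      · exact this.trans hy) (univ.biUnion Q)
    (fun a => by
      fin_cases a
      · exact (filter_subset _ _).trans (subset_biUnion_of_mem Q (mem_univ l))
      · exact (filter_subset _ _).trans (subset_biUnion_of_mem Q (mem_univ l')))
    (by rw [← S.hB i hi]; exact S.hQB i hi) (by rw [← S.hB i hi]; exact S.hno i hi)
    (nb G x (B i) ∩ nb G y (B i)) (fun a => by
      fin_cases a
      · exact cls_cm.mono subset_rfl inter_subset_left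
      · exact cls_cm.mono subset_rfl inter_subset_right)
  have h2 := nogain_miss (G := G) (t := 1) (r := 2) (P i) (fun j => by rw [S.hP1 i hi, mul_one])
    (S.hP2 i hi) _ _ h1
  rw [← S.hB i hi] at h2
  have h3 : ms G y (nn G x (B i)) + (B i \ (nb G x (B i) ∩ nb G y (B i))).card = ms G x (B i) + ms G y (B i) := by
    rw [← nn_card, ← nn_card, ← nn_card, ← card_union_add_card_inter (nn G x (B i)), add_comm]
    congr 2
    · ext v; simp [nn, nb]; tauto
    · ext v; simp [nn]; tauto
  simp only [mul_one] at h2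
  omega

/-- number of tiles on which x is not popular -/
noncomputable def np (G : SimpleGraph V) (s' : ℕ) (I : Finset ι) (B : ι → Finset V) (Q : Finset V) (x : V) : ℕ :=
  (I.filter (fun i => (cls G Q (B i) x).card < s')).card

lemma Setup.cardB (S : Setup G p σ ω θ e s s' I P B Q) {i : ι} (hi : i ∈ I) : (B i).card = (p * ω + σ) * θ := by
  rw [S.hB i hi, card_biUnion (fun j _ k _ hjk => (S.hP2 i hi j k hjk).disj), sum_congr rfl (fun j _ => S.hP1 i hi j), ← sum_mul, sum_sz]

lemma Setup.sum_np (S : Setup G p σ ω θ e s s' I P B Q) (l : Fin (e+1)) :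
    ∑ x ∈ Q l, np G s' I B (Q l) x ≤ I.card * (s' * 2 ^ ((p * ω + σ) * θ)) := by
  unfold np
  simp_rw [card_filter]
  rw [sum_comm]
  refine (sum_le_card_nsmul _ _ (s' * 2 ^ ((p * ω + σ) * θ)) ?_).trans (by rw [smul_eq_mul])
  intro i hi
  rw [← card_filter, ← S.cardB hi]
  exact nonpop _ _ _

lemma Setup.codeg (S : Setup G p σ ω θ e s s' I P B Q) {l l' : Fin (e+1)} (hl : l ≠ l') {x y : V} :
    ms G y (nn G x (I.biUnion B)) + 2 * (ω * θ) * I.card ≤ ms G x (I.biUnion B) + ms G y (I.biUnion B) +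
      2 * (ω * (p * ω + σ)) * I.card + 2 * (ω * θ) * (np G s' I B (Q l) x + np G s' I B (Q l') y) := by
  rw [nn_biUnion, ms_biUnion G x I B S.hBd, ms_biUnion G y I B S.hBd, ms_biUnion G y I (fun i => nn G x (B i)) (fun i hi j hj hij =>
    (S.hBd i hi j hj hij).mono (filter_subset _ _) (filter_subset _ _))]
  unfold np
  rw [card_filter, card_filter]
  have hI : I.card = ∑ i ∈ I, 1 := card_eq_sum_ones I
  rw [hI, mul_add (2 * (ω * θ)), mul_sum, mul_sum, mul_sum, mul_sum, ← sum_add_distrib, ← sum_add_distrib, ← sum_add_distrib, ← sum_add_distrib, ← sum_add_distrib]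
  apply sum_le_sum
  intro i hi
  have h0 : ms G y (nn G x (B i)) ≤ ms G x (B i) := by rw [← nn_card G x]; exact ms_le _ _ _
  by_cases hx : (cls G (Q l) (B i) x).card < s'
  · rw [if_pos hx]; omega
  · by_cases hy : (cls G (Q l') (B i) y).card < s'
    · rw [if_pos hy]; omega
    · rw [if_neg hx, if_neg hy]
      have := S.ms2 hi hl (not_lt.1 hx) (not_lt.1 hy)
      omega

/-- tiles with excess -/
noncomputable def xb (G : SimpleGraph V) (s' ω θ h : ℕ) (I : Finset ι) (B : ι → Finset V) (Q : Finset V) (x : V) : Finset ι :=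
  I.filter (fun i => s' ≤ (cls G Q (B i) x).card ∧ ω * θ + (θ - 1) ≤ ms G x (B i) + ω * h)

lemma Setup.excess (S : Setup G p σ ω θ e s s' I P B Q) {l : Fin (e+1)} {x : V} :
    ω * θ * I.card + (θ - 1) * (xb G s' ω θ (p * ω + σ) I B (Q l) x).card ≤ ms G x (I.biUnion B) +
      ω * (p * ω + σ) * I.card + ω * θ * (np G s' I B (Q l) x) := by
  rw [ms_biUnion G x I B S.hBd]
  unfold np xb
  rw [card_filter, card_filter]
  have hI : I.card = ∑ i ∈ I, 1 := card_eq_sum_ones I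
  rw [hI, mul_sum, mul_sum, mul_sum, mul_sum, ← sum_add_distrib, ← sum_add_distrib, ← sum_add_distrib]
  apply sum_le_sum
  intro i hi
  by_cases hx : (cls G (Q l) (B i) x).card < s'
  · rw [if_pos hx, if_neg (by omega)]; omega
  · rw [if_neg hx]
    have := S.ms1 hi (not_lt.1 hx)
    split_ifs with h <;> omega

/-- good tiles -/
lemma Setup.good (S : Setup G p σ ω θ e s s' I P B Q) {i : ι} (hi : i ∈ I) {l : Fin (e+1)} {x : V}
    (hx : s' ≤ (cls G (Q l) (B i) x).card) (hm : ms G x (B i) + ω * (p * ω + σ) < ω * θ + (θ - 1)) :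
    ∃ j1 : Fin (p+1), j1 ≠ 0 ∧ (P i j1 ∩ nb G x (B i)).card < ω * (p * ω + σ) ∧
      ∀ j, j ≠ j1 → sz σ ω j ≤ (P i j ∩ nb G x (B i)).card := by
  obtain ⟨j1, hj1⟩ := card_pos.1 (S.pop1 hi hx)
  simp only [mem_filter, mem_univ, true_and] at hj1
  refine ⟨j1, hj1.1, hj1.2, ?_⟩
  intro j hj
  by_contra hlt
  push Not at hlt
  have h1 : (P i j1 \ nb G x (B i)).card + (P i j \ nb G x (B i)).card ≤ ms G x (B i) := by
    rw [← card_union_of_disjoint ((S.hP2 i hi j1 j hj.symm).disj.mono sdiff_subset sdiff_subset), ← nn_card, ← sdiff_nb,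
      ← union_sdiff_distrib]
    apply card_le_card
    apply sdiff_subset_sdiff _ subset_rfl
    rw [S.hB i hi]
    exact union_subset (subset_biUnion_of_mem (P i) (mem_univ _)) (subset_biUnion_of_mem (P i) (mem_univ _))
  have h2 := card_sdiff_add_card_inter (P i j1) (nb G x (B i))
  have h3 := card_sdiff_add_card_inter (P i j) (nb G x (B i))
  rw [S.hP1 i hi] at h2 h3
  have h4 : sz σ ω j1 = ω := by simp [sz, hj1.1]
  rw [h4] at h2
  have h5 : sz σ ω j * θ ≥ (sz σ ω j - 1) * (θ - 1) + (θ - 1) + sz σ ω j := by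
    obtain ⟨a, ha⟩ : ∃ a, sz σ ω j = a + 1 := ⟨sz σ ω j - 1, by omega⟩
    have hθ : 1 ≤ θ := by
      have := S.hθ
      have := S.hep
      have := S.hσ
      have : 1 * ω ≤ p * ω := Nat.mul_le_mul_right _ (by omega)
      omega
    obtain ⟨b, hb⟩ : ∃ b, θ = b + 1 := ⟨θ - 1, by omega⟩
    rw [ha, hb]
    simp
    ring_nf
    omega
  omega

/-- swapping a vertex of a good tile -/
lemma Setup.swap (S : Setup G p σ ω θ e s s' I P B Q) {i : ι} (hi : i ∈ I) {l : Fin (e+1)} {x : V} {j1 : Fin (p+1)}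
    (hj : j1 ≠ 0) (hj1 : ∀ j, j ≠ j1 → sz σ ω j ≤ (P i j ∩ nb G x (B i)).card) {v q : V} (hv : v ∈ P i j1)
    (hq : q ∈ cls G (Q l) (B i) x) : HasTiles G p σ ω 1 θ ((B i).erase v ∪ {q}) := by
  have hω : 1 ≤ ω := by have := S.hσ; omega
  have hszj : sz σ ω j1 = ω := by simp [sz, hj]
  have hqB : q ∉ B i := by
    have : q ∈ univ.biUnion Q := mem_biUnion.2 ⟨l, mem_univ _, (mem_filter.1 hq).1⟩
    exact disjoint_left.1 (S.hQB i hi) this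
  have hθ : 1 ≤ θ := by
    have := S.hθ
    have := S.hep
    have := S.hσ
    have : 1 * ω ≤ p * ω := Nat.mul_le_mul_right _ (by omega)
    omega
  have hPB : ∀ j, P i j ⊆ B i := fun j => by rw [S.hB i hi]; exact subset_biUnion_of_mem (P i) (mem_univ _)
  have hXe : ω - 1 ≤ ((P i j1).erase v).card := by
    rw [card_erase_of_mem hv, S.hP1 i hi, hszj]
    have : ω * 1 ≤ ω * θ := Nat.mul_le_mul_left _ hθ
    omega
  obtain ⟨X, hX, hXc⟩ := exists_subset_card_eq hXe
  have hR : ∀ j, ∃ R : Finset V, R ⊆ (P i j).erase v ∧ (j ≠ j1 → R ⊆ nb G x (B i) ∧ R.card = sz σ ω j) ∧ (j = j1 → R = X) := by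
    intro j
    by_cases h : j = j1
    · subst h
      exact ⟨X, hX, fun h => absurd rfl h, fun _ => rfl⟩
    · obtain ⟨R, hR, hRc⟩ := exists_subset_card_eq (hj1 j h)
      refine ⟨R, ?_, fun _ => ⟨hR.trans inter_subset_right, hRc⟩, fun h' => absurd h' h⟩
      intro a ha
      refine mem_erase.2 ⟨?_, (mem_inter.1 (hR ha)).1⟩
      rintro rfl
      exact disjoint_left.1 (S.hP2 i hi j j1 h).disj (mem_inter.1 (hR ha)).1 hv
  choose R hR1 hR2 hR3 using hR
  have hcm := cls_cm (G := G) (Q := Q l) (T := B i) (x := x)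
  -- new tile
  let T1 : Fin (p+1) → Finset V := fun j => if j = j1 then insert q X else R j
  have hqR : ∀ j, j ≠ j1 → Cm G (insert q X) (R j) := by
    intro j h u hu w hw
    rw [mem_insert] at hu
    rcases hu with rfl | hu
    · exact hcm u hq w ((hR2 j h).1 hw)
    · exact S.hP2 i hi j1 j h.symm u (mem_of_mem_erase (hX hu)) w (mem_of_mem_erase (hR1 j hw))
  have ht1 : HasTiles G p σ ω 1 1 (univ.biUnion T1) := by
    apply OBT.split T1
    · intro j
      simp only [T1]
      split_ifs with h
      · rw [h, hszj, card_insert_of_notMem (fun hqX => hqB (hPB j1 (mem_of_mem_erase (hX hqX)))), hXc]; omega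
      · rw [(hR2 j h).2]; omega
    · intro a b hab
      simp only [T1]
      split_ifs with h1 h2 h2
      · exact absurd (h1.trans h2.symm) hab
      · exact hqR b h2
      · exact (hqR a h1).symm
      · exact (S.hP2 i hi a b hab).mono ((hR1 a).trans (erase_subset _ _)) ((hR1 b).trans (erase_subset _ _))
  let T2 : Fin (p+1) → Finset V := fun j => (P i j).erase v \ R j
  have ht2 : HasTiles G p σ ω 1 (θ - 1) (univ.biUnion T2) := by
    apply OBT.split T2
    · intro j
      simp only [T2]
      rw [card_sdiff_of_subset (hR1 j), mul_one, Nat.mul_sub, mul_one]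
      by_cases h : j = j1
      · rw [h, hR3 j1 rfl, hXc, card_erase_of_mem hv, S.hP1 i hi, hszj]; omega
      · have : v ∉ P i j := fun hv' => disjoint_left.1 (S.hP2 i hi j j1 h).disj hv' hv
        rw [erase_eq_of_notMem this, S.hP1 i hi, (hR2 j h).2]
    · intro a b hab
      exact (S.hP2 i hi a b hab).mono (sdiff_subset.trans (erase_subset _ _)) (sdiff_subset.trans (erase_subset _ _))
  have hd : Disjoint (univ.biUnion T1) (univ.biUnion T2) := by
    rw [disjoint_left]
    intro a ha hb
    simp only [mem_biUnion, mem_univ, true_and, T1, T2, mem_sdiff] at ha hb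
    obtain ⟨j, hj⟩ := ha
    obtain ⟨k, hk, hk'⟩ := hb
    have haR : a ∈ R j := by
      split_ifs at hj with h
      · rw [mem_insert] at hj
        rcases hj with rfl | hj
        · exact absurd (hPB k (mem_of_mem_erase hk)) hqB
        · rw [hR3 j h]; exact hj
      · exact hj
    by_cases hjk : j = k
    · subst hjk; exact hk' haR
    · exact disjoint_left.1 (S.hP2 i hi j k hjk).disj (mem_of_mem_erase (hR1 j haR)) (mem_of_mem_erase hk)
  have := ht1.add ht2 hd
  rw [show 1 + (θ - 1) = θ by omega] at this
  refine this.mono (union_subset (biUnion_subset.2 fun j _ => ?_) (biUnion_subset.2 fun j _ => ?_))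
  · simp only [T1]
    have hh : ∀ k, R k ⊆ (B i).erase v ∪ {q} := fun k a ha => by
      have := hR1 k ha
      rw [mem_erase] at this
      exact mem_union_left _ (mem_erase.2 ⟨this.1, hPB k this.2⟩)
    split_ifs with h
    · apply insert_subset
      · simp
      · rw [← hR3 j1 rfl]; exact hh j1
    · exact hh j
  · intro a ha
    have := (mem_sdiff.1 ha).1
    rw [mem_erase] at this
    exact mem_union_left _ (mem_erase.2 ⟨this.1, hPB j this.2⟩)

/-- multi swap -/
lemma multiswap {T : ι → Finset V} {Q0 : Finset V} (X : Finset V) (τ : V → ι) (hτ : ∀ u ∈ X, ∀ v ∈ X, τ u = τ v → u = v)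
    (hT : ∀ u ∈ X, ∀ v ∈ X, u ≠ v → Disjoint (T (τ u)) (T (τ v))) (hQT : ∀ u ∈ X, Disjoint Q0 (T (τ u)))
    (hXT : ∀ u ∈ X, u ∈ T (τ u)) (K : V → Finset V) (hK : ∀ v ∈ X, K v ⊆ Q0 ∧ X.card ≤ (K v).card)
    (hsw : ∀ v ∈ X, ∀ q ∈ K v, HasTiles G p σ ω 1 θ ((T (τ v)).erase v ∪ {q})) :
    HasTiles G p σ ω 1 (θ * X.card) (((X.image τ).biUnion T \ X) ∪ Q0) := by
  have hall := (Finset.all_card_le_biUnion_card_iff_exists_injective (fun v : X => K v.1)).1 (by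
    intro Y
    by_cases hY : Y.Nonempty
    · obtain ⟨v, hv⟩ := hY
      calc Y.card ≤ (univ : Finset X).card := card_le_univ _
        _ = X.card := by simp
        _ ≤ (K v.1).card := (hK v.1 v.2).2
        _ ≤ _ := card_le_card (subset_biUnion_of_mem (fun v : X => K v.1) hv)
    · rw [not_nonempty_iff_eq_empty.1 hY]; simp)
  obtain ⟨f, hf, hfK⟩ := hall
  let g : V → V := fun v => if h : v ∈ X then f ⟨v, h⟩ else v
  have hg : ∀ v ∈ X, g v ∈ K v := fun v hv => by simp only [g, dif_pos hv]; exact hfK ⟨v, hv⟩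
  have hgi : ∀ u ∈ X, ∀ v ∈ X, g u = g v → u = v := by
    intro u hu v hv h
    simp only [g, dif_pos hu, dif_pos hv] at h
    exact congrArg Subtype.val (hf h)
  have hgT : ∀ u ∈ X, ∀ v ∈ X, g u ∉ T (τ v) := fun u hu v hv =>
    disjoint_left.1 (hQT v hv) ((hK u hu).1 (hg u hu))
  have := HasTiles.biUnion (G := G) (p := p) (σ := σ) (ω := ω) (t := 1) (q := θ) X (fun v => (T (τ v)).erase v ∪ {g v})
    (fun v hv => hsw v hv _ (hg v hv)) (fun u hu v hv huv => by
      rw [disjoint_left]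
      intro a ha hb
      simp only [mem_union, mem_singleton, mem_erase] at ha hb
      rcases ha with ha | ha <;> rcases hb with hb | hb
      · exact disjoint_left.1 (hT u hu v hv huv) ha.2 hb.2
      · rw [hb] at ha; exact hgT v hv u hu ha.2
      · rw [ha] at hb; exact hgT u hu v hv hb.2
      · exact huv (hgi u hu v hv (ha.symm.trans hb)))
  refine this.mono (biUnion_subset.2 fun v hv => ?_)
  intro a ha
  simp only [mem_union, mem_singleton, mem_erase] at ha
  rcases ha with ha | ha
  · refine mem_union_left _ (mem_sdiff.2 ⟨mem_biUnion.2 ⟨τ v, mem_image_of_mem _ hv, ha.2⟩, ?_⟩)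
    intro haX
    by_cases hav : a = v
    · exact ha.1 hav
    · exact disjoint_left.1 (hT a haX v hv hav) (hXT a haX) ha.2
  · rw [ha]; exact mem_union_right _ ((hK v hv).1 (hg v hv))

end OBT

set_option linter.unusedVariables false
set_option linter.unusedSectionVars false
namespace OBT
open scoped Classical
open Finset

variable {V ι : Type} {G : SimpleGraph V} {p σ ω θ e s s' : ℕ} {I : Finset ι} {P : ι → Fin (p+1) → Finset V}
    {B : ι → Finset V} {Q : Fin (e+1) → Finset V}

lemma Setup.ne_num (S : Setup G p σ ω θ e s s' I P B Q) (hs : 1 ≤ s) (hθ2 : 2 ≤ θ) (n ρ : ℝ) (hn : 0 ≤ n) (hρ : 0 < ρ)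
    (hm : ∀ l, ∀ y ∈ Q l, (ms G y (I.biUnion B) : ℝ) ≤ ((ω : ℝ) / (p * ω + σ) + ρ) * n)
    (hN1 : (1 - ρ) * n ≤ (p * ω + σ) * θ * I.card) (hN2 : (p * ω + σ) * θ * (I.card : ℝ) ≤ n)
    (hρθ : ((p * ω + σ : ℕ) : ℝ) ≤ ρ * θ) (hν : ((s' * 2 ^ ((p * ω + σ) * θ) : ℕ) : ℝ) ≤ ρ * s) :
    ∃ x ∈ Q 0, ((np G s' I B (Q 0) x : ℝ) ≤ ρ * I.card) ∧
      ((xb G s' ω θ (p * ω + σ) I B (Q 0) x).card * (θ:ℝ) ≤ 8 * ρ * n) ∧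
      (∀ l, l ≠ 0 → ((∑ y ∈ Q l, ms G y (nn G x (I.biUnion B)) : ℕ) : ℝ) ≤ 10 * ρ * s * n) ∧
      (ω : ℝ) / (p * ω + σ) * n - ρ * n ≤ ω * θ * I.card ∧ (ω : ℝ) * θ * I.card ≤ n ∧
      (ω : ℝ) * (p * ω + σ) * I.card ≤ ρ * n := by
  have hω : 1 ≤ ω := by have := S.hσ; omega
  have hp : 1 ≤ p := by have := S.hep; omega
  have hsR : (0:ℝ) < s := by exact_mod_cast hs
  have hh0 : (ω : ℝ) ≤ p * ω + σ := by
    have : 1 * ω ≤ p * ω := Nat.mul_le_mul_right _ hp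
    exact_mod_cast (show ω ≤ p * ω + σ by omega)
  have hωR : (1:ℝ) ≤ ω := by exact_mod_cast hω
  set h : ℝ := (p * ω + σ : ℝ) with hh
  have hhpos : 0 < h := by linarith
  set N : ℝ := (I.card : ℝ) with hNN
  have hN0 : 0 ≤ N := Nat.cast_nonneg _
  have hθR : (2:ℝ) ≤ θ := by exact_mod_cast hθ2
  push_cast at hρθ hν
  -- beta
  have hb1 : (ω : ℝ) / h ≤ 1 := (div_le_one hhpos).2 hh0
  have hb0 : 0 ≤ (ω : ℝ) / h := by positivity
  have hbh : (ω : ℝ) / h * h = ω := by field_simp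
  have hf1 : (ω : ℝ) / h * n - ρ * n ≤ ω * θ * N := by
    have h1 : (ω : ℝ) / h * ((1 - ρ) * n) ≤ ω / h * (h * θ * N) := mul_le_mul_of_nonneg_left hN1 hb0
    have h2 : (ω : ℝ) / h * (h * θ * N) = ω * θ * N := by rw [← mul_assoc, ← mul_assoc, hbh]
    have h3 : (ω : ℝ) / h * (ρ * n) ≤ 1 * (ρ * n) := mul_le_mul_of_nonneg_right hb1 (by positivity)
    linarith
  have hf2 : (ω : ℝ) * θ * N ≤ n := by
    have : (ω:ℝ) * (θ * N) ≤ h * (θ * N) := mul_le_mul_of_nonneg_right hh0 (by positivity)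
    linarith
  have hf3 : (ω : ℝ) * h * N ≤ ρ * n := by
    have : h * (ω * N) ≤ ρ * θ * (ω * N) := mul_le_mul_of_nonneg_right hρθ (by positivity)
    have h2 : ρ * (ω * θ * N) ≤ ρ * n := mul_le_mul_of_nonneg_left hf2 hρ.le
    linarith
  have hsum : ∀ l, ((∑ x ∈ Q l, np G s' I B (Q l) x : ℕ) : ℝ) ≤ ρ * s * N := by
    intro l
    have h1 : ((∑ x ∈ Q l, np G s' I B (Q l) x : ℕ) : ℝ) ≤ ((I.card * (s' * 2 ^ ((p * ω + σ) * θ)) : ℕ) : ℝ) := by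
      exact_mod_cast S.sum_np l
    have h2 : N * ((s' * 2 ^ ((p * ω + σ) * θ) : ℕ) : ℝ) ≤ N * (ρ * s) := mul_le_mul_of_nonneg_left (by exact_mod_cast hν) hN0
    push_cast at h1 h2 ⊢
    linarith
  -- pick x
  obtain ⟨x, hx, hxnp⟩ : ∃ x ∈ Q 0, (np G s' I B (Q 0) x : ℝ) ≤ ρ * N := by
    by_contra hcon
    push Not at hcon
    have hne : (Q 0).Nonempty := by rw [← card_pos, S.hQc]; omega
    have h1 : ∑ x ∈ Q 0, ρ * N < ∑ x ∈ Q 0, (np G s' I B (Q 0) x : ℝ) := sum_lt_sum_of_nonempty hne hcon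
    rw [sum_const, S.hQc, nsmul_eq_mul] at h1
    have h2 := hsum 0
    push_cast at h2
    linarith
  refine ⟨x, hx, hxnp, ?_, ?_, hf1, hf2, hf3⟩
  · have h1 := S.excess (l := 0) (x := x)
    have h2 : ((ω * θ * I.card + (θ - 1) * (xb G s' ω θ (p * ω + σ) I B (Q 0) x).card : ℕ) : ℝ) ≤ ((ms G x (I.biUnion B) +
      ω * (p * ω + σ) * I.card + ω * θ * (np G s' I B (Q 0) x) : ℕ) : ℝ) := by exact_mod_cast h1
    push_cast [Nat.cast_sub (show 1 ≤ θ by omega)] at h2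
    have h3 := hm 0 x hx
    have h4 : (ω:ℝ) * θ * (np G s' I B (Q 0) x) ≤ ω * θ * (ρ * N) := mul_le_mul_of_nonneg_left hxnp (by positivity)
    have h5 : ρ * (ω * θ * N) ≤ ρ * n := mul_le_mul_of_nonneg_left hf2 hρ.le
    set X : ℝ := ((xb G s' ω θ (p * ω + σ) I B (Q 0) x).card : ℝ)
    have hX : 0 ≤ X := Nat.cast_nonneg _
    have h6 : X * θ ≤ 2 * ((θ - 1) * X) := by
      have : X * 2 ≤ X * θ := mul_le_mul_of_nonneg_left hθR hX
      linarith
    rw [← hh, ← hNN] at h2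
    linarith
  · intro l hl
    have h1 : ∀ y ∈ Q l, (ms G y (nn G x (I.biUnion B)) : ℝ) + 2 * (ω * θ) * N ≤ 2 * (((ω : ℝ) / h + ρ) * n) +
      2 * (ρ * n) + 2 * (ω * θ) * (ρ * N + (np G s' I B (Q l) y : ℝ)) := by
      intro y hy
      have h1 := S.codeg (l := 0) (l' := l) hl.symm (x := x) (y := y)
      have h2 : ((ms G y (nn G x (I.biUnion B)) + 2 * (ω * θ) * I.card : ℕ) : ℝ) ≤ ((ms G x (I.biUnion B) + ms G y (I.biUnion B) +
      2 * (ω * (p * ω + σ)) * I.card + 2 * (ω * θ) * (np G s' I B (Q 0) x + np G s' I B (Q l) y) : ℕ) : ℝ) := by exact_mod_cast h1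
      push_cast at h2
      have h3 := hm 0 x hx
      have h4 := hm l y hy
      have h5 : (2 * (ω * θ) : ℝ) * (np G s' I B (Q 0) x) ≤ 2 * (ω * θ) * (ρ * N) := mul_le_mul_of_nonneg_left hxnp (by positivity)
      rw [← hh, ← hNN] at h2
      linarith
    have h2 := sum_le_sum h1
    rw [sum_add_distrib, sum_add_distrib, sum_const, sum_const, S.hQc, nsmul_eq_mul, nsmul_eq_mul, ← mul_sum, sum_add_distrib, sum_const, S.hQc, nsmul_eq_mul] at h2
    have h3 := hsum l
    push_cast at h3 ⊢
    have h4 : (2 * (ω * θ) : ℝ) * (∑ y ∈ Q l, (np G s' I B (Q l) y : ℝ)) ≤ 2 * (ω * θ) * (ρ * s * N) := mul_le_mul_of_nonneg_left h3 (by positivity)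
    have h5 : (s * ρ) * (ω * θ * N) ≤ (s * ρ) * n := mul_le_mul_of_nonneg_left hf2 (by positivity)
    have h6 : (s:ℝ) * (ω / h * n - ρ * n) ≤ s * (ω * θ * N) := mul_le_mul_of_nonneg_left hf1 hsR.le
    linarith

lemma Setup.ne_U (hι : Nonempty ι) (S : Setup G p σ ω θ e s s' I P B Q) (hs : 1 ≤ s) (hθ2 : 2 ≤ θ) (n ρ : ℝ) (hn : 0 ≤ n) (hρ : 0 < ρ)
    (hm : ∀ l, ∀ y ∈ Q l, (ms G y (I.biUnion B) : ℝ) ≤ ((ω : ℝ) / (p * ω + σ) + ρ) * n)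
    (hN1 : (1 - ρ) * n ≤ (p * ω + σ) * θ * I.card) (hN2 : (p * ω + σ) * θ * (I.card : ℝ) ≤ n)
    (hρθ : ((p * ω + σ : ℕ) : ℝ) ≤ ρ * θ) (hν : ((s' * 2 ^ ((p * ω + σ) * θ) : ℕ) : ℝ) ≤ ρ * s) :
    ∃ x ∈ Q 0, ∃ (τ : V → ι) (U : Finset V), U ⊆ I.biUnion B ∧
      ((ω : ℝ) / (p * ω + σ) - (3 + 8 * ω + 40 * p) * ρ) * n ≤ U.card ∧
      ∀ v ∈ U, τ v ∈ I ∧ v ∈ B (τ v) ∧ s' ≤ (cls G (Q 0) (B (τ v)) x).card ∧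
        (∀ q ∈ cls G (Q 0) (B (τ v)) x, HasTiles G p σ ω 1 θ ((B (τ v)).erase v ∪ {q})) ∧
        (∀ l, l ≠ 0 → 3 * s ≤ 4 * (nb G v (Q l)).card) := by
  obtain ⟨x, hx, h1, h2, h3, h4, h5, h6⟩ := S.ne_num hs hθ2 n ρ hn hρ hm hN1 hN2 hρθ hν
  have hω : 1 ≤ ω := by have := S.hσ; omega
  have hsR : (0:ℝ) < s := by exact_mod_cast hs
  refine ⟨x, hx, ?_⟩
  let NP := I.filter (fun i => (cls G (Q 0) (B i) x).card < s')
  let X := xb G s' ω θ (p * ω + σ) I B (Q 0) x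
  let J := (I \ NP) \ X
  have hJI : J ⊆ I := sdiff_subset.trans sdiff_subset
  have hgood : ∀ i, ∃ j1 : Fin (p+1), i ∈ J → s' ≤ (cls G (Q 0) (B i) x).card ∧ j1 ≠ 0 ∧ (P i j1 ∩ nb G x (B i)).card < ω * (p * ω + σ) ∧
      ∀ j, j ≠ j1 → sz σ ω j ≤ (P i j ∩ nb G x (B i)).card := by
    intro i
    by_cases hi : i ∈ J
    · have hi' := hi
      simp only [J, NP, X, xb, mem_sdiff, mem_filter, not_and, not_lt, not_le] at hi'
      have ha := hi'.1.2 hi'.1.1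
      obtain ⟨j1, hj⟩ := S.good hi'.1.1 ha (hi'.2 hi'.1.1 ha)
      exact ⟨j1, fun _ => ⟨ha, hj⟩⟩
    · exact ⟨0, fun h => absurd h hi⟩
  choose j1 hj1 using hgood
  let E : ι → Finset V := fun i => P i (j1 i) \ nb G x (B i)
  have hPB : ∀ i ∈ I, ∀ j, P i j ⊆ B i := fun i hi j => by rw [S.hB i hi]; exact subset_biUnion_of_mem (P i) (mem_univ _)
  have hEB : ∀ i ∈ J, E i ⊆ nn G x (B i) := by
    intro i hi
    rw [← sdiff_nb]
    exact sdiff_subset_sdiff (hPB i (hJI hi) _) subset_rfl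
  let U0 := J.biUnion E
  have hU0 : U0 ⊆ nn G x (I.biUnion B) := by
    rw [nn_biUnion]
    intro v hv
    obtain ⟨i, hi, hvi⟩ := mem_biUnion.1 hv
    exact mem_biUnion.2 ⟨i, hJI hi, hEB i hi hvi⟩
  have hU0c : ω * θ * J.card ≤ U0.card + ω * (p * ω + σ) * J.card := by
    have : U0.card = ∑ i ∈ J, (E i).card := card_biUnion (fun i hi j hj hij => (S.hBd i (hJI hi) j (hJI hj) hij).mono
      ((hEB i hi).trans (filter_subset _ _)) ((hEB j hj).trans (filter_subset _ _)))
    rw [this]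
    have hJ : J.card = ∑ i ∈ J, 1 := card_eq_sum_ones J
    rw [hJ, mul_sum, mul_sum, ← sum_add_distrib]
    apply sum_le_sum
    intro i hi
    have ha := hj1 i hi
    have hb := card_sdiff_add_card_inter (P i (j1 i)) (nb G x (B i))
    rw [S.hP1 i (hJI hi), show sz σ ω (j1 i) = ω by simp [sz, ha.2.1]] at hb
    have : (E i).card = (P i (j1 i) \ nb G x (B i)).card := rfl
    omega
  let bad : Fin (e+1) → Finset V := fun l => (nn G x (I.biUnion B)).filter (fun v => 4 * (nb G v (Q l)).card < 3 * s)
  have hbad : ∀ l, l ≠ 0 → ((bad l).card : ℝ) ≤ 40 * ρ * n := by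
    intro l hl
    have ha : s * (bad l).card ≤ 4 * ∑ y ∈ Q l, ms G y (nn G x (I.biUnion B)) := by
      rw [sum_ms_comm]
      calc s * (bad l).card = ∑ v ∈ bad l, s := by rw [sum_const, smul_eq_mul, mul_comm]
        _ ≤ ∑ v ∈ bad l, 4 * ms G v (Q l) := sum_le_sum (fun v hv => by
            have hb := (mem_filter.1 hv).2
            have hc := nb_add_ms G v (Q l)
            rw [S.hQc] at hc
            omega)
        _ ≤ ∑ v ∈ nn G x (I.biUnion B), 4 * ms G v (Q l) := sum_le_sum_of_subset (filter_subset _ _)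
        _ = _ := by rw [mul_sum]
    have hb : ((s * (bad l).card : ℕ) : ℝ) ≤ ((4 * ∑ y ∈ Q l, ms G y (nn G x (I.biUnion B)) : ℕ) : ℝ) := by exact_mod_cast ha
    rw [Nat.cast_mul, Nat.cast_mul] at hb
    have hc := h3 l hl
    have hd : (s:ℝ) * (bad l).card ≤ s * (40 * ρ * n) := by
      push_cast at hb hc
      linarith
    exact le_of_mul_le_mul_left hd hsR
  let BAD := (univ.erase (0 : Fin (e+1))).biUnion bad
  have hBAD : (BAD.card : ℝ) ≤ 40 * p * ρ * n := by
    have ha : BAD.card ≤ ∑ l ∈ univ.erase (0 : Fin (e+1)), (bad l).card := card_biUnion_le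
    have hb : ((∑ l ∈ univ.erase (0 : Fin (e+1)), (bad l).card : ℕ) : ℝ) ≤ ∑ l ∈ univ.erase (0 : Fin (e+1)), (40 * ρ * n) := by
      push_cast
      exact sum_le_sum (fun l hl => hbad l (ne_of_mem_erase hl))
    rw [sum_const, card_erase_of_mem (mem_univ _), nsmul_eq_mul] at hb
    simp only [card_univ, Fintype.card_fin, Nat.add_sub_cancel] at hb
    have hc : (e : ℝ) ≤ p := by have := S.hep; exact_mod_cast (show e ≤ p by omega)
    have hd : (e:ℝ) * (40 * ρ * n) ≤ p * (40 * ρ * n) := mul_le_mul_of_nonneg_right hc (by positivity)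
    have he : (BAD.card : ℝ) ≤ ((∑ l ∈ univ.erase (0 : Fin (e+1)), (bad l).card : ℕ) : ℝ) := by exact_mod_cast ha
    linarith
  have htau : ∀ v, ∃ i, v ∈ U0 → i ∈ J ∧ v ∈ E i := by
    intro v
    by_cases hv : v ∈ U0
    · obtain ⟨i, hi⟩ := mem_biUnion.1 hv
      exact ⟨i, fun _ => hi⟩
    · exact ⟨Classical.choice hι, fun h => absurd h hv⟩
  choose τ hτ using htau
  refine ⟨τ, U0 \ BAD, sdiff_subset.trans (hU0.trans (filter_subset _ _)), ?_, ?_⟩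
  · have ha : (U0.card : ℝ) ≤ (U0 \ BAD).card + BAD.card := by
      have := card_le_card_sdiff_add_card (t := BAD) (s := U0)
      exact_mod_cast this
    have hb : I.card ≤ J.card + NP.card + X.card := by
      have h1 := card_le_card_sdiff_add_card (t := X) (s := I \ NP)
      have h2 := card_le_card_sdiff_add_card (t := NP) (s := I)
      have h3 : J.card = ((I \ NP) \ X).card := rfl
      omega
    have hb' : (I.card : ℝ) ≤ J.card + NP.card + X.card := by exact_mod_cast hb
    have hc : (ω : ℝ) * θ * J.card ≤ U0.card + ω * (p * ω + σ) * J.card := by exact_mod_cast hU0c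
    have hd : (J.card : ℝ) ≤ I.card := by exact_mod_cast card_le_card hJI
    have hNP : (NP.card : ℝ) ≤ ρ * I.card := h1
    have hX : (X.card : ℝ) * θ ≤ 8 * ρ * n := h2
    have e1 : (ω:ℝ) * θ * I.card ≤ ω * θ * (J.card + NP.card + X.card) := mul_le_mul_of_nonneg_left hb' (by positivity)
    have e2 : (ω:ℝ) * θ * NP.card ≤ ω * θ * (ρ * I.card) := mul_le_mul_of_nonneg_left hNP (by positivity)
    have e3 : (ω:ℝ) * (X.card * θ) ≤ ω * (8 * ρ * n) := mul_le_mul_of_nonneg_left hX (by positivity)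
    have e4 : ρ * ((ω : ℝ) * θ * I.card) ≤ ρ * n := mul_le_mul_of_nonneg_left h5 hρ.le
    have e5 : (ω : ℝ) * (p * ω + σ) * J.card ≤ ω * (p * ω + σ) * I.card := mul_le_mul_of_nonneg_left hd (by positivity)
    linarith
  · intro v hv
    rw [mem_sdiff] at hv
    obtain ⟨ht1, ht2⟩ := hτ v hv.1
    have hj := hj1 _ ht1
    refine ⟨hJI ht1, ?_, hj.1, ?_, ?_⟩
    · exact (filter_subset _ _) (hEB _ ht1 ht2)
    · intro q hq
      exact S.swap (hJI ht1) hj.2.1 hj.2.2.2 (mem_sdiff.1 ht2).1 hq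
    · intro l hl
      by_contra hlt
      push Not at hlt
      apply hv.2
      exact mem_biUnion.2 ⟨l, mem_erase.2 ⟨hl, mem_univ _⟩, mem_filter.2 ⟨hU0 hv.1, hlt⟩⟩
end OBT

set_option linter.unusedVariables false
set_option linter.unusedSectionVars false
namespace OBT
open scoped Classical
open Finset

lemma thin {V ι : Type} (X0 : Finset V) (τ : V → ι) (B : ι → Finset V) (K : Finset ι) (d t : ℕ)
    (hB : ∀ v ∈ X0, v ∈ B (τ v) ∧ (B (τ v)).card ≤ d) (hc : (t + K.card) * d ≤ X0.card) (hd : 1 ≤ d) :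
    ∃ X ⊆ X0, X.card = t ∧ (∀ u ∈ X, ∀ v ∈ X, τ u = τ v → u = v) ∧ ∀ u ∈ X, τ u ∉ K := by
  have h1 : X0.card ≤ (X0.image τ).card * d := by
    have : X0 ⊆ (X0.image τ).biUnion (fun i => X0.filter (fun v => τ v = i)) := by
      intro v hv
      exact mem_biUnion.2 ⟨τ v, mem_image_of_mem _ hv, by simp [hv]⟩
    refine (card_le_card this).trans (card_biUnion_le_card_mul _ _ _ ?_)
    intro i hi
    obtain ⟨u, hu, rfl⟩ := mem_image.1 hi
    refine (card_le_card ?_).trans (hB u hu).2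
    intro v hv
    rw [mem_filter] at hv
    rw [← hv.2]
    exact (hB v hv.1).1
  have h2 : t + K.card ≤ (X0.image τ).card := by
    by_contra hlt
    push Not at hlt
    have : (X0.image τ).card * d + d ≤ (t + K.card) * d := by
      have := Nat.mul_le_mul_right d (Nat.succ_le_of_lt hlt)
      rw [Nat.succ_mul] at this
      exact this
    omega
  have h3 : t ≤ (X0.image τ \ K).card := by
    have := card_le_card_sdiff_add_card (s := X0.image τ) (t := K)
    omega
  obtain ⟨Y, hY, hYc⟩ := exists_subset_card_eq h3
  by_cases hV : Nonempty V
  · have h4 : ∀ i, ∃ v, i ∈ Y → v ∈ X0 ∧ τ v = i := by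
      intro i
      by_cases hi : i ∈ Y
      · obtain ⟨v, hv, hvi⟩ := mem_image.1 (mem_sdiff.1 (hY hi)).1
        exact ⟨v, fun _ => ⟨hv, hvi⟩⟩
      · exact ⟨Classical.choice hV, fun h => absurd h hi⟩
    choose g hg using h4
    refine ⟨Y.image g, ?_, ?_, ?_, ?_⟩
    · intro v hv
      obtain ⟨i, hi, rfl⟩ := mem_image.1 hv
      exact (hg i hi).1
    · rw [card_image_of_injOn, hYc]
      intro i hi j hj hij
      have a := (hg i hi).2
      have b := (hg j hj).2
      rw [← a, ← b, hij]
    · intro u hu v hv huv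
      obtain ⟨i, hi, rfl⟩ := mem_image.1 hu
      obtain ⟨j, hj, rfl⟩ := mem_image.1 hv
      rw [(hg i hi).2, (hg j hj).2] at huv
      rw [huv]
    · intro u hu
      obtain ⟨i, hi, rfl⟩ := mem_image.1 hu
      rw [(hg i hi).2]
      exact (mem_sdiff.1 (hY hi)).2
  · have hX : X0 = ∅ := by ext v; exact absurd ⟨v⟩ hV
    have ht : t = 0 := by
      rw [hX] at h3
      simp at h3
      exact h3
    exact ⟨∅, by simp, by simp [ht], by simp, by simp⟩

/-- chain state -/
def Chain {V ι : Type} (G : SimpleGraph V) (p σ ω θ : ℕ) (L A : Finset V) (I : Finset ι) (B : ι → Finset V) (e s c : ℕ) : Prop :=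
  ∃ I0 ⊆ I, I0.card ≤ c ∧ ∃ Q : Fin (e+1) → Finset V, (∀ l, Q l ⊆ (L ∪ I0.biUnion B) \ A ∧ (Q l).card = s) ∧
    (∀ l l', l ≠ l' → Cm G (Q l) (Q l')) ∧ HasTiles G p σ ω 1 (θ * I0.card) ((L ∪ I0.biUnion B) \ univ.biUnion Q)

lemma ne_step (p σ ω θ s s1 e : ℕ) (η ρ : ℝ) (hσ : σ < ω) (hep : e + 1 ≤ p) (hθ : p * ω + σ ≤ θ) (hθ2 : 2 ≤ θ)
    (hη : 0 < η) (hρ : 0 < ρ) (hρη : (4 + 8 * ω + 40 * p) * ρ ≤ η) (hρθ : ((p * ω + σ : ℕ) : ℝ) ≤ ρ * θ)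
    (hs1 : p * ω + σ ≤ s1) (hs1' : (p+1) * ω * ω ≤ s1) (hs : 2 * s1 ≤ s)
    (hν : ((2 * s1 * 2 ^ ((p * ω + σ) * θ) : ℕ) : ℝ) ≤ ρ * s) :
    ∃ n0 : ℕ, ∀ (V ι : Type) (G : SimpleGraph V) (W A L : Finset V) (I : Finset ι) (B : ι → Finset V) (c c0 : ℕ),
      Nonempty ι → n0 ≤ W.card → (∀ u ∈ A, ∀ v ∈ A, u ≠ v → G.Adj u v) →
      (∀ x ∈ W, x ∉ A → (ms G x W : ℝ) ≤ ((ω : ℝ) / (p * ω + σ) + ρ) * W.card) →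
      (∀ i ∈ I, IsTile G p σ ω θ (B i) ∧ B i ⊆ W) → (∀ i ∈ I, ∀ j ∈ I, i ≠ j → Disjoint (B i) (B j)) →
      L ⊆ W → Disjoint L (I.biUnion B) →
      (∀ I0 ⊆ I, I0.card ≤ c0 → ¬ HasTiles G p σ ω 1 (θ * I0.card + 1) (L ∪ I0.biUnion B)) →
      ((1 - ρ) * W.card ≤ (p * ω + σ) * θ * ((I.card : ℝ) - c)) →
      (∀ U ⊆ W, ((ω : ℝ) / (p * ω + σ) - η) * W.card ≤ U.card → η * (W.card : ℝ)^2 ≤ ((∑ u ∈ U, (nb G u U).card : ℕ) : ℝ)) →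
      c + 2 * s1 ≤ c0 → Chain G p σ ω θ L A I B e s c → Chain G p σ ω θ L A I B (e+1) s1 (c + 2 * s1) := by
  have hω : 1 ≤ ω := by omega
  have hh1 : 1 ≤ p * ω + σ := by
    have : 1 * ω ≤ p * ω := Nat.mul_le_mul_right _ (by omega)
    omega
  obtain ⟨n1, hpair⟩ := pair e s (2 * s1 * ((p * ω + σ) * θ)) (Nat.mul_pos (by omega) (Nat.mul_pos hh1 (by omega))) η hη
  obtain ⟨n2, hn2⟩ := exists_nat_ge ((((p * ω + σ) * ((p * ω + σ) * θ) : ℕ) : ℝ) / ρ)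
  refine ⟨max n1 n2, ?_⟩
  intro V ι G W A L I B c c0 hι hn hA hW hB hBd hLW hLB hLM hN hdense hc0 hch
  obtain ⟨I0, hI0, hI0c, Q, hQ, hQc, hQt⟩ := hch
  set R := L ∪ I0.biUnion B with hR
  set I' := I \ I0 with hI'
  have hI'I : I' ⊆ I := sdiff_subset
  have hRB : ∀ i ∈ I', Disjoint R (B i) := by
    intro i hi
    rw [hI', mem_sdiff] at hi
    rw [hR, disjoint_union_left]
    refine ⟨hLB.mono_right (subset_biUnion_of_mem B hi.1), ?_⟩
    rw [disjoint_biUnion_left]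
    intro j hj
    exact hBd j (hI0 hj) i hi.1 (fun h => hi.2 (h ▸ hj))
  have hQR : ∀ l, Q l ⊆ R := fun l => (hQ l).1.trans sdiff_subset
  have hQUR : univ.biUnion Q ⊆ R := biUnion_subset.2 fun l _ => hQR l
  have hRW : R ⊆ W := union_subset hLW (biUnion_subset.2 fun i hi => (hB i (hI0 hi)).2)
  have hPex : ∀ i, ∃ P : Fin (p+1) → Finset V, i ∈ I' → (∀ j, (P j).card = sz σ ω j * θ) ∧
    (∀ j k, j ≠ k → Cm G (P j) (P k)) ∧ B i = univ.biUnion P := by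
    intro i
    by_cases hi : i ∈ I'
    · obtain ⟨P, hP⟩ := (hB i (hI'I hi)).1
      exact ⟨P, fun _ => hP⟩
    · exact ⟨fun _ => ∅, fun h => absurd h hi⟩
  choose P hP using hPex
  have hS : Setup G p σ ω θ e s (2 * s1) I' P B Q := by
    refine ⟨hσ, hep, hθ, fun i hi => (hP i hi).1, fun i hi => (hP i hi).2.1, fun i hi => (hP i hi).2.2,
      fun i hi j hj => hBd i (hI'I hi) j (hI'I hj), fun l => (hQ l).2, hQc, fun i hi => (hRB i hi).mono_left hQUR, ?_, by omega⟩
    intro i hi ht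
    have hi' := hi
    rw [hI', mem_sdiff] at hi'
    have := hQt.add ht (by
      rw [disjoint_union_right]
      exact ⟨sdiff_disjoint, (hRB i hi).mono_left sdiff_subset⟩)
    apply hLM (insert i I0) (insert_subset hi'.1 hI0) (by rw [card_insert_of_notMem hi'.2]; omega)
    rw [card_insert_of_notMem hi'.2]
    have h2 := this.mono (T := L ∪ (insert i I0).biUnion B) (by
      rw [biUnion_insert]
      intro v hv
      simp only [mem_union, mem_sdiff] at hv ⊢
      rcases hv with hv | hv | hv
      · have := hv.1
        rw [hR, mem_union] at this
        tauto
      · have := hQUR hv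
        rw [hR, mem_union] at this
        tauto
      · tauto)
    rw [show θ * (I0.card + 1) + 1 = θ * I0.card + (θ + 1) by ring]
    exact h2
  have hBI' : I'.biUnion B ⊆ W := biUnion_subset.2 fun i hi => (hB i (hI'I hi)).2
  have hIc : (I'.card : ℝ) ≥ I.card - c := by
    have h1 : I.card ≤ I'.card + I0.card := card_le_card_sdiff_add_card (s := I) (t := I0)
    have : I.card ≤ I'.card + c := by omega
    have : (I.card : ℝ) ≤ I'.card + c := by exact_mod_cast this
    linarith
  have hn1 : n1 ≤ W.card := le_trans (le_max_left _ _) hn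
  have hn2' : (((p * ω + σ) * ((p * ω + σ) * θ) : ℕ) : ℝ) ≤ ρ * W.card := by
    have h1 : (n2 : ℝ) ≤ W.card := by exact_mod_cast le_trans (le_max_right _ _) hn
    have h2 := hn2.trans h1
    rw [div_le_iff₀ hρ] at h2
    linarith
  obtain ⟨x, hx, τ, U, hUI, hUc, hU⟩ := hS.ne_U hι (by omega) hθ2 (W.card : ℝ) ρ (by positivity) hρ
    (fun l y hy => by
      have hy' := (hQ l).1 hy
      rw [mem_sdiff] at hy'
      refine le_trans ?_ (hW y (hRW hy'.1) hy'.2)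
      exact_mod_cast ms_mono hBI')
    (hN.trans (mul_le_mul_of_nonneg_left hIc (by positivity)))
    (by
      have h1 : (I'.biUnion B).card = (p * ω + σ) * θ * I'.card := by
        rw [card_biUnion (fun i hi j hj => hBd i (hI'I hi) j (hI'I hj)), sum_congr rfl (fun i hi => hS.cardB hi), sum_const, smul_eq_mul, mul_comm]
      have h2 := card_le_card hBI'
      rw [h1] at h2
      exact_mod_cast h2) hρθ hν
  -- the swap tool
  have hswap : ∀ X ⊆ U, X.card ≤ 2 * s1 → (∀ u ∈ X, ∀ v ∈ X, τ u = τ v → u = v) →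
      HasTiles G p σ ω 1 (θ * X.card) (((X.image τ).biUnion B \ X) ∪ Q 0) := by
    intro X hX hXc hXi
    apply multiswap X τ hXi
    · intro u hu v hv huv
      exact hBd _ (hI'I (hU u (hX hu)).1) _ (hI'I (hU v (hX hv)).1) (fun h => huv (hXi u hu v hv h))
    · intro u hu
      exact (hRB _ (hU u (hX hu)).1).mono_left (hQR 0)
    · exact fun u hu => (hU u (hX hu)).2.1
    · exact fun v hv => ⟨filter_subset _ _, hXc.trans (hU v (hX hv)).2.2.1⟩
    · exact fun v hv => (hU v (hX hv)).2.2.2.1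
  have hXI' : ∀ X ⊆ U, X.image τ ⊆ I' := by
    intro X hX i hi
    obtain ⟨v, hv, rfl⟩ := mem_image.1 hi
    exact (hU v (hX hv)).1
  have hXB : ∀ X ⊆ U, X ⊆ (X.image τ).biUnion B := fun X hX v hv =>
    mem_biUnion.2 ⟨τ v, mem_image_of_mem _ hv, (hU v (hX hv)).2.1⟩
  have hRX : ∀ X ⊆ U, Disjoint R ((X.image τ).biUnion B) := by
    intro X hX
    rw [disjoint_biUnion_right]
    exact fun i hi => hRB i (hXI' X hX hi)
  have hcard : ∀ X ⊆ U, (∀ u ∈ X, ∀ v ∈ X, τ u = τ v → u = v) → (I0 ∪ X.image τ).card = I0.card + X.card := by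
    intro X hX hXi
    rw [card_union_of_disjoint, card_image_of_injOn (fun u hu v hv => hXi u hu v hv)]
    exact disjoint_sdiff.mono_right (hXI' X hX)
  have hUB : ∀ v ∈ U, v ∈ B (τ v) ∧ (B (τ v)).card ≤ (p * ω + σ) * θ := fun v hv =>
    ⟨(hU v hv).2.1, (hS.cardB (hU v hv).1).le⟩
  have hd1 : 1 ≤ (p * ω + σ) * θ := Nat.mul_pos hh1 (by omega)
  have hUA : (U ∩ A).card < (p * ω + σ) * ((p * ω + σ) * θ) := by
    by_contra hge
    push Not at hge
    obtain ⟨X, hX, hXc, hXi, _⟩ := thin (U ∩ A) τ B ∅ ((p * ω + σ) * θ) (p * ω + σ) (fun v hv => hUB v (mem_inter.1 hv).1)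
      (by simpa using hge) hd1
    have hXU : X ⊆ U := hX.trans inter_subset_left
    have h1 := hswap X hXU (by omega) hXi
    have h2 : HasTiles G p σ ω 1 1 X := tile_of_clique X (fun u hu v hv => hA u (mem_inter.1 (hX hu)).2 v (mem_inter.1 (hX hv)).2) (by omega)
    have hdX : Disjoint R X := (hRX X hXU).mono_right (hXB X hXU)
    have h3 := h1.add h2 (by
      rw [disjoint_union_left]
      exact ⟨sdiff_disjoint, hdX.mono_left (hQR 0)⟩)
    have h4 := hQt.add h3 (by
      rw [disjoint_union_right, disjoint_union_right]
      refine ⟨⟨(hRX X hXU).mono sdiff_subset sdiff_subset, ?_⟩, hdX.mono_left sdiff_subset⟩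
      exact disjoint_sdiff.symm.mono_right (subset_biUnion_of_mem Q (mem_univ 0)))
    apply hLM (I0 ∪ X.image τ) (union_subset hI0 ((hXI' X hXU).trans hI'I)) (by rw [hcard X hXU hXi]; omega)
    rw [hcard X hXU hXi, show θ * (I0.card + X.card) + 1 = θ * I0.card + (θ * X.card + 1) by ring]
    refine h4.mono ?_
    have e1 : R ⊆ L ∪ (I0 ∪ X.image τ).biUnion B := union_subset_union subset_rfl (biUnion_subset_biUnion_of_subset_left _ subset_union_left)
    have e2 : (X.image τ).biUnion B ⊆ L ∪ (I0 ∪ X.image τ).biUnion B :=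
      (biUnion_subset_biUnion_of_subset_left _ subset_union_right).trans subset_union_right
    exact union_subset (sdiff_subset.trans e1) (union_subset (union_subset (sdiff_subset.trans e2) ((hQR 0).trans e1)) ((hXB X hXU).trans e2))
  set U0 := U \ A with hU0
  have hU0U : U0 ⊆ U := sdiff_subset
  have hU0W : U0 ⊆ W := hU0U.trans (hUI.trans hBI')
  have hU0c : ((ω : ℝ) / (p * ω + σ) - η) * W.card ≤ U0.card := by
    have h1 : U0.card + (U ∩ A).card = U.card := card_sdiff_add_card_inter U A
    have h2 : (U.card : ℝ) ≤ U0.card + ((p * ω + σ) * ((p * ω + σ) * θ) : ℕ) := by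
      exact_mod_cast (show U.card ≤ U0.card + (p * ω + σ) * ((p * ω + σ) * θ) by omega)
    have h3 : ((4 + 8 * ω + 40 * p) * ρ) * (W.card : ℝ) ≤ η * W.card := mul_le_mul_of_nonneg_right hρη (by positivity)
    linarith
  obtain ⟨P1, hP1, P2, hP2, hP1c, hP2c, hP12, Q', hQ'⟩ := hpair V G U0 W.card (fun l => Q l.succ) hn1 (card_le_card hU0W)
    (hdense U0 hU0W hU0c) (fun l => (hQ _).2) (fun v hv l => (hU v (hU0U hv)).2.2.2.2 l.succ (Fin.succ_ne_zero l))
  obtain ⟨X1, hX1, hX1c, hX1i, _⟩ := thin P1 τ B ∅ ((p * ω + σ) * θ) s1 (fun v hv => hUB v (hU0U (hP1 hv)))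
    (by rw [hP1c]; apply Nat.mul_le_mul_right; simp; omega) hd1
  obtain ⟨X2, hX2, hX2c, hX2i, hX2K⟩ := thin P2 τ B (X1.image τ) ((p * ω + σ) * θ) s1 (fun v hv => hUB v (hU0U (hP2 hv)))
    (by rw [hP2c, card_image_of_injOn (fun u hu v hv => hX1i u hu v hv), hX1c]; apply Nat.mul_le_mul_right; omega) hd1
  set X := X1 ∪ X2 with hX
  have hX12 : Cm G X1 X2 := hP12.mono hX1 hX2
  have hXU0 : X ⊆ U0 := union_subset (hX1.trans hP1) (hX2.trans hP2)
  have hXU : X ⊆ U := hXU0.trans hU0U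
  have hXc : X.card = 2 * s1 := by rw [hX, card_union_of_disjoint hX12.disj]; omega
  have hXi : ∀ u ∈ X, ∀ v ∈ X, τ u = τ v → u = v := by
    intro u hu v hv huv
    rw [hX, mem_union] at hu hv
    rcases hu with hu | hu <;> rcases hv with hv | hv
    · exact hX1i u hu v hv huv
    · exact absurd (huv ▸ mem_image_of_mem τ hu) (hX2K v hv)
    · exact absurd (huv ▸ mem_image_of_mem τ hv) (hX2K u hu)
    · exact hX2i u hu v hv huv
  obtain ⟨Q'', hQ''⟩ := trim_cells (t := s1) Q' (fun l => by have := (hQ' l).2.1; omega)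
  have hQ''s : ∀ l, Q'' l ⊆ Q l.succ := fun l => (hQ'' l).1.trans (hQ' l).1
  have e1 : R ⊆ L ∪ (I0 ∪ X.image τ).biUnion B := union_subset_union subset_rfl (biUnion_subset_biUnion_of_subset_left _ subset_union_left)
  have e2 : (X.image τ).biUnion B ⊆ L ∪ (I0 ∪ X.image τ).biUnion B :=
      (biUnion_subset_biUnion_of_subset_left _ subset_union_right).trans subset_union_right
  have hXsub : X ⊆ (L ∪ (I0 ∪ X.image τ).biUnion B) \ A := fun v hv =>
    mem_sdiff.2 ⟨e2 (hXB X hXU hv), (mem_sdiff.1 (hXU0 hv)).2⟩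
  have hdX : Disjoint R X := (hRX X hXU).mono_right (hXB X hXU)
  have hh := hswap X hXU hXc.le hXi
  have h4 := hQt.add hh (by
      rw [disjoint_union_right]
      refine ⟨(hRX X hXU).mono sdiff_subset sdiff_subset, ?_⟩
      exact disjoint_sdiff.symm.mono_right (subset_biUnion_of_mem Q (mem_univ 0)))
  refine ⟨I0 ∪ X.image τ, union_subset hI0 ((hXI' X hXU).trans hI'I), by rw [hcard X hXU hXi]; omega,
    (Fin.cons X1 (Fin.cons X2 Q'' : Fin (e+1) → Finset V) : Fin (e+2) → Finset V), ?_, ?_, ?_⟩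
  · intro l
    refine Fin.cases ?_ (fun l => ?_) l
    · simp only [Fin.cons_zero]
      exact ⟨subset_union_left.trans hXsub, hX1c⟩
    · refine Fin.cases ?_ (fun l => ?_) l
      · simp only [Fin.cons_succ, Fin.cons_zero]
        exact ⟨subset_union_right.trans hXsub, hX2c⟩
      · simp only [Fin.cons_succ]
        exact ⟨(hQ''s l).trans ((hQ l.succ).1.trans (sdiff_subset_sdiff e1 subset_rfl)), (hQ'' l).2⟩
  · apply cons_cells
    · apply cons_cells
      · intro a b hab
        exact (hQc a.succ b.succ (fun h => hab (Fin.succ_injective _ h))).mono (hQ''s a) (hQ''s b)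
      · exact fun l => (hQ' l).2.2.2.mono hX2 (hQ'' l).1
    · intro l
      refine Fin.cases ?_ (fun l => ?_) l
      · simp only [Fin.cons_zero]
        exact hX12
      · simp only [Fin.cons_succ]
        exact (hQ' l).2.2.1.mono hX1 (hQ'' l).1
  · rw [hcard X hXU hXi, mul_add]
    refine h4.mono ?_
    have key : ∀ l, ∀ v ∈ (Fin.cons X1 (Fin.cons X2 Q'' : Fin (e+1) → Finset V) : Fin (e+2) → Finset V) l, v ∈ X ∨ ∃ l : Fin e, v ∈ Q l.succ := by
      intro l
      refine Fin.cases ?_ (fun l => ?_) l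
      · simp only [Fin.cons_zero]
        exact fun v hv => Or.inl (mem_union_left _ hv)
      · refine Fin.cases ?_ (fun l => ?_) l
        · simp only [Fin.cons_succ, Fin.cons_zero]
          exact fun v hv => Or.inl (mem_union_right _ hv)
        · simp only [Fin.cons_succ]
          exact fun v hv => Or.inr ⟨l, hQ''s l hv⟩
    intro v hv
    refine mem_sdiff.2 ⟨?_, ?_⟩
    · exact (union_subset (sdiff_subset.trans e1) (union_subset (sdiff_subset.trans e2) ((hQR 0).trans e1))) hv
    · intro hv'
      obtain ⟨l, _, hl⟩ := mem_biUnion.1 hv'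
      rw [mem_union, mem_union, mem_sdiff, mem_sdiff] at hv
      rcases key l v hl with h | ⟨l, h⟩
      · rcases hv with hv | hv | hv
        · exact disjoint_left.1 hdX hv.1 h
        · exact hv.2 h
        · exact disjoint_left.1 hdX (hQR 0 hv) h
      · rcases hv with hv | hv | hv
        · exact hv.2 (mem_biUnion.2 ⟨_, mem_univ _, h⟩)
        · exact disjoint_left.1 (hRX X hXU) (hQR _ h) hv.1
        · exact disjoint_left.1 (hQc 0 l.succ (Fin.succ_ne_zero l).symm).disj hv h
end OBT

set_option linter.unusedVariables false
set_option linter.unusedSectionVars false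
namespace OBT
open scoped Classical
open Finset

lemma Chain.mono_c {V ι : Type} {G : SimpleGraph V} {p σ ω θ : ℕ} {L A : Finset V} {I : Finset ι} {B : ι → Finset V} {e s c c' : ℕ}
    (h : Chain G p σ ω θ L A I B e s c) (hc : c ≤ c') : Chain G p σ ω θ L A I B e s c' := by
  obtain ⟨I0, h1, h2, h3⟩ := h
  exact ⟨I0, h1, h2.trans hc, h3⟩

theorem NE (p σ ω : ℕ) (hp : 1 ≤ p) (hσ : σ < ω) (η : ℝ) (hη : 0 < η) :
    ∃ ε : ℝ, 0 < ε ∧ ∃ C n0 : ℕ, ∀ (V : Type) (G : SimpleGraph V) (W A : Finset V),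
      (∀ u ∈ A, ∀ v ∈ A, u ≠ v → G.Adj u v) →
      (∀ x ∈ W, x ∉ A → (ms G x W : ℝ) ≤ ((ω : ℝ) / (p * ω + σ) + ε) * W.card) →
      (∀ U ⊆ W, ((ω : ℝ) / (p * ω + σ) - η) * W.card ≤ U.card → η * (W.card : ℝ)^2 ≤ ((∑ u ∈ U, (nb G u U).card : ℕ) : ℝ)) →
      n0 ≤ W.card →
      ∃ q, HasTiles G p σ ω 1 q W ∧ W.card ≤ (p * ω + σ) * q + C := by
  have hω : 1 ≤ ω := by omega
  have hh1 : 1 ≤ p * ω + σ := by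
    have : 1 * ω ≤ p * ω := Nat.mul_le_mul_right _ (by omega)
    omega
  -- constants
  obtain ⟨ρ, hρ, hρη, hρ1⟩ : ∃ ρ : ℝ, 0 < ρ ∧ (4 + 8 * (ω:ℝ) + 40 * p) * ρ ≤ η ∧ ρ ≤ 1/2 := by
    have hpos : 0 < (4 + 8 * (ω:ℝ) + 40 * p) := by positivity
    refine ⟨min (η / (4 + 8 * (ω:ℝ) + 40 * p)) (1/2), by positivity, ?_, min_le_right _ _⟩
    calc (4 + 8 * (ω:ℝ) + 40 * p) * min (η / (4 + 8 * (ω:ℝ) + 40 * p)) (1/2) ≤ (4 + 8 * (ω:ℝ) + 40 * p) * (η / (4 + 8 * (ω:ℝ) + 40 * p)) :=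
        mul_le_mul_of_nonneg_left (min_le_left _ _) hpos.le
      _ = η := by field_simp
  obtain ⟨θ0, hθ0⟩ := exists_nat_ge (((p * ω + σ : ℕ) : ℝ) / ρ)
  obtain ⟨θ, hθ, hθ2, hρθ⟩ : ∃ θ : ℕ, p * ω + σ ≤ θ ∧ 2 ≤ θ ∧ ((p * ω + σ : ℕ) : ℝ) ≤ ρ * θ := by
    refine ⟨max θ0 (max 2 (p * ω + σ)), by omega, by omega, ?_⟩
    have : (θ0 : ℝ) ≤ ((max θ0 (max 2 (p * ω + σ)) : ℕ) : ℝ) := by exact_mod_cast le_max_left _ _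
    have h2 := hθ0.trans this
    rw [div_le_iff₀ hρ] at h2
    linarith
  obtain ⟨Λ0, hΛ0⟩ := exists_nat_ge (((2 * 2 ^ ((p * ω + σ) * θ) : ℕ) : ℝ) / ρ)
  obtain ⟨Λ, hΛ2, hΛ⟩ : ∃ Λ : ℕ, 2 ≤ Λ ∧ ((2 * 2 ^ ((p * ω + σ) * θ) : ℕ) : ℝ) ≤ ρ * Λ := by
    refine ⟨max Λ0 2, by omega, ?_⟩
    have : (Λ0 : ℝ) ≤ ((max Λ0 2 : ℕ) : ℝ) := by exact_mod_cast le_max_left _ _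
    have h2 := hΛ0.trans this
    rw [div_le_iff₀ hρ] at h2
    linarith
  set s0 : ℕ := (p+1) * ω * ω + (p * ω + σ) with hs0
  let S : ℕ → ℕ := fun e => Λ ^ (p - e) * s0
  have hSmono : ∀ e, s0 ≤ S e := fun e => Nat.le_mul_of_pos_left _ (Nat.pow_pos (by omega))
  have hSle : ∀ e, S e ≤ S 0 := fun e => Nat.mul_le_mul_right _ (Nat.pow_le_pow_right (by omega) (by omega))
  have hSs : ∀ e, e + 1 ≤ p → S e = Λ * S (e+1) := by
    intro e he
    simp only [S]
    rw [show p - e = (p - (e+1)) + 1 by omega, pow_succ]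
    ring
  set K := 2 * S 0 with hK
  set c0 := (p+1) * K with hc0
  have hsteps : ∀ e, ∃ n0 : ℕ, e + 1 ≤ p → ∀ (V ι : Type) (G : SimpleGraph V) (W A L : Finset V) (I : Finset ι) (B : ι → Finset V) (c c0 : ℕ),
      Nonempty ι → n0 ≤ W.card → (∀ u ∈ A, ∀ v ∈ A, u ≠ v → G.Adj u v) →
      (∀ x ∈ W, x ∉ A → (ms G x W : ℝ) ≤ ((ω : ℝ) / (p * ω + σ) + ρ) * W.card) →
      (∀ i ∈ I, IsTile G p σ ω θ (B i) ∧ B i ⊆ W) → (∀ i ∈ I, ∀ j ∈ I, i ≠ j → Disjoint (B i) (B j)) →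
      L ⊆ W → Disjoint L (I.biUnion B) →
      (∀ I0 ⊆ I, I0.card ≤ c0 → ¬ HasTiles G p σ ω 1 (θ * I0.card + 1) (L ∪ I0.biUnion B)) →
      ((1 - ρ) * W.card ≤ (p * ω + σ) * θ * ((I.card : ℝ) - c)) →
      (∀ U ⊆ W, ((ω : ℝ) / (p * ω + σ) - η) * W.card ≤ U.card → η * (W.card : ℝ)^2 ≤ ((∑ u ∈ U, (nb G u U).card : ℕ) : ℝ)) →
      c + 2 * S (e+1) ≤ c0 → Chain G p σ ω θ L A I B e (S e) c → Chain G p σ ω θ L A I B (e+1) (S (e+1)) (c + 2 * S (e+1)) := by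
    intro e
    by_cases he : e + 1 ≤ p
    · have h1 := hSmono (e+1)
      obtain ⟨n0, hn0⟩ := ne_step p σ ω θ (S e) (S (e+1)) e η ρ hσ he hθ hθ2 hη hρ hρη hρθ (by omega) (by omega)
        (by rw [hSs e he]; exact Nat.mul_le_mul_right _ hΛ2) (by
          rw [hSs e he]
          have h3 : ((S (e+1) : ℕ) : ℝ) * ((2 * 2 ^ ((p * ω + σ) * θ) : ℕ) : ℝ) ≤ (S (e+1) : ℕ) * (ρ * Λ) := mul_le_mul_of_nonneg_left hΛ (by positivity)
          push_cast at h3 ⊢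
          linarith)
      exact ⟨n0, fun _ => hn0⟩
    · exact ⟨0, fun h => absurd h he⟩
  choose nn0 hnn0 using hsteps
  have hHpos : (0:ℝ) < 1 + ((p * ω + σ) * θ * (c0 + 1) : ℕ) := by positivity
  set H : ℝ := 1 + ((p * ω + σ) * θ * (c0 + 1) : ℕ) with hH
  have hε1 : 0 < ρ / (2 * H) := by positivity
  obtain ⟨ε0, hε0, n1, hAT⟩ := AT p σ ω hp hσ θ (by omega) (ρ / (2 * H)) hε1
  obtain ⟨n2, hn2⟩ := exists_nat_ge (2 * (((p * ω + σ) * θ * c0 : ℕ) : ℝ) / ρ)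
  refine ⟨min ε0 ρ, by positivity, (p * ω + σ) + S 0, 1 + n1 + n2 + ∑ e ∈ range p, nn0 e, ?_⟩
  intro V G W A hA hW hdense hn
  have hnR : (0:ℝ) ≤ W.card := by positivity
  obtain ⟨N, hN, hNc⟩ := hAT V G W A hA (fun x hx hxA => (hW x hx hxA).trans (mul_le_mul_of_nonneg_right (by linarith [min_le_left ε0 ρ]) hnR)) (by omega)
  have hWρ : ∀ x ∈ W, x ∉ A → (ms G x W : ℝ) ≤ ((ω : ℝ) / (p * ω + σ) + ρ) * W.card := fun x hx hxA =>
    (hW x hx hxA).trans (mul_le_mul_of_nonneg_right (by linarith [min_le_right ε0 ρ]) hnR)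
  have hcl := hN.card_le
  obtain ⟨B, hB, hBd⟩ := hN
  set g := W.card - (p * ω + σ) * θ * N with hg
  have hgR : (g : ℝ) ≤ ρ / (2 * H) * W.card := by
    have : (g : ℝ) = W.card - ((p * ω + σ) * θ * N : ℕ) := by rw [hg, Nat.cast_sub hcl]
    linarith
  obtain ⟨I, q, F, hFW, hFI, hFc, hFt, hI1, hI2, hLM⟩ := cfgLemma (G := G) (p := p) (σ := σ) (ω := ω) (m := 1) (θ := θ) (c0 := c0) (g := g) (W := W) B
    (fun i => by rw [mul_one]; exact hB i) hBd (by
      intro Q hQ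
      have h1 := hQ.card_le
      have h2 : (p * ω + σ) * Q ≤ (p * ω + σ) * (θ * N) + g := by
        rw [mul_one] at h1
        have : (p * ω + σ) * (θ * N) = (p * ω + σ) * θ * N := by ring
        omega
      have h3 : (p * ω + σ) * Q ≤ (p * ω + σ) * (θ * N + g) := by
        rw [mul_add]
        have : 1 * g ≤ (p * ω + σ) * g := Nat.mul_le_mul_right _ hh1
        omega
      exact Nat.le_of_mul_le_mul_left h3 hh1)
  set L := (W \ I.biUnion B) \ F with hL
  have hIB : I.biUnion B ⊆ W := biUnion_subset.2 fun i _ => (hB i).2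
  have hLW : L ⊆ W := sdiff_subset.trans sdiff_subset
  have hIBc : (I.biUnion B).card = (p * ω + σ) * θ * I.card := by
    rw [card_biUnion (fun i _ j _ => hBd i j), sum_congr rfl (fun i _ => (hB i).1.card), sum_const, smul_eq_mul, mul_comm]
  have hWc : W.card = L.card + F.card + (I.biUnion B).card := by
    have h1 : (W \ I.biUnion B).card = W.card - (I.biUnion B).card := card_sdiff_of_subset hIB
    have h2 : F ⊆ W \ I.biUnion B := subset_sdiff.2 ⟨hFW, hFI⟩
    have h3 : L.card = (W \ I.biUnion B).card - F.card := card_sdiff_of_subset h2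
    have h4 := card_le_card h2
    have h5 := card_le_card hIB
    omega
  by_cases hLC : L.card ≤ (p * ω + σ) + S 0
  · refine ⟨θ * I.card + q, ?_, ?_⟩
    · have h1 : HasTiles G p σ ω 1 (θ * I.card) (I.biUnion B) := HasTiles.biUnion I B
        (fun i _ => IsTile.split (by rw [mul_one]; exact (hB i).1)) (fun i _ j _ => hBd i j)
      exact (h1.add hFt hFI.symm).mono (union_subset hIB hFW)
    · have : (p * ω + σ) * (θ * I.card + q) = (p * ω + σ) * θ * I.card + (p * ω + σ) * 1 * q := by ring
      omega
  · exfalso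
    push Not at hLC
    have hLA : (L ∩ A).card < p * ω + σ := by
      by_contra hge
      push Not at hge
      have h2 : HasTiles G p σ ω 1 1 (L ∩ A) := tile_of_clique _ (fun u hu v hv => hA u (mem_inter.1 hu).2 v (mem_inter.1 hv).2) (by omega)
      have := hLM ∅ (by simp) (by simp)
      simp only [card_empty, mul_zero, zero_add, biUnion_empty, union_empty] at this
      exact this (h2.mono inter_subset_left)
    have hLAc : S 0 ≤ (L \ A).card := by
      have := card_sdiff_add_card_inter L A
      omega
    obtain ⟨Q1, hQ1, hQ1c⟩ := exists_subset_card_eq hLAc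
    have hch0 : Chain G p σ ω θ L A I B 0 (S 0) (0 * K) := by
      refine ⟨∅, by simp, by simp, fun _ => Q1, ?_, ?_, ?_⟩
      · intro l; simpa using ⟨hQ1, hQ1c⟩
      · intro a b hab; exact absurd (Fin.ext (by omega)) hab
      · simpa using HasTiles.zero
    have heps1c : ((p * ω + σ) * θ * (c0 + 1) : ℕ) * (g : ℝ) + g ≤ ρ / 2 * W.card := by
      have h1 : H * g ≤ H * (ρ / (2 * H) * W.card) := mul_le_mul_of_nonneg_left hgR hHpos.le
      have h2 : H * (ρ / (2 * H) * W.card) = ρ / 2 * W.card := by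
        field_simp
      have h3 : H * g = ((p * ω + σ) * θ * (c0 + 1) : ℕ) * (g : ℝ) + g := by rw [hH]; ring
      linarith
    have hbigI : (1 - ρ) * W.card ≤ (p * ω + σ) * θ * ((I.card : ℝ) - c0) := by
      have h1 : ((p * ω + σ) * θ * N : ℕ) ≤ (p * ω + σ) * θ * (I.card + (c0 + 1) * g) := Nat.mul_le_mul_left _ hI1
      have h2 : W.card ≤ (p * ω + σ) * θ * I.card + (p * ω + σ) * θ * (c0 + 1) * g + g := by
        have : (p * ω + σ) * θ * (I.card + (c0 + 1) * g) = (p * ω + σ) * θ * I.card + (p * ω + σ) * θ * (c0 + 1) * g := by ring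
        omega
      have h3 : (W.card : ℝ) ≤ ((p * ω + σ) * θ * I.card + (p * ω + σ) * θ * (c0 + 1) * g + g : ℕ) := by exact_mod_cast h2
      have h4 : (n2 : ℝ) ≤ W.card := by exact_mod_cast (show n2 ≤ W.card by omega)
      have h5 := hn2.trans h4
      rw [div_le_iff₀ hρ] at h5
      push_cast at h3 h5 heps1c
      linarith
    have hNe : Nonempty (Fin N) := by
      by_contra hne
      have h0 : I.card = 0 := by
        rw [card_eq_zero]
        ext i
        exact absurd ⟨i⟩ hne
      rw [h0] at hbigI
      have h1 : (1:ℝ) ≤ W.card := by exact_mod_cast (show 1 ≤ W.card by omega)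
      have h2 : (p * ω + σ : ℝ) * θ * (((0:ℕ):ℝ) - c0) ≤ 0 := by
        have : (0:ℝ) ≤ (p * ω + σ : ℝ) * θ * c0 := by positivity
        push_cast
        linarith
      have h3 : (1/2:ℝ) * 1 ≤ (1 - ρ) * W.card := mul_le_mul (by linarith) h1 (by norm_num) (by linarith)
      linarith
    have hchain : ∀ e, e ≤ p → Chain G p σ ω θ L A I B e (S e) (e * K) := by
      intro e
      induction e with
      | zero => intro _; exact hch0
      | succ e ih =>
        intro he
        have h1 : nn0 e ≤ ∑ e ∈ range p, nn0 e := single_le_sum (f := nn0) (fun _ _ => Nat.zero_le _) (mem_range.2 (by omega))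
        have hKe := hSle (e+1)
        have hle : e * K + 2 * S (e+1) ≤ (e+1) * K := by rw [add_mul, one_mul]; omega
        have hle2 : (e+1) * K ≤ c0 := Nat.mul_le_mul_right _ (by omega)
        refine (hnn0 e (by omega) V (Fin N) G W A L I B (e * K) c0 hNe (by omega) hA hWρ (fun i _ => hB i) (fun i _ j _ => hBd i j) hLW
          (sdiff_disjoint.mono_left sdiff_subset) hLM ?_ hdense (hle.trans hle2) (ih (by omega))).mono_c hle
        refine hbigI.trans (mul_le_mul_of_nonneg_left ?_ (by positivity))
        have : ((e * K : ℕ) : ℝ) ≤ c0 := by exact_mod_cast (show e * K ≤ c0 by omega)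
        linarith
    obtain ⟨I0, hI0, hI0c, Q, hQ, hQc, hQt⟩ := hchain p le_rfl
    have hwle : ω ≤ s0 := by
      have : 1 * ω ≤ p * ω := Nat.mul_le_mul_right _ hp
      omega
    have h1 := tile_of_cells (G := G) (p := p) (σ := σ) (ω := ω) (m := 1) hσ.le Q hQc (fun i => by
      rw [(hQ i).2, mul_one]; exact hwle.trans (hSmono p)) (by rw [add_mul]; omega) (by omega)
    have h2 := hQt.add h1 sdiff_disjoint
    apply hLM I0 hI0 (hI0c.trans (Nat.mul_le_mul_right _ (by omega)))
    exact h2.mono (union_subset sdiff_subset (biUnion_subset.2 fun l _ => (hQ l).1.trans sdiff_subset))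
end OBT

set_option linter.unusedVariables false
set_option linter.unusedSectionVars false
namespace OBT
open scoped Classical
open Finset

lemma extra_cells (e t : ℕ) (ht : 1 ≤ t) (η c : ℝ) (hη : 0 < η) (hc : 0 < c) :
    ∃ ζ0 : ℝ, 0 < ζ0 ∧ ∃ n0 : ℕ, ∀ (V : Type) (G : SimpleGraph V) (W A : Finset V) (n : ℕ) (D : ℝ),
      n0 ≤ n → D ≤ n → c * n ≤ D → W.card ≤ n →
      ((e:ℝ) + 1) * D ≤ W.card + ζ0 * n →
      (∀ u ∈ A, ∀ v ∈ A, u ≠ v → G.Adj u v) → (∀ x ∈ W, x ∉ A → (ms G x W : ℝ) ≤ D) →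
      (∀ U ⊆ W, D - η * n ≤ U.card → η * (n : ℝ)^2 ≤ ((∑ u ∈ U, (nb G u U).card : ℕ) : ℝ)) →
      ∃ Q : Fin (e+2) → Finset V, (∀ i, Q i ⊆ W ∧ (Q i).card = t) ∧ ∀ i j, i ≠ j → Cm G (Q i) (Q j) := by
  obtain ⟨M0, hM0⟩ := exists_nat_ge (16 / η)
  obtain ⟨M, hM8, hM⟩ : ∃ M : ℕ, 8 ≤ M ∧ 16 / (M:ℝ) ≤ η := by
    refine ⟨max M0 8, le_max_right _ _, ?_⟩
    have h1 : (M0 : ℝ) ≤ ((max M0 8 : ℕ) : ℝ) := by exact_mod_cast le_max_left _ _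
    have h2 := hM0.trans h1
    have h3 : (0:ℝ) < ((max M0 8 : ℕ) : ℝ) := by
      have : 0 < max M0 8 := by omega
      exact_mod_cast this
    rw [div_le_iff₀ hη] at h2
    rw [div_le_iff₀ h3]
    linarith
  set s := M * t with hs
  have hs8 : 8 * t ≤ s := Nat.mul_le_mul_right _ hM8
  set ζ0 : ℝ := min (η / 40) (c / 4) with hζ0
  have hzetapos : 0 < ζ0 := by positivity
  have hζ1 : ζ0 ≤ η / 40 := min_le_left _ _
  have hζ2 : ζ0 ≤ c / 4 := min_le_right _ _
  obtain ⟨n1, hk⟩ := kcells e s (by omega) (c/2) (by positivity)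
  obtain ⟨n2, hpair⟩ := pair e s t ht η hη
  obtain ⟨n3, hn3⟩ := exists_nat_ge (((e+2) * t + 2 ^ ((e+1) * s) * t : ℕ) / ζ0)
  refine ⟨ζ0, hzetapos, n1 + n2 + n3, ?_⟩
  intro V G W A n D hn hDn hcD hWn hWD hA hW hdense
  have hnR : (0:ℝ) ≤ n := by positivity
  have hn3' : (((e+2) * t + 2 ^ ((e+1) * s) * t : ℕ) : ℝ) ≤ ζ0 * n := by
    have h1 : (n3 : ℝ) ≤ n := by exact_mod_cast (show n3 ≤ n by omega)
    have h2 := hn3.trans h1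
    rw [div_le_iff₀ hzetapos] at h2
    linarith
  by_cases hWA : (e+2) * t ≤ (W ∩ A).card
  · obtain ⟨Q, hQ1, hQ2⟩ := cells_of_clique (G := G) (W ∩ A) (fun u hu v hv => hA u (mem_inter.1 hu).2 v (mem_inter.1 hv).2) hWA
    exact ⟨Q, fun i => ⟨(hQ1 i).1.trans inter_subset_left, (hQ1 i).2⟩, hQ2⟩
  push Not at hWA
  have hWc : (W.card : ℝ) ≤ (W \ A).card + ζ0 * n := by
    have h1 : (W \ A).card + (W ∩ A).card = W.card := card_sdiff_add_card_inter W A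
    have h2 : W.card ≤ (W \ A).card + ((e+2) * t + 2 ^ ((e+1) * s) * t) := by omega
    have h3 : (W.card : ℝ) ≤ (W \ A).card + ((e+2) * t + 2 ^ ((e+1) * s) * t : ℕ) := by exact_mod_cast h2
    linarith
  have hD0 : 0 ≤ D := le_trans (by positivity) hcD
  have hζn : ζ0 * n ≤ c / 4 * n := mul_le_mul_of_nonneg_right hζ2 hnR
  have hmain : (e:ℝ) * D + c / 2 * n ≤ (W \ A).card := by linarith
  obtain ⟨Q0, C, hC, hCc, hQ0, hQ0c, hCQ⟩ := hk V G (W \ A) (W \ A) A n D (by omega) hDn hD0 subset_rfl hA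
    (fun x hx hxA => le_trans (by exact_mod_cast ms_mono sdiff_subset) (hW x (mem_sdiff.1 hx).1 hxA)) (fun he => by linarith) hmain
  set Q : Fin (e+1) → Finset V := Fin.cons C Q0 with hQ
  have hQc : ∀ i j, i ≠ j → Cm G (Q i) (Q j) := cons_cells C Q0 hQ0c hCQ
  have hQs : ∀ i, Q i ⊆ W \ A ∧ (Q i).card = s := by
    intro i
    refine Fin.cases ?_ (fun i => ?_) i
    · exact ⟨hC, hCc⟩
    · exact hQ0 i
  set E := W.filter (fun v => ∀ l, t ≤ (nb G v (Q l)).card) with hE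
  by_cases hEc : 2 ^ ((e+1) * s) * t ≤ E.card
  · obtain ⟨C', hC', hC'c, Q', hQ'⟩ := step (G := G) (μ := t) Q (fun i => (hQs i).2) ht E (fun v hv => (mem_filter.1 hv).2) hEc
    obtain ⟨R, hR1, hR2⟩ := Cells.cons (G := G) (S := W) (t := t) (hC'.trans (filter_subset _ _)) hC'c.ge
      (fun i j hij => (hQc i j hij).mono (hQ' i).1 (hQ' j).1) (fun i => (hQ' i).1.trans ((hQs i).1.trans sdiff_subset)) (fun i => (hQ' i).2.1)
      (fun i => (hQ' i).2.2)
    exact ⟨R, hR2, hR1⟩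
  push Not at hEc
  have hEn : (E.card : ℝ) ≤ ζ0 * n := by
    have : (E.card : ℝ) ≤ ((e+2) * t + 2 ^ ((e+1) * s) * t : ℕ) := by exact_mod_cast (show E.card ≤ (e+2) * t + 2 ^ ((e+1) * s) * t by omega)
    linarith
  set f : V → ℕ := fun v => ∑ l, ms G v (Q l) with hf
  have hsR : (0:ℝ) < s := by exact_mod_cast (show 0 < s by omega)
  have hfsum : ((∑ v ∈ W, f v : ℕ) : ℝ) ≤ ((e:ℝ)+1) * (s * D) := by
    have h1 : ∑ v ∈ W, f v = ∑ l, ∑ y ∈ Q l, ms G y W := by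
      simp only [hf]
      rw [sum_comm]
      exact sum_congr rfl fun l _ => sum_ms_comm _ _ _
    rw [h1]
    push_cast
    calc ∑ l, ∑ y ∈ Q l, (ms G y W : ℝ) ≤ ∑ l : Fin (e+1), ∑ y ∈ Q l, D := by
          refine sum_le_sum fun l _ => sum_le_sum fun y hy => ?_
          have := mem_sdiff.1 ((hQs l).1 hy)
          exact hW y this.1 this.2
      _ = ((e:ℝ)+1) * (s * D) := by
          simp only [sum_const, (hQs _).2, nsmul_eq_mul, card_univ, Fintype.card_fin]
          push_cast
          ring
  set F := (W \ E).filter (fun v => 9 * s < 8 * f v) with hF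
  have hlow : ∀ v ∈ W \ E, ∃ l, s < ms G v (Q l) + t := by
    intro v hv
    rw [mem_sdiff] at hv
    by_contra hcon
    push Not at hcon
    apply hv.2
    rw [hE, mem_filter]
    refine ⟨hv.1, fun l => ?_⟩
    have h1 := nb_add_ms G v (Q l)
    rw [(hQs l).2] at h1
    have := hcon l
    omega
  have hlow' : ∀ v ∈ W \ E, s ≤ f v + t := by
    intro v hv
    obtain ⟨l, hl⟩ := hlow v hv
    have : ms G v (Q l) ≤ f v := single_le_sum (f := fun l => ms G v (Q l)) (fun _ _ => Nat.zero_le _) (mem_univ l)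
    omega
  have hcount : 8 * (s * (W \ E).card) + s * F.card ≤ 8 * ∑ v ∈ W, f v + 8 * (t * (W \ E).card) := by
    have h1 : 8 * (s * (W \ E).card) + s * F.card = ∑ v ∈ W \ E, (8 * s + if 9 * s < 8 * f v then s else 0) := by
      rw [sum_add_distrib, sum_const, smul_eq_mul, ← sum_filter, sum_const, smul_eq_mul]
      ring
    have h2 : 8 * ∑ v ∈ W \ E, f v + 8 * (t * (W \ E).card) = ∑ v ∈ W \ E, (8 * f v + 8 * t) := by
      rw [sum_add_distrib, sum_const, smul_eq_mul, mul_sum]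
      ring
    have h3 : ∑ v ∈ W \ E, f v ≤ ∑ v ∈ W, f v := sum_le_sum_of_subset sdiff_subset
    have h4 : ∑ v ∈ W \ E, (8 * s + if 9 * s < 8 * f v then s else 0) ≤ ∑ v ∈ W \ E, (8 * f v + 8 * t) := by
      refine sum_le_sum fun v hv => ?_
      have := hlow' v hv
      split_ifs <;> omega
    omega
  have hMt : (t : ℝ) * 16 ≤ η * s := by
    have hMR : (0:ℝ) < M := by exact_mod_cast (show 0 < M by omega)
    rw [div_le_iff₀ hMR] at hM
    have : (t:ℝ) * 16 ≤ t * (η * M) := mul_le_mul_of_nonneg_left hM (by positivity)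
    rw [hs]; push_cast
    linarith
  have hWE : (W.card : ℝ) ≤ (W \ E).card + E.card := by
    exact_mod_cast card_le_card_sdiff_add_card (s := W) (t := E)
  have hWEn : ((W \ E).card : ℝ) ≤ n := by exact_mod_cast (card_le_card sdiff_subset).trans hWn
  have hFc : (F.card : ℝ) ≤ 16 * ζ0 * n + η / 2 * n := by
    have h1 : 8 * ((s:ℝ) * (W \ E).card) + s * F.card ≤ 8 * ((∑ v ∈ W, f v : ℕ) : ℝ) + 8 * (t * (W \ E).card) := by exact_mod_cast hcount
    have h2 : (t:ℝ) * 16 * (W \ E).card ≤ η * s * n := mul_le_mul hMt hWEn (by positivity) (by positivity)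
    have h3 : (s:ℝ) * (((e:ℝ)+1) * D) ≤ s * (W.card + ζ0 * n) := mul_le_mul_of_nonneg_left hWD hsR.le
    have h4 : (s:ℝ) * W.card ≤ s * ((W \ E).card + ζ0 * n) := mul_le_mul_of_nonneg_left (by linarith) hsR.le
    have h5 : (s:ℝ) * F.card ≤ s * (16 * ζ0 * n + η / 2 * n) := by linarith
    exact le_of_mul_le_mul_left h5 hsR
  -- classes
  set U : Fin (e+1) → Finset V := fun l => ((W \ E) \ F).filter (fun v => s < ms G v (Q l) + t) with hU
  have hcov : (W \ E) \ F ⊆ univ.biUnion U := by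
    intro v hv
    obtain ⟨l, hl⟩ := hlow v (mem_sdiff.1 hv).1
    exact mem_biUnion.2 ⟨l, mem_univ _, mem_filter.2 ⟨hv, hl⟩⟩
  have hex : ∃ l, D - η * n ≤ (U l).card := by
    by_contra hcon
    push Not at hcon
    have h1 : (((W \ E) \ F).card : ℝ) ≤ ∑ l, ((U l).card : ℝ) := by
      exact_mod_cast (card_le_card hcov).trans card_biUnion_le
    have h2 : ∑ l, ((U l).card : ℝ) ≤ ∑ l : Fin (e+1), (D - η * n) := sum_le_sum fun l _ => (hcon l).le
    rw [sum_const, card_univ, Fintype.card_fin, nsmul_eq_mul] at h2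
    push_cast at h2
    have h3 : ((W \ E).card : ℝ) ≤ ((W \ E) \ F).card + F.card := by
      exact_mod_cast card_le_card_sdiff_add_card (s := W \ E) (t := F)
    have h4 : 0 ≤ (e:ℝ) * (η * n) := by positivity
    have h5 : ζ0 * n ≤ η / 40 * n := mul_le_mul_of_nonneg_right hζ1 hnR
    have h6 : n1 + n2 + n3 ≤ n := hn
    have h7 : (0:ℝ) < ζ0 * n := by
      have : (1:ℝ) ≤ ((e+2) * t + 2 ^ ((e+1) * s) * t : ℕ) := by
        exact_mod_cast (show 1 ≤ (e+2) * t + 2 ^ ((e+1) * s) * t by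
          have : 1 * t ≤ (e+2) * t := Nat.mul_le_mul_right _ (by omega)
          omega)
      linarith
    linarith
  obtain ⟨l, hl⟩ := hex
  have hUW : U l ⊆ W := (filter_subset _ _).trans (sdiff_subset.trans sdiff_subset)
  obtain ⟨P, hP, P', hP', hPc, hP'c, hPP, Q', hQ'⟩ := hpair V G (U l) n (fun i => Q (l.succAbove i)) (by omega)
    ((card_le_card hUW).trans hWn) (hdense _ hUW hl) (fun i => (hQs _).2) (by
      intro v hv i
      rw [hU, mem_filter] at hv
      have h1 := hv.2
      have h2 : ¬ (9 * s < 8 * f v) := fun h => (mem_sdiff.1 hv.1).2 (mem_filter.2 ⟨(mem_sdiff.1 hv.1).1, h⟩)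
      have h3 : ms G v (Q l) + ms G v (Q (l.succAbove i)) ≤ f v := by
        rw [hf]
        simp only
        rw [Fin.sum_univ_succAbove _ l]
        have := single_le_sum (f := fun i => ms G v (Q (l.succAbove i))) (fun _ _ => Nat.zero_le _) (mem_univ i)
        omega
      have h4 := nb_add_ms G v (Q (l.succAbove i))
      rw [(hQs _).2] at h4
      omega)
  obtain ⟨R1, hR1, hR2⟩ := Cells.cons (G := G) (S := W) (t := t) (C := P') (Q := Q') (hP'.trans hUW) hP'c.ge
      (fun i j hij => (hQc _ _ (fun h => hij (Fin.succAbove_right_injective h))).mono (hQ' i).1 (hQ' j).1)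
      (fun i => (hQ' i).1.trans ((hQs _).1.trans sdiff_subset)) (fun i => by have := (hQ' i).2.1; omega)
      (fun i => (hQ' i).2.2.2)
  obtain ⟨Q'', hQ''⟩ := trim_cells (t := t) Q' (fun i => by have := (hQ' i).2.1; omega)
  refine ⟨(Fin.cons P (Fin.cons P' Q'' : Fin (e+1) → Finset V) : Fin (e+2) → Finset V), ?_, ?_⟩
  · intro i
    refine Fin.cases ?_ (fun i => ?_) i
    · simp only [Fin.cons_zero]
      exact ⟨hP.trans hUW, hPc⟩
    · refine Fin.cases ?_ (fun i => ?_) i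
      · simp only [Fin.cons_succ, Fin.cons_zero]
        exact ⟨hP'.trans hUW, hP'c⟩
      · simp only [Fin.cons_succ]
        exact ⟨(hQ'' i).1.trans ((hQ' i).1.trans ((hQs _).1.trans sdiff_subset)), (hQ'' i).2⟩
  · apply cons_cells
    · apply cons_cells
      · intro a b hab
        exact (hQc _ _ (fun h => hab (Fin.succAbove_right_injective h))).mono ((hQ'' a).1.trans (hQ' a).1) ((hQ'' b).1.trans (hQ' b).1)
      · exact fun i => (hQ' i).2.2.2.mono subset_rfl (hQ'' i).1
    · intro i
      refine Fin.cases ?_ (fun i => ?_) i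
      · simp only [Fin.cons_zero]
        exact hPP
      · simp only [Fin.cons_succ]
        exact (hQ' i).2.2.1.mono subset_rfl (hQ'' i).1
end OBT

set_option linter.unusedVariables false
set_option linter.unusedSectionVars false
namespace OBT
open scoped Classical
open Finset

/-- greedy choice of pairwise disjoint sets with reserved cores -/
lemma greedy {V : Type*} {J : Type*} [Fintype J] (X : J → Finset V) (F : J → Finset V → Prop) (b : ℕ)
    (hX : ∀ j, (X j).card ≤ b) (hXd : ∀ i j, i ≠ j → Disjoint (X i) (X j))
    (hav : ∀ j Z, Z.card ≤ b * Fintype.card J → Disjoint Z (X j) → (∀ i, i ≠ j → X i ⊆ Z) →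
      ∃ T, F j T ∧ X j ⊆ T ∧ T.card ≤ b ∧ Disjoint T Z) :
    ∃ T : J → Finset V, (∀ j, F j (T j)) ∧ ∀ i j, i ≠ j → Disjoint (T i) (T j) := by
  suffices h : ∀ I : Finset J, ∃ T : J → Finset V, (∀ j ∈ I, F j (T j)) ∧
      (∀ j, X j ⊆ T j ∧ (T j).card ≤ b) ∧ (∀ j, j ∉ I → T j = X j) ∧
      ∀ i j, i ≠ j → Disjoint (T i) (T j) by
    obtain ⟨T, h1, h2, h3, h4⟩ := h univ
    exact ⟨T, fun j => h1 j (mem_univ _), h4⟩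
  intro I
  induction I using Finset.induction_on with
  | empty => exact ⟨X, by simp, fun j => ⟨subset_rfl, hX j⟩, fun _ _ => rfl, hXd⟩
  | insert a I ha ih =>
    obtain ⟨T, h1, h2, h3, h4⟩ := ih
    obtain ⟨R, r1, r2, r3, r4⟩ := hav a ((univ.erase a).biUnion T) (by
        refine (card_biUnion_le_card_mul _ _ b (fun i _ => (h2 i).2)).trans ?_
        rw [mul_comm]
        exact Nat.mul_le_mul_left _ (card_le_univ _)) (by
        rw [← h3 a ha, disjoint_biUnion_left]
        intro i hi
        exact h4 _ _ (ne_of_mem_erase hi)) (by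
        intro i hi
        exact (h2 i).1.trans (subset_biUnion_of_mem T (mem_erase.2 ⟨hi, mem_univ _⟩)))
    refine ⟨Function.update T a R, ?_, ?_, ?_, ?_⟩
    · intro j hj
      by_cases hja : j = a
      · subst hja; simpa using r1
      · rw [Function.update_of_ne hja]; exact h1 j (mem_of_mem_insert_of_ne hj hja)
    · intro j
      by_cases hja : j = a
      · subst hja; simpa using ⟨r2, r3⟩
      · rw [Function.update_of_ne hja]; exact h2 j
    · intro j hj
      rw [mem_insert, not_or] at hj
      rw [Function.update_of_ne hj.1]; exact h3 j hj.2
    · have key : ∀ j, j ≠ a → Disjoint R (T j) := fun j hj =>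
        r4.mono_right (subset_biUnion_of_mem T (mem_erase.2 ⟨hj, mem_univ _⟩))
      intro i j hij
      by_cases hia : i = a
      · subst hia
        rw [Function.update_self, Function.update_of_ne hij.symm]
        exact key j hij.symm
      · rw [Function.update_of_ne hia]
        by_cases hja : j = a
        · subst hja
          rw [Function.update_self]
          exact (key i hia).symm
        · rw [Function.update_of_ne hja]; exact h4 i j hij

lemma IsTile.addPart {V : Type*} {G : SimpleGraph V} {a σ ω t : ℕ} {K R : Finset V} (hK : IsTile G a σ ω t K)
    (hR : R.card = ω * t) (hKR : Cm G K R) : IsTile G (a+1) σ ω t (K ∪ R) := by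
  obtain ⟨P, h1, h2, rfl⟩ := hK
  have hsub : ∀ i, P i ⊆ univ.biUnion P := fun i => subset_biUnion_of_mem P (mem_univ i)
  have := IsTile.of_fintype (G := G) (p := a+1) (σ := σ) (ω := ω) (t := t) (Γ := Option (Fin (a+1)))
    (by simp) (some 0) (fun o => o.elim R P) (by simpa [sz] using h1 0) (by
      rintro (_ | i) hi
      · simpa using hR
      · have : i ≠ 0 := fun h => hi (by rw [h])
        simpa [sz, this] using h1 i) (by
      rintro (_ | i) (_ | j) hij
      · exact absurd rfl hij
      · exact (hKR.mono (hsub j) subset_rfl).symm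
      · exact (hKR.mono (hsub i) subset_rfl)
      · exact h2 i j (fun h => hij (by rw [h])))
  convert this using 1
  ext x
  simp only [mem_union, mem_biUnion, mem_univ, true_and]
  constructor
  · rintro (⟨i, hi⟩ | h)
    · exact ⟨some i, hi⟩
    · exact ⟨none, h⟩
  · rintro ⟨_ | i, h⟩
    · exact Or.inr h
    · exact Or.inl ⟨i, h⟩

lemma IsTile.addParts {V : Type*} {ι : Type*} {G : SimpleGraph V} {a σ ω t : ℕ} {K : Finset V} (Ls : Finset ι)
    (R : ι → Finset V) (hK : IsTile G a σ ω t K)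
    (hR : ∀ l ∈ Ls, (R l).card = ω * t) (hKR : ∀ l ∈ Ls, Cm G K (R l))
    (hRR : ∀ l ∈ Ls, ∀ l' ∈ Ls, l ≠ l' → Cm G (R l) (R l')) :
    IsTile G (a+Ls.card) σ ω t (K ∪ Ls.biUnion R) := by
  induction Ls using Finset.induction_on with
  | empty => simpa using hK
  | insert b I hb ih =>
    have h := ih (fun l hl => hR l (mem_insert_of_mem hl)) (fun l hl => hKR l (mem_insert_of_mem hl))
      (fun l hl l' hl' => hRR l (mem_insert_of_mem hl) l' (mem_insert_of_mem hl'))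
    have h2 := h.addPart (hR b (mem_insert_self _ _)) (by
      intro u hu v hv
      rcases mem_union.1 hu with hu | hu
      · exact hKR b (mem_insert_self _ _) u hu v hv
      · obtain ⟨l, hl, hul⟩ := mem_biUnion.1 hu
        exact hRR l (mem_insert_of_mem hl) b (mem_insert_self _ _) (fun h => hb (h ▸ hl)) u hul v hv)
    rw [card_insert_of_notMem hb, biUnion_insert, ← add_assoc]
    convert h2 using 1
    ext x; simp only [mem_union]; tauto

lemma avail {V : Type*} (G : SimpleGraph V) (T B : Finset V) (D : ℕ) (h : ∀ u ∈ T, ms G u B ≤ D) :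
    B.card ≤ (B.filter (fun v => ∀ u ∈ T, G.Adj u v)).card + T.card * D := by
  have h1 : B ⊆ B.filter (fun v => ∀ u ∈ T, G.Adj u v) ∪ T.biUnion (fun u => B.filter (fun v => ¬ G.Adj u v)) := by
    intro v hv
    by_cases hc : ∀ u ∈ T, G.Adj u v
    · exact mem_union_left _ (mem_filter.2 ⟨hv, hc⟩)
    · push Not at hc
      obtain ⟨u, hu, huv⟩ := hc
      exact mem_union_right _ (mem_biUnion.2 ⟨u, hu, mem_filter.2 ⟨hv, huv⟩⟩)
  refine (card_le_card h1).trans ((card_union_le _ _).trans ?_)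
  gcongr
  exact card_biUnion_le_card_mul _ _ _ h

lemma complete {V : Type*} {ι : Type*} {G : SimpleGraph V} {a σ ω D : ℕ} (Ls : Finset ι) (S Y : ι → Finset V)
    (K Z : Finset V) (hK : IsTile G a σ ω 1 K)
    (hY : ∀ l ∈ Ls, (Y l).card ≤ ω) (hYK : ∀ l ∈ Ls, Cm G K (Y l))
    (hYY : ∀ l ∈ Ls, ∀ l' ∈ Ls, l ≠ l' → Cm G (Y l) (Y l'))
    (hSS : ∀ l ∈ Ls, ∀ l' ∈ Ls, l ≠ l' → ∀ v ∈ S l, ms G v (S l') ≤ D)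
    (hN : ∀ l ∈ Ls, (Y l).card < ω → Ls.card * ω * D + Z.card + ω ≤
      ((S l).filter (fun v => (∀ u ∈ K, G.Adj u v) ∧ ∀ l' ∈ Ls, l' ≠ l → ∀ u ∈ Y l', G.Adj u v)).card) :
    ∃ E : ι → Finset V, (∀ l ∈ Ls, E l ⊆ S l ∧ Disjoint (E l) Z ∧ Disjoint (E l) (Y l) ∧
        (Y l).card + (E l).card = ω) ∧
      IsTile G (a + Ls.card) σ ω 1 (K ∪ Ls.biUnion (fun l => Y l ∪ E l)) := by
  suffices h : ∀ M : Finset ι, M ⊆ Ls → ∃ E : ι → Finset V, (∀ l ∈ M, E l ⊆ S l ∧ Disjoint (E l) Z ∧ Disjoint (E l) (Y l) ∧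
        (Y l).card + (E l).card = ω) ∧ (∀ l ∈ M, Cm G K (E l)) ∧
        (∀ l ∈ M, ∀ l' ∈ Ls, l' ≠ l → Cm G (Y l') (E l)) ∧
        (∀ l ∈ M, ∀ l' ∈ M, l ≠ l' → Cm G (E l) (E l')) by
    obtain ⟨E, h1, h2, h3, h4⟩ := h Ls subset_rfl
    refine ⟨E, h1, ?_⟩
    refine IsTile.addParts Ls _ hK ?_ ?_ ?_
    · intro l hl
      rw [card_union_of_disjoint (h1 l hl).2.2.1.symm, (h1 l hl).2.2.2, mul_one]
    · intro l hl u hu v hv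
      rcases mem_union.1 hv with hv | hv
      · exact hYK l hl u hu v hv
      · exact h2 l hl u hu v hv
    · intro l hl l' hl' hne u hu v hv
      rcases mem_union.1 hu with hu | hu <;> rcases mem_union.1 hv with hv | hv
      · exact hYY l hl l' hl' hne u hu v hv
      · exact h3 l' hl' l hl hne u hu v hv
      · exact (h3 l hl l' hl' hne.symm v hv u hu).symm
      · exact h4 l hl l' hl' hne u hu v hv
  intro M
  induction M using Finset.induction_on with
  | empty => intro _; exact ⟨fun _ => ∅, by simp, by simp, by simp, by simp⟩
  | insert b M hb ih =>
    intro hM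
    have hbL : b ∈ Ls := hM (mem_insert_self _ _)
    have hML : M ⊆ Ls := fun l hl => hM (mem_insert_of_mem hl)
    obtain ⟨E, h1, h2, h3, h4⟩ := ih hML
    obtain ⟨R, r1, r2, r3, r4, r5, r6, r7⟩ : ∃ R : Finset V, R ⊆ S b ∧ Disjoint R Z ∧ Disjoint R (Y b) ∧
        (Y b).card + R.card = ω ∧ Cm G K R ∧ (∀ l' ∈ Ls, l' ≠ b → Cm G (Y l') R) ∧
        (∀ l ∈ M, Cm G (E l) R) := by
      rcases (hY b hbL).lt_or_eq with hlt | heq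
      swap
      · exact ⟨∅, by simp, by simp, by simp, by simpa using heq, by simp [Cm], by simp [Cm], by simp [Cm]⟩
      have h5 := hN b hbL hlt
      set N := (S b).filter (fun v => (∀ u ∈ K, G.Adj u v) ∧ ∀ l' ∈ Ls, l' ≠ b → ∀ u ∈ Y l', G.Adj u v) with hNd
      have h6 := avail G (M.biUnion E) N D (by
        intro u hu
        obtain ⟨l, hl, hul⟩ := mem_biUnion.1 hu
        exact (ms_mono (filter_subset _ _)).trans (hSS l (hML hl) b hbL (fun h => hb (h ▸ hl)) u ((h1 l hl).1 hul)))
      set N' := N.filter (fun v => ∀ u ∈ M.biUnion E, G.Adj u v) with hN'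
      have h7 : (M.biUnion E).card ≤ Ls.card * ω := by
        refine (card_biUnion_le_card_mul _ _ ω (fun l hl => by have := (h1 l hl).2.2.2; omega)).trans ?_
        exact Nat.mul_le_mul_right _ (card_le_card hML)
      have h8 := Nat.mul_le_mul_right D h7
      have h9 := card_le_card_sdiff_add_card (s := N') (t := Z)
      have h10 := card_le_card_sdiff_add_card (s := N' \ Z) (t := Y b)
      obtain ⟨R, hR, hRc⟩ := exists_subset_card_eq (s := (N' \ Z) \ Y b) (n := ω - (Y b).card) (by omega)
      have hRN : ∀ v ∈ R, v ∈ N' ∧ v ∉ Z ∧ v ∉ Y b := by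
        intro v hv
        have := hR hv
        simp only [mem_sdiff] at this
        tauto
      refine ⟨R, ?_, ?_, ?_, by omega, ?_, ?_, ?_⟩
      · intro v hv
        exact filter_subset _ _ (filter_subset _ _ (hRN v hv).1)
      · exact disjoint_left.2 fun v hv => (hRN v hv).2.1
      · exact disjoint_left.2 fun v hv => (hRN v hv).2.2
      · intro u hu v hv
        exact (mem_filter.1 (mem_filter.1 (hRN v hv).1).1).2.1 u hu
      · intro l' hl' hne u hu v hv
        exact (mem_filter.1 (mem_filter.1 (hRN v hv).1).1).2.2 l' hl' hne u hu
      · intro l hl u hu v hv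
        exact (mem_filter.1 (hRN v hv).1).2 u (mem_biUnion.2 ⟨l, hl, hu⟩)
    have hne : ∀ l ∈ M, l ≠ b := fun l hl h => hb (h ▸ hl)
    refine ⟨Function.update E b R, ?_, ?_, ?_, ?_⟩
    · intro l hl
      rcases mem_insert.1 hl with rfl | hl
      · rw [Function.update_self]; exact ⟨r1, r2, r3, r4⟩
      · rw [Function.update_of_ne (hne l hl)]; exact h1 l hl
    · intro l hl
      rcases mem_insert.1 hl with rfl | hl
      · rw [Function.update_self]; exact r5
      · rw [Function.update_of_ne (hne l hl)]; exact h2 l hl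
    · intro l hl
      rcases mem_insert.1 hl with rfl | hl
      · rw [Function.update_self]; exact r6
      · rw [Function.update_of_ne (hne l hl)]; exact h3 l hl
    · intro l hl l' hl' hll
      rcases mem_insert.1 hl with h5 | h5 <;> rcases mem_insert.1 hl' with h6 | h6
      · exact absurd (h5.trans h6.symm) hll
      · rw [h5, Function.update_self, Function.update_of_ne (hne l' h6)]; exact (r7 l' h6).symm
      · rw [h6, Function.update_self, Function.update_of_ne (hne l h5)]; exact r7 l h5
      · rw [Function.update_of_ne (hne l' h6), Function.update_of_ne (hne l h5)]; exact h4 l h5 l' h6 hll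

lemma stars {V : Type*} (G : SimpleGraph V) (Y A : Finset V) (ω t Δ : ℕ) (hA : ∀ u ∈ A, ∀ v ∈ A, u ≠ v → G.Adj u v)
    (h1 : ∀ v ∈ Y, v ∉ A → t ≤ (nb G v Y).card) (h2 : ∀ v ∈ Y, (nb G v Y).card ≤ Δ)
    (ht : 2 * ω ≤ t) (hY : 2 * (ω+1) * Δ + (ω+1) * t + Δ + 1 < Y.card) :
    ∃ c : Fin t → V, ∃ L : Fin t → Finset V, (∀ i, c i ∈ Y ∧ L i ⊆ Y ∧ (L i).card = ω ∧ Cm G {c i} (L i)) ∧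
      ∀ i j, i ≠ j → Disjoint (insert (c i) (L i)) (insert (c j) (L j)) := by
  suffices h : ∀ s, s ≤ t → ∃ c : Fin s → V, ∃ L : Fin s → Finset V,
      (∀ i, c i ∈ Y ∧ L i ⊆ Y ∧ (L i).card = ω ∧ Cm G {c i} (L i)) ∧
      ∀ i j, i ≠ j → Disjoint (insert (c i) (L i)) (insert (c j) (L j)) from h t le_rfl
  intro s
  induction s with
  | zero => intro _; exact ⟨fun i => i.elim0, fun i => i.elim0, fun i => i.elim0, fun i => i.elim0⟩
  | succ s ih =>
    intro hs
    obtain ⟨c, L, hc, hd⟩ := ih (by omega)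
    set M := univ.biUnion (fun i : Fin s => insert (c i) (L i)) with hM
    have hMY : M ⊆ Y := by
      rw [hM, biUnion_subset]
      intro i _
      exact insert_subset (hc i).1 (hc i).2.1
    have hMc : M.card ≤ s * (ω + 1) := by
      have := card_biUnion_le_card_mul (univ : Finset (Fin s)) (fun i => insert (c i) (L i)) (ω+1) (fun i _ => by
        refine (card_insert_le _ _).trans ?_
        rw [(hc i).2.2.1])
      simpa using this
    have hex : ∃ v ∈ Y \ M, ω ≤ (nb G v (Y \ M)).card := by
      by_contra hcon
      push Not at hcon
      have hAY : (A ∩ Y).card ≤ Δ + 1 := by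
        rcases (A ∩ Y).eq_empty_or_nonempty with h | ⟨v, hv⟩
        · rw [h]; simp
        · have : (A ∩ Y).erase v ⊆ nb G v Y := by
            intro u hu
            rw [mem_erase, mem_inter] at hu
            exact mem_nb.2 ⟨hu.2.2, hA v (mem_inter.1 hv).1 u hu.2.1 (Ne.symm hu.1)⟩
          have h3 := card_le_card this
          have h4 := h2 v (mem_inter.1 hv).2
          have h5 := card_erase_add_one hv
          omega
      have hsplit : ∀ v, (nb G v Y).card = (nb G v M).card + (nb G v (Y \ M)).card := by
        intro v
        rw [← card_union_of_disjoint]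
        · congr 1
          ext u
          simp only [mem_nb, mem_union, mem_sdiff]
          constructor
          · rintro ⟨a, b⟩
            by_cases u ∈ M <;> tauto
          · rintro (⟨a, b⟩ | ⟨a, b⟩)
            · exact ⟨hMY a, b⟩
            · exact ⟨a.1, b⟩
        · exact disjoint_left.2 fun u hu hu' => (mem_sdiff.1 (nb_sub hu')).2 (nb_sub hu)
      set B := (Y \ M) \ A with hB
      have hb1 : ∀ v ∈ B, t - ω + 1 ≤ (nb G v M).card := by
        intro v hv
        have hv1 := mem_sdiff.1 hv
        have a1 := h1 v (mem_sdiff.1 hv1.1).1 hv1.2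
        have a2 := hcon v hv1.1
        have a3 := hsplit v
        omega
      have hb2 : B.card * (t - ω + 1) ≤ ∑ v ∈ B, (nb G v M).card := by
        rw [← smul_eq_mul]
        exact card_nsmul_le_sum _ _ _ hb1
      have hb3 : ∑ v ∈ B, (nb G v M).card ≤ M.card * Δ := by
        rw [sum_nb_comm, ← smul_eq_mul]
        apply sum_le_card_nsmul
        intro v hv
        refine le_trans (card_le_card ?_) (h2 v (hMY hv))
        intro u hu
        rw [mem_nb] at hu ⊢
        exact ⟨(mem_sdiff.1 (mem_sdiff.1 hu.1).1).1, hu.2⟩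
      have hb4 : B.card * (t - ω + 1) ≤ s * (ω+1) * Δ := hb2.trans (hb3.trans (Nat.mul_le_mul_right _ hMc))
      have hb5 : Y.card ≤ B.card + M.card + (A ∩ Y).card := by
        have a1 := card_le_card_sdiff_add_card (s := Y) (t := M)
        have a2 := card_sdiff_add_card_inter (Y \ M) A
        have a3 : ((Y \ M) ∩ A).card ≤ (A ∩ Y).card := card_le_card (by
          intro u hu; simp only [mem_inter, mem_sdiff] at hu ⊢; tauto)
        have a4 : ((Y \ M) \ A).card = B.card := rfl
        omega
      have hst : s * (ω + 1) ≤ (ω + 1) * t := by rw [mul_comm]; exact Nat.mul_le_mul_left _ (by omega)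
      have hb6 : 2 * (ω+1) * Δ ≤ B.card := by omega
      have hb7 : 2 * (ω+1) * Δ * (t - ω + 1) ≤ s * (ω+1) * Δ := (Nat.mul_le_mul_right _ hb6).trans hb4
      have hb8 : 2 * (ω+1) * Δ * (t - ω + 1) = (ω+1) * Δ * (2 * (t - ω + 1)) := by ring
      have hb9 : s * (ω+1) * Δ = (ω+1) * Δ * s := by ring
      rw [hb8, hb9] at hb7
      have hb10 : Δ = 0 := by
        by_contra hΔ
        have := Nat.le_of_mul_le_mul_left hb7 (by positivity)
        omega
      rw [hb10, mul_zero] at hb4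
      have hb11 : B.card = 0 := by
        rcases Nat.mul_eq_zero.1 (Nat.le_zero.1 hb4) with h | h
        · exact h
        · omega
      omega
    obtain ⟨v, hv, hvc⟩ := hex
    obtain ⟨R, hR, hRc⟩ := exists_subset_card_eq hvc
    have hvM := mem_sdiff.1 hv
    have hRM : ∀ u ∈ R, u ∈ Y ∧ u ∉ M ∧ G.Adj v u := by
      intro u hu
      have := mem_nb.1 (hR hu)
      exact ⟨(mem_sdiff.1 this.1).1, (mem_sdiff.1 this.1).2, this.2⟩
    have hnew : ∀ i, Disjoint (insert (c i) (L i)) (insert v R) := by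
      intro i
      refine disjoint_left.2 fun u hu hu' => ?_
      have : u ∈ M := mem_biUnion.2 ⟨i, mem_univ _, hu⟩
      rcases mem_insert.1 hu' with rfl | h
      · exact hvM.2 this
      · exact (hRM u h).2.1 this
    refine ⟨Fin.cons v c, Fin.cons R L, ?_, ?_⟩
    · intro i
      refine Fin.cases ?_ (fun i => ?_) i
      · simp only [Fin.cons_zero]
        refine ⟨hvM.1, fun u hu => (hRM u hu).1, hRc, ?_⟩
        intro a ha b hb
        rw [mem_singleton.1 ha]
        exact (hRM b hb).2.2
      · simp only [Fin.cons_succ]; exact hc i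
    · intro i j
      refine Fin.cases ?_ (fun i => ?_) i <;> refine Fin.cases ?_ (fun j => ?_) j
      · intro h; exact absurd rfl h
      · intro _; simp only [Fin.cons_zero, Fin.cons_succ]; exact (hnew j).symm
      · intro _; simp only [Fin.cons_zero, Fin.cons_succ]; exact (hnew i)
      · intro h; simp only [Fin.cons_succ]; exact hd i j (fun h' => h (by rw [h']))

/-- Hall-type attaching lemma -/
lemma attach {V : Type*} {G : SimpleGraph V} {a σ ω q d : ℕ} {R Y : Finset V}
    (h : HasTiles G a σ ω 1 q R) (hd : Disjoint R Y) (hq : ω * q ≤ Y.card)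
    (h1 : ∀ u ∈ R, ms G u Y ≤ d) (h2 : ∀ y ∈ Y, ms G y R ≤ d)
    (hY : (1 + ω) * ((a * ω + σ + 1) * d) ≤ Y.card) :
    HasTiles G (a+1) σ ω 1 q (R ∪ Y) := by
  obtain ⟨f, hf, hfd⟩ := h
  set H := a * ω + σ with hH
  let N : Fin q × Fin ω → Finset V := fun x => Y.filter (fun y => ∀ u ∈ f x.1, G.Adj u y)
  have hN : ∀ x, Y.card ≤ (N x).card + H * d := by
    intro x
    have := avail G (f x.1) Y d (fun u hu => h1 u ((hf x.1).2 hu))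
    rw [(hf x.1).1.card, mul_one] at this
    exact this
  have hdd : H * d ≤ (H + 1) * d := Nat.mul_le_mul_right _ (by omega)
  have hdd2 : d ≤ (H + 1) * d := by nlinarith
  have hdd3 : ω * d ≤ ω * ((H + 1) * d) := Nat.mul_le_mul_left _ hdd2
  have hdd4 : (1 + ω) * ((H + 1) * d) = (H+1) * d + ω * ((H + 1) * d) := by ring
  have hall : ∀ s : Finset (Fin q × Fin ω), s.card ≤ (s.biUnion N).card := by
    intro s
    rcases s.eq_empty_or_nonempty with rfl | ⟨x0, hx0⟩
    · simp
    by_cases hs : s.card + H * d ≤ Y.card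
    · have a1 := card_le_card (subset_biUnion_of_mem N hx0)
      have a2 := hN x0
      omega
    · push Not at hs
      have hsd : d < (s.image Prod.fst).card := by
        by_contra hcon
        push Not at hcon
        have : s ⊆ (s.image Prod.fst) ×ˢ (univ : Finset (Fin ω)) := by
          intro x hx
          exact mem_product.2 ⟨mem_image_of_mem _ hx, mem_univ _⟩
        have b1 := card_le_card this
        rw [card_product, card_univ, Fintype.card_fin] at b1
        have b2 := Nat.mul_le_mul_right ω hcon
        have b3 : d * ω = ω * d := mul_comm _ _
        omega
      have hYs : Y ⊆ s.biUnion N := by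
        intro y hy
        by_contra hcon
        have hbad : ∀ i ∈ s.image Prod.fst, ∃ u ∈ f i, ¬ G.Adj y u := by
          intro i hi
          obtain ⟨x, hx, rfl⟩ := mem_image.1 hi
          by_contra hc
          push Not at hc
          exact hcon (mem_biUnion.2 ⟨x, hx, mem_filter.2 ⟨hy, fun u hu => (hc u hu).symm⟩⟩)
        have : Nonempty V := ⟨y⟩
        choose! g hg hg2 using hbad
        have : (s.image Prod.fst).card ≤ ms G y R := by
          unfold ms
          refine card_le_card_of_injOn g ?_ ?_
          · intro i hi
            exact mem_coe.2 (mem_filter.2 ⟨(hf i).2 (hg i hi), hg2 i hi⟩)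
          · intro i hi j hj hij
            by_contra hne
            have e1 := hg i hi
            rw [hij] at e1
            exact disjoint_left.1 (hfd i j hne) e1 (hg j hj)
        have := h2 y hy
        omega
      have c1 := card_le_card hYs
      have c2 : s.card ≤ q * ω := by
        have := card_le_univ s
        simpa using this
      have c3 : q * ω = ω * q := mul_comm _ _
      omega
  obtain ⟨g, hgi, hg⟩ := (Finset.all_card_le_biUnion_card_iff_exists_injective N).1 hall
  have hgN : ∀ i j, g (i, j) ∈ Y ∧ ∀ u ∈ f i, G.Adj u (g (i,j)) := fun i j => mem_filter.1 (hg (i,j))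
  refine ⟨fun i => f i ∪ univ.image (fun j => g (i, j)), ?_, ?_⟩
  · intro i
    refine ⟨(hf i).1.addPart ?_ ?_, ?_⟩
    · rw [card_image_of_injective]
      · simp
      · intro j j' hjj
        have := hgi hjj
        simpa using this
    · intro u hu v hv
      obtain ⟨j, _, rfl⟩ := mem_image.1 hv
      exact (hgN i j).2 u hu
    · apply union_subset_union (hf i).2
      intro v hv
      obtain ⟨j, _, rfl⟩ := mem_image.1 hv
      exact (hgN i j).1
  · intro i j hij
    rw [disjoint_left]
    intro u hu hu'
    rcases mem_union.1 hu with hu | hu <;> rcases mem_union.1 hu' with hu' | hu'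
    · exact disjoint_left.1 (hfd i j hij) hu hu'
    · obtain ⟨b, _, rfl⟩ := mem_image.1 hu'
      exact disjoint_left.1 hd ((hf i).2 hu) (hgN j b).1
    · obtain ⟨b, _, rfl⟩ := mem_image.1 hu
      exact disjoint_left.1 hd ((hf j).2 hu') (hgN i b).1
    · obtain ⟨b, _, rfl⟩ := mem_image.1 hu
      obtain ⟨b', _, hb'⟩ := mem_image.1 hu'
      have := hgi hb'
      simp only [Prod.mk.injEq] at this
      exact hij this.1.symm

lemma attach_all {V : Type*} {ι : Type*} [DecidableEq ι] {G : SimpleGraph V} {a σ ω q d H : ℕ} (L : Finset ι) {R : Finset V} (Y : ι → Finset V)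
    (h : HasTiles G a σ ω 1 q R) (hRY : ∀ l ∈ L, Disjoint R (Y l))
    (hYY : ∀ l ∈ L, ∀ l' ∈ L, l ≠ l' → Disjoint (Y l) (Y l')) (hq : ∀ l ∈ L, ω * q ≤ (Y l).card)
    (h1 : ∀ l ∈ L, ∀ u ∈ R ∪ (L.erase l).biUnion Y, ms G u (Y l) ≤ d)
    (h2 : ∀ l ∈ L, ∀ y ∈ Y l, ms G y (R ∪ (L.erase l).biUnion Y) ≤ d)
    (hH : (a + L.card) * ω + σ + 1 ≤ H)
    (hY : ∀ l ∈ L, (1 + ω) * (H * d) ≤ (Y l).card) :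
    HasTiles G (a+L.card) σ ω 1 q (R ∪ L.biUnion Y) := by
  suffices hs : ∀ M : Finset ι, M ⊆ L → HasTiles G (a+M.card) σ ω 1 q (R ∪ M.biUnion Y) from hs L subset_rfl
  intro M
  induction M using Finset.induction_on with
  | empty => intro _; simpa using h
  | insert b M hb ih =>
    intro hM
    have hbL : b ∈ L := hM (mem_insert_self _ _)
    have hML : M ⊆ L := fun l hl => hM (mem_insert_of_mem hl)
    have hsub : R ∪ M.biUnion Y ⊆ R ∪ (L.erase b).biUnion Y := by
      apply union_subset_union subset_rfl
      apply biUnion_subset_biUnion_of_subset_left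
      intro l hl
      exact mem_erase.2 ⟨fun h => hb (h ▸ hl), hML hl⟩
    have := attach (d := d) (ih hML) (Y := Y b) (by
      rw [disjoint_union_left, disjoint_biUnion_left]
      exact ⟨hRY b hbL, fun l hl => hYY l (hML hl) b hbL (fun h => hb (h ▸ hl))⟩) (hq b hbL)
      (fun u hu => h1 b hbL u (hsub hu)) (fun y hy => (ms_mono hsub).trans (h2 b hbL y hy)) (by
        refine le_trans ?_ (hY b hbL)
        have e1 : M.card ≤ L.card := card_le_card hML
        have e2 : (a + M.card) * ω ≤ (a + L.card) * ω := Nat.mul_le_mul_right _ (by omega)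
        exact Nat.mul_le_mul_left _ (Nat.mul_le_mul_right _ (by omega)))
    rw [card_insert_of_notMem hb, biUnion_insert, ← add_assoc]
    have e3 : R ∪ (Y b ∪ M.biUnion Y) = R ∪ M.biUnion Y ∪ Y b := by
      ext x; simp only [mem_union]; tauto
    rw [e3]; exact this

end OBT

set_option linter.unusedVariables false
set_option linter.unusedSectionVars false
namespace OBT
open scoped Classical
open Finset

/-- the structured partition in the extremal situation -/
structure Prt {V : Type} [Fintype V] (G : SimpleGraph V) (r : ℕ) (S B : Fin r → Finset V) (Ws A : Finset V)
    (β κ ξ : ℝ) : Prop where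
  clique : ∀ u ∈ A, ∀ v ∈ A, u ≠ v → G.Adj u v
  msA : ∀ v, v ∉ A → (ms G v univ : ℝ) ≤ β * Fintype.card V
  hub : ∀ x, x ∉ Ws → (ms G x univ : ℝ) ≤ (β + κ) * Fintype.card V
  SB : ∀ l, S l ⊆ B l
  Bdis : ∀ l l', l ≠ l' → Disjoint (B l) (B l')
  BW : ∀ l, Disjoint (B l) Ws
  Sc : ∀ l, (β - κ) * Fintype.card V ≤ (S l).card
  Bc : ∀ l, ((B l).card : ℝ) ≤ (β + 2 * κ) * Fintype.card V
  Bdeg : ∀ l, ∀ v ∈ B l, ((nb G v (B l)).card : ℝ) ≤ 2 * ξ * Fintype.card V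
  Bms : ∀ l, ∀ v ∈ B l, (ms G v (univ \ S l) : ℝ) ≤ 2 * ξ * Fintype.card V
  Sms : ∀ l l', l ≠ l' → ∀ v ∈ S l, (ms G v (S l') : ℝ) ≤ κ * Fintype.card V
  Wms : ∀ l, ∀ u ∈ Ws, (ms G u (S l) : ℝ) ≤ κ * Fintype.card V
  BS : ∀ l, ((B l \ S l).card : ℝ) ≤ κ * Fintype.card V
  res : ∀ x, x ∉ Ws → (∀ l, x ∉ B l) → ∀ l, ξ * Fintype.card V ≤ (nb G x (S l)).card
  resc : (((univ \ Ws) \ univ.biUnion B).card : ℝ) ≤ κ * Fintype.card V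

lemma ms_split {V : Type} [Fintype V] (G : SimpleGraph V) (v : V) (S : Finset V) :
    ms G v univ = ms G v S + ms G v (univ \ S) := by
  unfold ms
  rw [← card_union_of_disjoint]
  · congr 1
    ext u
    simp only [mem_filter, mem_union, mem_sdiff, mem_univ, true_and]
    tauto
  · exact disjoint_left.2 fun u hu hu' => (mem_sdiff.1 (mem_filter.1 hu').1).2 (mem_filter.1 hu).1

/-- passing from sparse sets to cleaned sets -/
lemma clean (β δ : ℝ) (hδ : 0 < δ) (hδ1 : δ ≤ 1) :
    ∃ ε : ℝ, 0 < ε ∧ ∃ n0 : ℕ, ∀ (V : Type) [Fintype V] (G : SimpleGraph V) (A U : Finset V),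
      n0 ≤ Fintype.card V → (∀ u ∈ A, ∀ v ∈ A, u ≠ v → G.Adj u v) →
      (β - ε) * Fintype.card V ≤ U.card →
      ((∑ u ∈ U, (nb G u U).card : ℕ) : ℝ) ≤ ε * (Fintype.card V : ℝ)^2 →
      ∃ S ⊆ U, Disjoint S A ∧ (β - δ) * Fintype.card V ≤ S.card ∧
        ∀ v ∈ S, ((nb G v S).card : ℝ) ≤ δ * Fintype.card V := by
  obtain ⟨n0, hn0⟩ := exists_nat_ge (4 / δ)
  refine ⟨δ^2 / 16, by positivity, n0 + 1, ?_⟩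
  intro V _ G A U hn hA hU hsum
  set n : ℝ := (Fintype.card V : ℝ) with hnd
  have hnn : (n0 : ℝ) + 1 ≤ n := by rw [hnd]; exact_mod_cast hn
  have hnpos : 0 < n := by
    have : (0:ℝ) ≤ n0 := by positivity
    linarith
  have h4 : 4 ≤ δ * n := by
    rw [div_le_iff₀ hδ] at hn0
    have : (n0:ℝ) * δ ≤ n * δ := by gcongr; linarith
    linarith
  set bad := U.filter (fun v => δ / 4 * n < (nb G v U).card) with hbad
  have hb1 : (bad.card : ℝ) * (δ / 4 * n) ≤ δ^2/16 * n^2 := by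
    refine le_trans ?_ hsum
    push_cast
    rw [← nsmul_eq_mul]
    refine (card_nsmul_le_sum _ _ _ (fun v hv => (mem_filter.1 hv).2.le)).trans ?_
    exact sum_le_sum_of_subset_of_nonneg (filter_subset _ _) (fun _ _ _ => by positivity)
  have hb2 : (bad.card : ℝ) ≤ δ / 4 * n := by
    have h5 : 0 < δ / 4 * n := by positivity
    have h6 : δ^2/16 * n^2 = (δ / 4 * n) * (δ / 4 * n) := by ring
    rw [h6] at hb1
    exact le_of_mul_le_mul_right hb1 h5
  have hA2 : (((U \ bad) ∩ A).card : ℝ) ≤ δ / 4 * n + 1 := by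
    rcases ((U \ bad) ∩ A).eq_empty_or_nonempty with h | ⟨v, hv⟩
    · rw [h]; simp; positivity
    · have hv1 := mem_inter.1 hv
      have hv2 := mem_sdiff.1 hv1.1
      have h1 : ((U \ bad) ∩ A).erase v ⊆ nb G v U := by
        intro u hu
        rw [mem_erase, mem_inter, mem_sdiff] at hu
        exact mem_nb.2 ⟨hu.2.1.1, hA v hv1.2 u hu.2.2 (Ne.symm hu.1)⟩
      have h2 := card_le_card h1
      have h3 := card_erase_add_one hv
      have h5 : ((nb G v U).card : ℝ) ≤ δ / 4 * n := by
        by_contra hc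
        exact hv2.2 (mem_filter.2 ⟨hv2.1, not_le.1 hc⟩)
      have h6 : (((U \ bad) ∩ A).card : ℝ) ≤ (nb G v U).card + 1 := by
        exact_mod_cast (show ((U \ bad) ∩ A).card ≤ (nb G v U).card + 1 by omega)
      linarith
  refine ⟨(U \ bad) \ A, sdiff_subset.trans sdiff_subset, sdiff_disjoint, ?_, ?_⟩
  · have e1 := card_le_card_sdiff_add_card (s := U) (t := bad)
    have e2 := card_sdiff_add_card_inter (U \ bad) A
    have e3 : (U.card : ℝ) ≤ ((U \ bad) \ A).card + ((U \ bad) ∩ A).card + bad.card := by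
      exact_mod_cast (show U.card ≤ ((U \ bad) \ A).card + ((U \ bad) ∩ A).card + bad.card by omega)
    have e4 : δ^2/16 * n ≤ δ / 16 * n := by
      have : δ^2 ≤ δ := by nlinarith
      gcongr
    have e5 : (β - δ^2/16) * n = β * n - δ^2/16 * n := by ring
    have e6 : (β - δ) * n = β * n - δ * n := by ring
    linarith
  · intro v hv
    have hv2 := mem_sdiff.1 (mem_sdiff.1 hv).1
    have h5 : ((nb G v U).card : ℝ) ≤ δ / 4 * n := by
      by_contra hc
      exact hv2.2 (mem_filter.2 ⟨hv2.1, not_le.1 hc⟩)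
    have h6 : ((nb G v ((U \ bad) \ A)).card : ℝ) ≤ (nb G v U).card := by
      exact_mod_cast card_le_card (filter_subset_filter _ (sdiff_subset.trans sdiff_subset))
    have : δ / 4 * n ≤ δ * n := by
      have : 0 < δ * n := by positivity
      linarith
    linarith

lemma mkPrt (r : ℕ) (β κ ξ : ℝ) (hκ : 0 < κ) (hκξ : κ ≤ ξ) (hξβ : 8 * ξ ≤ β) (hβ : β ≤ 1) :
    ∃ ε : ℝ, 0 < ε ∧ ∃ n0 : ℕ, ∀ (V : Type) [Fintype V] (G : SimpleGraph V) (A : Finset V) (U : Fin r → Finset V),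
      n0 ≤ Fintype.card V → (∀ u ∈ A, ∀ v ∈ A, u ≠ v → G.Adj u v) →
      (∀ v, v ∉ A → (ms G v univ : ℝ) ≤ β * Fintype.card V) →
      (∀ u v, u ≠ v → ¬ G.Adj u v → (ms G u univ : ℝ) + ms G v univ ≤ 2 * β * Fintype.card V) →
      (∀ i j, i ≠ j → Disjoint (U i) (U j)) →
      (∀ i, (β - ε) * Fintype.card V ≤ (U i).card) →
      (∀ i, ((∑ u ∈ U i, (nb G u (U i)).card : ℕ) : ℝ) ≤ ε * (Fintype.card V : ℝ)^2) →
      ∃ S B Ws, Prt G r S B Ws A β κ ξ := by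
  obtain ⟨δ, hδ, hδκ, hδr⟩ : ∃ δ : ℝ, 0 < δ ∧ 4 * δ ≤ κ ∧ 2 * δ * (r + 1) ≤ κ^2 := by
    refine ⟨min (κ/4) (κ^2 / (2 * (r+1))), by positivity, ?_, ?_⟩
    · have := min_le_left (κ/4) (κ^2 / (2 * (r+1))); linarith
    · have := min_le_right (κ/4) (κ^2 / (2 * ((r:ℝ)+1)))
      rw [le_div_iff₀ (by positivity)] at this
      linarith
  obtain ⟨ε, hε, n0, hcl⟩ := clean β δ hδ (by linarith)
  refine ⟨ε, hε, n0 + 1, ?_⟩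
  intro V _ G A U hn hA hmsA hOre hUd hUc hUs
  choose S hSU hSA hSc hSd using fun i => hcl V G A (U i) (by omega) hA (hUc i) (hUs i)
  set n : ℝ := (Fintype.card V : ℝ) with hnd
  have hn1 : (1:ℝ) ≤ n := by
    have : 1 ≤ Fintype.card V := by omega
    rw [hnd]; exact_mod_cast this
  have hnpos : 0 < n := by linarith
  have hδn : 0 < δ * n := by positivity
  have hδκn : 4 * (δ * n) ≤ κ * n := by nlinarith
  have hκξn : κ * n ≤ ξ * n := by gcongr
  have hξβn : 8 * (ξ * n) ≤ β * n := by nlinarith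
  have eSc : ∀ l, β * n - δ * n ≤ (S l).card := fun l => by have := hSc l; linarith
  have hSdis : ∀ i j, i ≠ j → Disjoint (S i) (S j) := fun i j h => (hUd i j h).mono (hSU i) (hSU j)
  have hms1 : ∀ l, ∀ v ∈ S l, (ms G v univ : ℝ) ≤ β * n := fun l v hv => hmsA v (disjoint_left.1 (hSA l) hv)
  have hms2 : ∀ l, ∀ v ∈ S l, β * n - 2 * (δ * n) ≤ (ms G v (S l) : ℝ) := by
    intro l v hv
    have h1 := nb_add_ms G v (S l)
    have h2 : ((nb G v (S l)).card : ℝ) + ms G v (S l) = (S l).card := by exact_mod_cast h1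
    have h3 := hSd l v hv
    have h4 := eSc l
    linarith
  have hspl : ∀ v l, (ms G v univ : ℝ) = ms G v (S l) + ms G v (univ \ S l) := fun v l => by
    exact_mod_cast ms_split G v (S l)
  have hms3 : ∀ l, ∀ v ∈ S l, (ms G v (univ \ S l) : ℝ) ≤ 2 * (δ * n) := by
    intro l v hv
    have h1 := hspl v l
    have h2 := hms1 l v hv
    have h3 := hms2 l v hv
    linarith
  have hSup : ∀ l, ((S l).card : ℝ) ≤ β * n + δ * n := by
    intro l
    rcases (S l).eq_empty_or_nonempty with h | ⟨v, hv⟩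
    · rw [h]; simp; linarith [mul_pos hκ hnpos]
    · have h1 := nb_add_ms G v (S l)
      have h2 : ((nb G v (S l)).card : ℝ) + ms G v (S l) = (S l).card := by exact_mod_cast h1
      have h3 := hSd l v hv
      have h4 := hms1 l v hv
      have h5 : (ms G v (S l) : ℝ) ≤ ms G v univ := by exact_mod_cast ms_mono (subset_univ _)
      linarith
  have hmeet : ∀ l u, u ∉ S l → 0 < ms G u (S l) → (ms G u univ : ℝ) ≤ β * n + 2 * (δ * n) := by
    intro l u hu hpos
    obtain ⟨v, hv⟩ := card_pos.1 hpos
    have hv1 := mem_filter.1 hv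
    have h1 := hOre u v (fun h => hu (h ▸ hv1.1)) hv1.2
    have h2 := hms2 l v hv1.1
    have h5 : (ms G v (S l) : ℝ) ≤ ms G v univ := by exact_mod_cast ms_mono (subset_univ _)
    linarith
  set SS := univ.biUnion S with hSS
  have hSSmem : ∀ {l u}, u ∉ SS → u ∉ S l := fun {l u} h h' => h (mem_biUnion.2 ⟨l, mem_univ _, h'⟩)
  set wk : Fin r → Finset V := fun l => (univ \ SS).filter (fun u => κ * n < ms G u (S l)) with hwk
  have hwkc : ∀ l, ((r:ℝ) + 1) * (wk l).card ≤ κ * n := by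
    intro l
    have h1 : ((wk l).card : ℝ) * (κ * n) ≤ ((∑ u ∈ wk l, ms G u (S l) : ℕ) : ℝ) := by
      push_cast
      rw [← nsmul_eq_mul]
      exact card_nsmul_le_sum _ _ _ (fun u hu => (mem_filter.1 hu).2.le)
    have h2 : ((∑ u ∈ wk l, ms G u (S l) : ℕ) : ℝ) ≤ n * (2 * (δ * n)) := by
      rw [sum_ms_comm]
      push_cast
      have h3 : ∑ v ∈ S l, (ms G v (wk l) : ℝ) ≤ (S l).card • (2 * (δ * n)) := by
        apply sum_le_card_nsmul
        intro v hv
        refine le_trans ?_ (hms3 l v hv)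
        have : wk l ⊆ univ \ S l := fun u hu => mem_sdiff.2 ⟨mem_univ _, hSSmem (mem_sdiff.1 (mem_filter.1 hu).1).2⟩
        exact_mod_cast ms_mono this
      refine h3.trans ?_
      rw [nsmul_eq_mul]
      have : ((S l).card : ℝ) ≤ n := by rw [hnd]; exact_mod_cast card_le_univ _
      gcongr
    have h3 : ((wk l).card : ℝ) * κ ≤ 2 * δ * n := by
      have : ((wk l).card : ℝ) * κ * n ≤ 2 * δ * n * n := by linarith
      exact le_of_mul_le_mul_right this hnpos
    have h4 : (((r:ℝ) + 1) * (wk l).card) * κ ≤ (κ * n) * κ := by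
      have := mul_le_mul_of_nonneg_left h3 (show (0:ℝ) ≤ (r:ℝ)+1 by positivity)
      have h5 := mul_le_mul_of_nonneg_right hδr hnpos.le
      nlinarith
    exact le_of_mul_le_mul_right h4 hκ
  set weak := univ.biUnion wk with hweak
  have hweakc : (weak.card : ℝ) ≤ κ * n := by
    have h1 : (weak.card : ℝ) ≤ ∑ l : Fin r, ((wk l).card : ℝ) := by exact_mod_cast card_biUnion_le
    have h2 : ((r:ℝ)+1) * weak.card ≤ r * (κ * n) := by
      calc ((r:ℝ)+1) * weak.card ≤ ((r:ℝ)+1) * ∑ l : Fin r, ((wk l).card : ℝ) := by gcongr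
        _ = ∑ l : Fin r, ((r:ℝ)+1) * ((wk l).card : ℝ) := by rw [mul_sum]
        _ ≤ ∑ l : Fin r, κ * n := sum_le_sum fun l _ => hwkc l
        _ = r * (κ * n) := by simp
    have h3 : ((r:ℝ)+1) * weak.card ≤ (r+1) * (κ * n) := by
      have : 0 < κ * n := by positivity
      linarith
    exact le_of_mul_le_mul_left h3 (by positivity)
  set home : Fin r → Finset V := fun l => (univ \ SS).filter (fun u => ((nb G u (S l)).card : ℝ) < ξ * n) with hhome
  have hhm : ∀ l, ∀ u ∈ home l, β * n - δ * n - ξ * n ≤ (ms G u (S l) : ℝ) := by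
    intro l u hu
    have h1 := nb_add_ms G u (S l)
    have h2 : ((nb G u (S l)).card : ℝ) + ms G u (S l) = (S l).card := by exact_mod_cast h1
    have h3 := (mem_filter.1 hu).2
    have h4 := eSc l
    linarith
  have hhS : ∀ l l', ∀ u ∈ home l, u ∉ S l' := fun l l' u hu => hSSmem (mem_sdiff.1 (mem_filter.1 hu).1).2
  have hκn : 0 < κ * n := by positivity
  have hhw : ∀ l, home l ⊆ weak := by
    intro l u hu
    refine mem_biUnion.2 ⟨l, mem_univ _, mem_filter.2 ⟨(mem_filter.1 hu).1, ?_⟩⟩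
    have := hhm l u hu
    linarith
  have hhms : ∀ l, ∀ u ∈ home l, (ms G u (univ \ S l) : ℝ) ≤ 2 * (ξ * n) := by
    intro l u hu
    have h1 := hhm l u hu
    have h2 : 0 < ms G u (S l) := by
      have : (0:ℝ) < ms G u (S l) := by linarith
      exact_mod_cast this
    have h3 := hmeet l u (hhS l l u hu) h2
    have h4 := hspl u l
    linarith
  have hhd : ∀ l l', l ≠ l' → Disjoint (home l) (home l') := by
    intro l l' hne
    refine disjoint_left.2 fun u hu hu' => ?_
    have h1 := hhm l' u hu'
    have h2 := hhms l u hu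
    have h3 : (ms G u (S l') : ℝ) ≤ ms G u (univ \ S l) := by
      have : S l' ⊆ univ \ S l := fun v hv => mem_sdiff.2 ⟨mem_univ _, fun h => disjoint_left.1 (hSdis l l' hne) h hv⟩
      exact_mod_cast ms_mono this
    linarith
  have hhc : ∀ l, ((home l).card : ℝ) ≤ κ * n := fun l => by
    refine le_trans ?_ hweakc
    exact_mod_cast card_le_card (hhw l)
  have hWsmem : ∀ {u}, u ∈ (univ \ SS) \ weak ↔ u ∉ SS ∧ u ∉ weak := by simp
  have hnbu : ∀ v l, ((nb G v (S l ∪ home l)).card : ℝ) ≤ (nb G v (S l)).card + (home l).card := by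
    intro v l
    have : (nb G v (S l ∪ home l)).card ≤ (nb G v (S l)).card + (home l).card := by
      unfold nb
      rw [filter_union]
      exact (card_union_le _ _).trans (by gcongr; exact filter_subset _ _)
    exact_mod_cast this
  refine ⟨S, fun l => S l ∪ home l, (univ \ SS) \ weak, ?_⟩
  constructor
  · exact hA
  · exact hmsA
  · intro x hx
    rw [hWsmem, not_and_or, not_not, not_not] at hx
    show (ms G x univ : ℝ) ≤ (β + κ) * n
    rcases hx with hx | hx
    · obtain ⟨l, _, hl⟩ := mem_biUnion.1 hx
      have := hms1 l x hl
      linarith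
    · obtain ⟨l, _, hl⟩ := mem_biUnion.1 hx
      have h1 := mem_filter.1 hl
      have h2 : 0 < ms G x (S l) := by
        have : (0:ℝ) < ms G x (S l) := by linarith [h1.2]
        exact_mod_cast this
      have := hmeet l x (hSSmem (mem_sdiff.1 h1.1).2) h2
      linarith
  · exact fun l => subset_union_left
  · intro l l' hne
    rw [disjoint_union_left, disjoint_union_right, disjoint_union_right]
    exact ⟨⟨hSdis l l' hne, disjoint_left.2 fun u hu hu' => hhS l' l u hu' hu⟩,
      disjoint_left.2 fun u hu hu' => hhS l l' u hu hu', hhd l l' hne⟩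
  · intro l
    refine disjoint_left.2 fun u hu hu' => ?_
    rw [hWsmem] at hu'
    rcases mem_union.1 hu with h | h
    · exact hu'.1 (mem_biUnion.2 ⟨l, mem_univ _, h⟩)
    · exact hu'.2 (hhw l h)
  · intro l
    show (β - κ) * n ≤ _
    have := eSc l
    linarith
  · intro l
    show _ ≤ (β + 2 * κ) * n
    have h1 : ((S l ∪ home l).card : ℝ) ≤ (S l).card + (home l).card := by exact_mod_cast card_union_le _ _
    have h2 := hhc l
    have h3 := hSup l
    linarith
  · intro l v hv
    show _ ≤ 2 * ξ * n
    have h1 := hnbu v l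
    have h2 := hhc l
    rcases mem_union.1 hv with h | h
    · have := hSd l v h
      linarith
    · have := (mem_filter.1 h).2
      linarith
  · intro l v hv
    show _ ≤ 2 * ξ * n
    rcases mem_union.1 hv with h | h
    · have := hms3 l v h
      linarith
    · have := hhms l v h
      linarith
  · intro l l' hne v hv
    have h1 := hms3 l v hv
    have h3 : (ms G v (S l') : ℝ) ≤ ms G v (univ \ S l) := by
      have : S l' ⊆ univ \ S l := fun v hv => mem_sdiff.2 ⟨mem_univ _, fun h => disjoint_left.1 (hSdis l l' hne) h hv⟩
      exact_mod_cast ms_mono this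
    show _ ≤ κ * n
    linarith
  · intro l u hu
    rw [hWsmem] at hu
    by_contra hc
    exact hu.2 (mem_biUnion.2 ⟨l, mem_univ _, mem_filter.2 ⟨mem_sdiff.2 ⟨mem_univ _, hu.1⟩, not_le.1 hc⟩⟩)
  · intro l
    refine le_trans ?_ (hhc l)
    have : (S l ∪ home l) \ S l ⊆ home l := by
      intro u hu
      simp only [mem_sdiff, mem_union] at hu
      tauto
    exact_mod_cast card_le_card this
  · intro x hx hxB l
    by_contra hc
    refine hxB l (mem_union_right _ (mem_filter.2 ⟨mem_sdiff.2 ⟨mem_univ _, ?_⟩, not_le.1 hc⟩))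
    intro h
    obtain ⟨l', _, hl'⟩ := mem_biUnion.1 h
    exact hxB l' (mem_union_left _ hl')
  · refine le_trans ?_ hweakc
    have : ((univ \ ((univ \ SS) \ weak)) \ univ.biUnion (fun l => S l ∪ home l)) ⊆ weak := by
      intro u hu
      rw [mem_sdiff, mem_sdiff, hWsmem] at hu
      by_contra hw
      apply hu.1.2
      refine ⟨fun h => ?_, hw⟩
      obtain ⟨l, _, hl⟩ := mem_biUnion.1 h
      exact hu.2 (mem_biUnion.2 ⟨l, mem_univ _, mem_union_left _ hl⟩)
    exact_mod_cast card_le_card this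

end OBT

set_option linter.unusedVariables false
set_option linter.unusedSectionVars false
namespace OBT
open scoped Classical
open Finset

lemma Prt.attach {V : Type} [Fintype V] {G : SimpleGraph V} {r : ℕ} {S B : Fin r → Finset V} {Ws A : Finset V}
    {β κ ξ : ℝ} (P : Prt G r S B Ws A β κ ξ) (hκ : 0 ≤ κ) (hκξ : κ ≤ ξ) {a σ ω q H : ℕ}
    {R : Finset V} (Y : Fin r → Finset V)
    (hR : R ⊆ Ws) (hY : ∀ l, Y l ⊆ B l) (h : HasTiles G a σ ω 1 q R) (hq : ∀ l, ω * q ≤ (Y l).card)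
    (hH : (a + r) * ω + σ + 1 ≤ H)
    (hbig : ∀ l, (1 + ω) * (H * (2 * ξ * Fintype.card V)) ≤ (Y l).card) :
    HasTiles G (a+r) σ ω 1 q (R ∪ univ.biUnion Y) := by
  set n : ℝ := (Fintype.card V : ℝ) with hnd
  have hn : 0 ≤ n := by positivity
  have hξ : 0 ≤ ξ := hκ.trans hκξ
  have := attach_all (G := G) (d := ⌊2 * ξ * n⌋₊) (H := H) univ Y h
    (fun l _ => ((P.BW l).mono (hY l) hR).symm)
    (fun l _ l' _ hne => (P.Bdis l l' hne).mono (hY l) (hY l')) (fun l _ => hq l) (by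
      intro l _ u hu
      apply Nat.le_floor
      rcases mem_union.1 hu with hu | hu
      · have h1 := P.Wms l u (hR hu)
        have h2 := P.BS l
        have h3 : ms G u (Y l) ≤ ms G u (S l) + (B l \ S l).card := by
          have a1 : ms G u (Y l) ≤ ms G u (S l ∪ B l \ S l) := ms_mono (by
            intro v hv
            have := hY l hv
            by_cases v ∈ S l <;> simp_all)
          have a2 := ms_union_le G u (S l) (B l \ S l)
          have a3 := ms_le G u (B l \ S l)
          omega
        have h4 : (ms G u (Y l) : ℝ) ≤ ms G u (S l) + (B l \ S l).card := by exact_mod_cast h3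
        have h5 : κ * n ≤ ξ * n := by gcongr
        linarith
      · obtain ⟨l', hl', hul⟩ := mem_biUnion.1 hu
        have hne := ne_of_mem_erase hl'
        have h1 := P.Bms l' u (hY l' hul)
        have h2 : (ms G u (Y l) : ℝ) ≤ ms G u (univ \ S l') := by
          have : Y l ⊆ univ \ S l' := fun v hv => mem_sdiff.2 ⟨mem_univ _, fun hv' =>
            disjoint_left.1 (P.Bdis l' l hne) (P.SB l' hv') (hY l hv)⟩
          exact_mod_cast ms_mono this
        linarith) (by
      intro l _ y hy
      apply Nat.le_floor
      have h1 := P.Bms l y (hY l hy)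
      have h2 : (ms G y (R ∪ (univ.erase l).biUnion Y) : ℝ) ≤ ms G y (univ \ S l) := by
        have : R ∪ (univ.erase l).biUnion Y ⊆ univ \ S l := by
          intro v hv
          refine mem_sdiff.2 ⟨mem_univ _, fun hv' => ?_⟩
          rcases mem_union.1 hv with hv | hv
          · exact disjoint_left.1 (P.BW l) (P.SB l hv') (hR hv)
          · obtain ⟨l', hl', hul⟩ := mem_biUnion.1 hv
            exact disjoint_left.1 (P.Bdis l' l (ne_of_mem_erase hl')) (hY l' hul) (P.SB l hv')
        exact_mod_cast ms_mono this
      linarith) (by simpa using hH) (by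
      intro l _
      have h1 : ((⌊2 * ξ * n⌋₊ : ℕ) : ℝ) ≤ 2 * ξ * n := Nat.floor_le (by positivity)
      have h2 := hbig l
      have h3 : ((1 + ω) * (H * ((⌊2 * ξ * n⌋₊ : ℕ) : ℝ)) : ℝ) ≤ (1 + ω) * (H * (2 * ξ * n)) := by gcongr
      exact_mod_cast h3.trans h2)
  simpa using this

/-- final step on the cleaned-up remainder -/
lemma Prt.fin {V : Type} [Fintype V] {G : SimpleGraph V} {r : ℕ} {S B : Fin r → Finset V} {Ws A : Finset V}
    {β κ ξ : ℝ} (P : Prt G r S B Ws A β κ ξ) (hκ : 0 ≤ κ) (hκξ : κ ≤ ξ) {a σ ω H h h' c C0 m : ℕ}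
    {R : Finset V} (Y : Fin r → Finset V)
    (hR : R ⊆ Ws) (hY : ∀ l, Y l ⊆ B l) (hω : 1 ≤ ω)
    (hh : h = (a + r) * ω + σ) (hh' : h' = a * ω + σ) (hpos : 0 < h)
    (ht : ∀ q, h' * q + C0 ≤ R.card → HasTiles G a σ ω 1 q R) (h0 : h' = 0 → C0 = 0)
    (hYc : ∀ l, ω * m ≤ h * (Y l).card + c) (hRc : h' * m ≤ h * R.card + c)
    (hH : (a + r) * ω + σ + 1 ≤ H)
    (hbig : ∀ l, (1 + ω) * (H * (2 * ξ * Fintype.card V)) ≤ (Y l).card) :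
    ∃ q, HasTiles G (a+r) σ ω 1 q (R ∪ univ.biUnion Y) ∧ m ≤ h * q + h * (c + C0 + 1) := by
  by_cases hq : m / h ≤ c + C0
  · refine ⟨0, HasTiles.zero, ?_⟩
    have h1 := Nat.div_add_mod m h
    have h2 := Nat.mod_lt m hpos
    have h3 := Nat.mul_le_mul_left h hq
    have h4 : h * (c + C0 + 1) = h * (c + C0) + h := by ring
    omega
  push Not at hq
  obtain ⟨q, hqd⟩ := Nat.exists_eq_add_of_lt hq
  have h1 := Nat.div_add_mod m h
  have h2 := Nat.mod_lt m hpos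
  -- m/h = c + C0 + q + 1
  have hm : h * (c + C0 + (q + 1)) ≤ m := by
    have : c + C0 + (q+1) = m / h := by omega
    rw [this]; omega
  refine ⟨q + 1, ?_, ?_⟩
  · refine P.attach hκ hκξ Y hR hY (ht _ ?_) ?_ hH hbig
    · by_cases hz : h' = 0
      · rw [h0 hz, hz]; simp
      · have a1 : h' * (h * (c + C0 + (q + 1))) ≤ h' * m := Nat.mul_le_mul_left _ hm
        have a2 : h' * (h * (c + C0 + (q + 1))) = h * (h' * (q+1)) + (h' * h) * c + h * (h' * C0) := by ring
        have a3 : 1 * c ≤ (h' * h) * c := Nat.mul_le_mul_right _ (Nat.mul_pos (by omega) hpos)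
        have a4 : h * (1 * C0) ≤ h * (h' * C0) := Nat.mul_le_mul_left _ (Nat.mul_le_mul_right _ (by omega))
        have a5 : h * (h' * (q+1) + C0) ≤ h * R.card := by
          rw [mul_add]
          have : h * (1 * C0) = h * C0 := by ring
          omega
        exact Nat.le_of_mul_le_mul_left a5 hpos
    · intro l
      have a1 : ω * (h * (c + C0 + (q + 1))) ≤ ω * m := Nat.mul_le_mul_left _ hm
      have a2 : ω * (h * (c + C0 + (q + 1))) = h * (ω * (q+1)) + (ω * h) * c + h * (ω * C0) := by ring
      have a3 : 1 * c ≤ (ω * h) * c := Nat.mul_le_mul_right _ (Nat.mul_pos (by omega) hpos)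
      have a5 : h * (ω * (q+1)) ≤ h * (Y l).card := by
        have := hYc l
        omega
      exact Nat.le_of_mul_le_mul_left a5 hpos
  · have : c + C0 + (q+1) = m / h := by omega
    have h3 : h * (q + 1) + h * (c + C0 + 1) = h * (m / h) + h := by rw [← this]; ring
    omega

lemma neck_tile {V : Type*} (G : SimpleGraph V) (σ ω : ℕ) (X : Finset V) (hX : X.card = σ) :
    IsTile G 0 σ ω 1 X := by
  refine ⟨fun _ => X, fun i => ?_, fun i j hij => ?_, ?_⟩
  · have : i = 0 := Fin.ext (by omega)
    simp [sz, this, hX]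
  · exact absurd (Fin.ext (by omega)) hij
  · ext x; simp

/-- core containing a prescribed vertex -/
lemma core_tile {V : Type*} {G : SimpleGraph V} {p σ ω e : ℕ} (hω : 1 ≤ ω) (hσ : σ ≤ ω)
    (he : (0 < σ ∧ e = p) ∨ (σ = 0 ∧ e + 1 = p))
    (Q : Fin e → Finset V) (C : Finset V) (x : V) (hQ : ∀ i, (Q i).card = ω) (hC : C.card = ω)
    (hQQ : ∀ i j, i ≠ j → Cm G (Q i) (Q j)) (hCQ : ∀ i, Cm G C (Q i)) (hx : ∀ i, Cm G {x} (Q i)) (hxC : x ∉ C) :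
    ∃ K, IsTile G p σ ω 1 K ∧ x ∈ K ∧ K ⊆ insert x (C ∪ univ.biUnion Q) := by
  have hins : ∀ C' ⊆ C, ∀ i, Cm G (insert x C') (Q i) := by
    intro C' hC' i u hu v hv
    rcases mem_insert.1 hu with rfl | hu
    · exact hx i u (mem_singleton_self _) v hv
    · exact hCQ i u (hC' hu) v hv
  have hsub : ∀ C' ⊆ C, insert x C' ∪ univ.biUnion Q ⊆ insert x (C ∪ univ.biUnion Q) := by
    intro C' hC' u hu
    simp only [mem_union, mem_insert] at hu ⊢
    rcases hu with (h | h) | h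
    · exact Or.inl h
    · exact Or.inr (Or.inl (hC' h))
    · exact Or.inr (Or.inr h)
  rcases he with ⟨h1, rfl⟩ | ⟨h1, rfl⟩
  · obtain ⟨C', hC', hC'c⟩ := exists_subset_card_eq (s := C) (n := σ - 1) (by omega)
    refine ⟨insert x C' ∪ univ.biUnion Q, ?_, by simp, hsub C' hC'⟩
    have := IsTile.addParts univ Q (neck_tile G σ ω (insert x C') (by
      rw [card_insert_of_notMem (fun h => hxC (hC' h))]; omega)) (fun l _ => by simp [hQ]) (fun l _ => hins C' hC' l)
      (fun l _ l' _ h => hQQ l l' h)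
    simpa using this
  · subst h1
    obtain ⟨C', hC', hC'c⟩ := exists_subset_card_eq (s := C) (n := ω - 1) (by omega)
    refine ⟨insert x C' ∪ univ.biUnion Q, ?_, by simp, hsub C' hC'⟩
    have h2 := (neck_tile G 0 ω ∅ rfl).addPart (R := insert x C') (by
      rw [card_insert_of_notMem (fun h => hxC (hC' h))]; omega) (by simp [Cm])
    rw [empty_union] at h2
    have := IsTile.addParts univ Q h2 (fun l _ => by simp [hQ]) (fun l _ => hins C' hC' l)
      (fun l _ l' _ h => hQQ l l' h)
    simpa [add_comm] using this

structure Jobs {V : Type} [Fintype V] (G : SimpleGraph V) (r ω : ℕ) (S B : Fin r → Finset V) (Ws : Finset V)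
    (β κ ξ : ℝ) (J : Type) [Fintype J] (x : J → V) (Y : J → Fin r → Finset V) : Prop where
  xW : ∀ j, x j ∉ Ws
  YB : ∀ j l, Y j l ⊆ B l
  Yc : ∀ j l, Y j l = ∅ ∨ (Y j l).card = ω
  Yadj : ∀ j l, ∀ u ∈ Y j l, G.Adj (x j) u
  Y1 : ∀ j l l', l ≠ l' → Y j l = ∅ ∨ Y j l' = ∅
  dis : ∀ i j, i ≠ j → Disjoint (insert (x i) (univ.biUnion (Y i))) (insert (x j) (univ.biUnion (Y j)))
  xB : ∀ j l, Y j l = ∅ → x j ∉ B l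
  deg : ∀ j l, Y j l = ∅ → ((∀ l', Y j l' = ∅) ∧ ξ * Fintype.card V ≤ (nb G (x j) (S l)).card) ∨
    (β - κ - 2 * ξ) * Fintype.card V ≤ (nb G (x j) (S l)).card
  cov : ∀ v, v ∈ Ws ∨ (∃ j, x j = v) ∨ ∃ l, v ∈ B l
  up : ∀ l, ((B l \ univ.image x).card : ℝ) ≤ β * Fintype.card V + 2 * ω
  lo : ∀ l, ((B l \ univ.image x).card : ℝ) < β * Fintype.card V → ∀ j, Y j l = ∅
  lo2 : ∀ l, (β - κ) * Fintype.card V ≤ (B l \ univ.image x).card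
  cJ : (Fintype.card J : ℝ) ≤ (1 + 2 * r) * (κ * Fintype.card V)

lemma Prt.jobs {V : Type} [Fintype V] {G : SimpleGraph V} {r : ℕ} {S B : Fin r → Finset V} {Ws A : Finset V}
    {β κ ξ : ℝ} (P : Prt G r S B Ws A β κ ξ) (hβ : 0 ≤ β) (hκ : 0 ≤ κ) (hκξ : κ ≤ ξ) {ω : ℕ} (hω : 1 ≤ ω)
    (hnum : ((6 * ω + 8) * ξ + κ) * Fintype.card V + 1 < β * Fintype.card V) :
    ∃ (J : Type) (_ : Fintype J) (x : J → V) (Y : J → Fin r → Finset V), Jobs G r ω S B Ws β κ ξ J x Y := by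
  set n : ℝ := (Fintype.card V : ℝ) with hnd
  have hn : 0 ≤ n := by positivity
  have hκn : 0 ≤ κ * n := by positivity
  have hκξn : κ * n ≤ ξ * n := by gcongr
  have hωξ : 0 ≤ (ω:ℝ) * (ξ * n) := by
    have := hκ.trans hκξ
    positivity
  have hst : ∀ l, ∃ t : ℕ, ∃ c : Fin t → V, ∃ L : Fin t → Finset V,
      (∀ i, c i ∈ B l ∧ L i ⊆ B l ∧ (L i).card = ω ∧ Cm G {c i} (L i)) ∧
      (∀ i j, i ≠ j → Disjoint (insert (c i) (L i)) (insert (c j) (L j))) ∧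
      (t = 0 ∨ β * n + t ≤ (B l).card) ∧ ((B l).card : ℝ) ≤ β * n + t + 2 * ω ∧ (t : ℝ) ≤ 2 * (κ * n) := by
    intro l
    have hSB : ((S l).card : ℝ) ≤ (B l).card := by exact_mod_cast card_le_card (P.SB l)
    have hBc := P.Bc l
    have hSc := P.Sc l
    by_cases hf : 2 * ω ≤ ⌊((B l).card : ℝ) - β * n⌋₊
    · set t := ⌊((B l).card : ℝ) - β * n⌋₊ with ht
      have hpos : 0 ≤ ((B l).card : ℝ) - β * n := by
        by_contra hc
        rw [Nat.floor_of_nonpos (not_le.1 hc).le] at ht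
        omega
      have ht1 : (t : ℝ) ≤ ((B l).card : ℝ) - β * n := Nat.floor_le hpos
      have ht2 : ((B l).card : ℝ) - β * n < t + 1 := Nat.lt_floor_add_one _
      have ht3 : (t : ℝ) ≤ 2 * (κ * n) := by linarith
      have hΔ : ((⌊2 * ξ * n⌋₊ : ℕ) : ℝ) ≤ 2 * ξ * n := Nat.floor_le (by have := hκ.trans hκξ; positivity)
      obtain ⟨c, L, h1, h2⟩ := stars G (B l) A ω t ⌊2 * ξ * n⌋₊ P.clique (by
        intro v hv hvA
        have a1 := P.msA v hvA
        have a2 := nb_add_ms G v (B l)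
        have a3 : ((nb G v (B l)).card : ℝ) + ms G v (B l) = (B l).card := by exact_mod_cast a2
        have a4 : (ms G v (B l) : ℝ) ≤ ms G v univ := by exact_mod_cast ms_mono (subset_univ _)
        have : (t : ℝ) ≤ (nb G v (B l)).card := by linarith
        exact_mod_cast this) (fun v hv => Nat.le_floor (P.Bdeg l v hv)) hf (by
        have a1 : (2 * (ω+1) * ((⌊2 * ξ * n⌋₊ : ℕ) : ℝ) + (ω+1) * t + ((⌊2 * ξ * n⌋₊ : ℕ) : ℝ) + 1 : ℝ) < (B l).card := by
          have b1 : (2 * (ω+1) * ((⌊2 * ξ * n⌋₊ : ℕ) : ℝ) : ℝ) ≤ 2 * (ω+1) * (2 * ξ * n) := by gcongr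
          have b2 : ((ω+1) * t : ℝ) ≤ (ω + 1) * (2 * (ξ * n)) := by
            have : (t:ℝ) ≤ 2 * (ξ * n) := by linarith
            gcongr
          linarith
        exact_mod_cast a1)
      exact ⟨t, c, L, h1, h2, Or.inr (by linarith), by
        have : (1:ℝ) ≤ ω := by exact_mod_cast hω
        linarith, ht3⟩
    · refine ⟨0, fun i => i.elim0, fun i => i.elim0, fun i => i.elim0, fun i => i.elim0, Or.inl rfl, ?_, ?_⟩
      · have h1 : ((B l).card : ℝ) - β * n < ⌊((B l).card : ℝ) - β * n⌋₊ + 1 := Nat.lt_floor_add_one _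
        have h2 : ((⌊((B l).card : ℝ) - β * n⌋₊ : ℕ) : ℝ) + 1 ≤ 2 * ω := by
          exact_mod_cast (show ⌊((B l).card : ℝ) - β * n⌋₊ + 1 ≤ 2 * ω by omega)
        push_cast
        linarith
      · push_cast; linarith
  choose t c L hcL hdisj ht0 htup htκ using hst
  set Hs := (univ \ Ws) \ univ.biUnion B with hHs
  let x : (↥Hs ⊕ (Σ l, Fin (t l))) → V := Sum.elim (fun v => v.1) (fun y => c y.1 y.2)
  let Y : (↥Hs ⊕ (Σ l, Fin (t l))) → Fin r → Finset V :=
    Sum.elim (fun _ _ => ∅) (fun y l => if l = y.1 then L y.1 y.2 else ∅)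
  have hHsB : ∀ v ∈ Hs, ∀ l, v ∉ B l := fun v hv l hl => (mem_sdiff.1 hv).2 (mem_biUnion.2 ⟨l, mem_univ _, hl⟩)
  have hYu : ∀ y : (Σ l, Fin (t l)), univ.biUnion (Y (Sum.inr y)) = L y.1 y.2 := by
    intro y
    ext u
    simp only [mem_biUnion, mem_univ, true_and, Y, Sum.elim_inr]
    constructor
    · rintro ⟨l, hl⟩
      split_ifs at hl with h
      · exact hl
      · simp at hl
    · intro h; exact ⟨y.1, by simpa using h⟩
  have hYe : ∀ v, univ.biUnion (Y (Sum.inl v)) = ∅ := by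
    intro v; ext u; simp [Y]
  have hsubB : ∀ y : (Σ l, Fin (t l)), insert (x (Sum.inr y)) (univ.biUnion (Y (Sum.inr y))) ⊆ B y.1 := by
    intro y
    rw [hYu]
    exact insert_subset (hcL y.1 y.2).1 (hcL y.1 y.2).2.1
  have hdis : ∀ i j, i ≠ j → Disjoint (insert (x i) (univ.biUnion (Y i))) (insert (x j) (univ.biUnion (Y j))) := by
    rintro (u | y) (v | z) hne
    · rw [hYe, hYe]
      simp only [x, Sum.elim_inl]
      rw [disjoint_left]
      intro a ha hb
      simp only [insert_empty_eq, mem_singleton] at ha hb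
      exact hne (by rw [Subtype.ext (ha.symm.trans hb)])
    · rw [disjoint_left]
      intro a ha hb
      rw [hYe] at ha
      have : a = u.1 := by simpa [x] using ha
      exact hHsB u.1 u.2 z.1 (this ▸ hsubB z hb)
    · rw [disjoint_left]
      intro a ha hb
      rw [hYe] at hb
      have : a = v.1 := by simpa [x] using hb
      exact hHsB v.1 v.2 y.1 (this ▸ hsubB y ha)
    · by_cases h : y.1 = z.1
      · obtain ⟨l, i⟩ := y
        obtain ⟨l', i'⟩ := z
        simp only at h
        subst h
        rw [hYu, hYu]
        exact hdisj l i i' (fun h => hne (by rw [h]))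
      · exact (P.Bdis _ _ h).mono (hsubB y) (hsubB z)
  have hxinj : Function.Injective x := by
    intro i j hij
    by_contra hne
    exact disjoint_left.1 (hdis i j hne) (mem_insert_self _ _) (hij ▸ mem_insert_self _ _)
  have hcard : ∀ l, ((B l \ univ.image x).card : ℝ) + t l = (B l).card := by
    intro l
    have h1 := card_sdiff_add_card_inter (B l) (univ.image x)
    have h2 : (B l ∩ univ.image x).card = t l := by
      have : B l ∩ univ.image x = univ.image (fun i : Fin (t l) => x (Sum.inr ⟨l, i⟩)) := by
        ext u
        simp only [mem_inter, mem_image, mem_univ, true_and]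
        constructor
        · rintro ⟨hu, (v | y), rfl⟩
          · exact absurd hu (hHsB v.1 v.2 l)
          · have : y.1 = l := by
              by_contra hne
              exact disjoint_left.1 (P.Bdis _ _ hne) (hcL y.1 y.2).1 hu
            obtain ⟨l', i⟩ := y
            simp only at this
            subst this
            exact ⟨i, rfl⟩
        · rintro ⟨i, rfl⟩
          exact ⟨(hcL l i).1, _, rfl⟩
      rw [this, card_image_of_injective]
      · simp
      · intro i j hij
        have := hxinj hij
        simpa using this
    rw [h2] at h1
    exact_mod_cast h1
  refine ⟨_, inferInstance, x, Y, ?_⟩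
  constructor
  · rintro (v | y)
    · exact (mem_sdiff.1 (mem_sdiff.1 v.2).1).2
    · exact disjoint_left.1 (P.BW y.1) (hcL y.1 y.2).1
  · rintro (v | y) l
    · simp [Y]
    · simp only [Y, Sum.elim_inr]
      split_ifs with h
      · rw [h]; exact (hcL y.1 y.2).2.1
      · simp
  · rintro (v | y) l
    · simp [Y]
    · simp only [Y, Sum.elim_inr]
      split_ifs with h
      · right; exact (hcL y.1 y.2).2.2.1
      · simp
  · rintro (v | y) l
    · simp [Y]
    · simp only [Y, Sum.elim_inr]
      split_ifs with h
      · exact fun u hu => (hcL y.1 y.2).2.2.2 _ (mem_singleton_self _) u hu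
      · simp
  · rintro (v | y) l l' hne
    · simp [Y]
    · simp only [Y, Sum.elim_inr]
      by_cases h : l = y.1
      · right; rw [if_neg (fun h' => hne (h.trans h'.symm))]
      · left; rw [if_neg h]
  · exact hdis
  · rintro (v | y) l hY
    · exact hHsB v.1 v.2 l
    · intro hl
      have : l = y.1 := by
        by_contra hne
        exact disjoint_left.1 (P.Bdis _ _ hne) hl (hcL y.1 y.2).1
      simp only [Y, Sum.elim_inr, if_pos this] at hY
      have h2 := (hcL y.1 y.2).2.2.1
      rw [hY] at h2
      simp at h2
      omega
  · rintro (v | y) l hY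
    · left
      exact ⟨fun _ => rfl, P.res v.1 (mem_sdiff.1 (mem_sdiff.1 v.2).1).2 (hHsB v.1 v.2) l⟩
    · right
      show (β - κ - 2 * ξ) * n ≤ _
      have hne : l ≠ y.1 := by
        intro h
        simp only [Y, Sum.elim_inr, if_pos h] at hY
        have h2 := (hcL y.1 y.2).2.2.1
        rw [hY] at h2
        simp at h2
        omega
      have a1 := P.Bms y.1 (c y.1 y.2) (hcL y.1 y.2).1
      have a2 : (ms G (c y.1 y.2) (S l) : ℝ) ≤ ms G (c y.1 y.2) (univ \ S y.1) := by
        have : S l ⊆ univ \ S y.1 := fun v hv => mem_sdiff.2 ⟨mem_univ _, fun hv' =>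
          disjoint_left.1 (P.Bdis l y.1 hne) (P.SB l hv) (P.SB _ hv')⟩
        exact_mod_cast ms_mono this
      have a3 : ((nb G (c y.1 y.2) (S l)).card : ℝ) + ms G (c y.1 y.2) (S l) = (S l).card := by
        exact_mod_cast nb_add_ms G (c y.1 y.2) (S l)
      have a4 := P.Sc l
      show _ ≤ ((nb G (c y.1 y.2) (S l)).card : ℝ)
      linarith
  · intro v
    by_cases hv : v ∈ Ws
    · exact Or.inl hv
    by_cases hB : ∃ l, v ∈ B l
    · exact Or.inr (Or.inr hB)
    · right; left
      refine ⟨Sum.inl ⟨v, ?_⟩, rfl⟩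
      rw [hHs, mem_sdiff, mem_sdiff, mem_biUnion]
      refine ⟨⟨mem_univ _, hv⟩, ?_⟩
      rintro ⟨l, _, hl⟩
      exact hB ⟨l, hl⟩
  · intro l
    have h1 := hcard l
    have h2 := htup l
    linarith
  · intro l hlt j
    have h1 := hcard l
    rcases ht0 l with h0 | h0
    · rcases j with v | y
      · rfl
      · simp only [Y, Sum.elim_inr]
        rw [if_neg]
        intro h
        have i := y.2
        rw [← h, h0] at i
        exact i.elim0
    · linarith
  · intro l
    have h1 := hcard l
    have h3 : ((S l).card : ℝ) ≤ (B l).card := by exact_mod_cast card_le_card (P.SB l)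
    have h4 := P.Sc l
    rcases ht0 l with h0 | h0
    · rw [h0] at h1
      push_cast at h1
      linarith
    · show (β - κ) * n ≤ _
      linarith
  · have h1 : Fintype.card (↥Hs ⊕ (Σ l, Fin (t l))) = Hs.card + ∑ l, t l := by simp
    rw [h1]
    push_cast
    have h2 := P.resc
    have h3 : ∑ l : Fin r, (t l : ℝ) ≤ ∑ l : Fin r, 2 * (κ * n) := sum_le_sum fun l _ => htκ l
    simp only [sum_const, card_univ, Fintype.card_fin, nsmul_eq_mul] at h3
    show _ ≤ (1 + 2 * (r:ℝ)) * (κ * n)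
    linarith

end OBT

set_option linter.unusedVariables false
set_option linter.unusedSectionVars false
namespace OBT
open scoped Classical
open Finset

lemma Prt.Wsc {V : Type} [Fintype V] {G : SimpleGraph V} {r : ℕ} {S B : Fin r → Finset V} {Ws A : Finset V}
    {β κ ξ : ℝ} (P : Prt G r S B Ws A β κ ξ) :
    (Fintype.card V : ℝ) ≤ Ws.card + r * ((β + 2 * κ) * Fintype.card V) + κ * Fintype.card V := by
  have h1 : (univ : Finset V) ⊆ Ws ∪ univ.biUnion B ∪ ((univ \ Ws) \ univ.biUnion B) := by
    intro v _
    simp only [mem_union, mem_sdiff, mem_univ, true_and]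
    tauto
  have h2 := (card_le_card h1).trans (card_union_le _ _)
  have h3 := card_union_le Ws (univ.biUnion B)
  have h4 : (univ.biUnion B).card ≤ ∑ l, (B l).card := card_biUnion_le
  rw [card_univ] at h2
  have h5 : (Fintype.card V : ℝ) ≤ Ws.card + ∑ l, ((B l).card : ℝ) + ((univ \ Ws) \ univ.biUnion B).card := by
    have : Fintype.card V ≤ Ws.card + ∑ l, (B l).card + ((univ \ Ws) \ univ.biUnion B).card := by omega
    exact_mod_cast this
  have h6 : ∑ l, ((B l).card : ℝ) ≤ ∑ l : Fin r, (β + 2 * κ) * (Fintype.card V : ℝ) := sum_le_sum fun l _ => P.Bc l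
  simp only [sum_const, card_univ, Fintype.card_fin, nsmul_eq_mul] at h6
  have := P.resc
  linarith

/-- in `Prt`, with `β = ω/h` -/
lemma Prt.Wsc2 {V : Type} [Fintype V] {G : SimpleGraph V} {r : ℕ} {S B : Fin r → Finset V} {Ws A : Finset V}
    {β κ ξ g : ℝ} (P : Prt G r S B Ws A β κ ξ) {p σ ω : ℕ} (hβ : β = ω * g) (hg : ((p + r) * ω + σ : ℝ) * g = 1) :
    (p * ω + σ : ℝ) * (g * Fintype.card V) ≤ Ws.card + (2 * r + 1) * (κ * Fintype.card V) := by
  have h1 := P.Wsc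
  have h2 : (Fintype.card V : ℝ) = ((p + r) * ω + σ : ℝ) * g * Fintype.card V := by rw [hg, one_mul]
  have h3 : (r:ℝ) * ((β + 2 * κ) * Fintype.card V) = r * ω * (g * Fintype.card V) + 2 * r * (κ * Fintype.card V) := by
    rw [hβ]; ring
  have h4 : ((p + r) * ω + σ : ℝ) * g * Fintype.card V = (p * ω + σ : ℝ) * (g * Fintype.card V) + r * ω * (g * Fintype.card V) := by ring
  linarith

lemma Prt.msBS {V : Type} [Fintype V] {G : SimpleGraph V} {r : ℕ} {S B : Fin r → Finset V} {Ws A : Finset V}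
    {β κ ξ : ℝ} (P : Prt G r S B Ws A β κ ξ) {l l' : Fin r} (hne : l ≠ l') {u : V} (hu : u ∈ B l) :
    (ms G u (S l') : ℝ) ≤ 2 * ξ * Fintype.card V := by
  refine le_trans ?_ (P.Bms l u hu)
  have : S l' ⊆ univ \ S l := fun v hv => mem_sdiff.2 ⟨mem_univ _, fun hv' =>
    disjoint_left.1 (P.Bdis l l' hne) (P.SB l hv') (P.SB l' hv)⟩
  exact_mod_cast ms_mono this

lemma Prt.msBW {V : Type} [Fintype V] {G : SimpleGraph V} {r : ℕ} {S B : Fin r → Finset V} {Ws A : Finset V}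
    {β κ ξ : ℝ} (P : Prt G r S B Ws A β κ ξ) {l : Fin r} {u : V} (hu : u ∈ B l) :
    (ms G u Ws : ℝ) ≤ 2 * ξ * Fintype.card V := by
  refine le_trans ?_ (P.Bms l u hu)
  have : Ws ⊆ univ \ S l := fun v hv => mem_sdiff.2 ⟨mem_univ _, fun hv' =>
    disjoint_left.1 (P.BW l) (P.SB l hv') hv⟩
  exact_mod_cast ms_mono this

lemma availR {V : Type*} (G : SimpleGraph V) (T B : Finset V) (D : ℝ) (hD : 0 ≤ D) (h : ∀ u ∈ T, (ms G u B : ℝ) ≤ D) :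
    ∃ F ⊆ B, (∀ v ∈ F, ∀ u ∈ T, G.Adj u v) ∧ (B.card : ℝ) ≤ F.card + T.card * D := by
  refine ⟨B.filter (fun v => ∀ u ∈ T, G.Adj u v), filter_subset _ _, fun v hv => (mem_filter.1 hv).2, ?_⟩
  have h1 := avail G T B ⌊D⌋₊ (fun u hu => Nat.le_floor (h u hu))
  have h2 : (B.card : ℝ) ≤ (B.filter (fun v => ∀ u ∈ T, G.Adj u v)).card + T.card * ((⌊D⌋₊ : ℕ) : ℝ) := by exact_mod_cast h1
  have h3 : ((⌊D⌋₊ : ℕ) : ℝ) ≤ D := Nat.floor_le hD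
  have h4 : (T.card : ℝ) * ((⌊D⌋₊ : ℕ) : ℝ) ≤ T.card * D := by gcongr
  linarith

/-- completing a hub core: shared by both assembly lemmas -/
lemma hubcomplete {V : Type} [Fintype V] {G : SimpleGraph V} {r : ℕ} {S B : Fin r → Finset V} {Ws A : Finset V}
    {β κ ξ lam : ℝ} (P : Prt G r S B Ws A β κ ξ) {p σ ω H : ℕ} {K Z : Finset V} {x : V} {Y : Fin r → Finset V}
    (hκ : 0 ≤ κ) (hξ : 0 ≤ ξ)
    (hK : IsTile G p σ ω 1 K) (hKs : K ⊆ insert x Ws) (hKc : K.card ≤ H)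
    (hY : ∀ l, (Y l).card ≤ ω) (hYB : ∀ l', (Y l') ⊆ insert x (B l')) (hYK : ∀ l, Cm G K (Y l))
    (hYY : ∀ l l', l ≠ l' → Cm G (Y l) (Y l'))
    (hdeg : ∀ l, (Y l).card < ω → ((∀ l', l' ≠ l → Y l' ⊆ {x}) ∧ ξ * Fintype.card V ≤ (nb G x (S l)).card) ∨
      (β - κ - 2 * ξ) * Fintype.card V ≤ (nb G x (S l)).card ∨ (x ∉ K ∧ (∀ l', l' ≠ l → x ∉ Y l')))
    (hZ : (Z.card : ℝ) ≤ lam * Fintype.card V)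
    (h2 : (H + r * ω + 1) * κ + lam ≤ ξ)
    (h3 : κ + 2 * ξ + (H + r * ω) * (2 * ξ) + r * ω * κ + lam + κ ≤ β)
    (h4 : (ω : ℝ) ≤ κ * Fintype.card V) (hκξ : κ ≤ ξ) :
    ∃ E : Fin r → Finset V, (∀ l, E l ⊆ S l ∧ Disjoint (E l) Z ∧ Disjoint (E l) (Y l) ∧
        (Y l).card + (E l).card = ω) ∧
      IsTile G (p + r) σ ω 1 (K ∪ univ.biUnion (fun l => Y l ∪ E l)) := by
  set n : ℝ := (Fintype.card V : ℝ) with hnd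
  have hn : 0 ≤ n := by positivity
  have := complete (G := G) (a := p) (σ := σ) (ω := ω) (D := ⌊κ * n⌋₊) (univ : Finset (Fin r)) S Y K Z hK
    (fun l _ => hY l) (fun l _ => hYK l) (fun l _ l' _ h => hYY l l' h)
    (fun l _ l' _ h v hv => Nat.le_floor (P.Sms l l' h v hv)) (by
      intro l _ hlt
      set N := (S l).filter (fun v => (∀ u ∈ K, G.Adj u v) ∧ ∀ l' ∈ (univ : Finset (Fin r)), l' ≠ l → ∀ u ∈ Y l', G.Adj u v) with hN
      rw [card_univ, Fintype.card_fin]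
      have hfl : ((⌊κ * n⌋₊ : ℕ) : ℝ) ≤ κ * n := Nat.floor_le (by positivity)
      have hfl2 : (r * ω : ℝ) * ((⌊κ * n⌋₊ : ℕ) : ℝ) ≤ (r * ω) * (κ * n) := by gcongr
      suffices hs : r * ω * (κ * n) + lam * n + κ * n ≤ (N.card : ℝ) by
        have : (r * ω * ((⌊κ * n⌋₊ : ℕ) : ℝ) + Z.card + ω : ℝ) ≤ N.card := by linarith
        exact_mod_cast this
      set T := (K ∪ (univ.filter (fun l' => l' ≠ l)).biUnion Y).erase x with hT
      have hTc : (T.card : ℝ) ≤ H + r * ω := by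
        have a1 : T.card ≤ K.card + ((univ.filter (fun l' : Fin r => l' ≠ l)).biUnion Y).card :=
          (card_le_card (erase_subset _ _)).trans (card_union_le _ _)
        have a2 := card_biUnion_le_card_mul (univ.filter (fun l' : Fin r => l' ≠ l)) Y ω (fun l' _ => hY l')
        have a3 : (univ.filter (fun l' : Fin r => l' ≠ l)).card ≤ r := by
          refine (card_le_univ _).trans (by simp)
        have a4 := Nat.mul_le_mul_right ω a3
        have : T.card ≤ H + r * ω := by omega
        exact_mod_cast this
      have hTmem : ∀ u, u ∈ T → u ∈ Ws ∨ ∃ l', l' ≠ l ∧ u ∈ Y l' ∧ u ∈ B l' := by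
        intro u hu
        obtain ⟨hux, hu⟩ := mem_erase.1 hu
        rcases mem_union.1 hu with hu | hu
        · exact Or.inl (mem_of_mem_insert_of_ne (hKs hu) hux)
        · obtain ⟨l', hl', hul⟩ := mem_biUnion.1 hu
          exact Or.inr ⟨l', (mem_filter.1 hl').2, hul, mem_of_mem_insert_of_ne (hYB l' hul) hux⟩
      have hinc : ∀ v ∈ S l, (∀ u ∈ T, G.Adj u v) → (G.Adj x v ∨ (x ∉ K ∧ (∀ l', l' ≠ l → x ∉ Y l'))) → v ∈ N := by
        intro v hv hTv hx
        refine mem_filter.2 ⟨hv, fun u hu => ?_, fun l' _ hne u hu => ?_⟩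
        · by_cases hux : u = x
          · rcases hx with hx | hx
            · rw [hux]; exact hx
            · exact absurd (hux ▸ hu) hx.1
          · exact hTv u (mem_erase.2 ⟨hux, mem_union_left _ hu⟩)
        · by_cases hux : u = x
          · rcases hx with hx | hx
            · rw [hux]; exact hx
            · exact absurd (hux ▸ hu) (hx.2 l' hne)
          · exact hTv u (mem_erase.2 ⟨hux, mem_union_right _ (mem_biUnion.2 ⟨l', mem_filter.2 ⟨mem_univ _, hne⟩, hu⟩)⟩)
      have h2n := mul_le_mul_of_nonneg_right h2 hn
      have h3n := mul_le_mul_of_nonneg_right h3 hn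
      have hκn : 0 ≤ κ * n := by positivity
      have hκξn : κ * n ≤ ξ * n := by gcongr
      have hξn : 0 ≤ ξ * n := by positivity
      rcases hdeg l hlt with ⟨hemp, hd⟩ | hd | hd
      · obtain ⟨F, hF1, hF2, b1⟩ := availR G T (nb G x (S l)) (κ * n) (by positivity) (by
          intro u hu
          have hW : u ∈ Ws := by
            rcases hTmem u hu with h | ⟨l', hne, hul, _⟩
            · exact h
            · exact absurd (mem_singleton.1 (hemp l' hne hul)) (mem_erase.1 hu).1
          refine le_trans ?_ (P.Wms l u hW)
          exact_mod_cast ms_mono nb_sub)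
        have b2 : (F.card : ℝ) ≤ N.card := by
          have : F ⊆ N := by
            intro v hv
            have hv2 := mem_nb.1 (hF1 hv)
            exact hinc v hv2.1 (hF2 v hv) (Or.inl hv2.2)
          exact_mod_cast card_le_card this
        -- need T.card ≤ H here
        have b4 : (T.card : ℝ) * (κ * n) ≤ H * (κ * n) := by
          have a1 : T ⊆ K := by
            intro u hu
            obtain ⟨hux, hu'⟩ := mem_erase.1 hu
            rcases mem_union.1 hu' with h | h
            · exact h
            · obtain ⟨l', hl', hul⟩ := mem_biUnion.1 h
              exact absurd (mem_singleton.1 (hemp l' (mem_filter.1 hl').2 hul)) hux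
          have : (T.card : ℝ) ≤ H := by exact_mod_cast (card_le_card a1).trans hKc
          gcongr
        linarith
      · obtain ⟨F, hF1, hF2, b1⟩ := availR G T (nb G x (S l)) (2 * ξ * n) (by positivity) (by
          intro u hu
          refine le_trans (b := (ms G u (S l) : ℝ)) (by exact_mod_cast ms_mono nb_sub) ?_
          rcases hTmem u hu with h | ⟨l', hne, hul, hB⟩
          · have := P.Wms l u h
            linarith
          · exact P.msBS hne hB)
        have b2 : (F.card : ℝ) ≤ N.card := by
          have : F ⊆ N := by
            intro v hv
            have hv2 := mem_nb.1 (hF1 hv)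
            exact hinc v hv2.1 (hF2 v hv) (Or.inl hv2.2)
          exact_mod_cast card_le_card this
        have b3 : (T.card : ℝ) * (2 * ξ * n) ≤ (H + r * ω) * (2 * ξ * n) := by gcongr
        linarith
      · obtain ⟨F, hF1, hF2, b1⟩ := availR G T (S l) (2 * ξ * n) (by positivity) (by
          intro u hu
          rcases hTmem u hu with h | ⟨l', hne, hul, hB⟩
          · have := P.Wms l u h
            linarith
          · exact P.msBS hne hB)
        have b2 : (F.card : ℝ) ≤ N.card := by
          have : F ⊆ N := by
            intro v hv
            exact hinc v (hF1 hv) (hF2 v hv) (Or.inr hd)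
          exact_mod_cast card_le_card this
        have b3 : (T.card : ℝ) * (2 * ξ * n) ≤ (H + r * ω) * (2 * ξ * n) := by gcongr
        have b4 := P.Sc l
        linarith)
  simpa using this

end OBT

set_option linter.unusedVariables false
set_option linter.unusedSectionVars false
namespace OBT
open scoped Classical
open Finset

lemma hubtile (p σ ω r : ℕ) (hω : 1 ≤ ω) (hσ : σ ≤ ω) (hpos : 0 < p * ω + σ) (hpr : 1 ≤ p + r) (g β : ℝ) (hg0 : 0 < g)
    (hg : ((p + r) * ω + σ : ℝ) * g = 1) (hβ : β = ω * g) :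
    ∃ n0 : ℕ, ∀ (V : Type) [Fintype V] (G : SimpleGraph V) (S B : Fin r → Finset V) (Ws A : Finset V)
      (κ ξ lam : ℝ) (J : Type) [Fintype J] (x : J → V) (Y : J → Fin r → Finset V),
      n0 ≤ Fintype.card V → Prt G r S B Ws A β κ ξ → Jobs G r ω S B Ws β κ ξ J x Y → 0 ≤ κ → κ ≤ ξ →
      (2 * r + 2) * κ + lam + 2 * r * ω * ξ ≤ 3 / 4 * g →
      ((((p + r) * ω + σ : ℕ) : ℝ) + r * ω + 1) * κ + lam ≤ ξ →
      κ + 2 * ξ + ((((p + r) * ω + σ : ℕ) : ℝ) + r * ω) * (2 * ξ) + r * ω * κ + lam + κ ≤ β →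
      (ω : ℝ) ≤ κ * Fintype.card V →
      ∀ (j : J) (Z : Finset V), (Z.card : ℝ) ≤ lam * Fintype.card V →
        Disjoint Z (insert (x j) (univ.biUnion (Y j))) → (∀ i, i ≠ j → insert (x i) (univ.biUnion (Y i)) ⊆ Z) →
        ∃ T, IsTile G (p + r) σ ω 1 T ∧ insert (x j) (univ.biUnion (Y j)) ⊆ T ∧ Disjoint T Z ∧
          ∀ l, (T ∩ (B l \ univ.image x)).card = ω := by
  obtain ⟨e, he⟩ : ∃ e, (0 < σ ∧ e = p) ∨ (σ = 0 ∧ e + 1 = p) := by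
    rcases Nat.eq_zero_or_pos σ with h | h
    · have : p ≠ 0 := by rintro rfl; simp [h] at hpos
      exact ⟨p - 1, Or.inr ⟨h, by omega⟩⟩
    · exact ⟨p, Or.inl ⟨h, rfl⟩⟩
  have hen : e * ω + 1 ≤ p * ω + σ := by
    rcases he with ⟨h1, rfl⟩ | ⟨h1, rfl⟩
    · omega
    · rw [add_mul]; omega
  obtain ⟨n0, hk⟩ := kcells e ω hω (g/4) (by positivity)
  refine ⟨n0, ?_⟩
  intro V _ G S B Ws A κ ξ lam J _ x Y hn0 P Jb hκ hκξ hnum1 hnum2 hnum3 hωκ j Z hZ hZX hXZ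
  set n : ℝ := (Fintype.card V : ℝ) with hnd
  have hn : 0 ≤ n := by positivity
  have hξ := hκ.trans hκξ
  set X := insert (x j) (univ.biUnion (Y j)) with hX
  have hYX : ∀ l, Y j l ⊆ X := fun l u hu => mem_insert_of_mem (mem_biUnion.2 ⟨l, mem_univ _, hu⟩)
  have hxX : x j ∈ X := mem_insert_self _ _
  have hYcard : ∀ l, (Y j l).card ≤ ω := by
    intro l
    rcases Jb.Yc j l with h | h
    · rw [h]; simp
    · omega
  -- the set U
  obtain ⟨U, hU1, hU2, hU3⟩ := availR G (univ.biUnion (Y j)) (Ws \ Z) (2 * ξ * n) (by positivity) (by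
    intro u hu
    obtain ⟨l, _, hul⟩ := mem_biUnion.1 hu
    refine le_trans ?_ (P.msBW (Jb.YB j l hul))
    exact_mod_cast ms_mono sdiff_subset)
  have hYt : ((univ.biUnion (Y j)).card : ℝ) ≤ r * ω := by
    have := card_biUnion_le_card_mul (univ : Finset (Fin r)) (Y j) ω (fun l _ => hYcard l)
    rw [card_univ, Fintype.card_fin] at this
    exact_mod_cast this
  have hYt2 : ((univ.biUnion (Y j)).card : ℝ) * (2 * ξ * n) ≤ r * ω * (2 * ξ * n) := by gcongr
  have hWZ : (Ws.card : ℝ) ≤ (Ws \ Z).card + Z.card := by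
    exact_mod_cast card_le_card_sdiff_add_card (s := Ws) (t := Z)
  have hWs := P.Wsc2 hβ hg
  have hen' : ((e:ℝ) * ω + 1) * (g * n) ≤ (p * ω + σ : ℝ) * (g * n) := by
    have : ((e:ℝ) * ω + 1) ≤ (p * ω + σ : ℝ) := by exact_mod_cast hen
    gcongr
  have hnum1n := mul_le_mul_of_nonneg_right hnum1 hn
  have hκn : 0 ≤ κ * n := by positivity
  have hgn : 0 ≤ g * n := by positivity
  have hUW : U ⊆ Ws := hU1.trans sdiff_subset
  have hβ1 : β ≤ 1 := by
    rw [← hg, hβ]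
    have : (ω : ℝ) ≤ ((p + r) * ω + σ : ℝ) := by
      have : ω ≤ (p + r) * ω + σ := by nlinarith
      exact_mod_cast this
    gcongr
  have hβ0 : 0 ≤ β := by rw [hβ]; positivity
  have hβn : β * n = ω * (g * n) := by rw [hβ]; ring
  have hUc : (e:ℝ) * (β * n) + (g / 4) * n + κ * n ≤ U.card := by
    rw [hβn]; linarith
  have hU'c : ((e:ℝ) - 1) * (β * n) + (g / 4) * n ≤ (nb G (x j) U).card := by
    have h1 := nb_add_ms G (x j) U
    have h1' : ((nb G (x j) U).card : ℝ) + ms G (x j) U = U.card := by exact_mod_cast h1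
    have h2 : (ms G (x j) U : ℝ) ≤ (β + κ) * n :=
      le_trans (by exact_mod_cast ms_mono (subset_univ U)) (P.hub (x j) (Jb.xW j))
    linarith
  obtain ⟨Q, C, hCU, hCc, hQ, hQQ, hCQ⟩ := hk V G (nb G (x j) U) U A (Fintype.card V) (β * n) hn0
    (by rw [← hnd]; nlinarith) (by positivity) nb_sub P.clique (by
      intro v hv hvA
      exact le_trans (by exact_mod_cast ms_mono (subset_univ U)) (P.msA v hvA))
    (fun _ => hU'c) (by rw [← hnd]; linarith)
  have hxC : x j ∉ C := fun h => Jb.xW j (hUW (hCU h))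
  obtain ⟨K, hK, hxK, hKs⟩ := core_tile (G := G) hω hσ he Q C (x j) (fun i => (hQ i).2) hCc hQQ hCQ
    (fun i u hu v hv => by
      rw [mem_singleton.1 hu]
      exact (mem_nb.1 ((hQ i).1 hv)).2) hxC
  have hKU : K ⊆ insert (x j) U := by
    intro v hv
    rcases mem_insert.1 (hKs hv) with h | h
    · exact mem_insert.2 (Or.inl h)
    · refine mem_insert_of_mem ?_
      rcases mem_union.1 h with h | h
      · exact hCU h
      · obtain ⟨i, _, hi⟩ := mem_biUnion.1 h
        exact nb_sub ((hQ i).1 hi)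
  have hKc : K.card ≤ (p + r) * ω + σ := by
    rw [hK.card, mul_one, add_mul]; omega
  obtain ⟨E, hE, hT⟩ := hubcomplete (lam := lam) (H := (p + r) * ω + σ) (Z := Z) (x := x j) (Y := Y j) P hκ hξ hK
    (hKU.trans (insert_subset_insert _ hUW)) hKc hYcard (fun l => (Jb.YB j l).trans (subset_insert _ _))
    (fun l u hu v hv => by
      rcases mem_insert.1 (hKU hu) with h | h
      · rw [h]; exact Jb.Yadj j l v hv
      · exact (hU2 u h v (mem_biUnion.2 ⟨l, mem_univ _, hv⟩)).symm)
    (fun l l' hne u hu v hv => by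
      rcases Jb.Y1 j l l' hne with h | h
      · rw [h] at hu; simp at hu
      · rw [h] at hv; simp at hv)
    (fun l hlt => by
      have hem : Y j l = ∅ := by
        rcases Jb.Yc j l with h | h
        · exact h
        · omega
      rcases Jb.deg j l hem with ⟨h1, h2⟩ | h
      · exact Or.inl ⟨fun l' _ => by rw [h1 l']; simp, h2⟩
      · exact Or.inr (Or.inl h))
    hZ hnum2 hnum3 hωκ hκξ
  refine ⟨_, hT, ?_, ?_, ?_⟩
  · intro v hv
    rcases mem_insert.1 hv with h | h
    · rw [h]; exact mem_union_left _ hxK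
    · obtain ⟨l, _, hl⟩ := mem_biUnion.1 h
      exact mem_union_right _ (mem_biUnion.2 ⟨l, mem_univ _, mem_union_left _ hl⟩)
  · rw [disjoint_left]
    intro v hv hvZ
    rcases mem_union.1 hv with hv | hv
    · rcases mem_insert.1 (hKU hv) with h | h
      · exact disjoint_left.1 hZX hvZ (h ▸ hxX)
      · exact (mem_sdiff.1 (hU1 h)).2 hvZ
    · obtain ⟨l, _, hl⟩ := mem_biUnion.1 hv
      rcases mem_union.1 hl with h | h
      · exact disjoint_left.1 hZX hvZ (hYX l h)
      · exact disjoint_left.1 (hE l).2.1 h hvZ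
  · intro l
    have heq : (K ∪ univ.biUnion (fun l => Y j l ∪ E l)) ∩ (B l \ univ.image x) = Y j l ∪ E l := by
      ext v
      simp only [mem_inter, mem_sdiff]
      constructor
      · rintro ⟨hv, hvB, hvx⟩
        rcases mem_union.1 hv with hv | hv
        · rcases mem_insert.1 (hKU hv) with h | h
          · exact absurd (mem_image.2 ⟨j, mem_univ _, h.symm⟩) hvx
          · exact absurd (hUW h) (disjoint_left.1 (P.BW l) hvB)
        · obtain ⟨l', _, hl'⟩ := mem_biUnion.1 hv
          have hvB' : v ∈ B l' := by
            rcases mem_union.1 hl' with h | h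
            · exact Jb.YB j l' h
            · exact P.SB l' ((hE l').1 h)
          by_cases hll : l' = l
          · rw [← hll]; exact hl'
          · exact absurd hvB (disjoint_left.1 (P.Bdis l' l hll) hvB')
      · intro hv
        refine ⟨mem_union_right _ (mem_biUnion.2 ⟨l, mem_univ _, hv⟩), ?_⟩
        rcases mem_union.1 hv with h | h
        · refine ⟨Jb.YB j l h, fun hvx => ?_⟩
          obtain ⟨i, _, hi⟩ := mem_image.1 hvx
          by_cases hij : i = j
          · have := Jb.Yadj j l v h
            rw [← hi, hij] at this
            exact G.irrefl this
          · exact disjoint_left.1 (Jb.dis i j hij) (mem_insert_self _ _) (hi ▸ hYX l h)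
        · refine ⟨P.SB l ((hE l).1 h), fun hvx => ?_⟩
          obtain ⟨i, _, hi⟩ := mem_image.1 hvx
          by_cases hij : i = j
          · have hYe : Y j l = ∅ := by
              rcases Jb.Yc j l with h' | h'
              · exact h'
              · have := (hE l).2.2.2
                have h0 : (E l).card = 0 := by omega
                rw [card_eq_zero.1 h0] at h
                simp at h
            apply Jb.xB j l hYe
            rw [← hij, hi]
            exact P.SB l ((hE l).1 h)
          · exact disjoint_left.1 (hE l).2.1 h (hXZ i hij (hi ▸ mem_insert_self _ _))
    rw [heq, card_union_of_disjoint (hE l).2.2.1.symm, (hE l).2.2.2]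

end OBT

set_option linter.unusedVariables false
set_option linter.unusedSectionVars false
namespace OBT
open scoped Classical
open Finset

lemma short_cells (p σ ω r : ℕ) (hω : 1 ≤ ω) (hσ : σ ≤ ω) (hpos : 0 < p * ω + σ) (hpr : 1 ≤ p + r) (g β : ℝ) (hg0 : 0 < g)
    (hg : ((p + r) * ω + σ : ℝ) * g = 1) (hβ : β = ω * g) (η : ℝ) (hη : 0 < η) :
    ∃ ζ : ℝ, 0 < ζ ∧ ∃ n0 : ℕ, ∀ (V : Type) [Fintype V] (G : SimpleGraph V) (S B : Fin r → Finset V) (Ws A : Finset V)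
      (κ ξ lam : ℝ),
      n0 ≤ Fintype.card V → Prt G r S B Ws A β κ ξ → 0 ≤ κ → 
      (∀ U ⊆ Ws, (β - η) * Fintype.card V ≤ U.card → η * (Fintype.card V : ℝ)^2 ≤ ((∑ u ∈ U, (nb G u U).card : ℕ) : ℝ)) →
      (2 * r + 1) * κ + lam ≤ ζ →
      ∀ (Z : Finset V), (Z.card : ℝ) ≤ lam * Fintype.card V →
        ∃ Q : Fin (p + 1) → Finset V, (∀ i, Q i ⊆ Ws \ Z ∧ (Q i).card = ω) ∧ ∀ i j, i ≠ j → Cm G (Q i) (Q j) := by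
  have hβ1 : β ≤ 1 := by
    rw [← hg, hβ]
    have : (ω : ℝ) ≤ ((p + r) * ω + σ : ℝ) := by
      have : ω ≤ (p + r) * ω + σ := by nlinarith
      exact_mod_cast this
    gcongr
  have hωR : (1:ℝ) ≤ ω := by exact_mod_cast hω
  have hβ0 : 0 < β := by rw [hβ]; positivity
  rcases Nat.eq_zero_or_pos σ with h | h
  · obtain ⟨e, rfl⟩ : ∃ e, p = e + 1 := by
      have : p ≠ 0 := by rintro rfl; simp [h] at hpos
      exact ⟨p - 1, by omega⟩
    obtain ⟨ζ, hζ, n0, hk⟩ := extra_cells e ω hω η β hη hβ0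
    refine ⟨ζ, hζ, n0, ?_⟩
    intro V _ G S B Ws A κ ξ lam hn0 P hκ hne hnum Z hZ
    set n : ℝ := (Fintype.card V : ℝ) with hnd
    have hn : 0 ≤ n := by positivity
    have hWs := P.Wsc2 hβ hg
    have hWZ : (Ws.card : ℝ) ≤ (Ws \ Z).card + Z.card := by
      exact_mod_cast card_le_card_sdiff_add_card (s := Ws) (t := Z)
    have hnumn := mul_le_mul_of_nonneg_right hnum hn
    have hβn : β * n = ω * (g * n) := by rw [hβ]; ring
    refine hk V G (Ws \ Z) A (Fintype.card V) (β * n) hn0 (by rw [← hnd]; nlinarith) le_rfl (card_le_univ _) ?_ P.clique ?_ ?_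
    · rw [hβn, ← hnd]
      rw [h] at hWs
      push_cast at hWs
      linarith
    · intro v hv hvA
      exact le_trans (by exact_mod_cast ms_mono (subset_univ _)) (P.msA v hvA)
    · intro U hU hUc
      exact hne U (hU.trans sdiff_subset) (by rw [← hnd] at hUc; linarith)
  · obtain ⟨n0, hk⟩ := kcells p ω hω (g/4) (by positivity)
    refine ⟨3 / 4 * g, by positivity, n0, ?_⟩
    intro V _ G S B Ws A κ ξ lam hn0 P hκ hne hnum Z hZ
    set n : ℝ := (Fintype.card V : ℝ) with hnd
    have hn : 0 ≤ n := by positivity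
    have hWs := P.Wsc2 hβ hg
    have hWZ : (Ws.card : ℝ) ≤ (Ws \ Z).card + Z.card := by
      exact_mod_cast card_le_card_sdiff_add_card (s := Ws) (t := Z)
    have hnumn := mul_le_mul_of_nonneg_right hnum hn
    have hβn : β * n = ω * (g * n) := by rw [hβ]; ring
    have hσR : (1:ℝ) ≤ σ := by exact_mod_cast h
    have hgn : 0 ≤ g * n := by positivity
    have hσg : 1 * (g * n) ≤ σ * (g * n) := by gcongr
    have hc : (p:ℝ) * (β * n) + g / 4 * n ≤ (Ws \ Z).card := by rw [hβn]; linarith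
    obtain ⟨Q, C, hCU, hCc, hQ, hQQ, hCQ⟩ := hk V G (Ws \ Z) (Ws \ Z) A (Fintype.card V) (β * n) hn0
      (by rw [← hnd]; nlinarith) (by positivity) subset_rfl P.clique (by
        intro v hv hvA
        exact le_trans (by exact_mod_cast ms_mono (subset_univ _)) (P.msA v hvA))
      (fun _ => by
        have : 0 ≤ β * n := by positivity
        rw [← hnd]; linarith) hc
    refine ⟨Fin.cons C Q, ?_, ?_⟩
    · intro i
      refine Fin.cases ?_ (fun i => ?_) i
      · exact ⟨hCU, hCc⟩
      · simpa using hQ i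
    · intro i j
      refine Fin.cases ?_ (fun i => ?_) i <;> refine Fin.cases ?_ (fun j => ?_) j <;> intro hij
      · exact absurd rfl hij
      · simpa using hCQ j
      · simpa using (hCQ i).symm
      · simpa using hQQ i j (fun h => hij (by rw [h]))

lemma shorttile (p σ ω r : ℕ) (hω : 1 ≤ ω) (hσ : σ ≤ ω) (β : ℝ)
    (V : Type) [Fintype V] (G : SimpleGraph V) (S B : Fin r → Finset V) (Ws A : Finset V)
      (κ ξ lam : ℝ) (P : Prt G r S B Ws A β κ ξ) (hκ : 0 ≤ κ) (hκξ : κ ≤ ξ)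
      (hnum3 : κ + 2 * ξ + ((((p + r) * ω + σ : ℕ) : ℝ) + r * ω) * (2 * ξ) + r * ω * κ + lam + κ ≤ β)
      (hωκ : (ω : ℝ) ≤ κ * Fintype.card V)
      (Z I : Finset V) (hZ : (Z.card : ℝ) ≤ lam * Fintype.card V) (hIZ : I ⊆ Z) 
      (Q : Fin (p + 1) → Finset V) (hQ : ∀ i, Q i ⊆ Ws \ Z ∧ (Q i).card = ω) (hQQ : ∀ i j, i ≠ j → Cm G (Q i) (Q j))
      (i : Fin r) :
      ∃ T, IsTile G (p + r) σ ω 1 T ∧ Disjoint T Z ∧ (T ∩ (B i \ I)).card = σ ∧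
          ∀ l, l ≠ i → (T ∩ (B l \ I)).card = ω := by
  set n : ℝ := (Fintype.card V : ℝ) with hnd
  have hn : 0 ≤ n := by positivity
  have hξ := hκ.trans hκξ
  have hr : 1 ≤ r := by have := i.2; omega
  have hQW : ∀ u ∈ univ.biUnion Q, u ∈ Ws ∧ u ∉ Z := by
    intro u hu
    obtain ⟨j, _, hj⟩ := mem_biUnion.1 hu
    exact mem_sdiff.1 ((hQ j).1 hj)
  have hQt : (univ.biUnion Q).card ≤ (p + 1) * ω := by
    have := card_biUnion_le_card_mul univ Q ω (fun j _ => (hQ j).2.le)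
    rwa [card_univ, Fintype.card_fin] at this
  have hhN : (p + 1) * ω + σ ≤ (p + r) * ω + σ := by
    have : (p + 1) * ω ≤ (p + r) * ω := Nat.mul_le_mul_right _ (by omega)
    omega
  have hhR : ((p:ℝ) + 1) * ω + σ ≤ (((p + r) * ω + σ : ℕ) : ℝ) := by exact_mod_cast hhN
  have hκn : 0 ≤ κ * n := by positivity
  have hκξn : κ * n ≤ ξ * n := by gcongr
  have hbound : (((p:ℝ) + 1) * ω + σ) * (κ * n) + r * ω * (κ * n) + lam * n + κ * n + κ * n ≤ β * n := by
    have a1 := mul_le_mul_of_nonneg_right hnum3 hn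
    have a2 : (((p:ℝ) + 1) * ω + σ) * (κ * n) ≤ (((p + r) * ω + σ : ℕ) : ℝ) * (ξ * n) := by gcongr
    have a3 : 0 ≤ (((p + r) * ω + σ : ℕ) : ℝ) * (ξ * n) := by positivity
    have a4 : 0 ≤ (r:ℝ) * ω * (ξ * n) := by positivity
    have a5 : 0 ≤ ξ * n := by positivity
    linarith
  have hσκ : 0 ≤ (σ:ℝ) * (κ * n) := by positivity
  have hrκ : 0 ≤ (r:ℝ) * ω * (κ * n) := by positivity
  -- neck
  obtain ⟨F, hF1, hF2, hF3⟩ := availR G (univ.biUnion Q) (S i) (κ * n) hκn (fun u hu => P.Wms i u (hQW u hu).1)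
  have hFc : σ ≤ (F \ Z).card := by
    have a1 : (F.card : ℝ) ≤ (F \ Z).card + Z.card := by
      exact_mod_cast card_le_card_sdiff_add_card (s := F) (t := Z)
    have a2 : ((univ.biUnion Q).card : ℝ) * (κ * n) ≤ ((p:ℝ) + 1) * ω * (κ * n) := by
      have : ((univ.biUnion Q).card : ℝ) ≤ ((p:ℝ) + 1) * ω := by exact_mod_cast hQt
      gcongr
    have a3 := P.Sc i
    have : (σ : ℝ) ≤ (F \ Z).card := by
      have : (σ:ℝ) ≤ ω := by exact_mod_cast hσ
      rw [← hnd] at a3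
      linarith
    exact_mod_cast this
  obtain ⟨Nk, hNk, hNc⟩ := exists_subset_card_eq hFc
  have hNS : Nk ⊆ S i := fun v hv => hF1 (mem_sdiff.1 (hNk hv)).1
  have hNZ : ∀ v ∈ Nk, v ∉ Z := fun v hv => (mem_sdiff.1 (hNk hv)).2
  have hK0 := (neck_tile G σ ω Nk hNc).addParts (univ : Finset (Fin (p+1))) Q (fun j _ => by rw [(hQ j).2, mul_one])
    (fun j _ u hu v hv => (hF2 u (mem_sdiff.1 (hNk hu)).1 v (mem_biUnion.2 ⟨j, mem_univ _, hv⟩)).symm)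
    (fun j _ j' _ h => hQQ j j' h)
  rw [card_univ, Fintype.card_fin, zero_add] at hK0
  set K := Nk ∪ univ.biUnion Q with hKd
  have hKc : (K.card : ℝ) ≤ ((p:ℝ) + 1) * ω + σ := by
    have := hK0.card
    rw [this]; push_cast; linarith
  obtain ⟨E, hE, hT⟩ := complete (G := G) (a := p + 1) (σ := σ) (ω := ω) (D := ⌊κ * n⌋₊) (univ.filter (fun l : Fin r => l ≠ i)) S
    (fun _ => ∅) K Z hK0 (by simp) (by intro l _ u _ v hv; simp at hv) (by intro l _ l' _ _ u hu; simp at hu)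
    (fun l _ l' _ h v hv => Nat.le_floor (P.Sms l l' h v hv)) (by
      intro l hl _
      have hli := (mem_filter.1 hl).2
      obtain ⟨F', hF1', hF2', hF3'⟩ := availR G K (S l) (κ * n) hκn (fun u hu => by
        rcases mem_union.1 hu with h | h
        · exact P.Sms i l (Ne.symm hli) u (hNS h)
        · exact P.Wms l u (hQW u h).1)
      refine le_trans ?_ (card_le_card (s := F') ?_)
      · have a0 : (univ.filter (fun l : Fin r => l ≠ i)).card ≤ r := (card_le_univ _).trans (by simp)
        have a1 : ((univ.filter (fun l : Fin r => l ≠ i)).card : ℝ) * ω * ((⌊κ * n⌋₊ : ℕ) : ℝ) ≤ r * ω * (κ * n) := by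
          have : ((⌊κ * n⌋₊ : ℕ) : ℝ) ≤ κ * n := Nat.floor_le (by positivity)
          have a0' : ((univ.filter (fun l : Fin r => l ≠ i)).card : ℝ) ≤ r := by exact_mod_cast a0
          gcongr
        have a2 : (K.card : ℝ) * (κ * n) ≤ (((p:ℝ) + 1) * ω + σ) * (κ * n) := by gcongr
        have a3 := P.Sc l
        rw [← hnd] at a3
        have : ((univ.filter (fun l : Fin r => l ≠ i)).card : ℝ) * ω * ((⌊κ * n⌋₊ : ℕ) : ℝ) + Z.card + ω ≤ F'.card := by
          linarith
        exact_mod_cast this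
      · intro v hv
        simp only [mem_filter]
        exact ⟨hF1' hv, fun u hu => hF2' v hv u hu, fun l' _ _ u hu => by simp at hu⟩)
  have hcard : (univ.filter (fun l : Fin r => l ≠ i)).card = r - 1 := by
    rw [filter_ne', card_erase_of_mem (mem_univ _), card_univ, Fintype.card_fin]
  rw [hcard, show p + 1 + (r - 1) = p + r by omega] at hT
  refine ⟨_, hT, ?_, ?_, ?_⟩
  · rw [disjoint_left]
    intro v hv hvZ
    rcases mem_union.1 hv with hv | hv
    · rcases mem_union.1 hv with h | h
      · exact hNZ v h hvZ
      · exact (hQW v h).2 hvZ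
    · obtain ⟨l, hl, hl'⟩ := mem_biUnion.1 hv
      simp only [empty_union] at hl'
      exact disjoint_left.1 (hE l hl).2.1 hl' hvZ
  · rw [← hNc]
    congr 1
    ext v
    simp only [mem_inter, mem_sdiff]
    constructor
    · rintro ⟨hv, hvB, hvx⟩
      rcases mem_union.1 hv with hv | hv
      · rcases mem_union.1 hv with h | h
        · exact h
        · exact absurd (hQW v h).1 (disjoint_left.1 (P.BW i) hvB)
      · obtain ⟨l, hl, hl'⟩ := mem_biUnion.1 hv
        simp only [empty_union] at hl'
        exact absurd hvB (disjoint_left.1 (P.Bdis l i (mem_filter.1 hl).2) (P.SB l ((hE l hl).1 hl')))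
    · intro h
      exact ⟨mem_union_left _ (mem_union_left _ h), P.SB i (hNS h), fun hvx => hNZ v h (hIZ hvx)⟩
  · intro l hli
    have hl : l ∈ univ.filter (fun l : Fin r => l ≠ i) := mem_filter.2 ⟨mem_univ _, hli⟩
    have hEc := (hE l hl).2.2.2
    rw [card_empty, zero_add] at hEc
    rw [← hEc]
    congr 1
    ext v
    simp only [mem_inter, mem_sdiff]
    constructor
    · rintro ⟨hv, hvB, hvx⟩
      rcases mem_union.1 hv with hv | hv
      · rcases mem_union.1 hv with h | h
        · exact absurd hvB (disjoint_left.1 (P.Bdis i l (Ne.symm hli)) (P.SB i (hNS h)))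
        · exact absurd (hQW v h).1 (disjoint_left.1 (P.BW l) hvB)
      · obtain ⟨l', hl1, hl2⟩ := mem_biUnion.1 hv
        simp only [empty_union] at hl2
        by_cases hll : l' = l
        · rw [← hll]; exact hl2
        · exact absurd hvB (disjoint_left.1 (P.Bdis l' l hll) (P.SB l' ((hE l' hl1).1 hl2)))
    · intro h
      exact ⟨mem_union_right _ (mem_biUnion.2 ⟨l, hl, by simpa using h⟩), P.SB l ((hE l hl).1 h),
        fun hvx => disjoint_left.1 (hE l hl).2.1 h (hIZ hvx)⟩

end OBT

set_option linter.unusedVariables false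
set_option linter.unusedSectionVars false
namespace OBT
open scoped Classical
open Finset

lemma card_sdiff_biUnion {V J : Type} [Fintype J] (T : J → Finset V) (hd : ∀ i j, i ≠ j → Disjoint (T i) (T j)) (X : Finset V) :
    X.card = (X \ univ.biUnion T).card + ∑ j, (T j ∩ X).card := by
  have h1 := card_sdiff_add_card_inter X (univ.biUnion T)
  have h2 : X ∩ univ.biUnion T = univ.biUnion (fun j => T j ∩ X) := by
    ext v; simp only [mem_inter, mem_biUnion, mem_univ, true_and]
    tauto
  rw [h2, card_biUnion (fun i _ j _ hij => (hd i j hij).mono inter_subset_left inter_subset_left)] at h1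
  exact h1.symm

lemma asm_fin {V : Type} [Fintype V] {G : SimpleGraph V} {r : ℕ} {S B : Fin r → Finset V} {Ws A : Finset V}
    {β κ ξ : ℝ} (P : Prt G r S B Ws A β κ ξ) (hκ : 0 ≤ κ) (hκξ : κ ≤ ξ) {p σ ω h h' c C0 : ℕ}
    (hω : 1 ≤ ω) (hh : h = (p + r) * ω + σ) (hh' : h' = p * ω + σ) (hpos : 0 < h)
    (Bs : Fin r → Finset V) (hBs : ∀ l, Bs l ⊆ B l) {J : Type} [Fintype J] (T : J → Finset V)
    (hT : ∀ j, IsTile G (p + r) σ ω 1 (T j)) (hTd : ∀ i j, i ≠ j → Disjoint (T i) (T j))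
    (hlow : ∀ l, ω * Fintype.card V + h * ∑ j, (T j ∩ Bs l).card ≤ h * (Bs l).card + h * (ω * Fintype.card J) + c)
    (hRc : h' * Fintype.card V ≤ h * (Ws \ univ.biUnion T).card + h' * (h * Fintype.card J) + c)
    (ht : ∀ q, h' * q + C0 ≤ (Ws \ univ.biUnion T).card → HasTiles G p σ ω 1 q (Ws \ univ.biUnion T))
    (h0 : h' = 0 → C0 = 0)
    (hbig : ∀ l, (1 + ω) * ((h + 1 : ℕ) * (2 * ξ * Fintype.card V)) ≤ (Bs l \ univ.biUnion T).card) :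
    ∃ q, HasTiles G (p + r) σ ω 1 q univ ∧ Fintype.card V ≤ h * q + h * (c + C0 + 1) := by
  have hTc : ∀ j, (T j).card = h := fun j => by rw [(hT j).card, mul_one, hh]
  have hUn : (univ.biUnion T).card = h * Fintype.card J := by
    rw [card_biUnion (fun i _ j _ hij => hTd i j hij)]
    simp [hTc, mul_comm]
  have hUnle : h * Fintype.card J ≤ Fintype.card V := by rw [← hUn]; exact card_le_univ _
  obtain ⟨m, hm⟩ := Nat.exists_eq_add_of_le hUnle
  obtain ⟨q, hq, hqm⟩ := P.fin (a := p) (σ := σ) (ω := ω) (H := h + 1) (h := h) (h' := h') (c := c) (C0 := C0) (m := m)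
    hκ hκξ (R := Ws \ univ.biUnion T) (fun l => Bs l \ univ.biUnion T) sdiff_subset
    (fun l => sdiff_subset.trans (hBs l)) hω hh hh' hpos ht h0 (by
      intro l
      have h1 := hlow l
      have h2 := card_sdiff_biUnion T hTd (Bs l)
      rw [hm] at h1
      rw [h2] at h1
      have e1 : ω * (h * Fintype.card J + m) = h * (ω * Fintype.card J) + ω * m := by ring
      have e2 : ∀ a b : ℕ, h * (a + b) = h * a + h * b := fun a b => mul_add _ _ _
      rw [e1, e2] at h1
      omega) (by
      rw [hm, mul_add] at hRc
      omega) (by omega) hbig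
  refine ⟨Fintype.card J + q, ?_, ?_⟩
  · have h1 : HasTiles G (p + r) σ ω 1 (Fintype.card J) (univ.biUnion T) :=
      HasTiles.of_fintype T (fun j => ⟨hT j, subset_biUnion_of_mem T (mem_univ j)⟩) hTd
    refine (h1.add hq ?_).mono (subset_univ _)
    rw [disjoint_left]
    intro v hv hv'
    rcases mem_union.1 hv' with h | h
    · exact (mem_sdiff.1 h).2 hv
    · obtain ⟨l, _, hl⟩ := mem_biUnion.1 h
      exact (mem_sdiff.1 hl).2 hv
  · rw [hm, mul_add]; omega

/-- tiles inside the remainder -/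
lemma inner_tiles (p σ ω r : ℕ) (hω : 1 ≤ ω) (hσ : σ < ω) (hpos : 0 < p * ω + σ) (g β : ℝ) (hg0 : 0 < g)
    (hβ : β = ω * g) (η : ℝ) (hη : 0 < η) :
    ∃ δ : ℝ, 0 < δ ∧ ∃ C0 n0 : ℕ, ∀ (V : Type) [Fintype V] (G : SimpleGraph V) (A R : Finset V),
      n0 ≤ Fintype.card V → (∀ u ∈ A, ∀ v ∈ A, u ≠ v → G.Adj u v) →
      (∀ v, v ∉ A → (ms G v univ : ℝ) ≤ β * Fintype.card V) →
      (∀ U ⊆ R, (β - η) * Fintype.card V ≤ U.card → η * (Fintype.card V : ℝ)^2 ≤ ((∑ u ∈ U, (nb G u U).card : ℕ) : ℝ)) →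
      (((p * ω + σ : ℕ) : ℝ) * g - δ) * Fintype.card V ≤ R.card →
      ∀ q, (p * ω + σ) * q + C0 ≤ R.card → HasTiles G p σ ω 1 q R := by
  rcases Nat.eq_zero_or_pos p with hp | hp
  · subst hp
    refine ⟨1, one_pos, 0, 0, ?_⟩
    intro V _ G A R _ _ _ _ _ q hq
    obtain ⟨f, hf, hfd⟩ := exists_disj_family (univ : Finset (Fin q)) (fun _ => σ) R (by
      simp only [sum_const, card_univ, Fintype.card_fin, smul_eq_mul]
      rw [mul_comm]; simpa using hq)
    exact ⟨f, fun i => ⟨neck_tile G σ ω _ (hf i (mem_univ _)).2, (hf i (mem_univ _)).1⟩,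
      fun i j hij => hfd i (mem_univ _) j (mem_univ _) hij⟩
  obtain ⟨ε, hε, C0, n1, hNE⟩ := NE p σ ω hp hσ (η/2) (by positivity)
  set h' : ℝ := (p:ℝ) * ω + σ with hh'
  have hh'0 : 0 < h' := by rw [hh']; exact_mod_cast hpos
  have hωR : (1:ℝ) ≤ ω := by exact_mod_cast hω
  have hh'1 : 1 ≤ h' := by rw [hh']; exact_mod_cast hpos
  set a : ℝ := (ω:ℝ) / h' with ha
  have ha0 : 0 < a := by positivity
  obtain ⟨δ, hδ, hδ1, hδ2, hδ3⟩ : ∃ δ : ℝ, 0 < δ ∧ (a + ε) * δ ≤ ε * (h' * g) ∧ a * δ ≤ η / 2 ∧ δ ≤ h' * g / 2 := by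
    refine ⟨min (min (ε * (h' * g) / (a + ε)) (η / 2 / a)) (h' * g / 2), by positivity, ?_, ?_, min_le_right _ _⟩
    · have h1 := (min_le_left (min (ε * (h' * g) / (a + ε)) (η / 2 / a)) (h' * g / 2)).trans (min_le_left _ _)
      have h2 := mul_le_mul_of_nonneg_left h1 (by positivity : 0 ≤ a + ε)
      rwa [mul_div_cancel₀ _ (by positivity)] at h2
    · have h1 := (min_le_left (min (ε * (h' * g) / (a + ε)) (η / 2 / a)) (h' * g / 2)).trans (min_le_right _ _)
      have h2 := mul_le_mul_of_nonneg_left h1 ha0.le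
      rwa [mul_div_cancel₀ _ (by positivity)] at h2
  obtain ⟨n2, hn2⟩ := exists_nat_ge ((n1:ℝ) / (h' * g / 2))
  rw [div_le_iff₀ (by positivity)] at hn2
  refine ⟨δ, hδ, C0, n2, ?_⟩
  intro V _ G A R hn0 hA hms hne hR q hq
  set n : ℝ := (Fintype.card V : ℝ) with hnd
  have hn : 0 ≤ n := by positivity
  have hnn : (n2 : ℝ) ≤ n := by rw [hnd]; exact_mod_cast hn0
  have hR' : (h' * g - δ) * n ≤ R.card := by
    refine le_trans (le_of_eq ?_) hR
    push_cast; rfl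
  have hRn : (R.card : ℝ) ≤ n := by rw [hnd]; exact_mod_cast card_le_univ R
  have hah : a * h' = ω := by rw [ha]; field_simp
  have hahg : a * (h' * g) = β := by rw [← mul_assoc, hah, hβ]
  have k1 : (a + ε) * ((h' * g - δ) * n) ≤ (a + ε) * R.card := by gcongr
  have k2 : (a + ε) * ((h' * g - δ) * n) = (β + (ε * (h' * g) - (a + ε) * δ)) * n := by rw [← hahg]; ring
  have k3 : 0 ≤ (ε * (h' * g) - (a + ε) * δ) * n := mul_nonneg (by linarith) hn
  have k4 : a * ((h' * g - δ) * n) ≤ a * R.card := by gcongr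
  have k5 : a * ((h' * g - δ) * n) = β * n - (a * δ) * n := by rw [← hahg]; ring
  have k6 : (a * δ) * n ≤ (η / 2) * n := by gcongr
  obtain ⟨q0, hq0, hq1⟩ := hNE V G R A hA (by
      intro v hv hvA
      have h1 : (ms G v R : ℝ) ≤ β * n := le_trans (by exact_mod_cast ms_mono (subset_univ _)) (hms v hvA)
      linarith) (by
      intro U hU hUc
      have h1 : η / 2 * (R.card:ℝ) ≤ η / 2 * n := by gcongr
      have h2 := hne U hU (by linarith)
      have h3 : (R.card:ℝ)^2 ≤ n^2 := by gcongr
      have h4 : η / 2 * (R.card:ℝ)^2 ≤ η / 2 * n^2 := by gcongr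
      have h5 : 0 ≤ η / 2 * n^2 := by positivity
      linarith) (by
      have h1 : (h' * g / 2) * n ≤ (h' * g - δ) * n := by
        have : h' * g / 2 ≤ h' * g - δ := by linarith
        gcongr
      have h2 : (n2:ℝ) * (h' * g / 2) ≤ n * (h' * g / 2) := by gcongr
      have : (n1:ℝ) ≤ R.card := by linarith
      exact_mod_cast this)
  refine hq0.le ?_
  have : (p * ω + σ) * q ≤ (p * ω + σ) * q0 := by omega
  exact Nat.le_of_mul_le_mul_left this hpos

end OBT

set_option linter.unusedVariables false
set_option linter.unusedSectionVars false
namespace OBT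
open scoped Classical
open Finset

lemma params1 (b h ω r : ℕ) (hωh : ω ≤ h) (hb : 1 ≤ b) (hrb : r * ω ≤ b) (τ : ℝ) (hτ : 0 < τ) :
    ∃ ξ κ : ℝ, 0 < κ ∧ κ ≤ ξ ∧ ξ ≤ τ ∧
      (2 * r + 2) * κ + b * (1 + 3 * r) * κ + 2 * r * ω * ξ ≤ τ ∧
      b * κ + b * (1 + 3 * r) * κ ≤ ξ ∧
      κ + 2 * ξ + (h + r * ω) * (2 * ξ) + r * ω * κ + b * (1 + 3 * r) * κ + κ ≤ τ ∧
      (2 * r + 1) * κ + h * (1 + 3 * r) * κ ≤ τ ∧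
      (2 * r + 1) * κ + b * (1 + 3 * r) * κ ≤ τ ∧
      (6 * ω + 8) * ξ + κ + 2 * ξ ≤ τ ∧
      (1 + ω) * ((h + 1) * (2 * ξ)) + κ + ω * (1 + 3 * r) * κ ≤ τ := by
  set L : ℝ := b + b * (1 + 3 * r) + (2 * r + 2) + h * (1 + 3 * r) with hL
  have hbR : (1:ℝ) ≤ b := by exact_mod_cast hb
  have hωhR : (ω:ℝ) ≤ h := by exact_mod_cast hωh
  have hrbR : (r:ℝ) * ω ≤ b := by exact_mod_cast hrb
  have hr0 : (0:ℝ) ≤ r := by positivity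
  have hω0 : (0:ℝ) ≤ ω := by positivity
  have hh0 : (0:ℝ) ≤ h := by positivity
  have hL1 : 1 ≤ L := by
    have : (0:ℝ) ≤ b * (1 + 3 * r) := by positivity
    have : (0:ℝ) ≤ h * (1 + 3 * r) := by positivity
    linarith
  set M : ℝ := 20 + 2 * r * ω + 2 * (h + r * ω) + 6 * ω + 2 * (1 + ω) * (h + 1) with hM
  have hM1 : 1 ≤ M := by
    have : (0:ℝ) ≤ 2 * r * ω := by positivity
    have : (0:ℝ) ≤ 2 * (h + r * ω) := by positivity
    have : (0:ℝ) ≤ 2 * (1 + ω) * (h + 1) := by positivity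
    linarith
  have hM0 : 0 < M := by linarith
  have hL0 : 0 < L := by linarith
  have hξ : 0 < τ / M := by positivity
  have hκ : 0 < τ / M / L := by positivity
  have e1 : M * (τ / M) = τ := by field_simp
  have e2 : L * (τ / M / L) = τ / M := by field_simp
  generalize τ / M / L = κ at *
  generalize τ / M = ξ at *
  have x1 : 0 ≤ (r:ℝ) * ω * ξ := by positivity
  have x2 : 0 ≤ (h:ℝ) * ξ := by positivity
  have x3 : 0 ≤ (ω:ℝ) * ξ := by positivity
  have x4 : 0 ≤ (ω:ℝ) * h * ξ := by positivity
  have y1 : 1 * κ ≤ b * κ := by gcongr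
  have y2 : 0 ≤ (r:ℝ) * κ := by positivity
  have y3 : 0 ≤ (b:ℝ) * r * κ := by positivity
  have y4 : 0 ≤ (h:ℝ) * κ := by positivity
  have y5 : 0 ≤ (h:ℝ) * r * κ := by positivity
  have y6 : (ω:ℝ) * κ ≤ h * κ := by gcongr
  have y7 : (ω:ℝ) * r * κ ≤ h * r * κ := by gcongr
  have y8 : (r:ℝ) * ω * κ ≤ b * κ := by gcongr
  have E1 : 20 * ξ + 4 * (r * ω * ξ) + 2 * (h * ξ) + 6 * (ω * ξ) + 2 * (ξ + ω * ξ + h * ξ + ω * h * ξ) = τ := by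
    rw [← e1, hM]; ring
  have E2 : b * κ + (b * κ + 3 * (b * r * κ)) + 2 * (r * κ) + 2 * κ + (h * κ + 3 * (h * r * κ)) = ξ := by
    rw [← e2, hL]; ring
  refine ⟨ξ, κ, hκ, ?_, ?_, ?_, ?_, ?_, ?_, ?_, ?_, ?_⟩ <;> linarith

lemma floor_facts (s : ℝ) (d : ℕ) (hd : 1 ≤ d) :
    s < (⌊s / d⌋₊ + 1 : ℝ) * d ∧ ((⌊s / d⌋₊ : ℕ) : ℝ) * d ≤ max s 0 ∧ ((⌊s / d⌋₊ : ℕ) : ℝ) ≤ max s 0 := by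
  have hdR : (1:ℝ) ≤ d := by exact_mod_cast hd
  have h1 : s / d < ⌊s / d⌋₊ + 1 := Nat.lt_floor_add_one _
  have h2 : ((⌊s / d⌋₊ : ℕ) : ℝ) * d ≤ max s 0 := by
    by_cases hs : 0 ≤ s
    · have := Nat.floor_le (div_nonneg hs (by positivity : (0:ℝ) ≤ d))
      rw [le_div_iff₀ (by positivity)] at this
      exact this.trans (le_max_left _ _)
    · push Not at hs
      have : ⌊s / d⌋₊ = 0 := Nat.floor_of_nonpos (div_nonpos_of_nonpos_of_nonneg hs.le (by positivity))
      rw [this]; simp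
  refine ⟨?_, h2, le_trans ?_ h2⟩
  · rwa [div_lt_iff₀ (by positivity)] at h1
  · nlinarith [(Nat.cast_nonneg ⌊s / (d:ℝ)⌋₊ : (0:ℝ) ≤ _)]

lemma asm1 (p σ ω r : ℕ) (hω : 1 ≤ ω) (hσ : σ < ω) (hpos : 0 < p * ω + σ) (hpr : 1 ≤ p + r) (g β : ℝ) (hg0 : 0 < g)
    (hg : ((p + r) * ω + σ : ℝ) * g = 1) (hβ : β = ω * g) (η : ℝ) (hη : 0 < η) (ξ0 : ℝ) (hξ0 : 0 < ξ0) :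
    ∃ ξ κ : ℝ, 0 < κ ∧ κ ≤ ξ ∧ ξ ≤ ξ0 ∧ ∃ C n0 : ℕ, ∀ (V : Type) [Fintype V] (G : SimpleGraph V)
      (S B : Fin r → Finset V) (Ws A : Finset V), n0 ≤ Fintype.card V → Prt G r S B Ws A β κ ξ →
      (∀ U ⊆ Ws, (β - η) * Fintype.card V ≤ U.card → η * (Fintype.card V : ℝ)^2 ≤ ((∑ u ∈ U, (nb G u U).card : ℕ) : ℝ)) →
      ∃ q, HasTiles G (p + r) σ ω 1 q univ ∧ Fintype.card V ≤ ((p + r) * ω + σ) * q + C := by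
  obtain ⟨n1, hhub⟩ := hubtile p σ ω r hω hσ.le hpos hpr g β hg0 hg hβ
  obtain ⟨ζ, hζ, n2, hsc⟩ := short_cells p σ ω r hω hσ.le hpos hpr g β hg0 hg hβ η hη
  obtain ⟨δ, hδ, C0, n3, hin⟩ := inner_tiles p σ ω r hω hσ hpos g β hg0 hβ η hη
  obtain ⟨h, hh⟩ : ∃ h, h = (p + r) * ω + σ := ⟨_, rfl⟩
  rw [← hh] at hhub
  have hhR : (h:ℝ) = (p + r) * ω + σ := by rw [hh]; push_cast; ring
  have hωR : (1:ℝ) ≤ ω := by exact_mod_cast hω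
  have hβ0 : 0 < β := by rw [hβ]; positivity
  have hωh : ω ≤ h := by rw [hh]; nlinarith
  obtain ⟨b, hbd⟩ : ∃ b, b = h + r * ω + 1 := ⟨_, rfl⟩
  set τ := min (min (min β (3 / 4 * g)) (min ζ δ)) ξ0 with hτd
  have hτ : 0 < τ := by positivity
  have t1 : τ ≤ β := (min_le_left _ _).trans ((min_le_left _ _).trans (min_le_left _ _))
  have t2 : τ ≤ 3 / 4 * g := (min_le_left _ _).trans ((min_le_left _ _).trans (min_le_right _ _))
  have t3 : τ ≤ ζ := (min_le_left _ _).trans ((min_le_right _ _).trans (min_le_left _ _))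
  have t4 : τ ≤ δ := (min_le_left _ _).trans ((min_le_right _ _).trans (min_le_right _ _))
  have t5 : τ ≤ ξ0 := min_le_right _ _
  obtain ⟨ξ, κ, hκ, hκξ, hξτ, q1, q2, q3, q4, q5, q6, q7⟩ := params1 b h ω r hωh (by omega) (by omega) τ hτ
  obtain ⟨n4, hn4⟩ := exists_nat_ge ((ω:ℝ) / κ)
  rw [div_le_iff₀ hκ] at hn4
  refine ⟨ξ, κ, hκ, hκξ, hξτ.trans t5, h * (2 * (r + 1) * (h * ω) + C0 + 1), n1 + n2 + n3 + n4, ?_⟩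
  intro V _ G S B Ws A hn0 P hne
  set n : ℝ := (Fintype.card V : ℝ) with hnd
  have hn : 0 ≤ n := by positivity
  have hκn : 0 ≤ κ * n := by positivity
  have hκξn : κ * n ≤ ξ * n := by gcongr
  have hωκ : (ω:ℝ) ≤ κ * n := by
    have : (n4:ℝ) ≤ n := by rw [hnd]; exact_mod_cast (by omega : n4 ≤ Fintype.card V)
    have : (n4:ℝ) * κ ≤ n * κ := by gcongr
    linarith
  have hβn : (h:ℝ) * (β * n) = ω * n := by
    have : (h:ℝ) * (β * n) = (h * g) * (ω * n) := by rw [hβ]; ring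
    rw [this, hhR, hg, one_mul]
  obtain ⟨J1, _, x, Y, Jb⟩ := P.jobs hβ0.le hκ.le hκξ hω (by
    rw [← hnd]
    have a1 := mul_le_mul_of_nonneg_right (q6.trans t1) hn
    linarith)
  set lam : ℝ := b * (1 + 3 * r) * κ with hlam
  set Bs : Fin r → Finset V := fun l => B l \ univ.image x with hBs
  obtain ⟨d, hd⟩ : ∃ d, d = ω - σ := ⟨_, rfl⟩
  have hd1 : 1 ≤ d := by omega
  set y : Fin r → ℕ := fun l => ⌊(β * n - (Bs l).card) / d⌋₊ with hy
  have hyf : ∀ l, β * n < (Bs l).card + ((y l:ℝ) + 1) * d ∧ ((Bs l).card : ℝ) + y l * d ≤ β * n + 2 * ω ∧ (y l : ℝ) ≤ κ * n := by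
    intro l
    obtain ⟨f1, f2, f3⟩ := floor_facts (β * n - (Bs l).card) d hd1
    have u1 := Jb.up l
    have u2 := Jb.lo2 l
    rw [← hnd] at u1 u2
    refine ⟨by linarith, ?_, ?_⟩
    · rcases le_total 0 (β * n - (Bs l).card) with hc | hc
      · rw [max_eq_left hc] at f2
        linarith
      · rw [max_eq_right hc] at f2
        linarith
    · refine f3.trans (max_le ?_ hκn)
      linarith
  let J := J1 ⊕ (Σ i : Fin r, Fin (y i))
  have hJc : (Fintype.card J : ℝ) ≤ (1 + 3 * r) * (κ * n) := by
    have e : Fintype.card J = Fintype.card J1 + ∑ i, y i := by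
      simp [J, Fintype.card_sum, Fintype.card_sigma]
    rw [e]
    push_cast
    have : ∑ i, (y i : ℝ) ≤ ∑ i : Fin r, κ * n := sum_le_sum fun i _ => (hyf i).2.2
    simp only [sum_const, card_univ, Fintype.card_fin, nsmul_eq_mul] at this
    have := Jb.cJ
    rw [← hnd] at this
    linarith
  let X : J → Finset V := Sum.elim (fun j => insert (x j) (univ.biUnion (Y j))) (fun _ => ∅)
  let cnt : J → Fin r → ℕ := Sum.elim (fun _ _ => ω) (fun i l => if l = i.1 then σ else ω)
  have hbR : (b:ℝ) = h + r * ω + 1 := by rw [hbd]; push_cast; ring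
  have hnum2 : ((h:ℝ) + r * ω + 1) * κ + lam ≤ ξ := by rw [← hbR]; exact q2
  obtain ⟨T, hTF, hTd⟩ := greedy X (fun j T => IsTile G (p + r) σ ω 1 T ∧ X j ⊆ T ∧ ∀ l, (T ∩ Bs l).card = cnt j l) b
    (by
      rintro (j | j)
      · have h1 := card_biUnion_le_card_mul (univ : Finset (Fin r)) (Y j) ω (fun l _ => by
          rcases Jb.Yc j l with h | h
          · rw [h]; simp
          · exact h.le)
        rw [card_univ, Fintype.card_fin] at h1
        have h2 := card_insert_le (x j) (univ.biUnion (Y j))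
        show (insert (x j) (univ.biUnion (Y j))).card ≤ b
        omega
      · simp [X])
    (by
      rintro (i | i) (j | j) hij
      · exact Jb.dis i j (fun h => hij (by rw [h]))
      · simp [X]
      · simp [X]
      · simp [X])
    (by
      intro j Z hZ hZX hXZ
      have hZR : (Z.card : ℝ) ≤ lam * n := by
        have a1 : (Z.card : ℝ) ≤ b * Fintype.card J := by exact_mod_cast hZ
        have a2 : (b:ℝ) * Fintype.card J ≤ b * ((1 + 3 * r) * (κ * n)) := by gcongr
        have a3 : (b:ℝ) * ((1 + 3 * r) * (κ * n)) = lam * n := by rw [hlam]; ring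
        linarith
      rcases j with j | ⟨i, k⟩
      · obtain ⟨T, h1, h2, h3, h4⟩ := hhub V G S B Ws A κ ξ lam J1 x Y (by omega) P Jb hκ.le hκξ (q1.trans t2) hnum2
          (q3.trans t1) hωκ j Z hZR hZX (fun i hi => hXZ (Sum.inl i) (fun h => hi (Sum.inl_injective h)))
        exact ⟨T, ⟨h1, h2, h4⟩, h2, by rw [h1.card]; omega, h3⟩
      · obtain ⟨Q, hQ, hQQ⟩ := hsc V G S B Ws A κ ξ lam (by omega) P hκ.le hne (q5.trans t3) Z hZR
        obtain ⟨T, h1, h2, h3, h4⟩ := shorttile p σ ω r hω hσ.le β V G S B Ws A κ ξ lam P hκ.le hκξ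
          (by rw [← hh]; exact q3.trans t1) hωκ Z (univ.image x) hZR (by
            intro v hv
            obtain ⟨i', _, rfl⟩ := mem_image.1 hv
            exact hXZ (Sum.inl i') (by simp) (mem_insert_self _ _)) Q hQ hQQ i
        refine ⟨T, ⟨h1, by simp [X], ?_⟩, by simp [X], by rw [h1.card]; omega, h2⟩
        intro l
        by_cases hl : l = i
        · subst hl
          simpa [cnt] using h3
        · simpa [cnt, hl] using h4 l hl)
  have hcs : ∀ l, ∑ j, (T j ∩ Bs l).card + y l * d = ω * Fintype.card J := by
    intro l
    have e1 : ∑ j, (T j ∩ Bs l).card = ∑ j, cnt j l := sum_congr rfl fun j _ => (hTF j).2.2 l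
    rw [e1]
    have e2 : Fintype.card J = Fintype.card J1 + ∑ i, y i := by
      simp [J, Fintype.card_sum, Fintype.card_sigma]
    rw [e2]
    have e3 : ∑ j, cnt j l = Fintype.card J1 * ω + ∑ i, y i * (if l = i then σ else ω) := by
      have e5 : ∑ j, cnt j l = ∑ j : J1, cnt (Sum.inl j) l + ∑ j : (Σ i : Fin r, Fin (y i)), cnt (Sum.inr j) l :=
        Fintype.sum_sum_type _
      rw [e5, Fintype.sum_sigma]
      simp only [cnt, Sum.elim_inl, Sum.elim_inr, sum_const, card_univ, smul_eq_mul]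
      congr 1
      refine sum_congr rfl fun i _ => ?_
      by_cases hli : l = i
      · simp only [hli, if_true, sum_const, card_univ, Fintype.card_fin, smul_eq_mul]
      · simp only [hli, if_false, sum_const, card_univ, Fintype.card_fin, smul_eq_mul]
    rw [e3]
    have e4 : ∑ i, y i * (if l = i then σ else ω) + y l * d = ∑ i, y i * ω := by
      rw [← add_sum_erase _ _ (mem_univ l), ← add_sum_erase _ (fun i => y i * ω) (mem_univ l)]
      have : ∑ i ∈ univ.erase l, y i * (if l = i then σ else ω) = ∑ i ∈ univ.erase l, y i * ω :=
        sum_congr rfl fun i hi => by rw [if_neg (fun h => (mem_erase.1 hi).1 h.symm)]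
      rw [this, if_pos rfl]
      have : y l * ω = y l * σ + y l * d := by rw [← mul_add]; congr 1; omega
      omega
    rw [mul_add, mul_sum]
    have : ∑ i, ω * y i = ∑ i, y i * ω := sum_congr rfl fun i _ => mul_comm _ _
    rw [this, ← e4]
    ring
  have hUn : (univ.biUnion T).card = h * Fintype.card J := by
    rw [card_biUnion (fun i _ j _ hij => hTd i j hij)]
    have e0 : ∀ j, (T j).card = h := fun j => by rw [(hTF j).1.card, mul_one, hh]
    simp [e0, mul_comm]
  have hdω : d ≤ ω := by omega
  have hhpos : 0 < h := by omega
  -- sizes of the leftovers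
  have hYup : ∀ l, h * (Bs l \ univ.biUnion T).card + h * (ω * Fintype.card J) ≤ ω * Fintype.card V + 2 * (h * ω) := by
    intro l
    have a1 := card_sdiff_biUnion T hTd (Bs l)
    have a2 := hcs l
    have a3 := (hyf l).2.1
    have a4 : (h:ℝ) * ((Bs l).card + y l * d) ≤ h * (β * n + 2 * ω) := by gcongr
    have a5 : (h:ℝ) * ((Bs l).card + y l * d) ≤ ω * n + 2 * (h * ω) := by
      rw [mul_add (h:ℝ) (β * n), hβn] at a4; linarith
    have a6 : h * ((Bs l).card + y l * d) ≤ ω * Fintype.card V + 2 * (h * ω) := by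
      rw [hnd] at a5; exact_mod_cast a5
    refine le_trans (le_of_eq ?_) a6
    rw [← a2, a1]; ring
  have hcov : Fintype.card V ≤ (Ws \ univ.biUnion T).card + ∑ l, (Bs l \ univ.biUnion T).card + h * Fintype.card J := by
    have c1 : (univ : Finset V) ⊆ (Ws \ univ.biUnion T) ∪ (univ.biUnion (fun l => Bs l \ univ.biUnion T)) ∪ univ.biUnion T := by
      intro v _
      by_cases hv : v ∈ univ.biUnion T
      · exact mem_union_right _ hv
      · refine mem_union_left _ ?_
        rcases Jb.cov v with h | ⟨j, hj⟩ | ⟨l, hl⟩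
        · exact mem_union_left _ (mem_sdiff.2 ⟨h, hv⟩)
        · exact absurd (mem_biUnion.2 ⟨Sum.inl j, mem_univ _, (hTF (Sum.inl j)).2.1 (hj ▸ mem_insert_self _ _)⟩) hv
        · refine mem_union_right _ (mem_biUnion.2 ⟨l, mem_univ _, mem_sdiff.2 ⟨mem_sdiff.2 ⟨hl, fun hx => ?_⟩, hv⟩⟩)
          obtain ⟨j, _, hj⟩ := mem_image.1 hx
          exact absurd (mem_biUnion.2 ⟨Sum.inl j, mem_univ _, (hTF (Sum.inl j)).2.1 (hj ▸ mem_insert_self _ _)⟩) hv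
    have c2 := (card_le_card c1).trans (card_union_le _ _)
    have c3 := card_union_le (Ws \ univ.biUnion T) (univ.biUnion (fun l => Bs l \ univ.biUnion T))
    have c4 : (univ.biUnion (fun l => Bs l \ univ.biUnion T)).card ≤ ∑ l, (Bs l \ univ.biUnion T).card := card_biUnion_le
    rw [card_univ] at c2
    omega
  have := asm_fin P hκ.le hκξ (p := p) (σ := σ) (ω := ω) (h := h) (h' := p * ω + σ) (c := 2 * (r + 1) * (h * ω)) (C0 := C0)
    hω hh rfl hhpos Bs (fun l => sdiff_subset) T (fun j => (hTF j).1) hTd (by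
      intro l
      have a1 := (hyf l).1
      have a2 : (h:ℝ) * (β * n) ≤ h * ((Bs l).card + ((y l:ℝ) + 1) * d) := by gcongr
      rw [hβn] at a2
      have a3 : ω * Fintype.card V ≤ h * ((Bs l).card + (y l + 1) * d) := by
        rw [hnd] at a2; exact_mod_cast a2
      have a4 := hcs l
      have a5 : h * d ≤ h * ω := Nat.mul_le_mul_left _ hdω
      have a6 : h * ω ≤ 2 * (r + 1) * (h * ω) := Nat.le_mul_of_pos_left _ (by positivity)
      rw [← a4]
      have e1 : h * ((Bs l).card + (y l + 1) * d) = h * (Bs l).card + h * (y l * d) + h * d := by ring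
      rw [mul_add h]
      omega) (by
      have a1 : ∑ l : Fin r, (h * (Bs l \ univ.biUnion T).card + h * (ω * Fintype.card J)) ≤
        ∑ l : Fin r, (ω * Fintype.card V + 2 * (h * ω)) := sum_le_sum fun l _ => hYup l
      rw [sum_add_distrib, ← mul_sum] at a1
      simp only [sum_const, card_univ, Fintype.card_fin, smul_eq_mul] at a1
      have a2 := Nat.mul_le_mul_left h hcov
      have a3 : h = (p * ω + σ) + r * ω := by rw [hh]; ring
      have a4 : h * Fintype.card V = (p * ω + σ) * Fintype.card V + r * (ω * Fintype.card V) := by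
        conv_lhs => rw [a3]
        ring
      have a5 : h * (h * Fintype.card J) = (p * ω + σ) * (h * Fintype.card J) + r * (ω * (h * Fintype.card J)) := by
        generalize h * Fintype.card J = w
        conv_lhs => rw [a3]
        ring
      have a7 : ω * (h * Fintype.card J) = h * (ω * Fintype.card J) := by ring
      rw [a4, mul_add, mul_add, a5, a7] at a2
      have a6 : 2 * (r + 1) * (h * ω) = r * (2 * (h * ω)) + 2 * (h * ω) := by ring
      rw [a6]
      rw [mul_add] at a1
      omega) (by
      refine hin V G A _ (by omega) P.clique P.msA (fun U hU => hne U (hU.trans sdiff_subset)) ?_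
      have b1 : (Ws.card : ℝ) ≤ (Ws \ univ.biUnion T).card + (univ.biUnion T).card := by
        exact_mod_cast card_le_card_sdiff_add_card (s := Ws) (t := univ.biUnion T)
      have b2 := P.Wsc2 hβ hg
      have b3 : ((univ.biUnion T).card : ℝ) ≤ h * ((1 + 3 * r) * (κ * n)) := by
        rw [hUn]; push_cast; gcongr
      have b4 := mul_le_mul_of_nonneg_right (q4.trans t4) hn
      rw [← hnd] at b2 ⊢
      push_cast
      linarith) (by intro h; omega) (by
      intro l
      have b1 := card_sdiff_biUnion T hTd (Bs l)
      have b2 := hcs l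
      have b3 : (Bs l).card ≤ (Bs l \ univ.biUnion T).card + ω * Fintype.card J := by omega
      have b3' : ((Bs l).card : ℝ) ≤ (Bs l \ univ.biUnion T).card + ω * Fintype.card J := by exact_mod_cast b3
      have b4 : (ω:ℝ) * Fintype.card J ≤ ω * ((1 + 3 * r) * (κ * n)) := by gcongr
      have b5 := mul_le_mul_of_nonneg_right (q7.trans t1) hn
      have b6 := Jb.lo2 l
      rw [← hnd] at b6 ⊢
      push_cast
      linarith)
  rw [← hh]
  exact this

end OBT

set_option linter.unusedVariables false
set_option linter.unusedSectionVars false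
namespace OBT
open scoped Classical
open Finset

lemma hub0 {V : Type} [Fintype V] {G : SimpleGraph V} {r : ℕ} {S B : Fin r → Finset V} {Ws A : Finset V}
    {β κ ξ lam : ℝ} (P : Prt G r S B Ws A β κ ξ) {ω h : ℕ} (hω : 1 ≤ ω) {Z I : Finset V} {x : V} {Y : Fin r → Finset V}
    (hκ : 0 ≤ κ) (hκξ : κ ≤ ξ)
    (hYB : ∀ l, Y l ⊆ B l) (hYc : ∀ l, Y l = ∅ ∨ (Y l).card = ω) (hYadj : ∀ l, ∀ u ∈ Y l, G.Adj x u)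
    (hY1 : ∀ l l', l ≠ l' → Y l = ∅ ∨ Y l' = ∅)
    (hdeg : ∀ l, Y l = ∅ → ((∀ l', Y l' = ∅) ∧ ξ * Fintype.card V ≤ (nb G x (S l)).card) ∨
      (β - κ - 2 * ξ) * Fintype.card V ≤ (nb G x (S l)).card)
    (t : Fin r) (ht : Y t = ∅) (hxI : x ∈ I ∨ ∀ l, x ∉ B l)
    (hZ : (Z.card : ℝ) ≤ lam * Fintype.card V)
    (h2 : (h + r * ω + 1) * κ + lam ≤ ξ)
    (h3 : κ + 2 * ξ + (h + r * ω) * (2 * ξ) + r * ω * κ + lam + κ ≤ β)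
    (h4 : (ω : ℝ) ≤ κ * Fintype.card V) (hZX : Disjoint Z (insert x (univ.biUnion Y))) :
    ∃ T, IsTile G (0 + r) 0 ω 1 T ∧ insert x (univ.biUnion Y) ⊆ T ∧ Disjoint T Z ∧
      ∀ l, (T ∩ (B l \ I)).card + (if l = t then 1 else 0) ≤ ω := by
  have hxY : ∀ l, x ∉ Y l := fun l h => G.irrefl (hYadj l x h)
  let Y' : Fin r → Finset V := fun l => if l = t then {x} else Y l
  have hY't : Y' t = {x} := by simp [Y']
  have hY'n : ∀ l, l ≠ t → Y' l = Y l := fun l hl => by simp [Y', hl]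
  have hYle : ∀ l, (Y l).card ≤ ω := fun l => by
    rcases hYc l with h | h
    · rw [h]; simp
    · exact h.le
  obtain ⟨E, hE, hT⟩ := hubcomplete (lam := lam) (H := h) (Z := Z) (x := x) (Y := Y') (p := 0) (σ := 0) (ω := ω) (K := ∅) P hκ
    (hκ.trans hκξ) (neck_tile G 0 ω ∅ rfl) (empty_subset _) (by simp)
    (fun l => by
      by_cases hl : l = t
      · rw [hl, hY't]; simpa using hω
      · rw [hY'n l hl]; exact hYle l)
    (fun l => by
      by_cases hl : l = t
      · rw [hl, hY't]; simp
      · rw [hY'n l hl]; exact (hYB l).trans (subset_insert _ _))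
    (fun l u hu => by simp at hu)
    (fun l l' hne u hu v hv => by
      by_cases hl : l = t
      · have hl' : l' ≠ t := fun h => hne (hl.trans h.symm)
        rw [hl, hY't, mem_singleton] at hu
        rw [hY'n l' hl'] at hv
        rw [hu]; exact hYadj l' v hv
      · rw [hY'n l hl] at hu
        by_cases hl' : l' = t
        · rw [hl', hY't, mem_singleton] at hv
          rw [hv]; exact (hYadj l u hu).symm
        · rw [hY'n l' hl'] at hv
          rcases hY1 l l' hne with h | h
          · rw [h] at hu; simp at hu
          · rw [h] at hv; simp at hv)
    (fun l hlt => by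
      by_cases hl : l = t
      · refine Or.inr (Or.inr ⟨by simp, fun l' hl' => ?_⟩)
        rw [hY'n l' (hl ▸ hl')]; exact hxY l'
      · rw [hY'n l hl] at hlt
        have hem : Y l = ∅ := by
          rcases hYc l with h | h
          · exact h
          · omega
        rcases hdeg l hem with ⟨a1, a2⟩ | a
        · refine Or.inl ⟨fun l' _ => ?_, a2⟩
          by_cases hl' : l' = t
          · rw [hl', hY't]
          · rw [hY'n l' hl', a1 l']; simp
        · exact Or.inr (Or.inl a))
    hZ h2 h3 h4 hκξ
  refine ⟨_, hT, ?_, ?_, ?_⟩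
  · intro v hv
    refine mem_union_right _ ?_
    rcases mem_insert.1 hv with h | h
    · exact mem_biUnion.2 ⟨t, mem_univ _, mem_union_left _ (by rw [hY't, h]; simp)⟩
    · obtain ⟨l, _, hl⟩ := mem_biUnion.1 h
      have hlt : l ≠ t := by rintro rfl; rw [ht] at hl; simp at hl
      exact mem_biUnion.2 ⟨l, mem_univ _, mem_union_left _ (by rw [hY'n l hlt]; exact hl)⟩
  · rw [disjoint_left]
    intro v hv hvZ
    rcases mem_union.1 hv with hv | hv
    · simp at hv
    · obtain ⟨l, _, hl⟩ := mem_biUnion.1 hv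
      rcases mem_union.1 hl with h | h
      · refine disjoint_left.1 hZX hvZ ?_
        by_cases hlt : l = t
        · rw [hlt, hY't, mem_singleton] at h
          rw [h]; exact mem_insert_self _ _
        · rw [hY'n l hlt] at h
          exact mem_insert_of_mem (mem_biUnion.2 ⟨l, mem_univ _, h⟩)
      · exact disjoint_left.1 (hE l).2.1 h hvZ
  · intro l
    have hsub : (∅ ∪ univ.biUnion (fun l => Y' l ∪ E l)) ∩ (B l \ I) ⊆ (Y' l ∪ E l).filter (fun v => v ≠ x) := by
      intro v hv
      obtain ⟨hv, hvB⟩ := mem_inter.1 hv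
      obtain ⟨hvB, hvI⟩ := mem_sdiff.1 hvB
      have hvx : v ≠ x := by
        rintro rfl
        rcases hxI with h | h
        · exact hvI h
        · exact h l hvB
      refine mem_filter.2 ⟨?_, hvx⟩
      rcases mem_union.1 hv with hv | hv
      · simp at hv
      obtain ⟨l', _, hl'⟩ := mem_biUnion.1 hv
      have hvB' : v ∈ B l' := by
        rcases mem_union.1 hl' with h | h
        · by_cases hlt : l' = t
          · rw [hlt, hY't, mem_singleton] at h; exact absurd h hvx
          · rw [hY'n l' hlt] at h; exact hYB l' h
        · exact P.SB l' ((hE l').1 h)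
      by_cases hll : l' = l
      · rw [← hll]; exact hl'
      · exact absurd hvB (disjoint_left.1 (P.Bdis l' l hll) hvB')
    have h1 := card_le_card hsub
    have h5 := card_union_of_disjoint (hE l).2.2.1.symm
    have h6 := (hE l).2.2.2
    by_cases hlt : l = t
    · rw [if_pos hlt]
      have : (Y' l ∪ E l).filter (fun v => v ≠ x) ⊂ Y' l ∪ E l := by
        refine filter_ssubset.2 ⟨x, ?_, by simp⟩
        rw [hlt, hY't]; simp
      have := card_lt_card this
      omega
    · rw [if_neg hlt]
      have := card_filter_le (Y' l ∪ E l) (fun v => v ≠ x)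
      omega

lemma asm2 (ω r : ℕ) (hω : 1 ≤ ω) (hr : 1 ≤ r) (g β : ℝ) (hg0 : 0 < g)
    (hg : ((r:ℝ) * ω) * g = 1) (hβ : β = ω * g) (ξ0 : ℝ) (hξ0 : 0 < ξ0) :
    ∃ ξ κ : ℝ, 0 < κ ∧ κ ≤ ξ ∧ ξ ≤ ξ0 ∧ ∃ C n0 : ℕ, ∀ (V : Type) [Fintype V] (G : SimpleGraph V)
      (S B : Fin r → Finset V) (Ws A : Finset V), n0 ≤ Fintype.card V → Prt G r S B Ws A β κ ξ →
      ∃ q, HasTiles G (0 + r) 0 ω 1 q univ ∧ Fintype.card V ≤ (r * ω) * q + C := by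
  obtain ⟨h, hh⟩ : ∃ h, h = r * ω := ⟨_, rfl⟩
  have hhR : (h:ℝ) = r * ω := by rw [hh]; push_cast; ring
  have hωR : (1:ℝ) ≤ ω := by exact_mod_cast hω
  have hβ0 : 0 < β := by rw [hβ]; positivity
  have hωh : ω ≤ h := by rw [hh]; nlinarith
  have hhpos : 0 < h := by omega
  obtain ⟨b, hbd⟩ : ∃ b, b = h + r * ω + 1 := ⟨_, rfl⟩
  set τ := min β ξ0 with hτd
  have hτ : 0 < τ := by positivity
  have t1 : τ ≤ β := min_le_left _ _
  have t5 : τ ≤ ξ0 := min_le_right _ _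
  obtain ⟨ξ, κ, hκ, hκξ, hξτ, q1, q2, q3, q4, q5, q6, q7⟩ := params1 b h ω r hωh (by omega) (by omega) τ hτ
  obtain ⟨n4, hn4⟩ := exists_nat_ge ((ω:ℝ) / κ)
  rw [div_le_iff₀ hκ] at hn4
  refine ⟨ξ, κ, hκ, hκξ, hξτ.trans t5, h * (h * (2 * ω * r + 1) + 0 + 1), n4, ?_⟩
  intro V _ G S B Ws A hn0 P
  set n : ℝ := (Fintype.card V : ℝ) with hnd
  have hn : 0 ≤ n := by positivity
  have hκn : 0 ≤ κ * n := by positivity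
  have hκξn : κ * n ≤ ξ * n := by gcongr
  have hωκ : (ω:ℝ) ≤ κ * n := by
    have : (n4:ℝ) ≤ n := by rw [hnd]; exact_mod_cast hn0
    have : (n4:ℝ) * κ ≤ n * κ := by gcongr
    linarith
  have hβn : (h:ℝ) * (β * n) = ω * n := by
    have : (h:ℝ) * (β * n) = (h * g) * (ω * n) := by rw [hβ]; ring
    rw [this, hhR, hg, one_mul]
  have hβr : (r:ℝ) * (β * n) = n := by
    have : (r:ℝ) * (β * n) = (r * ω * g) * n := by rw [hβ]; ring
    rw [this, hg, one_mul]
  obtain ⟨J1, _, x, Y, Jb⟩ := P.jobs hβ0.le hκ.le hκξ hω (by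
    rw [← hnd]
    have a1 := mul_le_mul_of_nonneg_right (q6.trans t1) hn
    linarith)
  set lam : ℝ := b * (1 + 3 * r) * κ with hlam
  set Bs : Fin r → Finset V := fun l => B l \ univ.image x with hBs
  set a : Fin r → ℕ := fun l => ⌊β * n - (Bs l).card⌋₊ with ha
  have haf : ∀ l, β * n < (Bs l).card + ((a l:ℝ) + 1) ∧ ((Bs l).card : ℝ) + a l ≤ β * n + 2 * ω ∧ (a l : ℝ) ≤ κ * n := by
    intro l
    obtain ⟨f1, f2, f3⟩ := floor_facts (β * n - (Bs l).card) 1 le_rfl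
    simp only [Nat.cast_one, div_one, mul_one] at f1 f2 f3
    have u1 := Jb.up l
    have u2 := Jb.lo2 l
    rw [← hnd] at u1 u2
    have ea : a l = ⌊β * n - (Bs l).card⌋₊ := rfl
    rw [← ea] at f1 f2 f3
    refine ⟨by linarith, ?_, ?_⟩
    · rcases le_total 0 (β * n - (Bs l).card) with hc | hc
      · rw [max_eq_left hc] at f2
        linarith
      · rw [max_eq_right hc] at f2
        linarith
    · refine f3.trans (max_le ?_ hκn)
      linarith
  let Hb := J1 ⊕ {v // v ∈ Ws}
  let hx : Hb → V := Sum.elim x (fun w => w.1)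
  let hY : Hb → Fin r → Finset V := Sum.elim Y (fun _ _ => ∅)
  set a' : Fin r → ℕ := fun l => a l - 2 * ω * r with ha'
  have hcov : Fintype.card V ≤ Fintype.card Hb + ∑ l, (Bs l).card := by
    have c1 : (univ : Finset V) ⊆ univ.image hx ∪ univ.biUnion Bs := by
      intro v _
      rcases Jb.cov v with h | ⟨j, hj⟩ | ⟨l, hl⟩
      · exact mem_union_left _ (mem_image.2 ⟨Sum.inr ⟨v, h⟩, mem_univ _, rfl⟩)
      · exact mem_union_left _ (mem_image.2 ⟨Sum.inl j, mem_univ _, hj⟩)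
      · by_cases hv : v ∈ univ.image x
        · obtain ⟨j, _, hj⟩ := mem_image.1 hv
          exact mem_union_left _ (mem_image.2 ⟨Sum.inl j, mem_univ _, hj⟩)
        · exact mem_union_right _ (mem_biUnion.2 ⟨l, mem_univ _, mem_sdiff.2 ⟨hl, hv⟩⟩)
    have c2 := (card_le_card c1).trans (card_union_le _ _)
    have c3 : (univ.image hx).card ≤ Fintype.card Hb := card_image_le
    have c4 : (univ.biUnion Bs).card ≤ ∑ l, (Bs l).card := card_biUnion_le
    rw [card_univ] at c2
    omega
  have hsa : ∑ l, a l ≤ Fintype.card Hb + 2 * ω * r := by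
    have s1 : ∑ l, (((Bs l).card : ℝ) + a l) ≤ ∑ l : Fin r, (β * n + 2 * ω) := sum_le_sum fun l _ => (haf l).2.1
    rw [sum_add_distrib] at s1
    simp only [sum_const, card_univ, Fintype.card_fin, nsmul_eq_mul] at s1
    have s2 : n ≤ Fintype.card Hb + ∑ l, ((Bs l).card : ℝ) := by rw [hnd]; exact_mod_cast hcov
    have s3 : (∑ l, (a l : ℝ)) ≤ Fintype.card Hb + 2 * ω * r := by linarith
    exact_mod_cast s3
  have hsa' : ∑ l, a' l ≤ Fintype.card Hb := by
    by_cases hex : ∃ l, 2 * ω * r ≤ a l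
    · obtain ⟨l, hl⟩ := hex
      rw [← add_sum_erase _ _ (mem_univ l)] at hsa ⊢
      have : ∑ i ∈ univ.erase l, a' i ≤ ∑ i ∈ univ.erase l, a i := sum_le_sum fun i _ => Nat.sub_le _ _
      have e : a' l = a l - 2 * ω * r := rfl
      omega
    · push Not at hex
      rw [sum_eq_zero (fun l _ => by have := hex l; simp only [ha']; omega)]
      exact Nat.zero_le _
  let J := Σ l : Fin r, Fin (a' l)
  have eJ : Fintype.card J = ∑ l, a' l := by simp [J, Fintype.card_sigma]
  obtain ⟨ι⟩ : Nonempty (J ↪ Hb) := Function.Embedding.nonempty_of_card_le (by rw [eJ]; exact hsa')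
  have hJc : (Fintype.card J : ℝ) ≤ (1 + 3 * r) * (κ * n) := by
    rw [eJ]
    push_cast
    have : ∑ i, (a' i : ℝ) ≤ ∑ i : Fin r, κ * n := sum_le_sum fun i _ => by
      refine le_trans ?_ (haf i).2.2
      exact_mod_cast Nat.sub_le _ _
    simp only [sum_const, card_univ, Fintype.card_fin, nsmul_eq_mul] at this
    have : 0 ≤ (r:ℝ) * (κ * n) := by positivity
    linarith
  have hbR : (b:ℝ) = h + r * ω + 1 := by rw [hbd]; push_cast; ring
  have hnum2 : ((h:ℝ) + r * ω + 1) * κ + lam ≤ ξ := by rw [← hbR]; exact q2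
  let X0 : Hb → Finset V := fun j => insert (hx j) (univ.biUnion (hY j))
  have hX0d : ∀ i j, i ≠ j → Disjoint (X0 i) (X0 j) := by
    have key : ∀ (i : J1) (w : {v // v ∈ Ws}), Disjoint (X0 (Sum.inl i)) (X0 (Sum.inr w)) := by
      intro i w
      rw [disjoint_left]
      intro v hv hv'
      have hvw : v = w.1 := by
        rcases mem_insert.1 hv' with h | h
        · exact h
        · obtain ⟨l, _, hl⟩ := mem_biUnion.1 h
          simp [hY] at hl
      rcases mem_insert.1 hv with h | h
      · apply Jb.xW i
        have h' : x i = w.1 := h.symm.trans hvw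
        rw [h']; exact w.2
      · obtain ⟨l, _, hl⟩ := mem_biUnion.1 h
        exact disjoint_left.1 (P.BW l) (Jb.YB i l hl) (hvw ▸ w.2)
    rintro (i | i) (j | j) hij
    · exact Jb.dis i j (fun h => hij (by rw [h]))
    · exact key i j
    · exact (key j i).symm
    · rw [disjoint_left]
      intro v hv hv'
      have e1 : ∀ w : {v // v ∈ Ws}, v ∈ X0 (Sum.inr w) → v = w.1 := by
        intro w hw
        rcases mem_insert.1 hw with h | h
        · exact h
        · obtain ⟨l, _, hl⟩ := mem_biUnion.1 h
          simp [hY] at hl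
      exact hij (by rw [Subtype.ext ((e1 i hv).symm.trans (e1 j hv'))])
  have hX0c : ∀ j, (X0 j).card ≤ b := by
    intro j
    have h1 := card_biUnion_le_card_mul (univ : Finset (Fin r)) (hY j) ω (fun l _ => by
      rcases j with j | j
      · rcases Jb.Yc j l with h | h
        · show (Y j l).card ≤ ω
          rw [h]; simp
        · exact h.le
      · simp [hY])
    rw [card_univ, Fintype.card_fin] at h1
    have h2 := card_insert_le (hx j) (univ.biUnion (hY j))
    show (insert (hx j) (univ.biUnion (hY j))).card ≤ b
    omega
  obtain ⟨T, hTF, hTd⟩ := greedy (fun j : J => X0 (ι j)) (fun j T => IsTile G (0 + r) 0 ω 1 T ∧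
      ∀ l, (T ∩ Bs l).card + (if l = j.1 then 1 else 0) ≤ ω) b
    (fun j => hX0c _) (fun i j hij => hX0d _ _ (fun h => hij (ι.injective h)))
    (by
      intro j Z hZ hZX hXZ
      have hZR : (Z.card : ℝ) ≤ lam * n := by
        have a1 : (Z.card : ℝ) ≤ b * Fintype.card J := by exact_mod_cast hZ
        have a2 : (b:ℝ) * Fintype.card J ≤ b * ((1 + 3 * r) * (κ * n)) := by gcongr
        have a3 : (b:ℝ) * ((1 + 3 * r) * (κ * n)) = lam * n := by rw [hlam]; ring
        linarith
      have hshort : ((B j.1 \ univ.image x).card : ℝ) < β * n := by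
        by_contra hc
        push Not at hc
        have : a j.1 = 0 := Nat.floor_of_nonpos (sub_nonpos.2 hc)
        have h2 : a' j.1 = 0 := by simp only [ha']; omega
        have h3 := j.2.2
        omega
      have hlo := Jb.lo j.1 hshort
      rcases hj : ι j with i | w
      · rw [hj] at hZX
        obtain ⟨T, h1, h2, h3, h4⟩ := hub0 (lam := lam) (h := h) (x := x i) (Y := Y i) (I := univ.image x) (Z := Z) P hω hκ.le hκξ
          (Jb.YB i) (Jb.Yc i) (Jb.Yadj i) (Jb.Y1 i) (Jb.deg i) j.1 (hlo i) (Or.inl (mem_image_of_mem _ (mem_univ _)))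
          hZR hnum2 (q3.trans t1) hωκ hZX
        exact ⟨T, ⟨h1, h4⟩, h2, by rw [h1.card]; simp; omega, h3⟩
      · rw [hj] at hZX
        obtain ⟨T, h1, h2, h3, h4⟩ := hub0 (lam := lam) (h := h) (x := w.1) (Y := fun _ => ∅) (I := univ.image x) (Z := Z) P hω hκ.le hκξ
          (fun l => by simp) (fun l => Or.inl rfl) (fun l u hu => by simp at hu) (fun l l' _ => Or.inl rfl) (fun l _ => by
            refine Or.inr ?_
            have b1 : ((nb G w.1 (S l)).card : ℝ) + ms G w.1 (S l) = (S l).card := by exact_mod_cast nb_add_ms G w.1 (S l)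
            have b2 := P.Wms l w.1 w.2
            have b3 := P.Sc l
            rw [← hnd] at b2 b3 ⊢
            linarith) j.1 rfl (Or.inr fun l hl => disjoint_left.1 (P.BW l) hl w.2)
          hZR hnum2 (q3.trans t1) hωκ hZX
        exact ⟨T, ⟨h1, h4⟩, h2, by rw [h1.card]; simp; omega, h3⟩)
  have hcs : ∀ l, ∑ j, (T j ∩ Bs l).card + a' l ≤ ω * Fintype.card J := by
    intro l
    have e1 : ∑ j : J, ((T j ∩ Bs l).card + (if l = j.1 then 1 else 0)) ≤ ∑ j : J, ω := sum_le_sum fun j _ => (hTF j).2 l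
    rw [sum_add_distrib] at e1
    have e2 : ∑ j : J, (if l = j.1 then 1 else 0) = a' l := by
      have e5 : ∑ j : J, (if l = j.1 then 1 else 0) = ∑ i : Fin r, ∑ k : Fin (a' i), (if l = i then 1 else 0) :=
        Fintype.sum_sigma _
      rw [e5]
      simp
    rw [e2] at e1
    simp only [sum_const, card_univ, smul_eq_mul] at e1
    rw [mul_comm ω]
    exact e1
  have := asm_fin P hκ.le hκξ (p := 0) (σ := 0) (ω := ω) (h := h) (h' := 0) (c := h * (2 * ω * r + 1)) (C0 := 0)
    hω (by rw [hh]; ring) (by ring) hhpos Bs (fun l => sdiff_subset) T (fun j => (hTF j).1) hTd (by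
      intro l
      have a1 := (haf l).1
      have a2 : (h:ℝ) * (β * n) ≤ h * ((Bs l).card + ((a l:ℝ) + 1)) := by gcongr
      rw [hβn] at a2
      have a3 : ω * Fintype.card V ≤ h * ((Bs l).card + (a l + 1)) := by
        rw [hnd] at a2; exact_mod_cast a2
      have a4 := Nat.mul_le_mul_left h (hcs l)
      have a5 : a l ≤ a' l + 2 * ω * r := by simp only [ha']; omega
      have a6 : h * ((Bs l).card + (a l + 1)) ≤ h * ((Bs l).card + (a' l + 2 * ω * r + 1)) := by gcongr
      have e1 : h * ((Bs l).card + (a' l + 2 * ω * r + 1)) = h * (Bs l).card + h * a' l + h * (2 * ω * r + 1) := by ring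
      rw [mul_add] at a4
      omega) (by simp) (by
      intro q hq
      refine ⟨fun _ => ∅, fun i => ⟨neck_tile G 0 ω ∅ rfl, empty_subset _⟩, fun i j _ => disjoint_empty_left _⟩)
      (by intro h; rfl) (by
      intro l
      have b1 := card_sdiff_biUnion T hTd (Bs l)
      have b2 := hcs l
      have b3 : (Bs l).card ≤ (Bs l \ univ.biUnion T).card + ω * Fintype.card J := by omega
      have b3' : ((Bs l).card : ℝ) ≤ (Bs l \ univ.biUnion T).card + ω * Fintype.card J := by exact_mod_cast b3
      have b4 : (ω:ℝ) * Fintype.card J ≤ ω * ((1 + 3 * r) * (κ * n)) := by gcongr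
      have b5 := mul_le_mul_of_nonneg_right (q7.trans t1) hn
      have b6 := Jb.lo2 l
      rw [← hnd] at b6 ⊢
      push_cast
      linarith)
  rw [← hh]
  exact this

end OBT

set_option linter.unusedVariables false
set_option linter.unusedSectionVars false
namespace OBT
open scoped Classical
open Finset

/-- the conclusion under `r` sparse sets -/
def Good (p σ ω r : ℕ) (β : ℝ) : Prop :=
  ∃ ε : ℝ, 0 < ε ∧ ∃ C n0 : ℕ, ∀ (V : Type) [Fintype V] (G : SimpleGraph V) (A : Finset V) (U : Fin r → Finset V),
    n0 ≤ Fintype.card V → (∀ u ∈ A, ∀ v ∈ A, u ≠ v → G.Adj u v) →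
    (∀ v, v ∉ A → (ms G v univ : ℝ) ≤ β * Fintype.card V) →
    (∀ u v, u ≠ v → ¬ G.Adj u v → (ms G u univ : ℝ) + ms G v univ ≤ 2 * β * Fintype.card V) →
    (∀ i j, i ≠ j → Disjoint (U i) (U j)) → (∀ i, (β - ε) * Fintype.card V ≤ (U i).card) →
    (∀ i, ((∑ u ∈ U i, (nb G u (U i)).card : ℕ) : ℝ) ≤ ε * (Fintype.card V : ℝ)^2) →
    ∃ q, HasTiles G p σ ω 1 q univ ∧ Fintype.card V ≤ (p * ω + σ) * q + C

lemma Prt.Wup {V : Type} [Fintype V] {G : SimpleGraph V} {r : ℕ} {S B : Fin r → Finset V} {Ws A : Finset V}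
    {β κ ξ : ℝ} (P : Prt G r S B Ws A β κ ξ) :
    (Ws.card : ℝ) + r * ((β - κ) * Fintype.card V) ≤ Fintype.card V := by
  have h1 : (univ.biUnion B).card = ∑ l, (B l).card := card_biUnion (fun i _ j _ hij => P.Bdis i j hij)
  have h2 : Disjoint (univ.biUnion B) Ws := by
    rw [disjoint_biUnion_left]; exact fun l _ => P.BW l
  have h3 : (univ.biUnion B ∪ Ws).card ≤ Fintype.card V := card_le_univ _
  rw [card_union_of_disjoint h2, h1] at h3
  have h4 : ∑ l : Fin r, (β - κ) * Fintype.card V ≤ ∑ l, ((B l).card : ℝ) := sum_le_sum fun l _ =>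
    (P.Sc l).trans (by exact_mod_cast card_le_card (P.SB l))
  simp only [sum_const, card_univ, Fintype.card_fin, nsmul_eq_mul] at h4
  have h3' : (∑ l, ((B l).card : ℝ)) + Ws.card ≤ Fintype.card V := by exact_mod_cast h3
  linarith

lemma beta_le_one {p σ ω r : ℕ} {g β : ℝ} (hpr : 1 ≤ p + r) (hg0 : 0 < g)
    (hg : ((p + r) * ω + σ : ℝ) * g = 1) (hβ : β = ω * g) : β ≤ 1 := by
  rw [← hg, hβ]
  have : (ω : ℝ) ≤ ((p + r) * ω + σ : ℝ) := by
    have : ω ≤ (p + r) * ω + σ := by nlinarith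
    exact_mod_cast this
  gcongr

lemma good_top0 (ω r : ℕ) (hω : 1 ≤ ω) (hr : 1 ≤ r) (g β : ℝ) (hg0 : 0 < g)
    (hg : ((r:ℝ) * ω) * g = 1) (hβ : β = ω * g) : Good r 0 ω r β := by
  have hωR : (1:ℝ) ≤ ω := by exact_mod_cast hω
  have hβ0 : 0 < β := by rw [hβ]; positivity
  obtain ⟨ξ, κ, hκ, hκξ, hξ, C, n0, h⟩ := asm2 ω r hω hr g β hg0 hg hβ (β / 8) (by positivity)
  obtain ⟨ε, hε, n1, hp⟩ := mkPrt r β κ ξ hκ hκξ (by linarith)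
    (beta_le_one (p := 0) (σ := 0) (r := r) (ω := ω) (g := g) (by omega) hg0 (by simpa using hg) hβ)
  refine ⟨ε, hε, C, n0 + n1, ?_⟩
  intro V _ G A U hn hA hms hO hUd hUc hUs
  obtain ⟨S, B, Ws, P⟩ := hp V G A U (by omega) hA hms hO hUd hUc hUs
  have := h V G S B Ws A (by omega) P
  rw [zero_add] at this
  simpa using this

lemma good_top1 (σ ω r : ℕ) (hσ : σ < ω) (hσ1 : 1 ≤ σ) (hr : 1 ≤ r) (g β : ℝ) (hg0 : 0 < g)
    (hg : ((r:ℝ) * ω + σ) * g = 1) (hβ : β = ω * g) : Good r σ ω r β := by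
  have hω : 1 ≤ ω := by omega
  have hωR : (1:ℝ) ≤ ω := by exact_mod_cast hω
  have hβ0 : 0 < β := by rw [hβ]; positivity
  have hg' : (((0:ℕ) + r) * ω + σ : ℝ) * g = 1 := by simpa using hg
  set ξ0 := min (β / 8) (g / (4 * (r + 1))) with hξ0
  have x0 : 0 < ξ0 := by positivity
  obtain ⟨ξ, κ, hκ, hκξ, hξ, C, n0, h⟩ := asm1 0 σ ω r hω hσ (by omega) (by omega) g β hg0 hg' hβ (g / 2) (by positivity) ξ0 x0
  obtain ⟨ε, hε, n1, hp⟩ := mkPrt r β κ ξ hκ hκξ (by linarith [hξ.trans (min_le_left _ _)])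
    (beta_le_one (p := 0) (σ := σ) (r := r) (ω := ω) (g := g) (by omega) hg0 hg' hβ)
  refine ⟨ε, hε, C, n0 + n1 + 1, ?_⟩
  intro V _ G A U hn hA hms hO hUd hUc hUs
  obtain ⟨S, B, Ws, P⟩ := hp V G A U (by omega) hA hms hO hUd hUc hUs
  have := h V G S B Ws A (by omega) P (by
    intro U hU hUc
    exfalso
    have w := P.Wup
    have hc : (U.card : ℝ) ≤ Ws.card := by exact_mod_cast card_le_card hU
    have hn1 : (0:ℝ) < Fintype.card V := by exact_mod_cast (by omega : 0 < Fintype.card V)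
    set n : ℝ := (Fintype.card V : ℝ)
    have hκ1 : κ * (4 * (r + 1)) ≤ g := by
      have := hκξ.trans (hξ.trans (min_le_right _ _))
      rwa [le_div_iff₀ (by positivity)] at this
    have e1 : n = (r * ω + σ) * g * n := by rw [hg, one_mul]
    have hσω : (σ:ℝ) + 1 ≤ ω := by exact_mod_cast hσ
    have hgn : 0 < g * n := by positivity
    have e2 := mul_le_mul_of_nonneg_right hσω hgn.le
    have e3 := mul_le_mul_of_nonneg_right hκ1 hn1.le
    have e4 : (r:ℝ) * ((β - κ) * n) = r * ω * g * n - r * κ * n := by rw [hβ]; ring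
    have e5 : (β - g / 2) * n = ω * (g * n) - g * n / 2 := by rw [hβ]; ring
    have e6 : (r * ω + σ) * g * n = r * ω * g * n + σ * (g * n) := by ring
    have e7 : 0 ≤ (r:ℝ) * κ * n := by positivity
    have e8 : 0 < κ * n := by positivity
    linarith)
  rw [zero_add] at this
  simpa using this

lemma good_step (p σ ω r : ℕ) (hω : 1 ≤ ω) (hσ : σ < ω) (g β : ℝ) (hg0 : 0 < g)
    (hg : (((p + 1 : ℕ) + r) * ω + σ : ℝ) * g = 1) (hβ : β = ω * g) (hr : Good (p + 1 + r) σ ω (r + 1) β) :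
    Good (p + 1 + r) σ ω r β := by
  have hωR : (1:ℝ) ≤ ω := by exact_mod_cast hω
  have hβ0 : 0 < β := by rw [hβ]; positivity
  obtain ⟨η, hη, C1, n1, hrec⟩ := hr
  set ξ0 := min (β / 8) (η / 2) with hξ0
  have x0 : 0 < ξ0 := by positivity
  obtain ⟨ξ, κ, hκ, hκξ, hξ, C2, n2, h⟩ := asm1 (p + 1) σ ω r hω hσ (by nlinarith) (by omega) g β hg0 hg hβ η hη ξ0 x0
  have hξ1 := hξ.trans (min_le_left _ _)
  have hξ2 := hξ.trans (min_le_right _ _)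
  obtain ⟨ε, hε, n3, hp⟩ := mkPrt r β κ ξ hκ hκξ (by linarith)
    (beta_le_one (p := p + 1) (σ := σ) (r := r) (ω := ω) (g := g) (by omega) hg0 hg hβ)
  refine ⟨ε, hε, C1 + C2, n1 + n2 + n3, ?_⟩
  intro V _ G A U hn hA hms hO hUd hUc hUs
  obtain ⟨S, B, Ws, P⟩ := hp V G A U (by omega) hA hms hO hUd hUc hUs
  by_cases hex : ∃ X ⊆ Ws, (β - η) * Fintype.card V ≤ X.card ∧ ((∑ u ∈ X, (nb G u X).card : ℕ) : ℝ) ≤ η * (Fintype.card V : ℝ)^2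
  · obtain ⟨X, hX, hX1, hX2⟩ := hex
    have hn0 : (0:ℝ) ≤ Fintype.card V := by positivity
    obtain ⟨q, hq, hq2⟩ := hrec V G A (Fin.cons X S) (by omega) hA hms hO (by
      have k : ∀ i, Disjoint X (S i) := fun i => ((P.BW i).mono (P.SB i) hX).symm
      intro i j hij
      induction i using Fin.cases with
      | zero =>
        induction j using Fin.cases with
        | zero => exact absurd rfl hij
        | succ j => simpa using k j
      | succ i =>
        induction j using Fin.cases with
        | zero => simpa using (k i).symm
        | succ j =>
          simp only [Fin.cons_succ]
          exact (P.Bdis i j (fun h => hij (by rw [h]))).mono (P.SB i) (P.SB j)) (by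
      intro i
      induction i using Fin.cases with
      | zero => simpa using hX1
      | succ i =>
        simp only [Fin.cons_succ]
        refine le_trans ?_ (P.Sc i)
        gcongr
        linarith) (by
      intro i
      induction i using Fin.cases with
      | zero => simpa using hX2
      | succ i =>
        simp only [Fin.cons_succ]
        push_cast
        have e1 : ∑ u ∈ S i, ((nb G u (S i)).card : ℝ) ≤ ∑ u ∈ S i, 2 * ξ * (Fintype.card V : ℝ) := by
          refine sum_le_sum fun u hu => le_trans ?_ (P.Bdeg i u (P.SB i hu))
          have : nb G u (S i) ⊆ nb G u (B i) := fun v hv => mem_nb.2 ⟨P.SB i (mem_nb.1 hv).1, (mem_nb.1 hv).2⟩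
          exact_mod_cast card_le_card this
        refine e1.trans ?_
        rw [sum_const, nsmul_eq_mul]
        have e2 : ((S i).card : ℝ) ≤ Fintype.card V := by exact_mod_cast card_le_univ _
        have hξ0' : 0 ≤ ξ := hκ.le.trans hκξ
        calc ((S i).card : ℝ) * (2 * ξ * Fintype.card V) ≤ Fintype.card V * (2 * ξ * Fintype.card V) := by gcongr
          _ = 2 * ξ * (Fintype.card V : ℝ)^2 := by ring
          _ ≤ η * (Fintype.card V : ℝ)^2 := by gcongr; linarith)
    exact ⟨q, hq, by omega⟩
  · push Not at hex
    obtain ⟨q, hq, hq2⟩ := h V G S B Ws A (by omega) P (fun X hX hX1 => (hex X hX hX1).le)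
    exact ⟨q, hq, by omega⟩

lemma good_all (p σ ω : ℕ) (hp : 1 ≤ p) (hω : 1 ≤ ω) (hσ : σ < ω) (g β : ℝ) (hg0 : 0 < g)
    (hg : ((p:ℝ) * ω + σ) * g = 1) (hβ : β = ω * g) : Good p σ ω 0 β := by
  have key : ∀ d r, d + r = p → Good p σ ω r β := by
    intro d
    induction d with
    | zero =>
      intro r hr
      have : r = p := by omega
      subst this
      rcases Nat.eq_zero_or_pos σ with h | h
      · subst h
        exact good_top0 ω r hω hp g β hg0 (by simpa using hg) hβ
      · exact good_top1 σ ω r hσ h hp g β hg0 hg hβ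
    | succ d ih =>
      intro r hr
      have h1 := ih (r + 1) (by omega)
      subst hr
      exact good_step d σ ω r hω hσ g β hg0 (by push_cast at hg ⊢; exact hg) hβ h1
  exact key p 0 (by omega)

end OBT

set_option linter.unusedVariables false
set_option linter.unusedSectionVars false
namespace OBT
open scoped Classical
open Finset

lemma core (p σ ω : ℕ) (hp : 1 ≤ p) (hω : 1 ≤ ω) (hσ : σ < ω) (β : ℝ) (hβ : β = ω / (p * ω + σ)) :
    ∃ C n0 : ℕ, ∀ (V : Type) [Fintype V] (G : SimpleGraph V), n0 ≤ Fintype.card V →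
      (∀ x y, x ≠ y → ¬ G.Adj x y → 2 * (1 - β) * Fintype.card V ≤ ((nb G x univ).card : ℝ) + (nb G y univ).card) →
      ∃ q, HasTiles G p σ ω 1 q univ ∧ Fintype.card V ≤ (p * ω + σ) * q + C := by
  have hωR : (1:ℝ) ≤ ω := by exact_mod_cast hω
  have hpR : (1:ℝ) ≤ p := by exact_mod_cast hp
  have hpos : (0:ℝ) < p * ω + σ := by positivity
  obtain ⟨ε, hε, C, n0, h⟩ := good_all p σ ω hp hω hσ (1 / (p * ω + σ)) β (by positivity)
    (by field_simp) (by rw [hβ]; ring)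
  refine ⟨C, n0, ?_⟩
  intro V _ G hn hO
  have hms : ∀ v, (ms G v univ : ℝ) = Fintype.card V - (nb G v univ).card := by
    intro v
    have : ((nb G v univ).card : ℝ) + ms G v univ = Fintype.card V := by
      exact_mod_cast nb_add_ms G v univ
    linarith
  have hO' : ∀ u v, u ≠ v → ¬ G.Adj u v → (ms G u univ : ℝ) + ms G v univ ≤ 2 * β * Fintype.card V := by
    intro u v huv hadj
    have := hO u v huv hadj
    rw [hms u, hms v]
    linarith
  refine h V G (univ.filter (fun v => β * Fintype.card V < (ms G v univ : ℝ))) Fin.elim0 hn ?_ ?_ hO'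
    (fun i => i.elim0) (fun i => i.elim0) (fun i => i.elim0)
  · intro u hu v hv huv
    by_contra hc
    have := hO' u v huv hc
    simp only [mem_filter] at hu hv
    linarith [hu.2, hv.2]
  · intro v hv
    simp only [mem_filter, mem_univ, true_and, not_lt] at hv
    exact hv

lemma IsTile.neckless {V : Type} {G : SimpleGraph V} {k ω : ℕ} {S : Finset V} (h : IsTile G (k + 1) 0 ω 1 S) :
    IsTile G k ω ω 1 S := by
  obtain ⟨P, h1, h2, h3⟩ := h
  refine ⟨fun i => P i.succ, fun i => ?_, fun i j hij => h2 _ _ (fun h => hij (Fin.succ_injective _ h)), ?_⟩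
  · rw [h1]; simp [sz, Fin.succ_ne_zero]
  · rw [h3]
    have h0 : P 0 = ∅ := card_eq_zero.1 (by rw [h1]; simp [sz])
    ext v
    simp only [mem_biUnion, mem_univ, true_and]
    constructor
    · rintro ⟨i, hi⟩
      induction i using Fin.cases with
      | zero => rw [h0] at hi; simp at hi
      | succ i => exact ⟨i, hi⟩
    · rintro ⟨i, hi⟩
      exact ⟨_, hi⟩

lemma IsTile.toMap {V : Type} {G : SimpleGraph V} {p σ ω : ℕ} {S : Finset V} (h : IsTile G p σ ω 1 S) :
    ∃ f : BottleVert (p + 1) σ ω → V, Function.Injective f ∧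
      (∀ a b, (bottleGraph (p + 1) σ ω).Adj a b → G.Adj (f a) (f b)) ∧ Set.range f = S := by
  obtain ⟨P, h1, h2, h3⟩ := h
  have hc : ∀ i : Fin (p + 1), (P i).card = if (i : ℕ) = 0 then σ else ω := by
    intro i
    rw [h1, mul_one, sz]
    by_cases hi : i = 0
    · simp [hi]
    · have hi' : ¬ (i : ℕ) = 0 := fun h => hi (Fin.ext h)
      rw [if_neg hi, if_neg hi']
  let e : ∀ i : Fin (p + 1), Fin (if (i : ℕ) = 0 then σ else ω) ≃ {v // v ∈ P i} :=
    fun i => ((P i).equivFinOfCardEq (hc i)).symm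
  have hadj : ∀ a b : BottleVert (p + 1) σ ω, a.1 ≠ b.1 → G.Adj (e a.1 a.2).1 (e b.1 b.2).1 :=
    fun a b hab => h2 _ _ hab _ (e a.1 a.2).2 _ (e b.1 b.2).2
  refine ⟨fun a => (e a.1 a.2).1, ?_, ?_, ?_⟩
  · rintro ⟨i, a⟩ ⟨j, b⟩ hab
    by_cases hij : i = j
    · subst hij
      have h5 : a = b := (e i).injective (Subtype.ext hab)
      rw [h5]
    · exact absurd hab (G.ne_of_adj (hadj ⟨i, a⟩ ⟨j, b⟩ hij))
  · intro a b hab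
    exact hadj a b hab
  · rw [h3]
    ext v
    simp only [Set.mem_range, coe_biUnion, Set.mem_iUnion, mem_coe, mem_univ]
    constructor
    · rintro ⟨a, rfl⟩
      exact ⟨a.1, trivial, (e a.1 a.2).2⟩
    · rintro ⟨i, _, hv⟩
      exact ⟨⟨i, (e i).symm ⟨v, hv⟩⟩, by simp⟩

lemma tiles_to_tiling {V : Type} [Fintype V] {G : SimpleGraph V} {p σ ω q C : ℕ} (h : HasTiles G p σ ω 1 q univ)
    (hc : Fintype.card V ≤ (p * ω + σ) * q + C) :
    ∃ 𝒯 : Finset (BottleVert (p + 1) σ ω → V),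
      IsTiling (bottleGraph (p + 1) σ ω) G 𝒯 ∧ (untiled 𝒯).ncard ≤ C := by
  obtain ⟨T, hT, hd⟩ := h
  choose f hf1 hf2 hf3 using fun i => (hT i).1.toMap
  refine ⟨univ.image f, ⟨?_, ?_⟩, ?_⟩
  · intro g hg
    obtain ⟨i, _, rfl⟩ := mem_image.1 hg
    exact ⟨hf1 i, hf2 i⟩
  · intro g hg g' hg' hne
    rw [mem_coe] at hg hg'
    obtain ⟨i, _, rfl⟩ := mem_image.1 hg
    obtain ⟨j, _, rfl⟩ := mem_image.1 hg'
    rw [hf3, hf3]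
    exact disjoint_coe.2 (hd i j (fun h => hne (by rw [h])))
  · have e : untiled (univ.image f) = ((univ \ univ.biUnion T : Finset V) : Set V) := by
      ext v
      simp only [untiled, Set.mem_setOf_eq, coe_sdiff, coe_univ, Set.mem_diff, Set.mem_univ, true_and, mem_coe,
        mem_biUnion, mem_univ, not_exists]
      constructor
      · intro hv i hi
        apply hv (f i) (mem_image_of_mem _ (mem_univ _))
        rw [hf3]; exact hi
      · intro hv g hg hvg
        obtain ⟨i, _, rfl⟩ := mem_image.1 hg
        rw [hf3] at hvg
        exact hv i hvg
    rw [e, Set.ncard_coe_finset, card_sdiff_of_subset (subset_univ _), card_biUnion (fun i _ j _ hij => hd i j hij)]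
    have e0 : ∀ j, (T j).card = p * ω + σ := fun j => by rw [(hT j).1.card, mul_one]
    simp only [e0, sum_const, card_univ, Fintype.card_fin, smul_eq_mul]
    rw [mul_comm q]
    omega

lemma deg_nb {V : Type} [Fintype V] (G : SimpleGraph V) [DecidableRel G.Adj] (x : V) :
    (nb G x univ).card = G.degree x := by
  rw [← SimpleGraph.card_neighborFinset_eq_degree]
  congr 1
  ext v
  simp [mem_nb]

end OBT

theorem ore_bottle_tiling (k σ ω : ℕ) (hk : 2 ≤ k) (hσ1 : 1 ≤ σ) (hσω : σ ≤ ω)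
    (α γ : ℝ) (hα : α = (σ : ℝ) / ω)
    (hγ : γ = α / (((k : ℝ) - 1) * ((k : ℝ) - 1 + α))) :
    ∃ (C n₀ : ℕ), ∀ (V : Type) [Fintype V] (G : SimpleGraph V) [DecidableRel G.Adj],
      n₀ ≤ Fintype.card V →
      (∀ x y : V, x ≠ y → ¬ G.Adj x y →
        2 * (1 - 1 / ((k : ℝ) - 1) + γ) * (Fintype.card V) ≤
          (G.degree x : ℝ) + (G.degree y : ℝ)) →
      ∃ 𝒯 : Finset (BottleVert k σ ω → V),
        IsTiling (bottleGraph k σ ω) G 𝒯 ∧ (untiled 𝒯).ncard ≤ C := by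
  obtain ⟨p, rfl⟩ : ∃ p, k = p + 1 := ⟨k - 1, by omega⟩
  have hp : 1 ≤ p := by omega
  have hω : 1 ≤ ω := by omega
  have hωR : (1:ℝ) ≤ ω := by exact_mod_cast hω
  have hpR : (1:ℝ) ≤ p := by exact_mod_cast hp
  have hσR : (1:ℝ) ≤ σ := by exact_mod_cast hσ1
  have hthr : 1 - 1 / (((p + 1 : ℕ) : ℝ) - 1) + γ = 1 - (ω : ℝ) / (p * ω + σ) := by
    rw [hγ, hα]
    push_cast
    rw [show (p:ℝ) + 1 - 1 = p by ring]
    have h1 : (p:ℝ) ≠ 0 := by positivity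
    have h2 : (ω:ℝ) ≠ 0 := by positivity
    have h3 : (p:ℝ) * ω + σ ≠ 0 := by positivity
    have h4 : (p:ℝ) + σ / ω = (p * ω + σ) / ω := by field_simp
    rw [h4]
    field_simp
    ring
  rcases lt_or_eq_of_le hσω with h | h
  · obtain ⟨C, n0, hc⟩ := OBT.core p σ ω hp hω h _ rfl
    refine ⟨C, n0, ?_⟩
    intro V _ G _ hn hO
    obtain ⟨q, hq, hqc⟩ := hc V G hn (fun x y hxy hadj => by
      rw [OBT.deg_nb, OBT.deg_nb, ← hthr]; exact hO x y hxy hadj)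
    exact OBT.tiles_to_tiling hq hqc
  · subst h
    obtain ⟨C, n0, hc⟩ := OBT.core (p + 1) 0 σ (by omega) hω (by omega) ((σ : ℝ) / (p * σ + σ)) (by
      push_cast; congr 1; ring)
    refine ⟨C, n0, ?_⟩
    intro V _ G _ hn hO
    obtain ⟨q, ⟨T, hT, hTd⟩, hqc⟩ := hc V G hn (fun x y hxy hadj => by
      rw [OBT.deg_nb, OBT.deg_nb, ← hthr]; exact hO x y hxy hadj)
    refine OBT.tiles_to_tiling (p := p) (q := q) ⟨T, fun i => ⟨(hT i).1.neckless, (hT i).2⟩, hTd⟩ ?_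
    rwa [show p * σ + σ = (p + 1) * σ + 0 by ring]
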